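/- Let A^{αβ}, for |α| = |β| = m, be simple coefficients (depending only on t), measurable, bounded by K, satisfying the Legendre–Hadamard condition with constant λ > 0, and let γ ∈ (0,1), R > 0. Let X₀ = (t₀,x₀) with (x₀)_d = 0, and let u ∈ C^∞(ℝ^{d+1}; ℝⁿ) satisfy ∂_t u + (−1)^m Σ_{|α|=|β|=m} A^{αβ}(t) D^{α+β} u = 0 for almost every (t,x) ∈ Q_{2R}⁺(X₀), with u = D_d u = ⋯ = D_d^{m−1} u = 0 on {x_d = 0} ∩ Q_{2R}(X₀). Then there exists a constant C depending only on d, n, m, λ, K, γ such that for all 0 < r ≤ R: (i) ∫_{Q_r⁺(X₀)} |u|² dx dt ≤ C (r/R)^{d+4m} ∫_{Q_R⁺(X₀)} |u|² dx dt; (ii) for every integer 0 < l < m, ∫_{Q_r⁺(X₀)} |D_d^l u|² dx dt ≤ C (r/R)^{2(m−l)+d+2m} ∫_{Q_R⁺(X₀)} |D_d^l u|² dx dt; (iii) ∫_{Q_r⁺(X₀)} |D_d^m u − (D_d^m u)_{Q_r⁺(X₀)}|² dx dt ≤ C (r/R)^{2γ+d+2m} ∫_{Q_R⁺(X₀)}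 |D_d^m u − (D_d^m u)_{Q_R⁺(X₀)}|² dx dt. -/

import Mathlib

open MeasureTheory Metric Set Topology

noncomputable section

/-- The parabolic cylinder `Q_r(t₀,x₀) = (t₀ - r^{2m}, t₀) × B_r(x₀)`. -/
def QCyl (d m : ℕ) (r : ℝ) (X : ℝ × EuclideanSpace ℝ (Fin d)) :
    Set (ℝ × EuclideanSpace ℝ (Fin d)) :=
  Set.Ioo (X.1 - r ^ (2 * m)) X.1 ×ˢ Metric.ball X.2 r

/-- The upper-half parabolic cylinder, `i` being the index of the normal direction. -/
def QCylP (d m : ℕ) (i : Fin d) (r : ℝ) (X : ℝ × EuclideanSpace ℝ (Fin d)) :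
    Set (ℝ × EuclideanSpace ℝ (Fin d)) :=
  {p ∈ QCyl d m r X | 0 < p.2 i}

/-- Multi-indices of order exactly `k`. -/
def MIdx (d k : ℕ) : Finset (Fin d → ℕ) :=
  (Fintype.piFinset fun _ : Fin d => Finset.range (k + 1)).filter fun γ => ∑ i, γ i = k

/-- Multi-indices of order at most `k`. -/
def MIdxLe (d k : ℕ) : Finset (Fin d → ℕ) :=
  (Fintype.piFinset fun _ : Fin d => Finset.range (k + 1)).filter fun γ => ∑ i, γ i ≤ k

/-- Multi-indices of order strictly less than `k`. -/
def MIdxLt (d k : ℕ) : Finset (Fin d → ℕ) :=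
  (Fintype.piFinset fun _ : Fin d => Finset.range (k + 1)).filter fun γ => ∑ i, γ i < k

variable {d n : ℕ} {F : Type*} [NormedAddCommGroup F] [NormedSpace ℝ F]

/-- Spatial partial derivative in the `i`-th coordinate direction. -/
def pder (i : Fin d) (u : ℝ × EuclideanSpace ℝ (Fin d) → F) :
    ℝ × EuclideanSpace ℝ (Fin d) → F :=
  fun p => fderiv ℝ (fun y => u (p.1, y)) p.2 (EuclideanSpace.single i 1)

/-- Multi-index spatial derivative `D^γ`. -/
def Dmul (γ : Fin d → ℕ) (u : ℝ × EuclideanSpace ℝ (Fin d) → F) :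
    ℝ × EuclideanSpace ℝ (Fin d) → F :=
  (List.finRange d).foldr (fun i v => (pder i)^[γ i] v) u

/-- Time derivative `∂_t`. -/
def tder (u : ℝ × EuclideanSpace ℝ (Fin d) → F) : ℝ × EuclideanSpace ℝ (Fin d) → F :=
  fun p => deriv (fun s => u (s, p.2)) p.1

/-- The set of difference quotients entering the spatial Hölder seminorm `[f]*_{a,D}`. -/
def sHolderSet (a : ℝ) (D : Set (ℝ × EuclideanSpace ℝ (Fin d)))
    (f : ℝ × EuclideanSpace ℝ (Fin d) → F) : Set ℝ :=
  {c | ∃ p ∈ D, ∃ q ∈ D, p.1 = q.1 ∧ p.2 ≠ q.2 ∧ c = ‖f p - f q‖ / dist p.2 q.2 ^ a}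

/-- The spatial Hölder seminorm `[f]*_{a,D}`. -/
def sHolder (a : ℝ) (D : Set (ℝ × EuclideanSpace ℝ (Fin d)))
    (f : ℝ × EuclideanSpace ℝ (Fin d) → F) : ℝ :=
  sSup (sHolderSet a D f)

/-- The set of difference quotients entering the parabolic Hölder seminorm `[f]_{σ,a,D}`. -/
def pHolderSet (σ a : ℝ) (D : Set (ℝ × EuclideanSpace ℝ (Fin d)))
    (f : ℝ × EuclideanSpace ℝ (Fin d) → F) : Set ℝ :=
  {c | ∃ p ∈ D, ∃ q ∈ D, p ≠ q ∧ c = ‖f p - f q‖ / (|p.1 - q.1| ^ σ + dist p.2 q.2 ^ a)}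

/-- The parabolic Hölder seminorm `[f]_{σ,a,D}`. -/
def pHolder (σ a : ℝ) (D : Set (ℝ × EuclideanSpace ℝ (Fin d)))
    (f : ℝ × EuclideanSpace ℝ (Fin d) → F) : ℝ :=
  sSup (pHolderSet σ a D f)

/-- The set of difference quotients entering the time Hölder seminorm `⟨f⟩_{σ,D}`. -/
def tHolderSet (σ : ℝ) (D : Set (ℝ × EuclideanSpace ℝ (Fin d)))
    (f : ℝ × EuclideanSpace ℝ (Fin d) → F) : Set ℝ :=
  {c | ∃ p ∈ D, ∃ q ∈ D, p.2 = q.2 ∧ p.1 ≠ q.1 ∧ c = ‖f p - f q‖ / |p.1 - q.1| ^ σ}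

/-- The time Hölder seminorm `⟨f⟩_{σ,D}`. -/
def tHolder (σ : ℝ) (D : Set (ℝ × EuclideanSpace ℝ (Fin d)))
    (f : ℝ × EuclideanSpace ℝ (Fin d) → F) : ℝ :=
  sSup (tHolderSet σ D f)

/-- The `L^∞` norm over a set. -/
def LpInf (D : Set (ℝ × EuclideanSpace ℝ (Fin d)))
    (f : ℝ × EuclideanSpace ℝ (Fin d) → F) : ℝ :=
  (eLpNorm f ⊤ (volume.restrict D)).toReal

/-- The `L²` norm over a set. -/
def L2Norm (D : Set (ℝ × EuclideanSpace ℝ (Fin d)))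
    (f : ℝ × EuclideanSpace ℝ (Fin d) → F) : ℝ :=
  (eLpNorm f 2 (volume.restrict D)).toReal

/-- The Legendre–Hadamard ellipticity condition with constant `lam`. -/
def LegHad (d n m : ℕ) (lam : ℝ)
    (B : (Fin d → ℕ) → (Fin d → ℕ) → Fin n → Fin n → ℝ) : Prop :=
  ∀ (ξ : Fin n → ℝ) (η : Fin d → ℝ),
    lam * (∑ i, ξ i ^ 2) * (∑ k, η k ^ 2) ^ m ≤
      ∑ α ∈ MIdx d m, ∑ β ∈ MIdx d m, ∑ i, ∑ j,
        B α β i j * ξ i * ξ j * ((∏ k, η k ^ α k) * ∏ k, η k ^ β k)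

end

namespace BDE

open Finset (sum_congr sum_nonneg sum_le_sum mul_sum sum_mul sum_comm single_le_sum abs_sum_le_sum_abs sum_const sum_add_distrib sum_eq_zero)
open ContinuousLinearMap (adjoint)
open EuclideanSpace (single)
open Function (update)
open Real (exp sin cos sq_sqrt sqrt_nonneg)

/-- Space-time with coordinate space the plain function space. -/
local notation "ST(" d ")" => ℝ × (Fin d → ℝ)

/-- Space-time with Euclidean coordinate space. -/
local notation "ET(" d ")" => ℝ × EuclideanSpace ℝ (Fin d)

/-- Smooth functions. -/
abbrev Sm {E F : Type*} [NormedAddCommGroup E] [NormedSpace ℝ E] [NormedAddCommGroup F]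
    [NormedSpace ℝ F] (f : E → F) : Prop := ContDiff ℝ ((⊤ : ℕ∞) : WithTop ℕ∞) f

theorem Sm.iterDeriv {f : ℝ → ℝ} (hf : Sm f) (j : ℕ) : Sm (iteratedDeriv j f) := by
  rw [iteratedDeriv_eq_iterate]
  exact ContDiff.iterate_deriv j hf

theorem Sm.contDiffAt {f : ℝ → ℝ} (hf : Sm f) (j : ℕ) (x : ℝ) : ContDiffAt ℝ j f x :=
  (hf.of_le (by exact_mod_cast le_top)).contDiffAt

theorem Sm.hasDerivAt {f : ℝ → ℝ} (hf : Sm f) (x : ℝ) : HasDerivAt f (deriv f x) x :=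
  (hf.differentiable (by simp) x).hasDerivAt

theorem Sm.hasDerivAt_iter {f : ℝ → ℝ} (hf : Sm f) (j : ℕ) (x : ℝ) :
    HasDerivAt (iteratedDeriv j f) (iteratedDeriv (j + 1) f x) x := by
  rw [iteratedDeriv_succ]; exact (hf.iterDeriv j).hasDerivAt x

theorem Sm.deriv' {f : ℝ → ℝ} (hf : Sm f) : Sm (deriv f) := by
  simpa [iteratedDeriv_one] using hf.iterDeriv 1

theorem iterDeriv_iterDeriv (i j : ℕ) (f : ℝ → ℝ) :
    iteratedDeriv i (iteratedDeriv j f) = iteratedDeriv (i + j) f := by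
  rw [iteratedDeriv_eq_iterate, iteratedDeriv_eq_iterate, iteratedDeriv_eq_iterate,
    Function.iterate_add_apply]

theorem sq_integral_mul_le {α : Type*} [MeasurableSpace α] {μ : Measure α} {f g : α → ℝ}
    (hf : Integrable (fun x => f x ^ 2) μ) (hg : Integrable (fun x => g x ^ 2) μ)
    (hfg : Integrable (fun x => f x * g x) μ) :
    (∫ x, f x * g x ∂μ) ^ 2 ≤ (∫ x, f x ^ 2 ∂μ) * ∫ x, g x ^ 2 ∂μ := by
  have h : ∀ c : ℝ, 0 ≤ (∫ x, f x ^ 2 ∂μ) * (c * c) + (2 * ∫ x, f x * g x ∂μ) * c +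
      ∫ x, g x ^ 2 ∂μ := by
    intro c
    have h1 : 0 ≤ ∫ x, (c * f x + g x) ^ 2 ∂μ := integral_nonneg fun x => sq_nonneg _
    have h2 : ∫ x, (c * f x + g x) ^ 2 ∂μ =
        ∫ x, (c * c) * f x ^ 2 + (2 * c) * (f x * g x) + g x ^ 2 ∂μ := by
      congr 1; ext x; ring
    rw [h2, integral_add, integral_add, integral_const_mul, integral_const_mul] at h1
    · linarith
    · exact hf.const_mul _
    · exact hfg.const_mul _
    · exact (hf.const_mul _).add (hfg.const_mul _)
    · exact hg
  have := discrim_le_zero h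
  unfold discrim at this
  nlinarith

theorem intervalIntegral_mul_sq_le {a b : ℝ} (hab : a ≤ b) {f g : ℝ → ℝ}
    (hf : Continuous f) (hg : Continuous g) :
    (∫ x in a..b, f x * g x) ^ 2 ≤ (∫ x in a..b, f x ^ 2) * ∫ x in a..b, g x ^ 2 := by
  simp only [intervalIntegral.integral_of_le hab]
  have h : ∀ {u : ℝ → ℝ}, Continuous u → Integrable u (volume.restrict (Ioc a b)) :=
    fun {u} hu => (hu.intervalIntegrable a b).1
  exact sq_integral_mul_le (h (hf.pow 2)) (h (hg.pow 2)) (h (hf.mul hg))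

theorem intervalIntegral_sq_le {a b : ℝ} (hab : a ≤ b) {f : ℝ → ℝ} (hf : Continuous f) :
    (∫ x in a..b, f x) ^ 2 ≤ (b - a) * ∫ x in a..b, f x ^ 2 := by
  have := intervalIntegral_mul_sq_le hab continuous_const (hf) (f := fun _ => (1 : ℝ))
  simpa using this

theorem abs_sub_le_intervalIntegral {a b : ℝ} {f : ℝ → ℝ} (hf : Sm f) {s x : ℝ}
    (hs : s ∈ Icc a b) (hx : x ∈ Icc a b) : |f s - f x| ≤ ∫ y in a..b, |deriv f y| := by
  have hc : Continuous fun y => |deriv f y| := hf.deriv'.continuous.abs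
  have key : ∀ {s x : ℝ}, a ≤ x → x ≤ s → s ≤ b → |f s - f x| ≤ ∫ y in a..b, |deriv f y| := by
    intro s x h1 h2 h3
    rw [← intervalIntegral.integral_eq_sub_of_hasDerivAt (fun y _ => hf.hasDerivAt y)
      (hf.deriv'.continuous.intervalIntegrable _ _)]
    refine (intervalIntegral.abs_integral_le_integral_abs h2).trans ?_
    exact intervalIntegral.integral_mono_interval h1 h2 h3
      (Filter.Eventually.of_forall fun y => abs_nonneg _) (hc.intervalIntegrable _ _)
  rcases le_total x s with h | h
  · exact key hx.1 h hs.2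
  · rw [abs_sub_comm]; exact key hs.1 h hx.2

theorem abs_deriv_le_of_Icc {a h : ℝ} (hh : 0 < h) {g : ℝ → ℝ} (hg : Sm g) {s : ℝ}
    (hs : s ∈ Icc a (a + h)) :
    |deriv g s| ≤ 6 / h ^ 2 * (∫ x in a..(a + h), |g x|) +
      ∫ x in a..(a + h), |deriv (deriv g) x| := by
  set b := a + h with hb
  have hab : a ≤ b := by linarith
  set J := ∫ x in a..b, |deriv (deriv g) x| with hJ
  set ρ : ℝ → ℝ := fun x => (x - a) * (b - x) with hρ
  set ρ' : ℝ → ℝ := fun x => (b - x) - (x - a) with hρ'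
  have hρc : Continuous ρ := by fun_prop
  have hρc' : Continuous ρ' := by fun_prop
  have hgc := hg.continuous
  have hdc := hg.deriv'.continuous
  have hρd : ∀ x, HasDerivAt ρ (ρ' x) x := by
    intro x
    have h1 : HasDerivAt ρ (1 * (b - x) + (x - a) * (-1)) x :=
      ((hasDerivAt_id' x).sub_const a).mul ((hasDerivAt_id' x).const_sub b)
    exact h1.congr_deriv (by simp only [hρ']; ring)
  have hintg : ∫ x in a..b, ρ x = h ^ 3 / 6 := by
    have : ∀ x ∈ uIcc a b, HasDerivAt (fun x => h * (x - a) ^ 2 / 2 - (x - a) ^ 3 / 3) (ρ x) x := by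
      intro x _
      have h1 : HasDerivAt (fun x => h * (x - a) ^ 2 / 2 - (x - a) ^ 3 / 3)
          (h * (((2 : ℕ) : ℝ) * (x - a) ^ (2 - 1) * 1) / 2 -
            ((3 : ℕ) : ℝ) * (x - a) ^ (3 - 1) * 1 / 3) x :=
        (((((hasDerivAt_id' x).sub_const a).pow 2).const_mul h).div_const 2).sub
          ((((hasDerivAt_id' x).sub_const a).pow 3).div_const 3)
      exact h1.congr_deriv (by simp only [hρ, hb]; push_cast; ring)
    rw [intervalIntegral.integral_eq_sub_of_hasDerivAt this (hρc.intervalIntegrable _ _)]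
    simp [hb]; ring
  have hibp : ∫ x in a..b, ρ x * deriv g x = - ∫ x in a..b, ρ' x * g x := by
    rw [intervalIntegral.integral_mul_deriv_eq_deriv_mul (fun x _ => hρd x)
      (fun x _ => hg.hasDerivAt x) (hρc'.intervalIntegrable _ _) (hdc.intervalIntegrable _ _)]
    simp [hρ]
  have h1 : deriv g s * (h ^ 3 / 6) = (- ∫ x in a..b, ρ' x * g x) +
      ∫ x in a..b, ρ x * (deriv g s - deriv g x) := by
    rw [← hintg, ← hibp, ← intervalIntegral.integral_const_mul, ← intervalIntegral.integral_add]
    · congr 1; ext x; ring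
    · exact (hρc.mul hdc).intervalIntegrable _ _
    · exact (hρc.mul (continuous_const.sub hdc)).intervalIntegrable _ _
  have h2 : |∫ x in a..b, ρ' x * g x| ≤ h * ∫ x in a..b, |g x| := by
    refine (intervalIntegral.abs_integral_le_integral_abs hab).trans ?_
    rw [← intervalIntegral.integral_const_mul]
    refine intervalIntegral.integral_mono_on hab ((hρc'.mul hgc).abs.intervalIntegrable _ _)
      ((hgc.abs.const_mul h).intervalIntegrable _ _) fun x hx => ?_
    rw [abs_mul]
    refine mul_le_mul_of_nonneg_right ?_ (abs_nonneg _)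
    rw [abs_le]; constructor <;> simp only [hρ', hb] <;> linarith [hx.1, hx.2, hb]
  have h3 : |∫ x in a..b, ρ x * (deriv g s - deriv g x)| ≤ h ^ 3 / 6 * J := by
    refine (intervalIntegral.abs_integral_le_integral_abs hab).trans ?_
    rw [← hintg, ← intervalIntegral.integral_mul_const]
    refine intervalIntegral.integral_mono_on hab
      ((hρc.mul (continuous_const.sub hdc)).abs.intervalIntegrable _ _)
      ((hρc.mul_const J).intervalIntegrable _ _) fun x hx => ?_
    have hp : 0 ≤ ρ x := mul_nonneg (by linarith [hx.1]) (by linarith [hx.2])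
    rw [abs_mul, abs_of_nonneg hp]
    exact mul_le_mul_of_nonneg_left (abs_sub_le_intervalIntegral hg.deriv' hs hx) hp
  have h4 : |deriv g s| * (h ^ 3 / 6) ≤ h * (∫ x in a..b, |g x|) + h ^ 3 / 6 * J := by
    have : |deriv g s| * (h ^ 3 / 6) = |deriv g s * (h ^ 3 / 6)| := by
      rw [abs_mul, abs_of_pos (a := h ^ 3 / 6) (by positivity)]
    rw [this, h1]
    refine (abs_add_le _ _).trans ?_
    rw [abs_neg]; exact add_le_add h2 h3
  have h5 : (6 / h ^ 2 * (∫ x in a..b, |g x|) + J) * (h ^ 3 / 6) =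
      h * (∫ x in a..b, |g x|) + h ^ 3 / 6 * J := by field_simp
  rw [← h5] at h4
  exact le_of_mul_le_mul_right h4 (by positivity)

theorem integral_deriv_sq_le_of_Icc {a h : ℝ} (hh : 0 < h) {g : ℝ → ℝ} (hg : Sm g) :
    ∫ s in a..(a + h), deriv g s ^ 2 ≤ 72 / h ^ 2 * (∫ x in a..(a + h), g x ^ 2) +
      2 * h ^ 2 * ∫ x in a..(a + h), deriv (deriv g) x ^ 2 := by
  have hab : a ≤ a + h := by linarith
  have h1 := intervalIntegral_sq_le hab hg.continuous.abs
  have h2 := intervalIntegral_sq_le hab hg.deriv'.deriv'.continuous.abs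
  simp only [sq_abs, add_sub_cancel_left] at h1 h2
  set I0 := ∫ x in a..(a + h), g x ^ 2
  set I2 := ∫ x in a..(a + h), deriv (deriv g) x ^ 2
  set P := ∫ x in a..(a + h), |g x|
  set Q := ∫ x in a..(a + h), |deriv (deriv g) x|
  have : ∫ s in a..(a + h), deriv g s ^ 2 ≤
      ∫ s in a..(a + h), (72 / h ^ 4 * P ^ 2 + 2 * Q ^ 2) := by
    refine intervalIntegral.integral_mono_on hab
      ((hg.deriv'.continuous.pow 2).intervalIntegrable _ _)
      (continuous_const.intervalIntegrable _ _) fun s hs => ?_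
    have h3 := abs_deriv_le_of_Icc hh hg hs
    rw [← sq_abs]
    calc |deriv g s| ^ 2 ≤ (6 / h ^ 2 * P + Q) ^ 2 := by gcongr
      _ ≤ 2 * (6 / h ^ 2 * P) ^ 2 + 2 * Q ^ 2 := by nlinarith [sq_nonneg (6 / h ^ 2 * P - Q)]
      _ = _ := by ring
  refine this.trans ?_
  rw [intervalIntegral.integral_const]
  simp only [add_sub_cancel_left, smul_eq_mul]
  calc h * (72 / h ^ 4 * P ^ 2 + 2 * Q ^ 2) ≤ h * (72 / h ^ 4 * (h * I0) + 2 * (h * I2)) := by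
        gcongr
    _ = _ := by field_simp

theorem integral_deriv_sq_le {g : ℝ → ℝ} (hg : Sm g) {N : ℕ} (hN : 0 < N) :
    ∫ s in 0..1, deriv g s ^ 2 ≤ 72 * N ^ 2 * (∫ x in 0..1, g x ^ 2) +
      2 / N ^ 2 * ∫ x in 0..1, deriv (deriv g) x ^ 2 := by
  have hN' : (0 : ℝ) < N := by exact_mod_cast hN
  have split : ∀ f : ℝ → ℝ, Continuous f → ∫ s in 0..1, f s =
      ∑ k ∈ Finset.range N, ∫ s in ((k : ℝ) / N)..((k : ℝ) / N + 1 / N), f s := by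
    intro f hf
    have := intervalIntegral.sum_integral_adjacent_intervals (μ := volume) (f := f)
      (a := fun k : ℕ => (k : ℝ) / N) (n := N) (fun k _ => hf.intervalIntegrable _ _)
    rw [show ((0 : ℕ) : ℝ) / N = 0 by simp, show (N : ℝ) / N = 1 by field_simp] at this
    rw [← this]
    refine sum_congr rfl fun k _ => ?_
    rw [← add_div]; push_cast; rfl
  rw [split (fun s => deriv g s ^ 2) (hg.deriv'.continuous.pow 2),
    split (fun s => g s ^ 2) (hg.continuous.pow 2),
    split (fun s => deriv (deriv g) s ^ 2) (hg.deriv'.deriv'.continuous.pow 2), mul_sum, mul_sum,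
    ← sum_add_distrib]
  refine sum_le_sum fun k _ => ?_
  refine (integral_deriv_sq_le_of_Icc (by positivity) hg).trans (le_of_eq ?_)
  field_simp

theorem sq_le_integral {g : ℝ → ℝ} (hg : Sm g) {N : ℝ} (hN : 0 < N) {a b : ℝ}
    (hab : a < b) {s : ℝ} (hs : s ∈ Icc a b) :
    g s ^ 2 ≤ (1 / (b - a) + N) * (∫ x in a..b, g x ^ 2) +
      1 / N * ∫ x in a..b, deriv g x ^ 2 := by
  have hsm : Sm fun x => g x ^ 2 := ContDiff.pow hg 2
  have hd : ∀ x, deriv (fun x => g x ^ 2) x = 2 * g x * deriv g x := by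
    intro x
    have : HasDerivAt (fun x => g x ^ 2) (((2 : ℕ) : ℝ) * g x ^ (2 - 1) * deriv g x) x :=
      (hg.hasDerivAt x).pow 2
    simpa using this.deriv
  have hgc := hg.continuous
  have hdc := hg.deriv'.continuous
  set B := ∫ y in a..b, |deriv (fun x => g x ^ 2) y| with hB
  have h1 : B ≤ N * (∫ x in a..b, g x ^ 2) + 1 / N * ∫ x in a..b, deriv g x ^ 2 := by
    rw [hB, ← intervalIntegral.integral_const_mul, ← intervalIntegral.integral_const_mul,
      ← intervalIntegral.integral_add (by apply Continuous.intervalIntegrable; fun_prop)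
        (by apply Continuous.intervalIntegrable; fun_prop)]
    refine intervalIntegral.integral_mono_on hab.le (hsm.deriv'.continuous.abs.intervalIntegrable _ _)
      (by apply Continuous.intervalIntegrable; fun_prop) fun x _ => ?_
    rw [hd]
    have hNN : N * (1 / N) = 1 := by field_simp
    have hN1 : 0 < 1 / N := by positivity
    rw [abs_le]
    constructor
    · have : 0 ≤ 1 / N * (N * g x + deriv g x) ^ 2 := by positivity
      have e : 1 / N * (N * g x + deriv g x) ^ 2 =
        N * g x ^ 2 + 2 * g x * deriv g x + 1 / N * deriv g x ^ 2 := by field_simp; ring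
      linarith
    · have : 0 ≤ 1 / N * (N * g x - deriv g x) ^ 2 := by positivity
      have e : 1 / N * (N * g x - deriv g x) ^ 2 =
        N * g x ^ 2 - 2 * g x * deriv g x + 1 / N * deriv g x ^ 2 := by field_simp; ring
      linarith
  have h2 : (b - a) * g s ^ 2 ≤ (∫ x in a..b, g x ^ 2) + (b - a) * B := by
    have : ∫ x in a..b, g s ^ 2 ≤ ∫ x in a..b, (g x ^ 2 + B) := by
      refine intervalIntegral.integral_mono_on hab.le (continuous_const.intervalIntegrable _ _)
        (by apply Continuous.intervalIntegrable; fun_prop) fun x hx => ?_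
      have := abs_sub_le_intervalIntegral hsm hs hx
      linarith [le_abs_self (g s ^ 2 - g x ^ 2)]
    rw [intervalIntegral.integral_add (by apply Continuous.intervalIntegrable; fun_prop)
      (by simp)] at this
    simpa using this
  have hba : 0 < b - a := by linarith
  have h3 : g s ^ 2 ≤ 1 / (b - a) * (∫ x in a..b, g x ^ 2) + B := by
    have e : (1 / (b - a) * (∫ x in a..b, g x ^ 2) + B) = ((∫ x in a..b, g x ^ 2) + (b - a) * B) / (b - a) := by
      field_simp
    rw [e, le_div_iff₀ hba]; linarith
  linarith

/-- Discrete interpolation. -/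
theorem discrete_interpolation (c : ℝ → ℝ) (hc : ∀ δ, 0 < δ → 0 ≤ c δ) (J : ℕ) :
    ∀ ε > 0, ∃ C, 0 ≤ C ∧ ∀ Z : ℕ → ℝ, (∀ j, 0 ≤ Z j) →
      (∀ j, 1 ≤ j → j < J → ∀ δ > 0, Z j ≤ δ * Z (j + 1) + c δ * Z (j - 1)) →
      ∀ j < J, Z j ≤ ε * Z J + C * Z 0 := by
  induction J with
  | zero => exact fun ε hε => ⟨0, le_rfl, fun Z _ _ j hj => absurd hj (by omega)⟩
  | succ J ih =>
    intro ε hε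
    -- bound for the top index, then for all
    have top : ∀ ε' > 0, ∃ C, 0 ≤ C ∧ ∀ Z : ℕ → ℝ, (∀ j, 0 ≤ Z j) →
      (∀ j, 1 ≤ j → j < J + 1 → ∀ δ > 0, Z j ≤ δ * Z (j + 1) + c δ * Z (j - 1)) →
        Z J ≤ ε' * Z (J + 1) + C * Z 0 := by
      intro ε' hε'
      rcases Nat.eq_zero_or_pos J with rfl | hJ
      · refine ⟨1, zero_le_one, fun Z h0 _ => ?_⟩
        have := mul_nonneg hε'.le (h0 1); simp; linarith
      · have hcc : 0 ≤ c (ε' / 2) := hc _ (by positivity)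
        obtain ⟨C, hC, h⟩ := ih (1 / (2 * (c (ε' / 2) + 1))) (by positivity)
        refine ⟨2 * (c (ε' / 2) * C), by positivity, fun Z h0 hZ => ?_⟩
        have h1 := hZ J hJ (by omega) (ε' / 2) (by positivity)
        have h2 := h Z h0 (fun j hj hj' => hZ j hj (by omega)) (J - 1) (by omega)
        have h3 : c (ε' / 2) * Z (J - 1) ≤ 1 / 2 * Z J + c (ε' / 2) * C * Z 0 := by
          refine (mul_le_mul_of_nonneg_left h2 hcc).trans ?_
          have : c (ε' / 2) * (1 / (2 * (c (ε' / 2) + 1))) ≤ 1 / 2 := by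
            rw [mul_one_div, div_le_div_iff₀ (by positivity) (by norm_num)]; linarith
          nlinarith [mul_le_mul_of_nonneg_right this (h0 J)]
        linarith
    obtain ⟨C1, hC1, h1⟩ := ih 1 one_pos
    obtain ⟨C2, hC2, h2⟩ := top ε hε
    refine ⟨C1 + C2, by positivity, fun Z h0 hZ j hj => ?_⟩
    have h3 := h2 Z h0 hZ
    have : 0 ≤ C1 * Z 0 := mul_nonneg hC1 (h0 0)
    rcases Nat.lt_succ_iff_lt_or_eq.1 hj with h | rfl
    · have := h1 Z h0 (fun j hj hj' => hZ j hj (by omega)) j h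
      linarith
    · linarith

theorem exists_hilbertBasis_eigenvectors {H : Type} [NormedAddCommGroup H] [InnerProductSpace ℝ H]
    [CompleteSpace H] (G : H →L[ℝ] H) (hG : IsCompactOperator G)
    (hs : (G : H →ₗ[ℝ] H).IsSymmetric) :
    ∃ (ι : Type) (b : HilbertBasis ι ℝ H) (κ : ι → ℝ), ∀ k, G (b k) = κ k • b k := by
  set V : ℝ → Submodule ℝ H := fun κ => Module.End.eigenspace (G : H →ₗ[ℝ] H) κ with hV
  have hcl : ∀ κ, IsClosed (V κ : Set H) := by
    intro κ
    have : (V κ : Set H) = {x | G x = κ • x} := by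
      ext x; simp [hV]
    rw [this]
    exact isClosed_eq G.continuous (continuous_const_smul κ)
  have hcs : ∀ κ, CompleteSpace (V κ) := fun κ => (hcl κ).completeSpace_coe
  choose w b hb using fun κ => exists_hilbertBasis ℝ (V κ)
  set v : (Σ κ, w κ) → H := fun a => (b a.1 a.2 : V a.1) with hv
  have hon : Orthonormal ℝ v :=
    OrthogonalFamily.orthonormal_sigma_orthonormal (hs.orthogonalFamily_eigenspaces)
      (v_family := fun κ => (b κ : w κ → V κ)) fun κ => (b κ).orthonormal
  have hbot : (Submodule.span ℝ (range v))ᗮ = ⊥ := by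
    rw [eq_bot_iff, ← ContinuousLinearMap.orthogonalComplement_iSup_eigenspaces_eq_bot hG hs]
    intro x hx
    rw [Submodule.mem_orthogonal] at hx ⊢
    have hx' : ∀ κ, ∀ y ∈ V κ, inner ℝ y x = 0 := by
      intro κ y hy
      have h1 := ((b κ).hasSum_repr ⟨y, hy⟩).mapL ((innerSL ℝ x).comp (V κ).subtypeL)
      have h2 : ∀ i, ((innerSL ℝ x).comp (V κ).subtypeL) ((b κ).repr ⟨y, hy⟩ i • b κ i) = 0 := by
        intro i
        have := hx (v ⟨κ, i⟩) (Submodule.subset_span ⟨_, rfl⟩)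
        rw [map_smul]
        simp only [ContinuousLinearMap.comp_apply, innerSL_apply_apply, Submodule.subtypeL_apply]
        rw [real_inner_comm]
        simp only [hv] at this
        rw [this, smul_zero]
      have h3 : HasSum (fun _ : w κ => (0 : ℝ)) (inner ℝ x y) := by
        simp only [h2] at h1
        exact h1
      rw [real_inner_comm]
      exact h3.unique hasSum_zero
    intro y hy
    induction hy using Submodule.iSup_induction' with
    | mem κ y hy => exact hx' κ y hy
    | zero => simp
    | add y z _ _ h1 h2 => rw [inner_add_left, h1, h2, add_zero]
  refine ⟨_, HilbertBasis.mkOfOrthogonalEqBot hon hbot, fun a => a.1, fun k => ?_⟩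
  rw [HilbertBasis.coe_mkOfOrthogonalEqBot]
  exact Module.End.mem_eigenspace_iff.1 (b k.1 k.2 : V k.1).2

theorem exists_smooth_extension {N : ℕ} (hN : 0 < N) (c : ℝ) {E : ℝ → ℝ} (hE : ContDiff ℝ N E)
    (h : ∀ s ∈ Icc (0 : ℝ) 1, iteratedDeriv N E s = c * E s) :
    ∃ f : ℝ → ℝ, Sm f ∧ (∀ s, iteratedDeriv N f s = c * f s) ∧
      ∀ s ∈ Icc (0 : ℝ) 1, ∀ j < N, iteratedDeriv j f s = iteratedDeriv j E s := by
  obtain ⟨N, rfl⟩ : ∃ k, N = k + 1 := ⟨N - 1, by omega⟩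
  set M : (Fin (N + 1) → ℝ) →L[ℝ] (Fin (N + 1) → ℝ) := ContinuousLinearMap.pi fun j =>
    if hj : (j : ℕ) + 1 < N + 1 then ContinuousLinearMap.proj ⟨j + 1, hj⟩
    else c • ContinuousLinearMap.proj 0 with hM
  have M1 : ∀ (y : Fin (N + 1) → ℝ) (j : ℕ) (hj : j + 1 < N + 1),
      M y ⟨j, by omega⟩ = y ⟨j + 1, hj⟩ := by
    intro y j hj; simp only [hM, ContinuousLinearMap.pi_apply]
    rw [dif_pos hj]; rfl
  have M2 : ∀ (y : Fin (N + 1) → ℝ), M y ⟨N, by omega⟩ = c * y 0 := by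
    intro y; simp [hM]
  set Y : ℝ → (Fin (N + 1) → ℝ) := fun s j => iteratedDeriv j E s with hY
  set y : ℝ → (Fin (N + 1) → ℝ) := fun s => NormedSpace.exp (s • M) (Y 0) with hy
  have hyd : ∀ s, HasDerivAt y (M (y s)) s := by
    intro s
    have := (hasDerivAt_exp_smul_const' M s).clm_apply (hasDerivAt_const s (Y 0))
    simpa using this
  have hYd : ∀ s ∈ Icc (0 : ℝ) 1, HasDerivAt Y (M (Y s)) s := by
    intro s hs
    rw [hasDerivAt_pi]
    rintro ⟨j, hj⟩
    have h1 : HasDerivAt (iteratedDeriv j E) (iteratedDeriv (j + 1) E s) s := by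
      rw [iteratedDeriv_succ]
      refine ((ContDiff.differentiable_iteratedDeriv j hE ?_) s).hasDerivAt
      exact_mod_cast hj
    rcases Nat.lt_succ_iff_lt_or_eq.1 hj with hj' | rfl
    · rw [M1 _ j (by omega)]; exact h1
    · rw [M2, ← show iteratedDeriv (j + 1) E s = c * Y s 0 by simpa [hY] using h s hs]; exact h1
  have heq : EqOn y Y (Icc 0 1) := by
    refine ODE_solution_unique_of_mem_Icc_right (v := fun _ => M) (s := fun _ => univ)
      (K := ‖M‖₊) (fun t _ => M.lipschitz.lipschitzOnWith)
      (fun s _ => (hyd s).continuousAt.continuousWithinAt)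
      (fun s _ => (hyd s).hasDerivWithinAt) (fun _ _ => mem_univ _)
      (fun s hs => (hYd s hs).continuousAt.continuousWithinAt)
      (fun s hs => (hYd s ⟨hs.1, hs.2.le⟩).hasDerivWithinAt) (fun _ _ => mem_univ _) ?_
    simp [hy]
  have hysm : Sm y := by
    refine contDiff_infty.2 fun n => ?_
    induction n with
    | zero =>
      exact contDiff_zero.2 (continuous_iff_continuousAt.2 fun s => (hyd s).continuousAt)
    | succ n ih =>
      push_cast
      rw [contDiff_succ_iff_deriv]
      refine ⟨fun s => (hyd s).differentiableAt, by simp, ?_⟩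
      rw [show deriv y = fun s => M (y s) from funext fun s => (hyd s).deriv]
      exact M.contDiff.comp ih
  have hcomp : ∀ j (hj : j < N + 1), iteratedDeriv j (fun s => y s 0) = fun s => y s ⟨j, hj⟩ := by
    intro j
    induction j with
    | zero => intro _; simp
    | succ j ih =>
      intro hj
      rw [iteratedDeriv_succ, ih (by omega)]
      ext s
      rw [((hasDerivAt_pi.1 (hyd s)) ⟨j, by omega⟩).deriv, M1 _ j hj]
  refine ⟨fun s => y s 0, contDiff_pi.1 hysm 0, fun s => ?_, fun s hs j hj => ?_⟩
  · rw [iteratedDeriv_succ, hcomp N (by omega), ((hasDerivAt_pi.1 (hyd s)) ⟨N, by omega⟩).deriv, M2]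
  · rw [hcomp j hj]
    simp only [heq hs]; rfl

/-- Lebesgue measure on the unit interval. -/
noncomputable abbrev nu : Measure ℝ := volume.restrict (Ioc (0 : ℝ) 1)

/-- The Hilbert space `L²(0,1)`. -/
abbrev HL : Type := Lp ℝ 2 nu

theorem HL.memLp (f : HL) : MemLp f 2 nu := Lp.memLp f

theorem HL.integrable (f : HL) : Integrable f nu := (HL.memLp f).integrable (by norm_num)

theorem HL.integrable_sq (f : HL) : Integrable (fun x => f x ^ 2) nu := (HL.memLp f).integrable_sq

theorem HL.inner_eq (f g : HL) : inner ℝ f g = ∫ x, f x * g x ∂nu := by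
  rw [L2.inner_def]; congr 1; ext x; simp [mul_comm]

theorem HL.norm_sq (f : HL) : ‖f‖ ^ 2 = ∫ x, f x ^ 2 ∂nu := by
  rw [← real_inner_self_eq_norm_sq, HL.inner_eq]; congr 1; ext x; ring

/-- The continuous representative of the Volterra operator. -/
noncomputable def volt (f : HL) (s : ℝ) : ℝ := ∫ x in (0 : ℝ)..s, f x ∂nu

theorem volt_holder_aux (f : HL) {a b : ℝ} (hab : a ≤ b) :
    (∫ x in a..b, f x ∂nu) ^ 2 ≤ (b - a) * ‖f‖ ^ 2 := by
  rw [intervalIntegral.integral_of_le hab]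
  have h := sq_integral_mul_le (μ := nu.restrict (Ioc a b)) (f := fun _ => (1 : ℝ)) (g := f)
    (integrable_const _) (HL.integrable_sq f).integrableOn
    (by simp only [one_mul]; exact (HL.integrable f).integrableOn)
  simp only [one_mul, one_pow] at h
  refine h.trans ?_
  have h1 : ∫ x in Ioc a b, f x ^ 2 ∂nu ≤ ‖f‖ ^ 2 := by
    rw [HL.norm_sq]
    exact setIntegral_le_integral (HL.integrable_sq f) (Filter.Eventually.of_forall fun x => sq_nonneg _)
  have h2 : ∫ _ in Ioc a b, (1 : ℝ) ∂nu ≤ b - a := by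
    rw [integral_const, smul_eq_mul, mul_one, measureReal_restrict_apply_univ]
    have : nu.real (Ioc a b) ≤ (volume : Measure ℝ).real (Ioc a b) :=
      ENNReal.toReal_mono (by simp) (Measure.restrict_le_self _)
    refine this.trans ?_
    simp [hab]
  have h3 : 0 ≤ ∫ x in Ioc a b, f x ^ 2 ∂nu := integral_nonneg fun x => sq_nonneg _
  exact mul_le_mul h2 h1 h3 (by linarith)

theorem volt_sub (f : HL) (s t : ℝ) : volt f t - volt f s = ∫ x in s..t, f x ∂nu := by
  have h : ∀ a b, IntervalIntegrable f nu a b := fun _ _ => (HL.integrable f).intervalIntegrable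
  rw [volt, volt, intervalIntegral.integral_interval_sub_left (h _ _) (h _ _)]

theorem volt_holder (f : HL) (s t : ℝ) : |volt f t - volt f s| ≤ √|t - s| * ‖f‖ := by
  have key : ∀ s t : ℝ, s ≤ t → |volt f t - volt f s| ≤ √|t - s| * ‖f‖ := by
    intro s t h
    refine abs_le_of_sq_le_sq ?_ (by positivity)
    rw [volt_sub, mul_pow, sq_sqrt (abs_nonneg _), abs_of_nonneg (by linarith)]
    exact volt_holder_aux f h
  rcases le_total s t with h | h
  · exact key s t h
  · rw [abs_sub_comm, abs_sub_comm t s]; exact key t s h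

theorem volt_continuous (f : HL) : Continuous (volt f) :=
  intervalIntegral.continuous_primitive (fun _ _ => (HL.integrable f).intervalIntegrable) 0

theorem volt_zero (f : HL) : volt f 0 = 0 := by simp [volt]

theorem volt_abs_le (f : HL) (s : ℝ) : |volt f s| ≤ ‖f‖ := by
  have h1 : |volt f s| ≤ ∫ x, |f x| ∂nu := by
    unfold volt
    rw [← Real.norm_eq_abs]
    refine (intervalIntegral.norm_integral_le_integral_norm_uIoc).trans ?_
    exact setIntegral_le_integral (HL.integrable f).abs (Filter.Eventually.of_forall fun x => abs_nonneg _)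
  refine h1.trans (abs_le_of_sq_le_sq' ?_ (norm_nonneg _)).2
  have h := sq_integral_mul_le (μ := nu) (f := fun _ => (1 : ℝ)) (g := fun x => |f x|)
    (integrable_const _) (by simpa only [sq_abs] using HL.integrable_sq f)
    (by simpa only [one_mul] using (HL.integrable f).abs)
  simpa [← HL.norm_sq] using h

/-- The Volterra primitive as a bounded continuous function. -/
noncomputable def voltB (f : HL) : BoundedContinuousFunction ℝ ℝ :=
  BoundedContinuousFunction.ofNormedAddCommGroup (volt f) (volt_continuous f) ‖f‖ (volt_abs_le f)

theorem voltB_add (f g : HL) : voltB (f + g) = voltB f + voltB g := by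
  ext s
  change volt (f + g) s = volt f s + volt g s
  unfold volt
  rw [← intervalIntegral.integral_add (HL.integrable f).intervalIntegrable
    (HL.integrable g).intervalIntegrable]
  refine intervalIntegral.integral_congr_ae ?_
  filter_upwards [Lp.coeFn_add f g] with x hx _
  rw [hx]; rfl

theorem voltB_smul (c : ℝ) (f : HL) : voltB (c • f) = c • voltB f := by
  ext s
  change volt (c • f) s = c * volt f s
  unfold volt
  rw [← intervalIntegral.integral_const_mul]
  refine intervalIntegral.integral_congr_ae ?_
  filter_upwards [Lp.coeFn_smul c f] with x hx _
  rw [hx]; rfl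

/-- The Volterra operator on `L²(0,1)`. -/
noncomputable def VO : HL →L[ℝ] HL :=
  LinearMap.mkContinuous
    { toFun := fun f => BoundedContinuousFunction.toLp 2 nu ℝ (voltB f)
      map_add' := fun f g => by rw [voltB_add, map_add]
      map_smul' := fun c f => by rw [voltB_smul, map_smul]; rfl } 1 fun f => by
    change ‖BoundedContinuousFunction.toLp 2 nu ℝ (voltB f)‖ ≤ 1 * ‖f‖
    refine (ContinuousLinearMap.le_opNorm _ _).trans ?_
    refine mul_le_mul ?_ ?_ (norm_nonneg _) zero_le_one
    · refine (BoundedContinuousFunction.toLp_norm_le (p := 2) nu).trans ?_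
      simp [measureUnivNNReal]
    · exact BoundedContinuousFunction.norm_ofNormedAddCommGroup_le _ (norm_nonneg _) _

theorem VO_apply (f : HL) : VO f = BoundedContinuousFunction.toLp 2 nu ℝ (voltB f) := rfl

theorem VO_ae (f : HL) : VO f =ᵐ[nu] volt f :=
  BoundedContinuousFunction.coeFn_toLp 2 nu ℝ (voltB f)

theorem VO_norm_le : ‖VO‖ ≤ 1 := LinearMap.mkContinuous_norm_le _ zero_le_one _

theorem VO_compact : IsCompactOperator VO := by
  rw [isCompactOperator_iff_exists_mem_nhds_image_subset_compact]
  set r : C(Icc (0 : ℝ) 1, ℝ) := ⟨Subtype.val, continuous_subtype_val⟩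
  set pr : C(ℝ, Icc (0 : ℝ) 1) := ⟨projIcc 0 1 zero_le_one, continuous_projIcc⟩
  set A : Set (BoundedContinuousFunction (Icc (0 : ℝ) 1) ℝ) :=
    (fun f => (voltB f).compContinuous r) '' ball (0 : HL) 1 with hA
  have hAc : IsCompact (closure A) := by
    refine BoundedContinuousFunction.arzela_ascoli (Icc (-1) 1) isCompact_Icc A ?_ ?_
    · rintro _ x ⟨f, hf, rfl⟩
      have h1 := volt_abs_le f x
      rw [mem_ball_zero_iff] at hf
      exact abs_le.1 (h1.trans hf.le)
    · intro x
      rw [Metric.equicontinuousAt_iff]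
      intro ε hε
      refine ⟨ε ^ 2, by positivity, ?_⟩
      rintro y hy ⟨_, ⟨f, hf, rfl⟩⟩
      rw [mem_ball_zero_iff] at hf
      change dist (volt f x) (volt f y) < ε
      rw [Real.dist_eq]
      refine (volt_holder f y x).trans_lt ?_
      have h1 : √|(x : ℝ) - y| < ε := by
        rw [Real.sqrt_lt' hε, abs_sub_comm]; exact hy
      nlinarith [sqrt_nonneg |(x : ℝ) - y|, norm_nonneg f]
  have hcont : Continuous fun g : BoundedContinuousFunction (Icc (0 : ℝ) 1) ℝ =>
      BoundedContinuousFunction.toLp 2 nu ℝ (g.compContinuous pr) :=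
    (ContinuousLinearMap.continuous _).comp
      (BoundedContinuousFunction.lipschitz_compContinuous pr).continuous
  refine ⟨ball 0 1, ball_mem_nhds _ one_pos, _, hAc.image hcont, ?_⟩
  rintro _ ⟨f, hf, rfl⟩
  refine ⟨(voltB f).compContinuous r, subset_closure ⟨f, hf, rfl⟩, ?_⟩
  refine Lp.ext ?_
  refine (BoundedContinuousFunction.coeFn_toLp 2 nu ℝ _).trans (Filter.EventuallyEq.trans ?_ (VO_ae f).symm)
  filter_upwards [ae_restrict_mem measurableSet_Ioc] with x hx
  change volt f (projIcc 0 1 zero_le_one x) = _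
  rw [projIcc_of_mem _ (Ioc_subset_Icc_self hx)]

/-- `g` represents the class `f`. -/
def Rep (f : HL) (g : ℝ → ℝ) : Prop := f =ᵐ[nu] g

theorem Rep.inner_eq {f g : HL} {u v : ℝ → ℝ} (hf : Rep f u) (hg : Rep g v) :
    inner ℝ f g = ∫ x in 0..1, u x * v x := by
  rw [HL.inner_eq, intervalIntegral.integral_of_le zero_le_one]
  refine integral_congr_ae ?_
  filter_upwards [hf, hg] with x h1 h2
  rw [h1, h2]

theorem Rep.volt {f : HL} {u : ℝ → ℝ} (hf : Rep f u) {s : ℝ} (hs : s ∈ Icc (0 : ℝ) 1) :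
    volt f s = ∫ x in (0 : ℝ)..s, u x := by
  unfold BDE.volt
  rw [intervalIntegral.integral_of_le hs.1, intervalIntegral.integral_of_le hs.1]
  rw [Measure.restrict_restrict measurableSet_Ioc, inter_eq_left.2 (Ioc_subset_Ioc_right hs.2)]
  refine integral_congr_ae ?_
  exact ae_mono (Measure.restrict_mono (Ioc_subset_Ioc_right hs.2) le_rfl) hf

theorem Rep.VO {f : HL} {u : ℝ → ℝ} (hf : Rep f u) : Rep (VO f) fun s => ∫ x in (0 : ℝ)..s, u x := by
  unfold Rep
  filter_upwards [VO_ae f, ae_restrict_mem measurableSet_Ioc] with x hx hx'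
  rw [hx, hf.volt (Ioc_subset_Icc_self hx')]

theorem Rep.add {f g : HL} {u v : ℝ → ℝ} (hf : Rep f u) (hg : Rep g v) :
    Rep (f + g) fun s => u s + v s := by
  unfold Rep
  filter_upwards [Lp.coeFn_add f g, hf, hg] with x h1 h2 h3
  rw [h1, Pi.add_apply, h2, h3]

theorem Rep.sub {f g : HL} {u v : ℝ → ℝ} (hf : Rep f u) (hg : Rep g v) :
    Rep (f - g) fun s => u s - v s := by
  unfold Rep
  filter_upwards [Lp.coeFn_sub f g, hf, hg] with x h1 h2 h3
  rw [h1, Pi.sub_apply, h2, h3]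

theorem Rep.smul {f : HL} {u : ℝ → ℝ} (c : ℝ) (hf : Rep f u) : Rep (c • f) fun s => c * u s := by
  unfold Rep
  filter_upwards [Lp.coeFn_smul c f, hf] with x h1 h2
  rw [h1, Pi.smul_apply, h2, smul_eq_mul]

theorem exists_rep_of_continuous {u : ℝ → ℝ} (hu : Continuous u) : ∃ f : HL, Rep f u := by
  set pr : C(ℝ, Icc (0 : ℝ) 1) := ⟨projIcc 0 1 zero_le_one, continuous_projIcc⟩
  set g := BoundedContinuousFunction.mkOfCompact (⟨fun x : Icc (0 : ℝ) 1 => u x, by fun_prop⟩ : C(Icc (0:ℝ) 1, ℝ))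
  refine ⟨BoundedContinuousFunction.toLp 2 nu ℝ (g.compContinuous pr), ?_⟩
  refine (BoundedContinuousFunction.coeFn_toLp 2 nu ℝ _).trans ?_
  filter_upwards [ae_restrict_mem measurableSet_Ioc] with x hx
  change u (projIcc 0 1 zero_le_one x) = _
  rw [projIcc_of_mem _ (Ioc_subset_Icc_self hx)]

theorem Rep.eq_of_continuous {f : HL} {u v : ℝ → ℝ} (hu : Rep f u) (hv : Rep f v)
    (hcu : Continuous u) (hcv : Continuous v) : EqOn u v (Icc 0 1) := by
  have h : u =ᵐ[nu] v := hu.symm.trans hv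
  have h1 : u =ᵐ[volume.restrict (Ioo (0 : ℝ) 1)] v :=
    ae_mono (Measure.restrict_mono Ioo_subset_Ioc_self le_rfl) h
  have h2 : EqOn u v (Ioo 0 1) :=
    Measure.eqOn_open_of_ae_eq h1 isOpen_Ioo hcu.continuousOn hcv.continuousOn
  have := h2.closure hcu hcv
  rwa [closure_Ioo (by norm_num)] at this

/-- The constant function one. -/
noncomputable def one1 : HL := (exists_rep_of_continuous (continuous_const (y := (1 : ℝ)))).choose

theorem rep_one1 : Rep one1 fun _ => 1 :=
  (exists_rep_of_continuous (continuous_const (y := (1 : ℝ)))).choose_spec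

theorem inner_VO (f g : HL) :
    inner ℝ (VO f) g + inner ℝ f (VO g) = inner ℝ f one1 * inner ℝ g one1 := by
  have hd := BoundedContinuousFunction.toLp_denseRange (α := ℝ) ℝ nu (p := 2) ℝ (by norm_num)
  refine hd.induction_on₂ (p := fun f g => inner ℝ (VO f) g + inner ℝ f (VO g) =
    inner ℝ f one1 * inner ℝ g one1) ?_ ?_ f g
  · exact isClosed_eq (by fun_prop) (by fun_prop)
  · intro u v
    have hu : Rep (BoundedContinuousFunction.toLp 2 nu ℝ u) u :=
      BoundedContinuousFunction.coeFn_toLp 2 nu ℝ u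
    have hv : Rep (BoundedContinuousFunction.toLp 2 nu ℝ v) v :=
      BoundedContinuousFunction.coeFn_toLp 2 nu ℝ v
    have hcu := u.continuous
    have hcv := v.continuous
    rw [hu.VO.inner_eq hv, hu.inner_eq hv.VO, hu.inner_eq rep_one1, hv.inner_eq rep_one1]
    have du : ∀ x, HasDerivAt (fun s => ∫ y in (0 : ℝ)..s, u y) (u x) x := fun x =>
      intervalIntegral.integral_hasDerivAt_right (hcu.intervalIntegrable _ _)
        (hcu.stronglyMeasurableAtFilter _ _) hcu.continuousAt
    have dv : ∀ x, HasDerivAt (fun s => ∫ y in (0 : ℝ)..s, v y) (v x) x := fun x =>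
      intervalIntegral.integral_hasDerivAt_right (hcv.intervalIntegrable _ _)
        (hcv.stronglyMeasurableAtFilter _ _) hcv.continuousAt
    rw [intervalIntegral.integral_mul_deriv_eq_deriv_mul (fun x _ => du x) (fun x _ => dv x)
      (hcu.intervalIntegrable _ _) (hcv.intervalIntegrable _ _)]
    simp

theorem adjoint_VO (f : HL) : adjoint VO f = inner ℝ f one1 • one1 - VO f := by
  refine ext_inner_left ℝ fun g => ?_
  rw [ContinuousLinearMap.adjoint_inner_right, inner_sub_right, inner_smul_right]
  have := inner_VO g f
  linarith

theorem Rep.adjoint {f : HL} {u : ℝ → ℝ} (hf : Rep f u) (hu : Continuous u) :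
    Rep (adjoint BDE.VO f) fun s => ∫ x in s..1, u x := by
  have h := (rep_one1.smul (inner ℝ f one1)).sub hf.VO
  rw [← adjoint_VO] at h
  refine h.trans (Filter.Eventually.of_forall fun s => ?_)
  simp only [hf.inner_eq rep_one1, mul_one]
  rw [← intervalIntegral.integral_add_adjacent_intervals (hu.intervalIntegrable 0 s)
    (hu.intervalIntegrable s 1)]
  ring

/-- Orthonormal, complete system of eigenfunctions of `(-1)^m D^{2m}` on the unit interval with
Dirichlet conditions. -/
structure IsEigenSystem (m : ℕ) {ι : Type} (e : ι → ℝ → ℝ) (μ : ι → ℝ) : Prop where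
  smooth : ∀ k, Sm (e k)
  one_le : ∀ k, 1 ≤ μ k
  eq : ∀ k s, iteratedDeriv (2 * m) (e k) s = (-1) ^ m * μ k * e k s
  bc0 : ∀ k, ∀ j < m, iteratedDeriv j (e k) 0 = 0
  bc1 : ∀ k, ∀ j < m, iteratedDeriv j (e k) 1 = 0
  orth : ∀ k, ∫ s in 0..1, e k s * e k s = 1
  orth_ne : ∀ k l, k ≠ l → ∫ s in 0..1, e k s * e l s = 0
  parseval : ∀ f g : ℝ → ℝ, Continuous f → Continuous g →
    HasSum (fun k => (∫ s in 0..1, f s * e k s) * ∫ s in 0..1, g s * e k s)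
      (∫ s in 0..1, f s * g s)

/-- Primitive vanishing at `0`. -/
noncomputable def prim (u : ℝ → ℝ) : ℝ → ℝ := fun s => ∫ x in (0 : ℝ)..s, u x

/-- Negative primitive vanishing at `1`. -/
noncomputable def primR (u : ℝ → ℝ) : ℝ → ℝ := fun s => ∫ x in s..1, u x

theorem hasDerivAt_prim {u : ℝ → ℝ} (hu : Continuous u) (x : ℝ) : HasDerivAt (prim u) (u x) x :=
  intervalIntegral.integral_hasDerivAt_right (hu.intervalIntegrable _ _)
    (hu.stronglyMeasurableAtFilter _ _) hu.continuousAt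

theorem hasDerivAt_primR {u : ℝ → ℝ} (hu : Continuous u) (x : ℝ) :
    HasDerivAt (primR u) (-u x) x :=
  intervalIntegral.integral_hasDerivAt_left (hu.intervalIntegrable _ _)
    (hu.stronglyMeasurableAtFilter _ _) hu.continuousAt

theorem continuous_prim {u : ℝ → ℝ} (hu : Continuous u) : Continuous (prim u) :=
  continuous_iff_continuousAt.2 fun x => (hasDerivAt_prim hu x).continuousAt

theorem continuous_primR {u : ℝ → ℝ} (hu : Continuous u) : Continuous (primR u) :=
  continuous_iff_continuousAt.2 fun x => (hasDerivAt_primR hu x).continuousAt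

theorem continuous_prim_iter {u : ℝ → ℝ} (hu : Continuous u) (k : ℕ) : Continuous (prim^[k] u) := by
  induction k with
  | zero => exact hu
  | succ k ih => rw [Function.iterate_succ_apply']; exact continuous_prim ih

theorem continuous_primR_iter {u : ℝ → ℝ} (hu : Continuous u) (k : ℕ) :
    Continuous (primR^[k] u) := by
  induction k with
  | zero => exact hu
  | succ k ih => rw [Function.iterate_succ_apply']; exact continuous_primR ih

theorem deriv_prim {u : ℝ → ℝ} (hu : Continuous u) : deriv (prim u) = u :=
  funext fun x => (hasDerivAt_prim hu x).deriv

theorem deriv_primR {u : ℝ → ℝ} (hu : Continuous u) : deriv (primR u) = -u :=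
  funext fun x => (hasDerivAt_primR hu x).deriv

theorem contDiff_prim {N : ℕ} {u : ℝ → ℝ} (hu : ContDiff ℝ N u) :
    ContDiff ℝ (N + 1 : ℕ) (prim u) := by
  push_cast
  rw [contDiff_succ_iff_deriv]
  refine ⟨fun x => (hasDerivAt_prim hu.continuous x).differentiableAt, by simp, ?_⟩
  rwa [deriv_prim hu.continuous]

theorem contDiff_primR {N : ℕ} {u : ℝ → ℝ} (hu : ContDiff ℝ N u) :
    ContDiff ℝ (N + 1 : ℕ) (primR u) := by
  push_cast
  rw [contDiff_succ_iff_deriv]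
  refine ⟨fun x => (hasDerivAt_primR hu.continuous x).differentiableAt, by simp, ?_⟩
  rw [deriv_primR hu.continuous]
  exact hu.neg

theorem contDiff_prim_iter {N : ℕ} {u : ℝ → ℝ} (hu : ContDiff ℝ N u) (k : ℕ) :
    ContDiff ℝ (N + k : ℕ) (prim^[k] u) := by
  induction k with
  | zero => exact hu
  | succ k ih => rw [Function.iterate_succ_apply']; exact contDiff_prim ih

theorem contDiff_primR_iter {N : ℕ} {u : ℝ → ℝ} (hu : ContDiff ℝ N u) (k : ℕ) :
    ContDiff ℝ (N + k : ℕ) (primR^[k] u) := by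
  induction k with
  | zero => exact hu
  | succ k ih => rw [Function.iterate_succ_apply']; exact contDiff_primR ih

theorem iteratedDeriv_prim_iter {u : ℝ → ℝ} (hu : Continuous u) (j k : ℕ) :
    iteratedDeriv j (prim^[j + k] u) = prim^[k] u := by
  induction j with
  | zero => simp
  | succ j ih =>
    rw [iteratedDeriv_succ', show j + 1 + k = (j + k) + 1 by ring, Function.iterate_succ_apply',
      deriv_prim (continuous_prim_iter hu _), ih]

theorem iteratedDeriv_primR_iter {u : ℝ → ℝ} (hu : Continuous u) (j : ℕ) :
    iteratedDeriv j (primR^[j] u) = fun s => (-1) ^ j * u s := by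
  induction j with
  | zero => simp
  | succ j ih =>
    rw [iteratedDeriv_succ', Function.iterate_succ_apply', deriv_primR (continuous_primR_iter hu _),
      show -primR^[j] u = fun s => -(primR^[j] u s) from rfl]
    ext s
    rw [iteratedDeriv_fun_neg, ih]; simp [pow_succ]

theorem Rep.VO_iter {f : HL} {u : ℝ → ℝ} (hf : Rep f u) (k : ℕ) : Rep ((BDE.VO ^ k) f) (prim^[k] u) := by
  induction k with
  | zero => exact hf
  | succ k ih => rw [Function.iterate_succ_apply', pow_succ']; exact ih.VO

theorem Rep.adjoint_iter {f : HL} {u : ℝ → ℝ} (hf : Rep f u) (hu : Continuous u) (k : ℕ) :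
    Rep ((ContinuousLinearMap.adjoint BDE.VO ^ k) f) (primR^[k] u) := by
  induction k with
  | zero => exact hf
  | succ k ih =>
    rw [Function.iterate_succ_apply', pow_succ']; exact ih.adjoint (continuous_primR_iter hu k)

theorem adjoint_iter_inner (k : ℕ) (f g : HL) :
    inner ℝ ((adjoint VO ^ k) f) g = inner ℝ f ((VO ^ k) g) := by
  induction k generalizing g with
  | zero => simp
  | succ k ih =>
    rw [pow_succ', pow_succ]
    change inner ℝ (adjoint VO _) g = inner ℝ f ((VO ^ k) (VO g))
    rw [ContinuousLinearMap.adjoint_inner_left]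
    exact ih _

/-- The span of the iterated adjoint primitives of the constants. -/
noncomputable def polySpan (m : ℕ) : Submodule ℝ HL :=
  Submodule.span ℝ ((fun k : ℕ => (adjoint VO ^ k) one1) '' (Finset.range m : Set ℕ))

instance (m : ℕ) : FiniteDimensional ℝ (polySpan m) :=
  FiniteDimensional.span_of_finite ℝ ((Finset.range m).finite_toSet.image _)

theorem rep_of_mem_polySpan {m : ℕ} {p : HL} (hp : p ∈ polySpan m) :
    ∃ q : ℝ → ℝ, ContDiff ℝ m q ∧ Rep p q ∧ iteratedDeriv m q = 0 := by
  induction hp using Submodule.span_induction with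
  | mem x hx =>
    obtain ⟨k, hk, rfl⟩ := hx
    have hk' : k < m := by simpa using hk
    have hs : ∀ N : ℕ, ContDiff ℝ N (primR^[k] fun _ => (1 : ℝ)) := fun N =>
      (contDiff_primR_iter (N := N) contDiff_const k).of_le (by exact_mod_cast Nat.le_add_right _ _)
    refine ⟨_, hs m, rep_one1.adjoint_iter continuous_const k, ?_⟩
    have h1 := iteratedDeriv_primR_iter (u := fun _ => (1 : ℝ)) continuous_const k
    obtain ⟨l, rfl⟩ : ∃ l, m = (l + 1) + k := ⟨m - k - 1, by omega⟩
    rw [iteratedDeriv_eq_iterate] at h1 ⊢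
    rw [Function.iterate_add_apply, h1, ← iteratedDeriv_eq_iterate, iteratedDeriv_succ']
    simp
    ext; simp
  | zero =>
    refine ⟨fun _ => 0, contDiff_const, Lp.coeFn_zero _ _ _, ?_⟩
    ext x; simp
  | add x y _ _ hx hy =>
    obtain ⟨q, h1, h2, h3⟩ := hx
    obtain ⟨q', h1', h2', h3'⟩ := hy
    refine ⟨fun s => q s + q' s, h1.add h1', h2.add h2', ?_⟩
    ext s
    rw [iteratedDeriv_fun_add h1.contDiffAt h1'.contDiffAt, h3, h3']; simp
  | smul a x _ hx =>
    obtain ⟨q, h1, h2, h3⟩ := hx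
    refine ⟨fun s => a * q s, contDiff_const.mul h1, h2.smul a, ?_⟩
    ext s
    rw [iteratedDeriv_const_mul_field, h3]; simp

/-- The projection orthogonal to `polySpan`. -/
noncomputable def projP (m : ℕ) : HL →L[ℝ] HL := (polySpan m)ᗮ.starProjection

/-- The Green operator of `(-1)^m D^{2m}` with Dirichlet conditions. -/
noncomputable def green (m : ℕ) : HL →L[ℝ] HL :=
  VO ^ m * projP m * adjoint VO ^ m

theorem green_apply (m : ℕ) (f : HL) :
    green m f = (VO ^ m) (projP m ((adjoint VO ^ m) f)) := rfl

theorem projP_inner (m : ℕ) (f g : HL) : inner ℝ (projP m f) g = inner ℝ (projP m f) (projP m g) := by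
  have h1 := Submodule.inner_starProjection_left_eq_right (polySpan m)ᗮ (projP m f) g
  rw [← projP] at h1
  rw [← h1]
  congr 1
  exact (Submodule.starProjection_eq_self_iff.2 (Submodule.starProjection_apply_mem _ _)).symm

theorem green_inner (m : ℕ) (f g : HL) : inner ℝ (green m f) g =
    inner ℝ (projP m ((adjoint VO ^ m) f))
      (projP m ((adjoint VO ^ m) g)) := by
  rw [green_apply, real_inner_comm, ← adjoint_iter_inner, real_inner_comm, projP_inner]

theorem VO_pow_norm_le (m : ℕ) (f : HL) : ‖(VO ^ m) f‖ ≤ ‖f‖ := by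
  induction m with
  | zero => simp
  | succ k ih =>
    rw [pow_succ']
    refine (VO.le_opNorm _).trans ?_
    exact (mul_le_of_le_one_left (norm_nonneg _) VO_norm_le).trans ih

theorem adjVO_pow_norm_le (m : ℕ) (f : HL) : ‖(adjoint VO ^ m) f‖ ≤ ‖f‖ := by
  have h := adjoint_iter_inner m f ((adjoint VO ^ m) f)
  rw [real_inner_self_eq_norm_sq] at h
  have h2 := real_inner_le_norm f ((VO ^ m) ((adjoint VO ^ m) f))
  have h3 := VO_pow_norm_le m ((adjoint VO ^ m) f)
  by_contra! hc
  nlinarith [norm_nonneg f, norm_nonneg ((adjoint VO ^ m) f)]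

theorem green_compact {m : ℕ} (hm : 1 ≤ m) : IsCompactOperator (green m) := by
  obtain ⟨k, rfl⟩ : ∃ k, m = k + 1 := ⟨m - 1, by omega⟩
  have : green (k + 1) = VO ∘L (VO ^ k * projP (k + 1) * adjoint VO ^ (k + 1)) := by
    rw [green, pow_succ' VO]; rfl
  rw [this]
  exact VO_compact.comp_clm _

theorem green_symm (m : ℕ) : (green m : HL →ₗ[ℝ] HL).IsSymmetric := by
  intro f g
  change inner ℝ (green m f) g = inner ℝ f (green m g)
  rw [green_inner, real_inner_comm (green m g) f, green_inner, real_inner_comm]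

theorem prim_iter_iteratedDeriv {φ : ℝ → ℝ} (hφ : Sm φ) (h0 : ∀ j, iteratedDeriv j φ 0 = 0)
    (j k : ℕ) : prim^[k] (iteratedDeriv (j + k) φ) = iteratedDeriv j φ := by
  induction k with
  | zero => rfl
  | succ k ih =>
    rw [Function.iterate_succ_apply]
    have : prim (iteratedDeriv (j + (k + 1)) φ) = iteratedDeriv (j + k) φ := by
      ext s
      unfold prim
      rw [show j + (k + 1) = j + k + 1 by ring]
      rw [intervalIntegral.integral_eq_sub_of_hasDerivAt
        (fun x _ => hφ.hasDerivAt_iter (j + k) x)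
        ((hφ.iterDeriv _).continuous.intervalIntegrable _ _), h0, sub_zero]
    rw [this, ih]

theorem green_ker {m : ℕ} {f : HL} (hf : projP m ((adjoint VO ^ m) f) = 0) :
    f = 0 := by
  have hS : (adjoint VO ^ m) f ∈ polySpan m := by
    have := (Submodule.starProjection_apply_eq_zero_iff (K := (polySpan m)ᗮ)).1 hf
    rwa [Submodule.orthogonal_orthogonal] at this
  have key : ∀ φ : ℝ → ℝ, Sm φ → HasCompactSupport φ → tsupport φ ⊆ Ioo 0 1 →
      ∫ x, φ x • f x ∂nu = 0 := by
    intro φ hφ _ hsupp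
    have hz : ∀ x, x ∉ Ioo (0 : ℝ) 1 → ∀ j, iteratedDeriv j φ x = 0 := by
      intro x hx j
      have hx' : x ∉ tsupport φ := fun h => hx (hsupp h)
      have : φ =ᶠ[𝓝 x] fun _ => 0 := notMem_tsupport_iff_eventuallyEq.1 hx'
      rw [this.iteratedDeriv_eq]
      simp
    have h0 := hz 0 (by simp)
    have h1 := hz 1 (by simp)
    obtain ⟨G, hG⟩ := exists_rep_of_continuous (hφ.iterDeriv m).continuous
    have hVG : Rep ((VO ^ m) G) φ := by
      have := hG.VO_iter m
      have h2 := prim_iter_iteratedDeriv hφ h0 0 m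
      rw [zero_add, iteratedDeriv_zero] at h2
      rwa [h2] at this
    have horth : ∀ p ∈ polySpan m, inner ℝ p G = 0 := by
      intro p hp
      induction hp using Submodule.span_induction with
      | mem x hx =>
        obtain ⟨k, hk, rfl⟩ := hx
        have hk' : k < m := by simpa using hk
        change inner ℝ ((adjoint VO ^ k) one1) G = 0
        rw [adjoint_iter_inner, rep_one1.inner_eq (hG.VO_iter k)]
        obtain ⟨l, rfl⟩ : ∃ l, m = (l + 1) + k := ⟨m - k - 1, by omega⟩
        rw [prim_iter_iteratedDeriv hφ h0]
        simp only [one_mul]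
        rw [intervalIntegral.integral_eq_sub_of_hasDerivAt (fun x _ => hφ.hasDerivAt_iter l x)
          ((hφ.iterDeriv _).continuous.intervalIntegrable _ _), h0, h1, sub_zero]
      | zero => simp
      | add x y _ _ hx hy => rw [inner_add_left, hx, hy, add_zero]
      | smul a x _ hx => rw [inner_smul_left, hx, mul_zero]
    have h3 := horth _ hS
    rw [adjoint_iter_inner, HL.inner_eq] at h3
    rw [← h3]
    refine integral_congr_ae ?_
    filter_upwards [hVG] with x hx
    rw [hx, smul_eq_mul, mul_comm]
  have h := isOpen_Ioo (a := (0 : ℝ)) (b := 1) |>.ae_eq_zero_of_integral_contDiff_smul_eq_zero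
    (f := f) (μ := nu) ((HL.integrable f).locallyIntegrable.locallyIntegrableOn _) key
  refine Lp.ext ?_
  have h2 : ∀ᵐ x ∂nu, x ∈ Ioo (0 : ℝ) 1 := by
    rw [nu, ← Measure.restrict_congr_set (μ := volume) Ioo_ae_eq_Ioc]
    exact ae_restrict_mem measurableSet_Ioo
  filter_upwards [h, h2, Lp.coeFn_zero ℝ 2 nu] with x hx hx2 hx3
  rw [hx hx2, hx3]; rfl

/-- Regularity of eigenvectors of the Green operator. -/
theorem exists_smooth_eigenfunction {m : ℕ} (hm : 1 ≤ m) {f : HL} {κ : ℝ} (hf : ‖f‖ = 1)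
    (h : green m f = κ • f) :
    0 < κ ∧ κ ≤ 1 ∧ ∃ e : ℝ → ℝ, Sm e ∧ Rep f e ∧
      (∀ s, iteratedDeriv (2 * m) e s = (-1) ^ m * κ⁻¹ * e s) ∧
      ∀ j < m, iteratedDeriv j e 0 = 0 ∧ iteratedDeriv j e 1 = 0 := by
  set p := projP m ((adjoint VO ^ m) f) with hp
  have hκ : κ = ‖p‖ ^ 2 := by
    have h1 := green_inner m f f
    rw [h, inner_smul_left, real_inner_self_eq_norm_sq, real_inner_self_eq_norm_sq, hf, ← hp] at h1
    rw [← h1, one_pow, mul_one]; rfl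
  have hpos : 0 < κ := by
    rw [hκ]
    have : p ≠ 0 := fun h0 => by
      have := green_ker (hp ▸ h0)
      rw [this, norm_zero] at hf
      norm_num at hf
    positivity
  have hle : κ ≤ 1 := by
    have h1 : ‖p‖ ≤ 1 := by
      refine ((polySpan m)ᗮ.norm_starProjection_apply_le _).trans ?_
      exact (adjVO_pow_norm_le m f).trans hf.le
    rw [hκ]; nlinarith [norm_nonneg p]
  refine ⟨hpos, hle, ?_⟩
  have hfe : f = κ⁻¹ • (VO ^ m) p := by
    rw [hp, ← green_apply, h, smul_smul, inv_mul_cancel₀ hpos.ne', one_smul]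
  -- a continuous representative
  obtain ⟨e0, he0c, he0⟩ : ∃ e0 : ℝ → ℝ, Continuous e0 ∧ Rep f e0 := by
    obtain ⟨k, rfl⟩ : ∃ k, m = k + 1 := ⟨m - 1, by omega⟩
    refine ⟨fun s => κ⁻¹ * volt ((VO ^ k) p) s, continuous_const.mul (volt_continuous _), ?_⟩
    rw [hfe, pow_succ']
    exact Rep.smul κ⁻¹ (VO_ae ((VO ^ k) p))
  obtain ⟨q, hq, hqr, hq0⟩ : ∃ q : ℝ → ℝ, ContDiff ℝ m q ∧
      Rep ((adjoint VO ^ m) f - p) q ∧ iteratedDeriv m q = 0 := by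
    refine rep_of_mem_polySpan ?_
    have := Submodule.sub_starProjection_mem_orthogonal (K := (polySpan m)ᗮ)
      ((adjoint VO ^ m) f)
    rwa [Submodule.orthogonal_orthogonal] at this
  have hw : ContDiff ℝ m (primR^[m] e0) := by
    have := contDiff_primR_iter (N := 0) (contDiff_zero.2 he0c) m
    simpa using this
  set h0 : ℝ → ℝ := fun s => primR^[m] e0 s - q s with hh0
  have hh0c : ContDiff ℝ m h0 := hw.sub hq
  have hrp : Rep p h0 := by
    have := (he0.adjoint_iter he0c m).sub hqr
    rwa [sub_sub_cancel] at this
  have hDh0 : ∀ s, iteratedDeriv m h0 s = (-1) ^ m * e0 s := by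
    intro s
    rw [hh0, iteratedDeriv_fun_sub hw.contDiffAt hq.contDiffAt, hq0,
      iteratedDeriv_primR_iter he0c]
    simp
  set E1 := prim^[m] h0 with hE1
  have hE1c : ContDiff ℝ (2 * m : ℕ) E1 := by
    have := contDiff_prim_iter hh0c m
    rwa [← two_mul] at this
  have hE1r : Rep ((VO ^ m) p) E1 := hrp.VO_iter m
  set E : ℝ → ℝ := fun s => κ⁻¹ * E1 s with hE
  have hEc : ContDiff ℝ (2 * m : ℕ) E := contDiff_const.mul hE1c
  have hEr : Rep f E := by
    have := hE1r.smul κ⁻¹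
    rwa [← hfe] at this
  have hEe : EqOn E e0 (Icc 0 1) := hEr.eq_of_continuous he0 hEc.continuous he0c
  have hDE : ∀ j s, iteratedDeriv j E s = κ⁻¹ * iteratedDeriv j E1 s := fun j s => by
    rw [hE, iteratedDeriv_const_mul_field]
  have hD1 : ∀ l j, l + j = m → iteratedDeriv j E1 = prim^[l] h0 := by
    intro l j hl
    rw [hE1, ← hl, add_comm l j]
    exact iteratedDeriv_prim_iter hh0c.continuous j l
  have heq : ∀ s ∈ Icc (0 : ℝ) 1, iteratedDeriv (2 * m) E s = (-1) ^ m * κ⁻¹ * E s := by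
    intro s hs
    have h2 : iteratedDeriv (2 * m) E1 = iteratedDeriv m h0 := by
      have h3 := hD1 0 m (by simp)
      rw [Function.iterate_zero, id] at h3
      rw [← h3, iterDeriv_iterDeriv]; congr 1; ring
    rw [hDE, h2, hDh0, ← hEe hs]; ring
  obtain ⟨e, hes, hee, heE⟩ := exists_smooth_extension (N := 2 * m) (by omega) _ hEc heq
  refine ⟨e, hes, ?_, hee, ?_⟩
  · refine hEr.trans ?_
    filter_upwards [ae_restrict_mem measurableSet_Ioc] with x hx
    have := heE x (Ioc_subset_Icc_self hx) 0 (by omega)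
    simpa using this.symm
  · intro j hj
    obtain ⟨l, rfl⟩ : ∃ l, m = (l + 1) + j := ⟨m - j - 1, by omega⟩
    rw [heE 0 (by simp) j (by omega), heE 1 (by simp) j (by omega), hDE, hDE, hD1 (l + 1) j rfl,
      Function.iterate_succ_apply']
    have h1 : prim (prim^[l] h0) 1 = 0 := by
      have h2 : inner ℝ p ((adjoint VO ^ l) one1) = 0 := by
        have h3 : p ∈ (polySpan (l + 1 + j))ᗮ := Submodule.starProjection_apply_mem _ _
        refine (Submodule.mem_orthogonal' _ _).1 h3 _ (Submodule.subset_span ⟨l, ?_, rfl⟩)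
        simp; omega
      rw [real_inner_comm, adjoint_iter_inner, rep_one1.inner_eq (hrp.VO_iter l)] at h2
      simpa [prim] using h2
    rw [h1]
    simp [prim]

theorem exists_isEigenSystem {m : ℕ} (hm : 1 ≤ m) :
    ∃ (ι : Type) (e : ι → ℝ → ℝ) (μ : ι → ℝ), IsEigenSystem m e μ := by
  obtain ⟨ι, b, κ, hb⟩ := exists_hilbertBasis_eigenvectors (green m) (green_compact hm) (green_symm m)
  have hn : ∀ k, ‖b k‖ = 1 := fun k => b.orthonormal.1 k
  choose hpos hle e he using fun k => exists_smooth_eigenfunction hm (hn k) (hb k)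
  refine ⟨ι, e, fun k => (κ k)⁻¹, fun k => (he k).1, fun k => (one_le_inv₀ (hpos k)).2 (hle k),
    fun k => (he k).2.2.1, fun k j hj => ((he k).2.2.2 j hj).1, fun k j hj => ((he k).2.2.2 j hj).2,
    fun k => ?_, fun k l hkl => ?_, fun f g hf hg => ?_⟩
  · rw [← (he k).2.1.inner_eq (he k).2.1, real_inner_self_eq_norm_sq, hn]; norm_num
  · rw [← (he k).2.1.inner_eq (he l).2.1]
    exact b.orthonormal.2 hkl
  · obtain ⟨F, hF⟩ := exists_rep_of_continuous hf
    obtain ⟨G, hG⟩ := exists_rep_of_continuous hg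
    have h := b.hasSum_inner_mul_inner F G
    rw [hF.inner_eq hG] at h
    refine h.congr_fun ?_
    intro k
    rw [hF.inner_eq (he k).2.1, real_inner_comm, hG.inner_eq (he k).2.1]

/-- Squared `L²(0,1)` norm. -/
noncomputable def nsq (f : ℝ → ℝ) : ℝ := ∫ s in 0..1, f s ^ 2

/-- `L²(0,1)` norm. -/
noncomputable def nrm (f : ℝ → ℝ) : ℝ := √(nsq f)

theorem nsq_nonneg (f : ℝ → ℝ) : 0 ≤ nsq f :=
  intervalIntegral.integral_nonneg zero_le_one fun _ _ => sq_nonneg _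

theorem nrm_nonneg (f : ℝ → ℝ) : 0 ≤ nrm f := sqrt_nonneg _

theorem nrm_sq (f : ℝ → ℝ) : nrm f ^ 2 = nsq f := sq_sqrt (nsq_nonneg f)

theorem nrm_le_of_nsq_le {f : ℝ → ℝ} {c : ℝ} (hc : 0 ≤ c) (h : nsq f ≤ c ^ 2) : nrm f ≤ c := by
  rw [nrm, Real.sqrt_le_left hc]; exact h

theorem abs_integral_mul_le {f g : ℝ → ℝ} (hf : Continuous f) (hg : Continuous g) :
    |∫ s in 0..1, f s * g s| ≤ nrm f * nrm g := by
  refine abs_le_of_sq_le_sq ?_ (mul_nonneg (nrm_nonneg _) (nrm_nonneg _))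
  rw [mul_pow, nrm_sq, nrm_sq]
  exact intervalIntegral_mul_sq_le zero_le_one hf hg

theorem nrm_add_le {f g : ℝ → ℝ} (hf : Continuous f) (hg : Continuous g) :
    nrm (fun s => f s + g s) ≤ nrm f + nrm g := by
  refine nrm_le_of_nsq_le (add_nonneg (nrm_nonneg _) (nrm_nonneg _)) ?_
  have h : nsq (fun s => f s + g s) = nsq f + 2 * (∫ s in 0..1, f s * g s) + nsq g := by
    unfold nsq
    rw [← intervalIntegral.integral_const_mul, ← intervalIntegral.integral_add,
      ← intervalIntegral.integral_add]
    · congr 1; ext s; ring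
    all_goals exact Continuous.intervalIntegrable (by fun_prop) _ _
  have := (abs_le.1 (abs_integral_mul_le hf hg)).2
  rw [h, add_sq, nrm_sq, nrm_sq]; linarith

theorem nsq_const_mul (c : ℝ) (f : ℝ → ℝ) : nsq (fun s => c * f s) = c ^ 2 * nsq f := by
  unfold nsq
  rw [← intervalIntegral.integral_const_mul]; congr 1; ext s; ring

theorem nrm_const_mul (c : ℝ) (f : ℝ → ℝ) : nrm (fun s => c * f s) = |c| * nrm f := by
  rw [nrm, nsq_const_mul, Real.sqrt_mul (sq_nonneg c), Real.sqrt_sq_eq_abs, nrm]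

theorem nrm_sub_le {f g : ℝ → ℝ} (hf : Continuous f) (hg : Continuous g) :
    nrm (fun s => f s - g s) ≤ nrm f + nrm g := by
  have h := nrm_add_le hf (g := fun s => (-1) * g s) (by fun_prop)
  rw [nrm_const_mul] at h
  simpa [sub_eq_add_neg] using h

theorem nrm_sum_le {α : Type*} (S : Finset α) (f : α → ℝ → ℝ) (hf : ∀ k, Continuous (f k)) :
    nrm (fun s => ∑ k ∈ S, f k s) ≤ ∑ k ∈ S, nrm (f k) := by
  classical
  induction S using Finset.induction_on with
  | empty => simp [nrm, nsq]
  | insert a S ha ih =>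
    simp only [Finset.sum_insert ha]
    exact (nrm_add_le (hf a) (by fun_prop)).trans (by linarith)

theorem nsq_mono {f g : ℝ → ℝ} (hf : Continuous f) (hg : Continuous g)
    (h : ∀ s ∈ Icc (0 : ℝ) 1, |f s| ≤ |g s|) : nsq f ≤ nsq g :=
  intervalIntegral.integral_mono_on zero_le_one (Continuous.intervalIntegrable (by fun_prop) _ _)
    (Continuous.intervalIntegrable (by fun_prop) _ _) fun s hs => sq_le_sq.2 (h s hs)

theorem nrm_mul_le {φ f : ℝ → ℝ} (hφ : Continuous φ) (hf : Continuous f) {c : ℝ} (hc : 0 ≤ c)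
    (h : ∀ s ∈ Icc (0 : ℝ) 1, |φ s| ≤ c) : nrm (fun s => φ s * f s) ≤ c * nrm f := by
  have h1 := nsq_mono (f := fun s => φ s * f s) (g := fun s => c * f s) (by fun_prop) (by fun_prop)
    fun s hs => by
      rw [abs_mul, abs_mul, abs_of_nonneg hc]
      exact mul_le_mul_of_nonneg_right (h s hs) (abs_nonneg _)
  have h2 := Real.sqrt_le_sqrt h1
  have h3 := nrm_const_mul c f
  rw [abs_of_nonneg hc] at h3
  rw [← h3]; exact h2

/-- Finite linear combinations. -/
noncomputable def comb {ι : Type} (e : ι → ℝ → ℝ) (S : Finset ι) (a : ι → ℝ) : ℝ → ℝ :=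
  fun s => ∑ k ∈ S, a k * e k s

section
variable {m : ℕ} {ι : Type} {e : ι → ℝ → ℝ} {μ : ι → ℝ}

theorem IsEigenSystem.comb_smooth (h : IsEigenSystem m e μ) (S : Finset ι) (a : ι → ℝ) :
    Sm (comb e S a) := by
  unfold comb
  exact ContDiff.sum fun k _ => contDiff_const.mul (h.smooth k)

theorem IsEigenSystem.iteratedDeriv_comb (h : IsEigenSystem m e μ) (S : Finset ι) (a : ι → ℝ)
    (j : ℕ) (s : ℝ) : iteratedDeriv j (comb e S a) s = ∑ k ∈ S, a k * iteratedDeriv j (e k) s := by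
  unfold comb
  rw [iteratedDeriv_fun_sum fun k _ => (contDiff_const.mul ((h.smooth k).of_le (by exact_mod_cast le_top))).contDiffAt]
  simp [iteratedDeriv_const_mul_field]

theorem IsEigenSystem.comb_eq (h : IsEigenSystem m e μ) (S : Finset ι) (a : ι → ℝ) :
    iteratedDeriv (2 * m) (comb e S a) = comb e S fun k => (-1) ^ m * (μ k * a k) := by
  ext s
  rw [h.iteratedDeriv_comb]
  unfold comb
  refine sum_congr rfl fun k _ => ?_
  rw [h.eq]; ring

theorem IsEigenSystem.comb_bc0 (h : IsEigenSystem m e μ) (S : Finset ι) (a : ι → ℝ) {j : ℕ}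
    (hj : j < m) : iteratedDeriv j (comb e S a) 0 = 0 := by
  rw [h.iteratedDeriv_comb]
  exact sum_eq_zero fun k _ => by rw [h.bc0 k j hj, mul_zero]

theorem IsEigenSystem.comb_bc1 (h : IsEigenSystem m e μ) (S : Finset ι) (a : ι → ℝ) {j : ℕ}
    (hj : j < m) : iteratedDeriv j (comb e S a) 1 = 0 := by
  rw [h.iteratedDeriv_comb]
  exact sum_eq_zero fun k _ => by rw [h.bc1 k j hj, mul_zero]

theorem IsEigenSystem.integral_comb_mul (h : IsEigenSystem m e μ) (S : Finset ι) (a : ι → ℝ)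
    {g : ℝ → ℝ} (hg : Continuous g) :
    ∫ s in 0..1, comb e S a s * g s = ∑ k ∈ S, a k * ∫ s in 0..1, g s * e k s := by
  have hc : ∀ k, Continuous (e k) := fun k => (h.smooth k).continuous
  unfold comb
  simp_rw [sum_mul]
  rw [intervalIntegral.integral_finsetSum fun k _ => Continuous.intervalIntegrable (by fun_prop) _ _]
  refine sum_congr rfl fun k _ => ?_
  rw [← intervalIntegral.integral_const_mul]
  congr 1; ext s; ring

theorem IsEigenSystem.integral_comb_mul_e (h : IsEigenSystem m e μ) (S : Finset ι) (a : ι → ℝ)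
    (k : ι) [Decidable (k ∈ S)] :
    ∫ s in 0..1, comb e S a s * e k s = if k ∈ S then a k else 0 := by
  classical
  rw [h.integral_comb_mul S a (h.smooth k).continuous]
  have : ∀ l, ∫ s in 0..1, e k s * e l s = if k = l then 1 else 0 := fun l => by
    split_ifs with hkl
    · subst hkl; exact h.orth k
    · exact h.orth_ne k l hkl
  simp_rw [this]
  simp

theorem IsEigenSystem.nsq_comb (h : IsEigenSystem m e μ) (S : Finset ι) (a : ι → ℝ) :
    nsq (comb e S a) = ∑ k ∈ S, a k ^ 2 := by
  classical
  have h1 := h.integral_comb_mul S a (h.comb_smooth S a).continuous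
  unfold nsq
  simp_rw [pow_two]
  rw [h1]
  refine sum_congr rfl fun k hk => ?_
  rw [h.integral_comb_mul_e, if_pos hk]

/-- Bernstein inequality for finite combinations of eigenfunctions. -/
theorem IsEigenSystem.bernstein (h : IsEigenSystem m e μ) :
    ∃ C, 0 < C ∧ ∀ (Λ : ℝ) (S : Finset ι) (a : ι → ℝ), 1 ≤ Λ → (∀ k ∈ S, μ k ≤ Λ ^ (2 * m)) →
      ∀ j ≤ 2 * m, nrm (iteratedDeriv j (comb e S a)) ≤ C * Λ ^ j * nrm (comb e S a) := by
  set c : ℝ → ℝ := fun δ => 72 * (√(2 / δ) + 1) ^ 2 with hc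
  obtain ⟨C, hC, H⟩ := discrete_interpolation c (fun δ _ => by positivity) (2 * m) 1 one_pos
  refine ⟨1 + C, by linarith, fun Λ S a hΛ hS j hj => ?_⟩
  set z := comb e S a with hz
  have hzs : Sm z := h.comb_smooth S a
  have hΛ0 : 0 < Λ := by linarith
  set Z : ℕ → ℝ := fun j => nsq (iteratedDeriv j z) / Λ ^ (2 * j) with hZ
  have hZ0 : Z 0 = nsq z := by simp [hZ]
  have hZn : ∀ j, 0 ≤ Z j := fun j => div_nonneg (nsq_nonneg _) (by positivity)
  have htop : Z (2 * m) ≤ Z 0 := by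
    rw [hZ0, hZ]
    simp only
    rw [div_le_iff₀ (by positivity), hz, h.comb_eq, h.nsq_comb, h.nsq_comb, sum_mul]
    refine sum_le_sum fun k hk => ?_
    have h1 := hS k hk
    have h2 := h.one_le k
    have h3 : (Λ ^ (2 * m)) ^ 2 = Λ ^ (2 * (2 * m)) := by rw [← pow_mul]; ring_nf
    rw [← h3, mul_pow, mul_pow, ← pow_mul, mul_comm m 2, pow_mul (-1 : ℝ) 2]
    have : μ k ^ 2 ≤ (Λ ^ (2 * m)) ^ 2 := by gcongr
    simp only [even_two, Even.neg_pow, one_pow, one_mul]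
    nlinarith [sq_nonneg (a k)]
  have step : ∀ j, 1 ≤ j → j < 2 * m → ∀ δ > 0, Z j ≤ δ * Z (j + 1) + c δ * Z (j - 1) := by
    intro j hj _ δ hδ
    obtain ⟨j, rfl⟩ : ∃ i, j = i + 1 := ⟨j - 1, by omega⟩
    simp only [Nat.add_sub_cancel]
    set N : ℕ := ⌈√(2 / δ) * Λ⌉₊ with hN
    have hNpos : 0 < N := Nat.ceil_pos.2 (by positivity)
    have hN1 : √(2 / δ) * Λ ≤ N := Nat.le_ceil _
    have hN2 : (N : ℝ) ≤ (√(2 / δ) + 1) * Λ := by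
      have := Nat.ceil_lt_add_one (show 0 ≤ √(2 / δ) * Λ by positivity)
      nlinarith
    have hI := integral_deriv_sq_le (hzs.iterDeriv j) hNpos
    simp only [← iteratedDeriv_succ] at hI
    change nsq (iteratedDeriv (j + 1) z) ≤ 72 * N ^ 2 * nsq (iteratedDeriv j z) +
      2 / N ^ 2 * nsq (iteratedDeriv (j + 1 + 1) z) at hI
    have hNr : (0 : ℝ) < N := by exact_mod_cast hNpos
    have h1 : 2 / (N : ℝ) ^ 2 ≤ δ / Λ ^ 2 := by
      rw [div_le_div_iff₀ (by positivity) (by positivity)]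
      have h4 : (√(2 / δ) * Λ) ^ 2 ≤ (N : ℝ) ^ 2 := by gcongr
      rw [mul_pow, sq_sqrt (by positivity)] at h4
      have : 2 * Λ ^ 2 = δ * (2 / δ * Λ ^ 2) := by field_simp
      rw [this]; gcongr
    have h2 : 72 * (N : ℝ) ^ 2 ≤ c δ * Λ ^ 2 := by
      have : (N : ℝ) ^ 2 ≤ ((√(2 / δ) + 1) * Λ) ^ 2 := by gcongr
      rw [hc]; nlinarith
    simp only [hZ]
    have e1 : Λ ^ (2 * (j + 1)) = Λ ^ (2 * j) * Λ ^ 2 := by ring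
    have e2 : Λ ^ (2 * (j + 1 + 1)) = Λ ^ (2 * j) * Λ ^ 2 * Λ ^ 2 := by ring
    rw [e1, e2, div_le_iff₀ (by positivity)]
    calc nsq (iteratedDeriv (j + 1) z) ≤ _ := hI
      _ ≤ c δ * Λ ^ 2 * nsq (iteratedDeriv j z) +
          δ / Λ ^ 2 * nsq (iteratedDeriv (j + 1 + 1) z) := by
        gcongr
        · exact nsq_nonneg _
        · exact nsq_nonneg _
      _ = _ := by field_simp; ring
  have hj' : Z j ≤ (1 + C) * Z 0 := by
    rcases hj.lt_or_eq with hlt | heq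
    · have := H Z hZn step j hlt
      nlinarith
    · rw [heq]; nlinarith [hZn 0]
  refine nrm_le_of_nsq_le (by have := nrm_nonneg z; positivity) ?_
  rw [hZ0] at hj'
  simp only [hZ] at hj'
  rw [div_le_iff₀ (by positivity)] at hj'
  refine hj'.trans ?_
  have h5 : (1 + C) ≤ (1 + C) ^ 2 := by nlinarith
  have e3 : ((1 + C) * Λ ^ j * nrm z) ^ 2 = (1 + C) ^ 2 * nsq z * Λ ^ (2 * j) := by
    rw [← nrm_sq]; ring
  rw [e3]
  have := nsq_nonneg z
  gcongr

theorem IsEigenSystem.bernstein_sup (hm : 1 ≤ m) (h : IsEigenSystem m e μ) :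
    ∃ C, 0 < C ∧ ∀ (Λ : ℝ) (S : Finset ι) (a : ι → ℝ), 1 ≤ Λ → (∀ k ∈ S, μ k ≤ Λ ^ (2 * m)) →
      ∀ j ≤ 2 * m, ∀ s ∈ Icc (0 : ℝ) 1,
        iteratedDeriv j (comb e S a) s ^ 2 ≤ C * Λ ^ (2 * j + 1) * nsq (comb e S a) := by
  obtain ⟨C, hC, H⟩ := h.bernstein
  have base : ∀ (Λ : ℝ) (S : Finset ι) (a : ι → ℝ), 1 ≤ Λ → (∀ k ∈ S, μ k ≤ Λ ^ (2 * m)) →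
      ∀ j < 2 * m, ∀ s ∈ Icc (0 : ℝ) 1,
        iteratedDeriv j (comb e S a) s ^ 2 ≤ 3 * C ^ 2 * Λ ^ (2 * j + 1) * nsq (comb e S a) := by
    intro Λ S a hΛ hS j hj s hs
    have hΛ0 : 0 < Λ := by linarith
    have h1 := sq_le_integral ((h.comb_smooth S a).iterDeriv j) hΛ0 zero_lt_one hs
    rw [← iteratedDeriv_succ] at h1
    change _ ≤ (1 / (1 - 0) + Λ) * nsq (iteratedDeriv j (comb e S a)) +
      1 / Λ * nsq (iteratedDeriv (j + 1) (comb e S a)) at h1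
    have hb : ∀ i ≤ 2 * m, nsq (iteratedDeriv i (comb e S a)) ≤
        C ^ 2 * Λ ^ (2 * i) * nsq (comb e S a) := by
      intro i hi
      have h2 := H Λ S a hΛ hS i hi
      have h3 := pow_le_pow_left₀ (nrm_nonneg _) h2 2
      rw [mul_pow, nrm_sq, nrm_sq, mul_pow, ← pow_mul, mul_comm i 2] at h3
      exact h3
    have hn := nsq_nonneg (comb e S a)
    calc _ ≤ _ := h1
      _ ≤ (1 / (1 - 0) + Λ) * (C ^ 2 * Λ ^ (2 * j) * nsq (comb e S a)) +
          1 / Λ * (C ^ 2 * Λ ^ (2 * (j + 1)) * nsq (comb e S a)) := by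
        have := hb j hj.le
        have := hb (j + 1) (by omega)
        have : (0 : ℝ) ≤ 1 / (1 - 0) + Λ := by norm_num; linarith
        gcongr
      _ = (1 + 2 * Λ) * Λ ^ (2 * j) * (C ^ 2 * nsq (comb e S a)) := by
        field_simp; ring
      _ ≤ (3 * Λ) * Λ ^ (2 * j) * (C ^ 2 * nsq (comb e S a)) := by
        gcongr; linarith
      _ = _ := by ring
  refine ⟨3 * C ^ 2, by positivity, fun Λ S a hΛ hS j hj s hs => ?_⟩
  have hΛ0 : 0 < Λ := by linarith
  rcases hj.lt_or_eq with hlt | rfl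
  · exact base Λ S a hΛ hS j hlt s hs
  · rw [h.comb_eq]
    have h1 := base Λ S (fun k => (-1) ^ m * (μ k * a k)) hΛ hS 0 (by omega) s hs
    rw [iteratedDeriv_zero, ← h.comb_eq] at h1
    rw [← h.comb_eq]
    refine h1.trans ?_
    have h2 : nsq (iteratedDeriv (2 * m) (comb e S a)) ≤ Λ ^ (2 * (2 * m)) * nsq (comb e S a) := by
      rw [h.comb_eq, h.nsq_comb, h.nsq_comb, mul_sum]
      refine sum_le_sum fun k hk => ?_
      have h1 := hS k hk
      have h2 := h.one_le k
      have h3 : (Λ ^ (2 * m)) ^ 2 = Λ ^ (2 * (2 * m)) := by rw [← pow_mul]; ring_nf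
      rw [← h3, mul_pow, mul_pow, ← pow_mul, mul_comm m 2, pow_mul (-1 : ℝ) 2]
      have : μ k ^ 2 ≤ (Λ ^ (2 * m)) ^ 2 := by gcongr
      simp only [even_two, Even.neg_pow, one_pow, one_mul]
      nlinarith [sq_nonneg (a k)]
    calc _ ≤ 3 * C ^ 2 * Λ ^ (2 * 0 + 1) * (Λ ^ (2 * (2 * m)) * nsq (comb e S a)) := by gcongr
      _ = _ := by ring

theorem IsEigenSystem.finite_le (hm : 1 ≤ m) (h : IsEigenSystem m e μ) {Λ : ℝ} (hΛ : 1 ≤ Λ) :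
    {k | μ k ≤ Λ ^ (2 * m)}.Finite := by
  obtain ⟨C, hC, H⟩ := h.bernstein_sup hm
  have hΛ0 : 0 < Λ := by linarith
  by_contra hinf
  obtain ⟨S, hS, hcard⟩ := (Set.Infinite.exists_subset_card_eq hinf (⌊C * Λ⌋₊ + 1))
  have hS' : ∀ k ∈ S, μ k ≤ Λ ^ (2 * m) := fun k hk => hS hk
  have pt : ∀ s ∈ Icc (0 : ℝ) 1, ∑ k ∈ S, e k s ^ 2 ≤ C * Λ := by
    intro s hs
    have h1 := H Λ S (fun k => e k s) hΛ hS' 0 (by omega) s hs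
    rw [iteratedDeriv_zero, h.nsq_comb] at h1
    unfold comb at h1
    simp only [← pow_two, mul_zero, zero_add, pow_one] at h1
    set y := ∑ k ∈ S, e k s ^ 2
    have hy : 0 ≤ y := sum_nonneg fun k _ => sq_nonneg _
    rcases hy.eq_or_lt with h0 | hpos
    · rw [← h0]; positivity
    · nlinarith
  have hcont : ∀ k, Continuous (e k) := fun k => (h.smooth k).continuous
  have h2 : ∫ s in 0..1, ∑ k ∈ S, e k s ^ 2 ≤ ∫ _ in 0..1, C * Λ :=
    intervalIntegral.integral_mono_on zero_le_one (Continuous.intervalIntegrable (by fun_prop) _ _)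
      (by simp) pt
  rw [intervalIntegral.integral_finsetSum
    fun k _ => Continuous.intervalIntegrable (by fun_prop) _ _] at h2
  simp_rw [pow_two, h.orth] at h2
  simp only [sum_const, hcard, intervalIntegral.integral_const, sub_zero, smul_eq_mul, one_mul,
    nsmul_eq_mul, mul_one] at h2
  have h3 := Nat.lt_floor_add_one (C * Λ)
  push_cast at h2
  linarith

end

/-- `g` vanishes to order `m` at both end points of the unit interval. -/
def Flat (m : ℕ) (g : ℝ → ℝ) : Prop :=
  ∀ j < m, iteratedDeriv j g 0 = 0 ∧ iteratedDeriv j g 1 = 0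

theorem iteratedDeriv_mul_sm {φ g : ℝ → ℝ} (hφ : Sm φ) (hg : Sm g) (j : ℕ) (s : ℝ) :
    iteratedDeriv j (fun s => φ s * g s) s = ∑ i ∈ Finset.range (j + 1),
      j.choose i * iteratedDeriv i φ s * iteratedDeriv (j - i) g s :=
  iteratedDeriv_fun_mul (hφ.contDiffAt j s) (hg.contDiffAt j s)

theorem Flat.mul {m : ℕ} {φ g : ℝ → ℝ} (hφ : Sm φ) (hg : Sm g) (h : Flat m g) :
    Flat m fun s => φ s * g s := by
  intro j hj
  rw [iteratedDeriv_mul_sm hφ hg, iteratedDeriv_mul_sm hφ hg]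
  exact ⟨sum_eq_zero fun i _ => by rw [(h (j - i) (by omega)).1, mul_zero],
    sum_eq_zero fun i _ => by rw [(h (j - i) (by omega)).2, mul_zero]⟩

theorem Flat.sub {m : ℕ} {f g : ℝ → ℝ} (hsf : Sm f) (hsg : Sm g) (hf : Flat m f) (hg : Flat m g) :
    Flat m fun s => f s - g s := by
  intro j hj
  rw [iteratedDeriv_fun_sub (hsf.contDiffAt j _) (hsg.contDiffAt j _),
    iteratedDeriv_fun_sub (hsf.contDiffAt j _) (hsg.contDiffAt j _), (hf j hj).1, (hg j hj).1,
    (hf j hj).2, (hg j hj).2]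
  simp

theorem integral_deriv_mul {f g : ℝ → ℝ} (hf : Sm f) (hg : Sm g) (a b : ℝ) :
    ∫ s in a..b, deriv f s * g s =
      f b * g b - f a * g a - ∫ s in a..b, f s * deriv g s := by
  have hf' := hf.deriv'.continuous
  have hg' := hg.deriv'.continuous
  have hfc := hf.continuous
  have hgc := hg.continuous
  rw [← intervalIntegral.integral_deriv_mul_eq_sub (fun x _ => hf.hasDerivAt x)
    (fun x _ => hg.hasDerivAt x) (hf'.intervalIntegrable _ _) (hg'.intervalIntegrable _ _),
    intervalIntegral.integral_add, add_sub_cancel_right]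
  all_goals exact Continuous.intervalIntegrable (by fun_prop) _ _

theorem integral_iteratedDeriv_mul {m : ℕ} {f g : ℝ → ℝ} (hf : Sm f) (hg : Sm g) (hff : Flat m f)
    (hgf : Flat m g) {j : ℕ} (hj : j ≤ 2 * m) :
    ∫ s in 0..1, iteratedDeriv j f s * g s =
      (-1) ^ j * ∫ s in 0..1, f s * iteratedDeriv j g s := by
  have H : ∀ i ≤ j, ∫ s in 0..1, iteratedDeriv j f s * g s =
      (-1) ^ i * ∫ s in 0..1, iteratedDeriv (j - i) f s * iteratedDeriv i g s := by
    intro i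
    induction i with
    | zero => simp
    | succ i ih =>
      intro hi
      rw [ih (by omega)]
      obtain ⟨a, ha⟩ : ∃ a, j - i = a + 1 := ⟨j - i - 1, by omega⟩
      have ha' : j - (i + 1) = a := by omega
      rw [ha, ha', iteratedDeriv_succ, integral_deriv_mul (hf.iterDeriv a) (hg.iterDeriv i) 0 1,
        iteratedDeriv_succ]
      have hb : iteratedDeriv a f 1 * iteratedDeriv i g 1 -
          iteratedDeriv a f 0 * iteratedDeriv i g 0 = 0 := by
        by_cases ham : a < m
        · rw [(hff a ham).1, (hff a ham).2]; simp
        · rw [(hgf i (by omega)).1, (hgf i (by omega)).2]; simp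
      rw [hb]; ring
  have := H j le_rfl
  simpa using this

/-- Powers of `2^i` with real exponents. -/
noncomputable def pw (i : ℕ) (a : ℝ) : ℝ := (2 : ℝ) ^ ((i : ℝ) * a)

theorem pw_pos (i : ℕ) (a : ℝ) : 0 < pw i a := Real.rpow_pos_of_pos two_pos _

theorem pw_add (i : ℕ) (a b : ℝ) : pw i (a + b) = pw i a * pw i b := by
  rw [pw, mul_add, Real.rpow_add two_pos]; rfl

theorem pw_zero (i : ℕ) : pw i 0 = 1 := by simp [pw]

theorem pw_zero_left (a : ℝ) : pw 0 a = 1 := by simp [pw]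

theorem pw_mono (i : ℕ) {a b : ℝ} (h : a ≤ b) : pw i a ≤ pw i b :=
  Real.rpow_le_rpow_of_exponent_le one_le_two (by gcongr)

theorem pw_natCast (i j : ℕ) : pw i j = ((2 : ℝ) ^ i) ^ j := by
  rw [pw, ← pow_mul, ← Real.rpow_natCast]; push_cast; rfl

theorem pw_eq_pow (i : ℕ) (a : ℝ) : pw i a = ((2 : ℝ) ^ a) ^ i := by
  rw [pw, mul_comm, Real.rpow_mul_natCast (by norm_num)]

theorem pw_neg (i : ℕ) (a : ℝ) : pw i (-a) = (pw i a)⁻¹ := by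
  rw [pw, mul_neg, Real.rpow_neg (by norm_num)]; rfl

theorem pw_succ (i : ℕ) (a : ℝ) : pw (i + 1) a = 2 ^ a * pw i a := by
  rw [pw_eq_pow, pw_eq_pow, pow_succ']

theorem pw_sq (i : ℕ) (a : ℝ) : pw i a ^ 2 = pw i (2 * a) := by
  rw [pow_two, ← pw_add]; ring_nf

theorem sum_geom_le_inv {q : ℝ} (h0 : 0 ≤ q) (h1 : q < 1) (i : ℕ) :
    ∑ l ∈ Finset.range i, q ^ l ≤ (1 - q)⁻¹ := by
  rw [← tsum_geometric_of_lt_one h0 h1]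
  exact (summable_geometric_of_lt_one h0 h1).sum_le_tsum _ fun _ _ => pow_nonneg h0 _

theorem exists_sum_pw_le {a : ℝ} (ha : a ≠ 0) :
    ∃ C, 0 < C ∧ ∀ i, ∑ l ∈ Finset.range i, pw l a ≤ C * pw i (max 0 a) := by
  rcases lt_or_gt_of_ne ha with h | h
  · have hq : (2 : ℝ) ^ a < 1 := Real.rpow_lt_one_of_one_lt_of_neg one_lt_two h
    have hq0 : (0 : ℝ) < (2 : ℝ) ^ a := Real.rpow_pos_of_pos two_pos _
    refine ⟨(1 - (2 : ℝ) ^ a)⁻¹, inv_pos.2 (by linarith), fun i => ?_⟩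
    rw [max_eq_left h.le, pw_zero, mul_one]
    simp_rw [pw_eq_pow]
    exact sum_geom_le_inv hq0.le hq i
  · have hq : 1 < (2 : ℝ) ^ a := Real.one_lt_rpow one_lt_two h
    refine ⟨((2 : ℝ) ^ a - 1)⁻¹, inv_pos.2 (by linarith), fun i => ?_⟩
    rw [max_eq_right h.le]
    simp_rw [pw_eq_pow]
    rw [geom_sum_eq hq.ne', inv_mul_eq_div]
    have : 0 < (2 : ℝ) ^ a - 1 := by linarith
    gcongr
    linarith

section
open Classical in
/-- The set of indices of frequency below `2^i`. -/
noncomputable def lowS {ι : Type} (m : ℕ) (μ : ι → ℝ) (i : ℕ) : Finset ι :=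
  if hf : {k | μ k < ((2 : ℝ) ^ i) ^ (2 * m)}.Finite then hf.toFinset else ∅

open Classical in
/-- The indices of frequency comparable to `2^i`. -/
noncomputable def blk {ι : Type} (m : ℕ) (μ : ι → ℝ) (i : ℕ) : Finset ι :=
  (lowS m μ (i + 1)).filter fun k => ((2 : ℝ) ^ i) ^ (2 * m) ≤ μ k

/-- Generalized Fourier coefficients. -/
noncomputable def cf {ι : Type} (e : ι → ℝ → ℝ) (g : ℝ → ℝ) (k : ι) : ℝ :=
  ∫ s in 0..1, g s * e k s

/-- The partial sums of the spectral expansion. -/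
noncomputable def SS {ι : Type} (m : ℕ) (e : ι → ℝ → ℝ) (μ : ι → ℝ) (i : ℕ) (g : ℝ → ℝ) : ℝ → ℝ :=
  comb e (lowS m μ i) (cf e g)

/-- The blocks of the spectral expansion. -/
noncomputable def PP {ι : Type} (m : ℕ) (e : ι → ℝ → ℝ) (μ : ι → ℝ) (i : ℕ) (g : ℝ → ℝ) : ℝ → ℝ :=
  comb e (blk m μ i) (cf e g)

variable {m : ℕ} {ι : Type} {e : ι → ℝ → ℝ} {μ : ι → ℝ}

theorem IsEigenSystem.mem_lowS (h : IsEigenSystem m e μ) (hm : 1 ≤ m) {i : ℕ} {k : ι} :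
    k ∈ lowS m μ i ↔ μ k < ((2 : ℝ) ^ i) ^ (2 * m) := by
  have hf : {k | μ k < ((2 : ℝ) ^ i) ^ (2 * m)}.Finite :=
    (h.finite_le hm (one_le_pow₀ one_le_two (n := i))).subset fun k hk =>
      (show μ k < _ from hk).le
  rw [lowS, dif_pos hf]; simp

theorem IsEigenSystem.mem_blk (h : IsEigenSystem m e μ) (hm : 1 ≤ m) {i : ℕ} {k : ι} :
    k ∈ blk m μ i ↔ ((2 : ℝ) ^ i) ^ (2 * m) ≤ μ k ∧ μ k < ((2 : ℝ) ^ (i + 1)) ^ (2 * m) := by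
  rw [blk, Finset.mem_filter, h.mem_lowS hm, and_comm]

theorem IsEigenSystem.lowS_zero (h : IsEigenSystem m e μ) (hm : 1 ≤ m) : lowS m μ 0 = ∅ := by
  ext k
  rw [h.mem_lowS hm]
  simpa using h.one_le k

theorem IsEigenSystem.sum_lowS_succ (h : IsEigenSystem m e μ) (hm : 1 ≤ m) (i : ℕ) (f : ι → ℝ) :
    ∑ k ∈ lowS m μ (i + 1), f k = ∑ k ∈ lowS m μ i, f k + ∑ k ∈ blk m μ i, f k := by
  classical
  rw [← Finset.sum_union]
  · congr 1
    ext k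
    rw [Finset.mem_union, h.mem_lowS hm, h.mem_lowS hm, h.mem_blk hm]
    have : ((2 : ℝ) ^ i) ^ (2 * m) ≤ ((2 : ℝ) ^ (i + 1)) ^ (2 * m) := by
      gcongr
      · norm_num
      · omega
    constructor
    · intro hk
      rcases lt_or_ge (μ k) (((2 : ℝ) ^ i) ^ (2 * m)) with h1 | h1
      · exact Or.inl h1
      · exact Or.inr ⟨h1, hk⟩
    · rintro (h1 | h1)
      · linarith
      · exact h1.2
  · rw [Finset.disjoint_left]
    intro k hk hk'
    rw [h.mem_lowS hm] at hk
    rw [h.mem_blk hm] at hk'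
    linarith [hk'.1]

theorem IsEigenSystem.SS_succ (h : IsEigenSystem m e μ) (hm : 1 ≤ m) (i : ℕ) (g : ℝ → ℝ) (s : ℝ) :
    SS m e μ (i + 1) g s = SS m e μ i g s + PP m e μ i g s :=
  h.sum_lowS_succ hm i _

theorem IsEigenSystem.SS_add (h : IsEigenSystem m e μ) (hm : 1 ≤ m) (i p : ℕ) (g : ℝ → ℝ) (s : ℝ) :
    SS m e μ (i + p) g s = SS m e μ i g s + ∑ l ∈ Finset.range p, PP m e μ (i + l) g s := by
  induction p with
  | zero => simp
  | succ p ih => rw [← add_assoc, h.SS_succ hm, ih, Finset.sum_range_succ]; ring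

theorem IsEigenSystem.SS_eq_sum (h : IsEigenSystem m e μ) (hm : 1 ≤ m) (i : ℕ) (g : ℝ → ℝ) :
    SS m e μ i g = fun s => ∑ l ∈ Finset.range i, PP m e μ l g s := by
  ext s
  have := h.SS_add hm 0 i g s
  simp only [zero_add] at this
  rw [this]
  simp [SS, comb, h.lowS_zero hm]

theorem IsEigenSystem.flat_comb (h : IsEigenSystem m e μ) (S : Finset ι) (a : ι → ℝ) :
    Flat m (comb e S a) := fun _ hj => ⟨h.comb_bc0 S a hj, h.comb_bc1 S a hj⟩

theorem IsEigenSystem.nsq_sub_comb (h : IsEigenSystem m e μ) (S : Finset ι) {g : ℝ → ℝ}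
    (hg : Continuous g) :
    nsq (fun s => g s - comb e S (cf e g) s) = nsq g - ∑ k ∈ S, cf e g k ^ 2 := by
  have hc := (h.comb_smooth S (cf e g)).continuous
  have h1 := h.integral_comb_mul S (cf e g) hg
  have h2 := h.nsq_comb S (cf e g)
  have h3 : nsq (fun s => g s - comb e S (cf e g) s) = nsq g -
      2 * (∫ s in 0..1, comb e S (cf e g) s * g s) + nsq (comb e S (cf e g)) := by
    unfold nsq
    rw [← intervalIntegral.integral_const_mul, ← intervalIntegral.integral_sub,
      ← intervalIntegral.integral_add]
    · congr 1; ext s; ring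
    all_goals exact Continuous.intervalIntegrable (by fun_prop) _ _
  rw [h3, h2, h1]
  simp only [cf, ← pow_two]
  ring

theorem IsEigenSystem.nrm_PP_le (h : IsEigenSystem m e μ) (hm : 1 ≤ m) (i : ℕ) {g : ℝ → ℝ}
    (hg : Continuous g) : nrm (PP m e μ i g) ≤ nrm (fun s => g s - SS m e μ i g s) := by
  refine Real.sqrt_le_sqrt ?_
  have h1 := nsq_nonneg (fun s => g s - comb e (lowS m μ (i + 1)) (cf e g) s)
  rw [h.nsq_sub_comb _ hg, h.sum_lowS_succ hm] at h1
  rw [SS, h.nsq_sub_comb _ hg, PP, h.nsq_comb]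
  linarith

theorem IsEigenSystem.tendsto_nsq_sub_SS (h : IsEigenSystem m e μ) (hm : 1 ≤ m) {g : ℝ → ℝ}
    (hg : Continuous g) :
    Filter.Tendsto (fun i => nsq fun s => g s - SS m e μ i g s) Filter.atTop (𝓝 0) := by
  have h1 := h.parseval g g hg hg
  have hmono : Monotone (lowS m μ) := by
    refine monotone_nat_of_le_succ fun i => ?_
    intro k hk
    rw [h.mem_lowS hm] at hk ⊢
    refine hk.trans_le ?_
    gcongr
    · norm_num
    · omega
  have hex : ∀ k, ∃ i, k ∈ lowS m μ i := by
    intro k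
    obtain ⟨i, hi⟩ := pow_unbounded_of_one_lt (μ k) (one_lt_two (α := ℝ))
    refine ⟨i, (h.mem_lowS hm).2 (hi.trans_le ?_)⟩
    exact le_self_pow₀ (one_le_pow₀ one_le_two) (by omega)
  have h2 := h1.comp (Filter.tendsto_atTop_finset_of_monotone hmono hex)
  have h3 : (fun i => nsq fun s => g s - SS m e μ i g s) =
      fun i => nsq g - ∑ k ∈ lowS m μ i, cf e g k ^ 2 := by
    ext i; rw [SS, h.nsq_sub_comb _ hg]
  rw [h3, ← sub_self (nsq g)]
  refine Filter.Tendsto.sub tendsto_const_nhds ?_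
  have h4 : nsq g = ∫ s in 0..1, g s * g s := by unfold nsq; simp_rw [pow_two]
  rw [h4]
  refine h2.congr fun i => ?_
  simp only [Function.comp_apply, cf, pow_two]

/-- Decay of the spectral tails at rate `2^{-is}`. -/
def Tail (m : ℕ) (e : ι → ℝ → ℝ) (μ : ι → ℝ) (g : ℝ → ℝ) (s N : ℝ) : Prop :=
  ∀ i, nrm (fun x => g x - SS m e μ i g x) ≤ N * pw i (-s)

theorem IsEigenSystem.tail_of_nrm_le (h : IsEigenSystem m e μ) {g : ℝ → ℝ} (hg : Continuous g)
    {s N : ℝ} (hs : s ≤ 0) (hN : nrm g ≤ N) : Tail m e μ g s N := by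
  intro i
  have h1 : nrm (fun x => g x - SS m e μ i g x) ≤ nrm g := by
    refine Real.sqrt_le_sqrt ?_
    rw [SS, h.nsq_sub_comb _ hg]
    have := sum_nonneg (s := lowS m μ i) fun k _ => sq_nonneg (cf e g k)
    linarith
  have h2 : 1 ≤ pw i (-s) := by
    rw [← pw_zero i]; exact pw_mono i (by linarith)
  have h3 := (nrm_nonneg g).trans hN
  nlinarith

theorem IsEigenSystem.tail_of_blocks (h : IsEigenSystem m e μ) (hm : 1 ≤ m) {s : ℝ} (hs : 0 < s) :
    ∃ C, 0 < C ∧ ∀ (g : ℝ → ℝ) (N : ℝ), Continuous g → 0 ≤ N →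
      (∀ i, nrm (PP m e μ i g) ≤ N * pw i (-s)) → Tail m e μ g s (C * N) := by
  have hq : (2 : ℝ) ^ (-s) < 1 := Real.rpow_lt_one_of_one_lt_of_neg one_lt_two (by linarith)
  have hq0 : (0 : ℝ) < (2 : ℝ) ^ (-s) := Real.rpow_pos_of_pos two_pos _
  refine ⟨(1 - (2 : ℝ) ^ (-s))⁻¹, inv_pos.2 (by linarith), fun g N hg hN hP i => ?_⟩
  have hSc : ∀ i, Continuous (SS m e μ i g) := fun i => (h.comb_smooth _ _).continuous
  have hPc : ∀ i, Continuous (PP m e μ i g) := fun i => (h.comb_smooth _ _).continuous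
  have key : ∀ p, nrm (fun x => g x - SS m e μ i g x) ≤
      nrm (fun x => g x - SS m e μ (i + p) g x) + (1 - (2 : ℝ) ^ (-s))⁻¹ * N * pw i (-s) := by
    intro p
    have e1 : (fun x => g x - SS m e μ i g x) = fun x => (g x - SS m e μ (i + p) g x) +
        ∑ l ∈ Finset.range p, PP m e μ (i + l) g x := by
      ext x; rw [h.SS_add hm]; ring
    rw [e1]
    refine (nrm_add_le (hg.sub (hSc _)) (by fun_prop)).trans ?_
    refine add_le_add le_rfl ((nrm_sum_le _ _ fun l => hPc _).trans ?_)
    calc ∑ l ∈ Finset.range p, nrm (PP m e μ (i + l) g)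
        ≤ ∑ l ∈ Finset.range p, N * pw i (-s) * ((2 : ℝ) ^ (-s)) ^ l := by
          refine sum_le_sum fun l _ => (hP _).trans ?_
          rw [pw_eq_pow, pw_eq_pow, pow_add, mul_assoc]
      _ = N * pw i (-s) * ∑ l ∈ Finset.range p, ((2 : ℝ) ^ (-s)) ^ l := by rw [mul_sum]
      _ ≤ N * pw i (-s) * (1 - (2 : ℝ) ^ (-s))⁻¹ := by
          have := sum_geom_le_inv hq0.le hq p
          have := pw_pos i (-s)
          gcongr
      _ = _ := by ring
  have hlim : Filter.Tendsto (fun p => nrm (fun x => g x - SS m e μ (i + p) g x) +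
      (1 - (2 : ℝ) ^ (-s))⁻¹ * N * pw i (-s)) Filter.atTop
      (𝓝 (0 + (1 - (2 : ℝ) ^ (-s))⁻¹ * N * pw i (-s))) := by
    refine Filter.Tendsto.add_const _ ?_
    have h1 := (h.tendsto_nsq_sub_SS hm hg).sqrt
    rw [Real.sqrt_zero] at h1
    exact h1.comp (Filter.tendsto_atTop_mono (fun p => Nat.le_add_left p i) Filter.tendsto_id)
  rw [zero_add] at hlim
  exact ge_of_tendsto' hlim key

theorem IsEigenSystem.PP_smooth (h : IsEigenSystem m e μ) (i : ℕ) (g : ℝ → ℝ) :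
    Sm (PP m e μ i g) := h.comb_smooth _ _

theorem IsEigenSystem.SS_smooth (h : IsEigenSystem m e μ) (i : ℕ) (g : ℝ → ℝ) :
    Sm (SS m e μ i g) := h.comb_smooth _ _

theorem IsEigenSystem.blk_nrm (hm : 1 ≤ m) (h : IsEigenSystem m e μ) :
    ∃ C, 0 < C ∧ ∀ (i : ℕ) (a : ι → ℝ), ∀ j ≤ 2 * m,
      nrm (iteratedDeriv j (comb e (blk m μ i) a)) ≤ C * pw i j * nrm (comb e (blk m μ i) a) := by
  obtain ⟨C, hC, H⟩ := h.bernstein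
  refine ⟨C * 2 ^ (2 * m), by positivity, fun i a j hj => ?_⟩
  refine (H (2 ^ (i + 1)) _ a (one_le_pow₀ one_le_two)
    (fun k hk => ((h.mem_blk hm).1 hk).2.le) j hj).trans ?_
  refine mul_le_mul_of_nonneg_right ?_ (nrm_nonneg _)
  rw [pw_natCast, pow_succ, mul_pow, mul_assoc]
  have : (2 : ℝ) ^ j ≤ 2 ^ (2 * m) := pow_le_pow_right₀ one_le_two hj
  have h2 : (0 : ℝ) ≤ (2 ^ i) ^ j := by positivity
  rw [mul_comm ((2 : ℝ) ^ (2 * m))]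
  gcongr

theorem IsEigenSystem.blk_sup (hm : 1 ≤ m) (h : IsEigenSystem m e μ) :
    ∃ C, 0 < C ∧ ∀ (i : ℕ) (a : ι → ℝ), ∀ j ≤ 2 * m, ∀ x ∈ Icc (0 : ℝ) 1,
      |iteratedDeriv j (comb e (blk m μ i) a) x| ≤
        C * pw i (j + 1 / 2) * nrm (comb e (blk m μ i) a) := by
  obtain ⟨C, hC, H⟩ := h.bernstein_sup hm
  refine ⟨√(C * 2 ^ (4 * m + 1)), by positivity, fun i a j hj x hx => ?_⟩
  refine abs_le_of_sq_le_sq ?_ (mul_nonneg (mul_nonneg (sqrt_nonneg _) (pw_pos _ _).le)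
    (nrm_nonneg _))
  refine (H (2 ^ (i + 1)) _ a (one_le_pow₀ one_le_two)
    (fun k hk => ((h.mem_blk hm).1 hk).2.le) j hj x hx).trans ?_
  rw [mul_pow, mul_pow, nrm_sq, sq_sqrt (by positivity), pw_sq]
  refine mul_le_mul_of_nonneg_right ?_ (nsq_nonneg _)
  have e1 : (2 * ((j : ℝ) + 1 / 2)) = ((2 * j + 1 : ℕ) : ℝ) := by push_cast; ring
  rw [e1, pw_natCast, pow_succ 2 i, mul_pow, mul_assoc]
  have : (2 : ℝ) ^ (2 * j + 1) ≤ 2 ^ (4 * m + 1) := pow_le_pow_right₀ one_le_two (by omega)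
  have h2 : (0 : ℝ) ≤ (2 ^ i) ^ (2 * j + 1) := by positivity
  rw [mul_comm ((2 : ℝ) ^ (4 * m + 1))]
  gcongr

theorem IsEigenSystem.PP_nrm (hm : 1 ≤ m) (h : IsEigenSystem m e μ) :
    ∃ C, 0 < C ∧ ∀ (g : ℝ → ℝ) (s N : ℝ), Continuous g → Tail m e μ g s N →
      ∀ i, ∀ j ≤ 2 * m, nrm (iteratedDeriv j (PP m e μ i g)) ≤ C * N * pw i (j - s) := by
  obtain ⟨C, hC, H⟩ := h.blk_nrm hm
  refine ⟨C, hC, fun g s N hg hT i j hj => (H i _ j hj).trans ?_⟩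
  have h1 := (h.nrm_PP_le hm i hg).trans (hT i)
  rw [PP] at h1
  have := pw_pos i j
  calc _ ≤ C * pw i j * (N * pw i (-s)) := by gcongr
    _ = _ := by rw [sub_eq_add_neg, pw_add]; ring

theorem IsEigenSystem.PP_sup (hm : 1 ≤ m) (h : IsEigenSystem m e μ) :
    ∃ C, 0 < C ∧ ∀ (g : ℝ → ℝ) (s N : ℝ), Continuous g → Tail m e μ g s N →
      ∀ i, ∀ j ≤ 2 * m, ∀ x ∈ Icc (0 : ℝ) 1,
        |iteratedDeriv j (PP m e μ i g) x| ≤ C * N * pw i (j + 1 / 2 - s) := by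
  obtain ⟨C, hC, H⟩ := h.blk_sup hm
  refine ⟨C, hC, fun g s N hg hT i j hj x hx => (H i _ j hj x hx).trans ?_⟩
  have h1 := (h.nrm_PP_le hm i hg).trans (hT i)
  rw [PP] at h1
  have := pw_pos i (j + 1 / 2)
  calc _ ≤ C * pw i (j + 1 / 2) * (N * pw i (-s)) := by gcongr
    _ = _ := by rw [sub_eq_add_neg, pw_add i _ (-s)]; ring

theorem IsEigenSystem.iteratedDeriv_SS (h : IsEigenSystem m e μ) (hm : 1 ≤ m) (i j : ℕ)
    (g : ℝ → ℝ) (x : ℝ) : iteratedDeriv j (SS m e μ i g) x =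
      ∑ l ∈ Finset.range i, iteratedDeriv j (PP m e μ l g) x := by
  rw [h.SS_eq_sum hm, iteratedDeriv_fun_sum fun l _ => (h.PP_smooth l g).contDiffAt j x]

theorem Tail.nonneg {g : ℝ → ℝ} {s N : ℝ} (hT : Tail m e μ g s N) : 0 ≤ N := by
  have h1 := hT 0
  rw [pw_zero_left, mul_one] at h1
  exact (nrm_nonneg _).trans h1

theorem IsEigenSystem.SS_nrm (hm : 1 ≤ m) (h : IsEigenSystem m e μ) {s : ℝ} {j : ℕ}
    (hj : j ≤ 2 * m) (hs : (j : ℝ) - s ≠ 0) :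
    ∃ C, 0 < C ∧ ∀ (g : ℝ → ℝ) (N : ℝ), Continuous g → Tail m e μ g s N →
      ∀ i, nrm (iteratedDeriv j (SS m e μ i g)) ≤ C * N * pw i (max 0 (j - s)) := by
  obtain ⟨C, hC, H⟩ := h.PP_nrm hm
  obtain ⟨D, hD, H'⟩ := exists_sum_pw_le hs
  refine ⟨C * D, by positivity, fun g N hg hT i => ?_⟩
  have e1 : iteratedDeriv j (SS m e μ i g) = fun x =>
      ∑ l ∈ Finset.range i, iteratedDeriv j (PP m e μ l g) x := by
    ext x; exact h.iteratedDeriv_SS hm i j g x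
  have hN := hT.nonneg
  rw [e1]
  refine (nrm_sum_le _ _ fun l => ((h.PP_smooth l g).iterDeriv j).continuous).trans ?_
  calc _ ≤ ∑ l ∈ Finset.range i, C * N * pw l (j - s) :=
        sum_le_sum fun l _ => H g s N hg hT l j hj
    _ = C * N * ∑ l ∈ Finset.range i, pw l (j - s) := by rw [mul_sum]
    _ ≤ C * N * (D * pw i (max 0 (j - s))) := by
        have := H' i
        gcongr
    _ = _ := by ring

theorem IsEigenSystem.SS_sup (hm : 1 ≤ m) (h : IsEigenSystem m e μ) {s : ℝ} {j : ℕ}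
    (hj : j ≤ 2 * m) (hs : (j : ℝ) + 1 / 2 - s ≠ 0) :
    ∃ C, 0 < C ∧ ∀ (g : ℝ → ℝ) (N : ℝ), Continuous g → Tail m e μ g s N →
      ∀ i, ∀ x ∈ Icc (0 : ℝ) 1,
        |iteratedDeriv j (SS m e μ i g) x| ≤ C * N * pw i (max 0 (j + 1 / 2 - s)) := by
  obtain ⟨C, hC, H⟩ := h.PP_sup hm
  obtain ⟨D, hD, H'⟩ := exists_sum_pw_le hs
  refine ⟨C * D, by positivity, fun g N hg hT i x hx => ?_⟩
  have hN := hT.nonneg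
  rw [h.iteratedDeriv_SS hm]
  refine (abs_sum_le_sum_abs _ _).trans ?_
  calc _ ≤ ∑ l ∈ Finset.range i, C * N * pw l (j + 1 / 2 - s) :=
        sum_le_sum fun l _ => H g s N hg hT l j hj x hx
    _ = C * N * ∑ l ∈ Finset.range i, pw l (j + 1 / 2 - s) := by rw [mul_sum]
    _ ≤ C * N * (D * pw i (max 0 (j + 1 / 2 - s))) := by
        have := H' i
        gcongr
    _ = _ := by ring

theorem exists_iteratedDeriv_bound {φ : ℝ → ℝ} (hφ : Sm φ) (Q : ℕ) :
    ∃ c, 0 < c ∧ ∀ q ≤ Q, ∀ x ∈ Icc (0 : ℝ) 1, |iteratedDeriv q φ x| ≤ c := by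
  have H : ∀ q, ∃ c, 0 ≤ c ∧ ∀ x ∈ Icc (0 : ℝ) 1, |iteratedDeriv q φ x| ≤ c := fun q => by
    obtain ⟨c, hc⟩ := (isCompact_Icc (a := (0 : ℝ)) (b := 1)).exists_bound_of_continuousOn
      (hφ.iterDeriv q).continuous.continuousOn
    exact ⟨c, (norm_nonneg _).trans (hc 0 (by simp)), hc⟩
  choose c hc0 hc using H
  refine ⟨1 + ∑ q ∈ Finset.range (Q + 1), c q, ?_, fun q hq x hx => (hc q x hx).trans ?_⟩
  · have := sum_nonneg (s := Finset.range (Q + 1)) fun q _ => hc0 q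
    linarith
  · have := single_le_sum (fun q _ => hc0 q) (Finset.mem_range.2 (Nat.lt_succ_of_le hq))
    linarith

/-- Derivatives of a fixed smooth multiple of a block. -/
theorem IsEigenSystem.nrm_mul_blk (hm : 1 ≤ m) (h : IsEigenSystem m e μ) {φ : ℝ → ℝ} (hφ : Sm φ) :
    ∃ C, 0 < C ∧ ∀ (i : ℕ) (a : ι → ℝ), ∀ j ≤ 2 * m,
      nrm (iteratedDeriv j fun x => φ x * comb e (blk m μ i) a x) ≤
        C * pw i j * nrm (comb e (blk m μ i) a) := by
  obtain ⟨C, hC, H⟩ := h.blk_nrm hm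
  obtain ⟨c, hc, Hc⟩ := exists_iteratedDeriv_bound hφ (2 * m)
  refine ⟨4 ^ m * c * C, by positivity, fun i a j hj => ?_⟩
  set z := comb e (blk m μ i) a with hz
  have hzs : Sm z := h.comb_smooth _ _
  have e1 : (iteratedDeriv j fun x => φ x * z x) = fun x => ∑ q ∈ Finset.range (j + 1),
      (j.choose q * iteratedDeriv q φ x) * iteratedDeriv (j - q) z x := by
    ext x; exact iteratedDeriv_mul_sm hφ hzs j x
  have hc1 : ∀ q, Continuous (iteratedDeriv q φ) := fun q => (hφ.iterDeriv q).continuous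
  have hc2 : ∀ q, Continuous (iteratedDeriv q z) := fun q => (hzs.iterDeriv q).continuous
  rw [e1]
  refine (nrm_sum_le _ _ fun q => by
    have := hc1 q; have := hc2 (j - q); fun_prop).trans ?_
  have hz0 := nrm_nonneg z
  have hp := pw_pos i j
  calc _ ≤ ∑ q ∈ Finset.range (j + 1), (j.choose q : ℝ) * (c * (C * pw i j * nrm z)) := by
        refine sum_le_sum fun q hq => ?_
        have hq' : q ≤ j := Nat.lt_succ_iff.1 (Finset.mem_range.1 hq)
        have h1 := H i a (j - q) (by omega)
        have h2 : pw i ((j - q : ℕ) : ℝ) ≤ pw i j := pw_mono i (by exact_mod_cast Nat.sub_le _ _)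
        refine (nrm_mul_le (c := j.choose q * c) (by have := hc1 q; fun_prop) (hc2 _)
          (by positivity) fun x hx => ?_).trans ?_
        · rw [abs_mul, Nat.abs_cast]
          have := Hc q (by omega) x hx
          gcongr
        · rw [mul_assoc]
          refine mul_le_mul_of_nonneg_left (mul_le_mul_of_nonneg_left (h1.trans ?_) hc.le)
            (Nat.cast_nonneg _)
          gcongr
    _ = (2 : ℝ) ^ j * (c * (C * pw i j * nrm z)) := by
        rw [← sum_mul]; congr 1; exact_mod_cast Nat.sum_range_choose j
    _ ≤ (4 : ℝ) ^ m * (c * (C * pw i j * nrm z)) := by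
        have : (2 : ℝ) ^ j ≤ 4 ^ m := by
          calc (2 : ℝ) ^ j ≤ 2 ^ (2 * m) := pow_le_pow_right₀ one_le_two hj
            _ = 4 ^ m := by rw [pow_mul]; norm_num
        gcongr
    _ = _ := by ring

/-- Each block is an exact derivative of order `2 m` with the expected gain. -/
theorem IsEigenSystem.exists_primitive (hm : 1 ≤ m) (h : IsEigenSystem m e μ) (i : ℕ) (a : ι → ℝ) :
    ∃ b : ι → ℝ, iteratedDeriv (2 * m) (comb e (blk m μ i) b) = comb e (blk m μ i) a ∧
      nrm (comb e (blk m μ i) b) ≤ pw i (-(2 * m : ℕ)) * nrm (comb e (blk m μ i) a) := by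
  refine ⟨fun k => (-1) ^ m * (a k / μ k), ?_, ?_⟩
  · rw [h.comb_eq]
    ext s
    refine sum_congr rfl fun k _ => ?_
    have : μ k ≠ 0 := by linarith [h.one_le k]
    have h1 : ((-1 : ℝ) ^ m) * (-1) ^ m = 1 := by rw [← mul_pow]; simp
    congr 1
    calc (-1 : ℝ) ^ m * (μ k * ((-1) ^ m * (a k / μ k)))
        = ((-1) ^ m * (-1) ^ m) * (μ k * (a k / μ k)) := by ring
      _ = a k := by rw [h1]; field_simp
  · refine nrm_le_of_nsq_le (mul_nonneg (pw_pos _ _).le (nrm_nonneg _)) ?_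
    rw [mul_pow, nrm_sq, h.nsq_comb, h.nsq_comb, mul_sum]
    refine sum_le_sum fun k hk => ?_
    have h1 := ((h.mem_blk hm).1 hk).1
    rw [mul_pow, ← pow_mul, mul_comm m 2, pow_mul]
    simp only [even_two, Even.neg_pow, one_pow, one_mul]
    rw [pw_neg, pw_natCast, div_pow, div_eq_inv_mul, inv_pow]
    have h2 : (0 : ℝ) < (2 ^ i) ^ (2 * m) := by positivity
    gcongr

/-- Pairing of derivatives of a flat function with frequency blocks, low frequency part. -/
theorem IsEigenSystem.pairing_low (hm : 1 ≤ m) (h : IsEigenSystem m e μ) {φ : ℝ → ℝ} (hφ : Sm φ)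
    {s : ℝ} (hs : ∀ j : ℤ, (j : ℝ) / 2 ≠ s) {j : ℕ} (hj : j < 2 * m) :
    ∃ C, 0 < C ∧ ∀ (g : ℝ → ℝ) (N : ℝ), Continuous g → Tail m e μ g s N →
      ∀ (i : ℕ) (a : ι → ℝ),
        |∫ x in 0..1, φ x * iteratedDeriv j (SS m e μ i g) x * comb e (blk m μ i) a x| ≤
          C * N * pw i (-min (1 / 2) (s - 2 * m + 1)) * nrm (comb e (blk m μ i) a) := by
  have hjr : (j : ℝ) + 1 ≤ 2 * m := by exact_mod_cast hj
  have n1 : (j : ℝ) - s ≠ 0 := fun hh => hs (2 * j) (by push_cast; linarith)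
  have n2 : ((j + 1 : ℕ) : ℝ) - s ≠ 0 := fun hh =>
    hs (2 * j + 2) (by push_cast at hh ⊢; linarith)
  have n3 : (j : ℝ) + 1 / 2 - s ≠ 0 := fun hh => hs (2 * j + 1) (by push_cast; linarith)
  obtain ⟨C1, hC1, H1⟩ := h.SS_nrm hm hj.le n1
  obtain ⟨C2, hC2, H2⟩ := h.SS_nrm hm hj n2
  obtain ⟨C3, hC3, H3⟩ := h.SS_sup hm hj.le n3
  obtain ⟨C4, hC4, H4⟩ := h.blk_nrm hm
  obtain ⟨C5, hC5, H5⟩ := h.blk_sup hm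
  obtain ⟨c, hc, Hc⟩ := exists_iteratedDeriv_bound hφ 1
  refine ⟨c * (2 * C3 * C5 + (C1 + C2) * C4), by positivity, fun g N hg hT i a => ?_⟩
  obtain ⟨b, hb, hbn⟩ := h.exists_primitive hm i a
  set z := comb e (blk m μ i) a with hz
  set y := comb e (blk m μ i) b with hy
  set f := SS m e μ i g with hf
  have hN := hT.nonneg
  have hfs : Sm f := h.SS_smooth i g
  have hys : Sm y := h.comb_smooth _ _
  have hm1 : 2 * m = (2 * m - 1) + 1 := by omega
  have hWs : Sm (iteratedDeriv (2 * m - 1) y) := hys.iterDeriv _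
  have hW' : deriv (iteratedDeriv (2 * m - 1) y) = z := by
    rw [← iteratedDeriv_succ, ← hm1, hb]
  set W := iteratedDeriv (2 * m - 1) y with hWdef
  have hz0 := nrm_nonneg z
  set σ := min (1 / 2) (s - 2 * m + 1) with hσ
  have hσ1 : σ ≤ 1 / 2 := min_le_left _ _
  have hσ2 : σ ≤ s - 2 * m + 1 := min_le_right _ _
  have hcast : ((2 * m - 1 : ℕ) : ℝ) = 2 * m - 1 := by
    rw [Nat.cast_sub (by omega)]; push_cast; ring
  have hWn : nrm W ≤ C4 * pw i (-1) * nrm z := by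
    refine (H4 i b (2 * m - 1) (by omega)).trans ?_
    have := pw_pos i ((2 * m - 1 : ℕ) : ℝ)
    calc _ ≤ C4 * pw i ((2 * m - 1 : ℕ) : ℝ) * (pw i (-(2 * m : ℕ)) * nrm z) := by gcongr
      _ = C4 * (pw i ((2 * m - 1 : ℕ) : ℝ) * pw i (-(2 * m : ℕ))) * nrm z := by ring
      _ = _ := by rw [← pw_add, hcast]; push_cast; ring_nf
  have hWsup : ∀ x ∈ Icc (0 : ℝ) 1, |W x| ≤ C5 * pw i (-(1 / 2)) * nrm z := by
    intro x hx
    refine (H5 i b (2 * m - 1) (by omega) x hx).trans ?_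
    have := pw_pos i (((2 * m - 1 : ℕ) : ℝ) + 1 / 2)
    calc _ ≤ C5 * pw i (((2 * m - 1 : ℕ) : ℝ) + 1 / 2) * (pw i (-(2 * m : ℕ)) * nrm z) := by gcongr
      _ = C5 * (pw i (((2 * m - 1 : ℕ) : ℝ) + 1 / 2) * pw i (-(2 * m : ℕ))) * nrm z := by ring
      _ = _ := by rw [← pw_add, hcast]; push_cast; ring_nf
  have hGs : Sm fun x => φ x * iteratedDeriv j f x := hφ.mul (hfs.iterDeriv j)
  have hG' : deriv (fun x => φ x * iteratedDeriv j f x) = fun x =>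
      deriv φ x * iteratedDeriv j f x + φ x * iteratedDeriv (j + 1) f x := by
    ext x
    exact ((hφ.hasDerivAt x).mul (hfs.hasDerivAt_iter j x)).deriv
  have hc0 : ∀ x ∈ Icc (0 : ℝ) 1, |φ x| ≤ c := fun x hx => by simpa using Hc 0 (by omega) x hx
  have hc1 : ∀ x ∈ Icc (0 : ℝ) 1, |deriv φ x| ≤ c := fun x hx => by
    simpa using Hc 1 le_rfl x hx
  have ibp := integral_deriv_mul hWs hGs 0 1
  rw [hW', hG'] at ibp
  have e0 : ∫ x in 0..1, φ x * iteratedDeriv j f x * z x =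
      ∫ x in 0..1, z x * (φ x * iteratedDeriv j f x) := by
    congr 1; ext x; ring
  rw [e0, ibp]
  have cφ := hφ.continuous
  have cφ' := hφ.deriv'.continuous
  have cf0 := (hfs.iterDeriv j).continuous
  have cf1 := (hfs.iterDeriv (j + 1)).continuous
  have b1 : ∀ x ∈ Icc (0 : ℝ) 1, |W x * (φ x * iteratedDeriv j f x)| ≤
      c * C3 * C5 * N * pw i (-σ) * nrm z := by
    intro x hx
    have hp : pw i (max 0 ((j : ℝ) + 1 / 2 - s)) * pw i (-(1 / 2)) ≤ pw i (-σ) := by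
      rw [← pw_add]
      refine pw_mono i ?_
      rcases max_cases 0 ((j : ℝ) + 1 / 2 - s) with hh | hh <;> linarith [hh.1]
    have q1 := hWsup x hx
    have q2 := hc0 x hx
    have q3 := H3 g N hg hT i x hx
    have := pw_pos i (-(1 / 2))
    have := pw_pos i (max 0 ((j : ℝ) + 1 / 2 - s))
    rw [abs_mul, abs_mul]
    calc _ ≤ (C5 * pw i (-(1 / 2)) * nrm z) * (c * (C3 * N * pw i (max 0 (j + 1 / 2 - s)))) := by
          gcongr
      _ = c * C3 * C5 * N * (pw i (max 0 ((j : ℝ) + 1 / 2 - s)) * pw i (-(1 / 2))) * nrm z := by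
          ring
      _ ≤ _ := by gcongr
  have b2 : |∫ x in 0..1, W x *
      (deriv φ x * iteratedDeriv j f x + φ x * iteratedDeriv (j + 1) f x)| ≤
      c * (C1 + C2) * C4 * N * pw i (-σ) * nrm z := by
    refine (abs_integral_mul_le hWs.continuous (by fun_prop)).trans ?_
    have hp1 : pw i (max 0 ((j : ℝ) - s)) * pw i (-1) ≤ pw i (-σ) := by
      rw [← pw_add]
      refine pw_mono i ?_
      rcases max_cases 0 ((j : ℝ) - s) with hh | hh <;> linarith [hh.1]
    have hp2 : pw i (max 0 (((j + 1 : ℕ) : ℝ) - s)) * pw i (-1) ≤ pw i (-σ) := by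
      rw [← pw_add]
      refine pw_mono i ?_
      push_cast
      rcases max_cases 0 ((j : ℝ) + 1 - s) with hh | hh <;> linarith [hh.1]
    have q : nrm (fun x => deriv φ x * iteratedDeriv j f x + φ x * iteratedDeriv (j + 1) f x) ≤
        c * (C1 * N * pw i (max 0 ((j : ℝ) - s))) +
        c * (C2 * N * pw i (max 0 (((j + 1 : ℕ) : ℝ) - s))) := by
      refine (nrm_add_le (by fun_prop) (by fun_prop)).trans (add_le_add ?_ ?_)
      · refine (nrm_mul_le cφ' cf0 hc.le hc1).trans ?_
        have := H1 g N hg hT i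
        gcongr
      · refine (nrm_mul_le cφ cf1 hc.le hc0).trans ?_
        have := H2 g N hg hT i
        gcongr
    have := pw_pos i (-1)
    have := pw_pos i (-σ)
    have := pw_pos i (max 0 ((j : ℝ) - s))
    have := pw_pos i (max 0 (((j + 1 : ℕ) : ℝ) - s))
    calc _ ≤ (C4 * pw i (-1) * nrm z) * (c * (C1 * N * pw i (max 0 ((j : ℝ) - s))) +
          c * (C2 * N * pw i (max 0 (((j + 1 : ℕ) : ℝ) - s)))) := by
          refine mul_le_mul hWn q (nrm_nonneg _) (by positivity)
      _ = c * C4 * N * (C1 * (pw i (max 0 ((j : ℝ) - s)) * pw i (-1)) +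
          C2 * (pw i (max 0 (((j + 1 : ℕ) : ℝ) - s)) * pw i (-1))) * nrm z := by ring
      _ ≤ c * C4 * N * (C1 * pw i (-σ) + C2 * pw i (-σ)) * nrm z := by gcongr
      _ = _ := by ring
  have t1 := b1 1 (by simp)
  have t0 := b1 0 (by simp)
  have := abs_sub (W 1 * (φ 1 * iteratedDeriv j f 1) - W 0 * (φ 0 * iteratedDeriv j f 0))
    (∫ x in 0..1, W x *
      (deriv φ x * iteratedDeriv j f x + φ x * iteratedDeriv (j + 1) f x))
  have := abs_sub (W 1 * (φ 1 * iteratedDeriv j f 1)) (W 0 * (φ 0 * iteratedDeriv j f 0))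
  nlinarith

/-- Pairing of derivatives of a flat function with frequency blocks. -/
theorem IsEigenSystem.pairing (hm : 1 ≤ m) (h : IsEigenSystem m e μ) {φ : ℝ → ℝ} (hφ : Sm φ)
    {s : ℝ} (hs : ∀ j : ℤ, (j : ℝ) / 2 ≠ s) {j : ℕ} (hj : j < 2 * m) :
    ∃ C, 0 < C ∧ ∀ (g : ℝ → ℝ) (N : ℝ), Sm g → Flat m g → Tail m e μ g s N →
      ∀ (i : ℕ) (a : ι → ℝ),
        |∫ x in 0..1, φ x * iteratedDeriv j g x * comb e (blk m μ i) a x| ≤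
          C * N * pw i (-min (1 / 2) (s - 2 * m + 1)) * nrm (comb e (blk m μ i) a) := by
  have hjr : (j : ℝ) + 1 ≤ 2 * m := by exact_mod_cast hj
  obtain ⟨C1, hC1, H1⟩ := h.pairing_low hm hφ hs hj
  obtain ⟨C2, hC2, H2⟩ := h.nrm_mul_blk hm hφ
  refine ⟨C1 + C2, by positivity, fun g N hg hgf hT i a => ?_⟩
  have q1 := H1 g N hg.continuous hT i a
  have q2 := H2 i a j hj.le
  set z := comb e (blk m μ i) a with hz
  have hN := hT.nonneg
  have hzs : Sm z := h.comb_smooth _ _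
  have hfs : Sm (SS m e μ i g) := h.SS_smooth i g
  set f := SS m e μ i g with hf
  have hff : Flat m f := h.flat_comb _ _
  have hg2s : Sm fun x => g x - f x := hg.sub hfs
  have hg2f : Flat m fun x => g x - f x := Flat.sub hg hfs hgf hff
  have hφz : Flat m fun x => φ x * z x := Flat.mul hφ hzs (h.flat_comb _ _)
  have hφzs : Sm fun x => φ x * z x := hφ.mul hzs
  have ibp := integral_iteratedDeriv_mul hg2s hφzs hg2f hφz hj.le
  have e1 : ∀ x, iteratedDeriv j (fun x => g x - f x) x =
      iteratedDeriv j g x - iteratedDeriv j f x := fun x =>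
    iteratedDeriv_fun_sub (hg.contDiffAt j x) (hfs.contDiffAt j x)
  have c1 := (hg.iterDeriv j).continuous
  have c2 := (hfs.iterDeriv j).continuous
  have c3 := hφ.continuous
  have c4 := hzs.continuous
  have e2 : ∫ x in 0..1, φ x * iteratedDeriv j g x * z x =
      (∫ x in 0..1, φ x * iteratedDeriv j f x * z x) +
      ∫ x in 0..1, iteratedDeriv j (fun x => g x - f x) x * (φ x * z x) := by
    rw [← intervalIntegral.integral_add]
    · congr 1; ext x; rw [e1]; ring
    · exact Continuous.intervalIntegrable (by fun_prop) _ _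
    · simp_rw [e1]
      exact Continuous.intervalIntegrable (by fun_prop) _ _
  rw [e2, ibp]
  set σ := min (1 / 2) (s - 2 * m + 1) with hσ
  have hσ2 : σ ≤ s - 2 * m + 1 := min_le_right _ _
  have q3 : |(-1) ^ j * ∫ x in 0..1, (g x - f x) *
      iteratedDeriv j (fun x => φ x * z x) x| ≤ C2 * N * pw i (-σ) * nrm z := by
    rw [abs_mul, abs_pow, abs_neg, abs_one, one_pow, one_mul]
    refine (abs_integral_mul_le hg2s.continuous (hφzs.iterDeriv j).continuous).trans ?_
    have q4 := hT i
    have hz0 := nrm_nonneg z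
    have hp : pw i (-s) * pw i j ≤ pw i (-σ) := by
      rw [← pw_add]; exact pw_mono i (by linarith)
    have := pw_pos i (-s)
    calc _ ≤ (N * pw i (-s)) * (C2 * pw i j * nrm z) :=
          mul_le_mul q4 q2 (nrm_nonneg _) (by positivity)
      _ = C2 * N * (pw i (-s) * pw i j) * nrm z := by ring
      _ ≤ _ := by gcongr
  refine (abs_add_le _ _).trans ?_
  linarith

end

/-- A linear differential inequality with damping. -/
theorem le_of_deriv_le_damped {y y' : ℝ → ℝ} {t0 t1 L B : ℝ} (hL : 0 < L) (hB0 : 0 ≤ B)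
    (hy : ∀ t ∈ Icc t0 t1, HasDerivAt y (y' t) t) (h : ∀ t ∈ Icc t0 t1, y' t ≤ -L * y t + B) :
    ∀ t ∈ Icc t0 t1, y t ≤ exp (-L * (t - t0)) * y t0 + B / L := by
  intro t ht
  have hB : B / L * L = B := by field_simp
  have hd : ∀ s ∈ Icc t0 t1, HasDerivAt (fun s => (y s - B / L) * exp (L * (s - t0)))
      (y' s * exp (L * (s - t0)) + (y s - B / L) * (exp (L * (s - t0)) * L)) s := by
    intro s hs
    have h1 : HasDerivAt (fun s => L * (s - t0)) L s := by
      simpa using ((hasDerivAt_id' s).sub_const t0).const_mul L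
    exact ((hy s hs).sub_const _).mul h1.exp
  have hanti : AntitoneOn (fun s => (y s - B / L) * exp (L * (s - t0))) (Icc t0 t1) := by
    refine antitoneOn_of_deriv_nonpos (convex_Icc _ _)
      (fun s hs => (hd s hs).continuousAt.continuousWithinAt)
      (fun s hs => (hd s (interior_subset hs)).differentiableAt.differentiableWithinAt)
      fun s hs => ?_
    rw [(hd s (interior_subset hs)).deriv]
    have h2 := h s (interior_subset hs)
    have : y' s * exp (L * (s - t0)) + (y s - B / L) * (exp (L * (s - t0)) * L) =
        (y' s + L * y s - B / L * L) * exp (L * (s - t0)) := by ring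
    rw [this, hB]
    exact mul_nonpos_of_nonpos_of_nonneg (by linarith) (Real.exp_pos _).le
  have h3 := hanti ⟨le_rfl, ht.1.trans ht.2⟩ ht ht.1
  simp only [sub_self, mul_zero, Real.exp_zero, mul_one] at h3
  have h4 : exp (-L * (t - t0)) * exp (L * (t - t0)) = 1 := by
    rw [← Real.exp_add]; simp
  have h5 : y t - B / L ≤ exp (-L * (t - t0)) * (y t0 - B / L) := by
    calc y t - B / L = exp (-L * (t - t0)) * ((y t - B / L) * exp (L * (t - t0))) := by
          rw [mul_comm (y t - B / L), ← mul_assoc, h4, one_mul]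
      _ ≤ _ := mul_le_mul_of_nonneg_left h3 (Real.exp_pos _).le
  have := mul_nonneg (Real.exp_pos (-L * (t - t0))).le (div_nonneg hB0 hL.le)
  linarith

/-- A bound on the `m`-th derivative is stable under `L²` limits of flat functions. -/
theorem iteratedDeriv_le_of_tendsto {m : ℕ} (hm : 1 ≤ m) {f : ℝ → ℝ} {F : ℕ → ℝ → ℝ} (hf : Sm f)
    (hff : Flat m f) (hF : ∀ k, Sm (F k)) (hFf : ∀ k, Flat m (F k))
    (hlim : Filter.Tendsto (fun k => nsq fun x => f x - F k x) Filter.atTop (𝓝 0)) {M : ℝ}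
    (hM : ∀ k, ∀ x ∈ Icc (0 : ℝ) 1, iteratedDeriv m (F k) x ≤ M) :
    ∀ x ∈ Icc (0 : ℝ) 1, iteratedDeriv m f x ≤ M := by
  have hcf := (hf.iterDeriv m).continuous
  have key : ∀ x ∈ Ioo (0 : ℝ) 1, iteratedDeriv m f x ≤ M := by
    intro x hx
    by_contra hcon
    push Not at hcon
    obtain ⟨ε, hε, hball⟩ := Metric.isOpen_iff.1
      ((isOpen_lt continuous_const hcf).inter isOpen_Ioo) x ⟨hcon, hx⟩
    let φ : ContDiffBump x := ⟨ε / 4, ε / 2, by linarith, by linarith⟩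
    have hφs : Sm φ := φ.contDiff
    have hφ0 : ∀ s, 0 ≤ φ s := fun s => φ.nonneg
    have hz : ∀ s, s ∉ Ioo (0 : ℝ) 1 → ∀ᶠ r in 𝓝 s, φ r = 0 := by
      intro s hs
      have h1 : ε / 2 < dist s x := by
        by_contra h2
        exact hs (hball (mem_ball.2 (by linarith))).2
      filter_upwards [(isOpen_lt continuous_const (continuous_id.dist continuous_const)).mem_nhds
        (show ε / 2 < dist (id s) x from h1)] with r hr
      exact φ.zero_of_le_dist (le_of_lt hr)
    have hφf : Flat m φ := by
      have : ∀ s, s ∉ Ioo (0 : ℝ) 1 → ∀ j, iteratedDeriv j φ s = 0 := by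
        intro s hs j
        rw [Filter.EventuallyEq.iteratedDeriv_eq (g := fun _ => (0 : ℝ)) j (hz s hs)]
        simp
      exact fun j _ => ⟨this 0 (by simp) j, this 1 (by simp) j⟩
    have hm2 : m ≤ 2 * m := by omega
    have hcφ := hφs.continuous
    have hle : ∀ k, ∫ s in 0..1, iteratedDeriv m (F k) s * φ s ≤
        ∫ s in 0..1, M * φ s := fun k => by
      have := ((hF k).iterDeriv m).continuous
      refine intervalIntegral.integral_mono_on zero_le_one
        (Continuous.intervalIntegrable (by fun_prop) _ _)
        (Continuous.intervalIntegrable (by fun_prop) _ _) fun s hs => ?_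
      exact mul_le_mul_of_nonneg_right (hM k s hs) (hφ0 s)
    have hdiff : ∀ k, |(∫ s in 0..1, iteratedDeriv m f s * φ s) -
        ∫ s in 0..1, iteratedDeriv m (F k) s * φ s| ≤
        √(nsq fun x => f x - F k x) * nrm (iteratedDeriv m φ) := fun k => by
      have c1 := (hφs.iterDeriv m).continuous
      have c2 := hf.continuous
      have c3 := (hF k).continuous
      rw [integral_iteratedDeriv_mul hf hφs hff hφf hm2,
        integral_iteratedDeriv_mul (hF k) hφs (hFf k) hφf hm2, ← mul_sub, abs_mul, abs_pow,
        abs_neg, abs_one, one_pow, one_mul, ← intervalIntegral.integral_sub]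
      · refine le_trans (le_of_eq ?_) (abs_integral_mul_le (f := fun x => f x - F k x)
          (g := iteratedDeriv m φ) (by fun_prop) c1)
        congr 2; ext s; ring
      all_goals exact Continuous.intervalIntegrable (by fun_prop) _ _
    have hlim2 : Filter.Tendsto (fun k => (∫ s in 0..1, M * φ s) +
        √(nsq fun x => f x - F k x) * nrm (iteratedDeriv m φ)) Filter.atTop
        (𝓝 ((∫ s in 0..1, M * φ s) + 0 * nrm (iteratedDeriv m φ))) := by
      refine Filter.Tendsto.const_add _ (Filter.Tendsto.mul_const _ ?_)
      simpa using hlim.sqrt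
    have hle2 : ∫ s in 0..1, iteratedDeriv m f s * φ s ≤ ∫ s in 0..1, M * φ s := by
      have := ge_of_tendsto' hlim2 (b := ∫ s in 0..1, iteratedDeriv m f s * φ s) fun k => by
        linarith [hle k, (abs_le.1 (hdiff k)).2]
      simpa using this
    have hpos : 0 < ∫ s in 0..1, (iteratedDeriv m f s - M) * φ s := by
      refine intervalIntegral.integral_pos zero_lt_one (by fun_prop) (fun s hs => ?_)
        ⟨x, ⟨hx.1.le, hx.2.le⟩, ?_⟩
      · by_cases h1 : s ∈ ball x ε
        · exact mul_nonneg (by linarith [show M < iteratedDeriv m f s from (hball h1).1]) (hφ0 s)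
        · have : φ s = 0 := φ.zero_of_le_dist (by
            rw [mem_ball, not_lt] at h1
            exact le_trans (by show ε / 2 ≤ ε; linarith) h1)
          rw [this, mul_zero]
      · have : φ x = 1 := φ.one_of_mem_closedBall (mem_closedBall_self (by
          show 0 ≤ ε / 4; linarith))
        rw [this, mul_one]; linarith
    have : ∫ s in 0..1, (iteratedDeriv m f s - M) * φ s =
        (∫ s in 0..1, iteratedDeriv m f s * φ s) - ∫ s in 0..1, M * φ s := by
      rw [← intervalIntegral.integral_sub]
      · congr 1; ext s; ring
      all_goals exact Continuous.intervalIntegrable (by fun_prop) _ _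
    linarith
  have hcl : IsClosed {x | iteratedDeriv m f x ≤ M} := isClosed_le hcf continuous_const
  have := hcl.closure_subset_iff.2 (show Ioo (0 : ℝ) 1 ⊆ {x | iteratedDeriv m f x ≤ M} from key)
  rwa [closure_Ioo (by norm_num)] at this

theorem abs_iteratedDeriv_le_of_tendsto {m : ℕ} (hm : 1 ≤ m) {f : ℝ → ℝ} {F : ℕ → ℝ → ℝ}
    (hf : Sm f) (hff : Flat m f) (hF : ∀ k, Sm (F k)) (hFf : ∀ k, Flat m (F k))
    (hlim : Filter.Tendsto (fun k => nsq fun x => f x - F k x) Filter.atTop (𝓝 0)) {M : ℝ}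
    (hM : ∀ k, ∀ x ∈ Icc (0 : ℝ) 1, |iteratedDeriv m (F k) x| ≤ M) :
    ∀ x ∈ Icc (0 : ℝ) 1, |iteratedDeriv m f x| ≤ M := by
  intro x hx
  rw [abs_le]
  constructor
  · have h1 : Flat m fun x => -f x := fun j hj => by
      simp [iteratedDeriv_fun_neg, (hff j hj).1, (hff j hj).2]
    have h2 : ∀ k, Flat m fun x => -F k x := fun k j hj => by
      simp [iteratedDeriv_fun_neg, (hFf k j hj).1, (hFf k j hj).2]
    have := iteratedDeriv_le_of_tendsto hm hf.neg h1 (fun k => (hF k).neg) h2 (M := M) (by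
      refine hlim.congr fun k => ?_
      unfold nsq; congr 1; ext x; ring) (fun k x hx => by
      rw [iteratedDeriv_fun_neg]; linarith [(abs_le.1 (hM k x hx)).1]) x hx
    rw [iteratedDeriv_fun_neg] at this
    linarith
  · exact iteratedDeriv_le_of_tendsto hm hf hff hF hFf hlim
      (fun k x hx => (abs_le.1 (hM k x hx)).2) x hx

section
variable {m : ℕ} {ι : Type} {e : ι → ℝ → ℝ} {μ : ι → ℝ}

theorem IsEigenSystem.iteratedDeriv_sub_le_of_tail (hm : 1 ≤ m) (h : IsEigenSystem m e μ) {γ : ℝ}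
    (hγ : γ < 1) :
    ∃ C, 0 < C ∧ ∀ (g : ℝ → ℝ) (N : ℝ), Sm g → Flat m g → Tail m e μ g (2 * m + 1 / 2) N →
      ∀ x ∈ Icc (0 : ℝ) 1, ∀ y ∈ Icc (0 : ℝ) 1, ∀ i,
        |iteratedDeriv m g x - iteratedDeriv m g y| ≤
          C * N * (pw i (-1) + pw i (1 - γ) * |x - y|) := by
  have hm1 : (1 : ℝ) ≤ m := by exact_mod_cast hm
  obtain ⟨C, hC, H⟩ := h.PP_sup hm
  obtain ⟨D, hD, HD⟩ := exists_sum_pw_le (a := 1 - γ) (by linarith)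
  refine ⟨C * (4 + D), by positivity, fun g N hg hgf hT x hx y hy i => ?_⟩
  have hN := hT.nonneg
  have e1 : (m : ℝ) + 1 / 2 - (2 * m + 1 / 2) = -m := by ring
  have e2 : ((m + 1 : ℕ) : ℝ) + 1 / 2 - (2 * m + 1 / 2) = 1 - m := by push_cast; ring
  have hSs := h.SS_smooth i g
  have high : ∀ x ∈ Icc (0 : ℝ) 1, |iteratedDeriv m (fun x => g x - SS m e μ i g x) x| ≤
      2 * C * N * pw i (-1) := by
    refine abs_iteratedDeriv_le_of_tendsto hm (F := fun k x => SS m e μ (i + k) g x - SS m e μ i g x)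
      (hg.sub hSs) (Flat.sub hg hSs hgf (h.flat_comb _ _))
      (fun k => (h.SS_smooth (i + k) g).sub hSs)
      (fun k => Flat.sub (h.SS_smooth (i + k) g) hSs (h.flat_comb _ _) (h.flat_comb _ _)) ?_ ?_
    · refine ((h.tendsto_nsq_sub_SS hm hg.continuous).comp (Filter.tendsto_atTop_mono
        (fun p => Nat.le_add_left p i) Filter.tendsto_id)).congr fun k => ?_
      simp [nsq]
    · intro k x hx
      have e3 : (fun x => SS m e μ (i + k) g x - SS m e μ i g x) = fun x =>
          ∑ l ∈ Finset.range k, PP m e μ (i + l) g x := by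
        ext x; rw [h.SS_add hm]; ring
      rw [e3, iteratedDeriv_fun_sum fun l _ => (h.PP_smooth _ g).contDiffAt m x]
      refine (abs_sum_le_sum_abs _ _).trans ?_
      calc _ ≤ ∑ l ∈ Finset.range k, C * N * pw i (-1) * ((1 : ℝ) / 2) ^ l := by
            refine sum_le_sum fun l _ => ?_
            have := H g _ N hg.continuous hT (i + l) m (by omega) x hx
            rw [e1] at this
            refine this.trans ?_
            have h4 : pw (i + l) (-m) ≤ pw (i + l) (-1) := pw_mono _ (by linarith)
            have h5 : pw (i + l) (-1) = pw i (-1) * (1 / 2) ^ l := by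
              rw [pw_eq_pow, pw_eq_pow, pow_add, Real.rpow_neg_one]; norm_num
            rw [mul_assoc (C * N), ← h5]
            gcongr
        _ = C * N * pw i (-1) * ∑ l ∈ Finset.range k, ((1 : ℝ) / 2) ^ l := by
            rw [mul_sum]
        _ ≤ C * N * pw i (-1) * (1 - 1 / 2)⁻¹ := by
            have := sum_geom_le_inv (q := 1 / 2) (by norm_num) (by norm_num) k
            have := pw_pos i (-1)
            gcongr
        _ = _ := by norm_num; ring
  have low : |iteratedDeriv m (SS m e μ i g) x - iteratedDeriv m (SS m e μ i g) y| ≤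
      C * N * (D * pw i (1 - γ)) * |x - y| := by
    have hb : ∀ x ∈ Icc (0 : ℝ) 1, ‖iteratedDeriv (m + 1) (SS m e μ i g) x‖ ≤
        C * N * (D * pw i (1 - γ)) := by
      intro x hx
      rw [Real.norm_eq_abs, h.iteratedDeriv_SS hm]
      refine (abs_sum_le_sum_abs _ _).trans ?_
      calc _ ≤ ∑ l ∈ Finset.range i, C * N * pw l (1 - γ) := by
            refine sum_le_sum fun l _ => ?_
            have := H g _ N hg.continuous hT l (m + 1) (by omega) x hx
            rw [e2] at this
            refine this.trans ?_
            have h4 : pw l (1 - m) ≤ pw l 0 := pw_mono _ (by linarith)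
            have h5 : pw l 0 ≤ pw l (1 - γ) := pw_mono _ (by linarith)
            have := h4.trans h5
            gcongr
        _ = C * N * ∑ l ∈ Finset.range i, pw l (1 - γ) := by rw [mul_sum]
        _ ≤ C * N * (D * pw i (max 0 (1 - γ))) := by have := HD i; gcongr
        _ = _ := by rw [max_eq_right (by linarith)]
    have := (convex_Icc (0 : ℝ) 1).norm_image_sub_le_of_norm_hasDerivWithin_le
      (fun x _ => (hSs.hasDerivAt_iter m x).hasDerivWithinAt) hb hy hx
    simpa [Real.norm_eq_abs] using this
  have e4 : ∀ x, iteratedDeriv m (fun x => g x - SS m e μ i g x) x =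
      iteratedDeriv m g x - iteratedDeriv m (SS m e μ i g) x := fun x =>
    iteratedDeriv_fun_sub (hg.contDiffAt m x) (hSs.contDiffAt m x)
  have hx1 := high x hx
  have hy1 := high y hy
  rw [e4] at hx1 hy1
  have hp := pw_pos i (-1)
  have hp' := pw_pos i (1 - γ)
  have : iteratedDeriv m g x - iteratedDeriv m g y =
      (iteratedDeriv m g x - iteratedDeriv m (SS m e μ i g) x) -
      (iteratedDeriv m g y - iteratedDeriv m (SS m e μ i g) y) +
      (iteratedDeriv m (SS m e μ i g) x - iteratedDeriv m (SS m e μ i g) y) := by ring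
  rw [this]
  have h6 : 0 ≤ C * N * pw i (-1) * D := by positivity
  have h7 : 0 ≤ C * N * (pw i (1 - γ) * |x - y|) := by positivity
  calc _ ≤ 2 * C * N * pw i (-1) + 2 * C * N * pw i (-1) +
        C * N * (D * pw i (1 - γ)) * |x - y| :=
        (abs_add_le _ _).trans (add_le_add ((abs_sub _ _).trans (add_le_add hx1 hy1)) low)
    _ ≤ _ := by nlinarith

theorem IsEigenSystem.holder_of_tail (hm : 1 ≤ m) (h : IsEigenSystem m e μ) {γ : ℝ}
    (hγ : γ < 1) :
    ∃ C, 0 < C ∧ ∀ (g : ℝ → ℝ) (N : ℝ), Sm g → Flat m g → Tail m e μ g (2 * m + 1 / 2) N →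
      ∀ x ∈ Icc (0 : ℝ) 1, ∀ y ∈ Icc (0 : ℝ) 1,
        |iteratedDeriv m g x - iteratedDeriv m g y| ≤ C * N * |x - y| ^ γ := by
  obtain ⟨C, hC, H⟩ := h.iteratedDeriv_sub_le_of_tail hm hγ
  refine ⟨3 * C, by positivity, fun g N hg hgf hT x hx y hy => ?_⟩
  have hN := hT.nonneg
  rcases eq_or_ne x y with rfl | hxy
  · simp; positivity
  have h0 : 0 < |x - y| := abs_pos.2 (sub_ne_zero.2 hxy)
  have h1 : |x - y| ≤ 1 := by
    rw [abs_le]; constructor <;> linarith [hx.1, hx.2, hy.1, hy.2]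
  obtain ⟨i, hi1, hi2⟩ := exists_nat_pow_near_of_lt_one h0 h1 (y := (1 : ℝ) / 2) (by norm_num)
    (by norm_num)
  have h2 := H g N hg hgf hT x hx y hy i
  set r := |x - y| with hr
  have h3 : r ≤ r ^ γ := by
    calc r = r ^ (1 : ℝ) := (Real.rpow_one r).symm
      _ ≤ r ^ γ := Real.rpow_le_rpow_of_exponent_ge h0 h1 hγ.le
  have h4 : pw i (-1) ≤ 2 * r ^ γ := by
    have : pw i (-1) = (1 / 2) ^ i := by rw [pw_eq_pow, Real.rpow_neg_one]; norm_num
    rw [this]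
    rw [pow_succ] at hi1
    linarith
  have h5 : pw i (1 - γ) * r ≤ r ^ γ := by
    have e1 : pw i (1 - γ) = ((1 / 2 : ℝ) ^ i) ^ (γ - 1) := by
      rw [pw, one_div, inv_pow, Real.inv_rpow (by positivity), ← Real.rpow_neg (by positivity),
        Real.rpow_mul (by norm_num), Real.rpow_natCast]
      ring_nf
    have h6 : ((1 / 2 : ℝ) ^ i) ^ (γ - 1) ≤ r ^ (γ - 1) :=
      Real.rpow_le_rpow_of_nonpos h0 hi2 (by linarith)
    calc pw i (1 - γ) * r ≤ r ^ (γ - 1) * r := by rw [e1]; gcongr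
      _ = r ^ γ := by
        rw [← Real.rpow_add_one h0.ne']; ring_nf
  calc _ ≤ C * N * (pw i (-1) + pw i (1 - γ) * r) := h2
    _ ≤ C * N * (2 * r ^ γ + r ^ γ) := by gcongr
    _ = _ := by ring

end

/-- Directional derivative on space-time. -/
noncomputable def dv {d : ℕ} (v : ST(d)) (f : ST(d) → ℝ) :
    ST(d) → ℝ :=
  fun p => fderiv ℝ f p v

/-- Spatial partial derivative. -/
noncomputable def pd {d : ℕ} (l : Fin d) (f : ST(d) → ℝ) : ST(d) → ℝ :=
  dv (0, Pi.single l 1) f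

/-- Time derivative. -/
noncomputable def td {d : ℕ} (f : ST(d) → ℝ) : ST(d) → ℝ :=
  dv (1, 0) f

/-- Iterated spatial derivative along a word of directions. -/
noncomputable def dw {d : ℕ} (W : List (Fin d)) (f : ST(d) → ℝ) :
    ST(d) → ℝ :=
  W.foldr pd f

section calculus

variable {d : ℕ} {f g : ST(d) → ℝ} {v w : ST(d)} {l : Fin d}

theorem Sm.dv (hf : Sm f) (v : ST(d)) : Sm (dv v f) :=
  (ContDiff.fderiv_right (m := ((⊤ : ℕ∞) : WithTop ℕ∞)) hf (by simp)).clm_apply contDiff_const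

theorem Sm.pd (hf : Sm f) (l : Fin d) : Sm (pd l f) := hf.dv _

theorem Sm.td (hf : Sm f) : Sm (td f) := hf.dv _

theorem Sm.dw (hf : Sm f) (W : List (Fin d)) : Sm (dw W f) := by
  induction W with
  | nil => exact hf
  | cons l W ih => exact ih.pd l

theorem Sm.diff {E F : Type*} [NormedAddCommGroup E] [NormedSpace ℝ E] [NormedAddCommGroup F]
    [NormedSpace ℝ F] {f : E → F} (hf : Sm f) (p : E) : DifferentiableAt ℝ f p :=
  (ContDiff.differentiable hf (by simp)) p

theorem dv_add (hf : Sm f) (hg : Sm g) : dv v (fun p => f p + g p) = fun p => dv v f p + dv v g p := by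
  funext p
  simp [dv, fderiv_fun_add (hf.diff p) (hg.diff p)]

theorem dv_mul (hf : Sm f) (hg : Sm g) :
    dv v (fun p => f p * g p) = fun p => dv v f p * g p + f p * dv v g p := by
  funext p
  simp [dv, fderiv_fun_mul (hf.diff p) (hg.diff p)]
  ring

theorem dv_const (c : ℝ) : dv v (fun _ => c) = fun _ => 0 := by
  funext p
  simp [dv]

theorem dv_const_mul (c : ℝ) (hf : Sm f) : dv v (fun p => c * f p) = fun p => c * dv v f p := by
  funext p
  simp [dv, fderiv_const_mul (hf.diff p)]

theorem dv_sum {ι : Type*} (S : Finset ι) (F : ι → ST(d) → ℝ) (h : ∀ i ∈ S, Sm (F i)) :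
    dv v (fun p => ∑ i ∈ S, F i p) = fun p => ∑ i ∈ S, dv v (F i) p := by
  funext p
  simp [dv, fderiv_fun_sum fun i hi => (h i hi).diff p]

theorem dv_comm (hf : Sm f) (v w : ST(d)) : dv v (dv w f) = dv w (dv v f) := by
  funext p
  have hd : DifferentiableAt ℝ (fderiv ℝ f) p :=
    Sm.diff (ContDiff.fderiv_right (m := ((⊤ : ℕ∞) : WithTop ℕ∞)) hf (by simp)) p
  have h1 : ∀ v w, dv v (dv w f) p = fderiv ℝ (fderiv ℝ f) p v w := by
    intro v w
    change fderiv ℝ (fun q => fderiv ℝ f q w) p v = _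
    rw [fderiv_clm_apply hd (differentiableAt_const w)]
    simp
  rw [h1, h1]
  have : ContDiffAt ℝ 2 f p := (contDiff_infty.1 hf 2).contDiffAt
  exact (this.isSymmSndFDerivAt (by simp)).eq v w

theorem dw_nil (f : ST(d) → ℝ) : dw [] f = f := rfl

theorem dw_cons (l : Fin d) (W : List (Fin d)) (f : ST(d) → ℝ) :
    dw (l :: W) f = pd l (dw W f) := rfl

theorem dw_append (V W : List (Fin d)) (f : ST(d) → ℝ) :
    dw (V ++ W) f = dw V (dw W f) := by
  simp [dw]

theorem pd_comm (hf : Sm f) (k l : Fin d) : pd k (pd l f) = pd l (pd k f) := dv_comm hf _ _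

theorem td_pd (hf : Sm f) (l : Fin d) : td (pd l f) = pd l (td f) := dv_comm hf _ _

theorem dw_perm (hf : Sm f) {V W : List (Fin d)} (h : V.Perm W) : dw V f = dw W f := by
  induction h with
  | nil => rfl
  | cons l _ ih => rw [dw_cons, dw_cons, ih]
  | swap k l W => rw [dw_cons, dw_cons, dw_cons, dw_cons, pd_comm (hf.dw W)]
  | trans _ _ h1 h2 => rw [h1, h2]

theorem dw_comm (hf : Sm f) (V W : List (Fin d)) : dw V (dw W f) = dw W (dw V f) := by
  rw [← dw_append, ← dw_append, dw_perm hf List.perm_append_comm]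

theorem dw_add (W : List (Fin d)) (hf : Sm f) (hg : Sm g) :
    dw W (fun p => f p + g p) = fun p => dw W f p + dw W g p := by
  induction W with
  | nil => rfl
  | cons l W ih => rw [dw_cons, ih]; exact dv_add (hf.dw W) (hg.dw W)

theorem hasDerivAt_update (hf : Sm f) (t : ℝ) (x : Fin d → ℝ) (l : Fin d) (s : ℝ) :
    HasDerivAt (fun s => f (t, update x l s)) (pd l f (t, update x l s)) s := by
  have h1 : HasDerivAt (fun s => (t, update x l s)) ((0 : ℝ), Pi.single l (1 : ℝ)) s :=
    (hasDerivAt_const s t).prodMk (_root_.hasDerivAt_update x l s)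
  exact (hf.diff _).hasFDerivAt.comp_hasDerivAt s h1

theorem hasDerivAt_td (hf : Sm f) (x : Fin d → ℝ) (t : ℝ) :
    HasDerivAt (fun t => f (t, x)) (td f (t, x)) t := by
  have h1 : HasDerivAt (fun t => (t, x)) ((1 : ℝ), (0 : Fin d → ℝ)) t :=
    (hasDerivAt_id t).prodMk (hasDerivAt_const t x)
  exact (hf.diff _).hasFDerivAt.comp_hasDerivAt t h1

theorem sm_line (hf : Sm f) (t : ℝ) (x : Fin d → ℝ) (l : Fin d) :
    Sm fun s => f (t, update x l s) := by
  refine ContDiff.comp hf (contDiff_const.prodMk ?_)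
  exact contDiff_update _ x l

theorem iteratedDeriv_line (hf : Sm f) (t : ℝ) (x : Fin d → ℝ) (l : Fin d) (q : ℕ) :
    iteratedDeriv q (fun s => f (t, update x l s)) =
      fun s => dw (List.replicate q l) f (t, update x l s) := by
  induction q with
  | zero => simp [dw]
  | succ q ih =>
    rw [iteratedDeriv_succ, ih]
    funext s
    rw [List.replicate_succ, dw_cons]
    exact (BDE.hasDerivAt_update (hf.dw _) t x l s).deriv

theorem Sm.continuous' (hf : Sm f) : Continuous f := ContDiff.continuous hf

theorem continuous_slice (hf : Continuous f) (t : ℝ) : Continuous fun x => f (t, x) := by fun_prop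

end calculus

/-- Unit cube with lower corner `a`. -/
def cube {d : ℕ} (a : Fin d → ℝ) : Set (Fin d → ℝ) := Icc a fun i => a i + 1

/-- The boundary of the unit cube. -/
def cubeBd {d : ℕ} (a : Fin d → ℝ) : Set (Fin d → ℝ) :=
  {x | x ∈ cube a ∧ ∃ l, x l = a l ∨ x l = a l + 1}

/-- Vanishing to order `k` on a set of space-time points. -/
def VanS {d : ℕ} (Z : Set ST(d)) : ℕ → (ST(d) → ℝ) → Prop
  | 0, _ => True
  | k + 1, f => (∀ p ∈ Z, f p = 0) ∧ ∀ l, VanS Z k (pd l f)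

/-- Vanishing to order `k` on the boundary of the cube at time `t`. -/
abbrev Van {d : ℕ} (a : Fin d → ℝ) (t : ℝ) (k : ℕ) (f : ST(d) → ℝ) : Prop :=
  VanS {p | p.1 = t ∧ p.2 ∈ cubeBd a} k f

section cube

variable {d : ℕ} {a : Fin d → ℝ} {t : ℝ} {f g : ST(d) → ℝ} {l : Fin d}
  {Z : Set ST(d)}

theorem isCompact_cube (a : Fin d → ℝ) : IsCompact (cube a) := isCompact_Icc

theorem measurableSet_cube (a : Fin d → ℝ) : MeasurableSet (cube a) := measurableSet_Icc

theorem integrableOn_cube {f : (Fin d → ℝ) → ℝ} (hf : Continuous f) : IntegrableOn f (cube a) :=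
  hf.continuousOn.integrableOn_compact (isCompact_cube a)

theorem hasDerivAt_integral_of_continuous {α : Type*} [TopologicalSpace α] [MeasurableSpace α]
    [OpensMeasurableSpace α] {μ : Measure α}
    {K : Set α} (hK : IsCompact K) (hKm : MeasurableSet K) (hμ : μ K ≠ ⊤)
    {F F' : ℝ → α → ℝ} (hF : Continuous F.uncurry) (hF' : Continuous F'.uncurry)
    (h : ∀ t x, HasDerivAt (fun t => F t x) (F' t x) t) (t : ℝ) :
    HasDerivAt (fun t => ∫ x in K, F t x ∂μ) (∫ x in K, F' t x ∂μ) t := by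
  obtain ⟨C, hC⟩ := ((isCompact_closedBall t 1).prod hK).exists_bound_of_continuousOn
    hF'.continuousOn
  have : IsFiniteMeasure (μ.restrict K) := ⟨by simpa using hμ.lt_top⟩
  have hsl : ∀ {G : ℝ → α → ℝ}, Continuous G.uncurry → ∀ s, Continuous (G s) := fun hG s =>
    hG.comp (by fun_prop : Continuous fun x : α => (s, x))
  refine (hasDerivAt_integral_of_dominated_loc_of_deriv_le (bound := fun _ => C)
    (Metric.closedBall_mem_nhds t one_pos) ?_ ?_ ?_ ?_ ?_ ?_).2
  · exact Filter.Eventually.of_forall fun s => (hsl hF s).aestronglyMeasurable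
  · obtain ⟨D, hD⟩ := hK.exists_bound_of_continuousOn (hsl hF t).continuousOn
    refine Integrable.of_bound (hsl hF t).aestronglyMeasurable D ?_
    exact (ae_restrict_iff' hKm).2 (Filter.Eventually.of_forall hD)
  · exact (hsl hF' t).aestronglyMeasurable
  · exact (ae_restrict_iff' hKm).2 (Filter.Eventually.of_forall fun x hx s hs =>
      hC (s, x) ⟨hs, hx⟩)
  · exact integrable_const C
  · exact Filter.Eventually.of_forall fun x s _ => h s x

theorem hasDerivAt_integral_cube (hf : Sm f) (a : Fin d → ℝ) (t : ℝ) :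
    HasDerivAt (fun t => ∫ x in cube a, f (t, x)) (∫ x in cube a, td f (t, x)) t :=
  hasDerivAt_integral_of_continuous (μ := volume) (isCompact_cube a) (measurableSet_cube a)
    (isCompact_cube a).measure_lt_top.ne (F := fun t x => f (t, x))
    (F' := fun t x => td f (t, x)) hf.continuous' hf.td.continuous'
    (fun t x => hasDerivAt_td hf x t) t

theorem integral_pd_eq_zero (hf : Sm f)
    (h : ∀ x ∈ cube a, x l = a l ∨ x l = a l + 1 → f (t, x) = 0) :
    ∫ x in cube a, pd l f (t, x) = 0 := by
  cases d with
  | zero => exact l.elim0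
  | succ d =>
    have hc : Continuous f := hf.continuous'
    have hle : a ≤ fun i => a i + 1 := fun i => by linarith
    have e1 : ∀ x : Fin (d + 1) → ℝ, (∑ i, ((ContinuousLinearMap.single ℝ (fun _ => ℝ) l).comp
        ((fderiv ℝ f (t, x)).comp (ContinuousLinearMap.inr ℝ ℝ (Fin (d + 1) → ℝ))))
        (Pi.single i 1) i) = pd l f (t, x) := by
      intro x
      rw [Finset.sum_eq_single l]
      · simp [pd, dv]
      · intro i _ hi
        simp [hi]
      · simp
    have key := integral_divergence_of_hasFDerivAt_off_countable a (fun i => a i + 1) hle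
      (fun x => Pi.single l (f (t, x)))
      (fun x => (ContinuousLinearMap.single ℝ (fun _ => ℝ) l).comp
        ((fderiv ℝ f (t, x)).comp (ContinuousLinearMap.inr ℝ ℝ (Fin (d + 1) → ℝ))))
      ∅ countable_empty ?_ ?_ ?_
    · simp_rw [e1] at key
      rw [cube, key]
      refine sum_eq_zero fun i _ => ?_
      by_cases hi : i = l
      · subst hi
        rw [setIntegral_eq_zero_of_forall_eq_zero, setIntegral_eq_zero_of_forall_eq_zero, sub_zero]
        · intro x hx
          have := h (Fin.insertNth i (a i) x) ?_ (Or.inl (by simp))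
          · simpa using this
          · rw [cube, Fin.insertNth_mem_Icc]
            exact ⟨⟨le_rfl, by linarith⟩, hx⟩
        · intro x hx
          have := h (Fin.insertNth i (a i + 1) x) ?_ (Or.inr (by simp))
          · simpa using this
          · rw [cube, Fin.insertNth_mem_Icc]
            exact ⟨⟨by linarith, le_rfl⟩, hx⟩
      · simp [hi]
    · refine Continuous.continuousOn ?_
      exact (ContinuousLinearMap.single ℝ (fun _ => ℝ) l).continuous.comp (by fun_prop : Continuous fun x => f (t, x))
    · intro x _
      have h1 : HasFDerivAt (fun x => f (t, x))
          ((fderiv ℝ f (t, x)).comp (ContinuousLinearMap.inr ℝ ℝ (Fin (d + 1) → ℝ))) x := by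
        refine (hf.diff (t, x)).hasFDerivAt.comp x ?_
        exact hasFDerivAt_prodMk_right t x
      exact (ContinuousLinearMap.single ℝ (fun _ => ℝ) l).hasFDerivAt.comp x h1
    · refine Continuous.integrableOn_Icc ?_
      have : Continuous (pd l f) := (hf.pd l).continuous'
      simp_rw [e1]
      fun_prop

theorem integral_pd_mul (hf : Sm f) (hg : Sm g)
    (h : ∀ x ∈ cube a, x l = a l ∨ x l = a l + 1 → f (t, x) * g (t, x) = 0) :
    ∫ x in cube a, pd l f (t, x) * g (t, x) = -∫ x in cube a, f (t, x) * pd l g (t, x) := by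
  have hcf := hf.continuous'
  have hcg := hg.continuous'
  have hcf' := (hf.pd l).continuous'
  have hcg' := (hg.pd l).continuous'
  have := integral_pd_eq_zero (f := fun p => f p * g p) (ContDiff.mul hf hg) h
  rw [show pd l (fun p => f p * g p) = fun p => pd l f p * g p + f p * pd l g p from dv_mul hf hg,
    integral_add] at this
  · linarith
  all_goals exact integrableOn_cube (by fun_prop)

theorem VanS.zero_on {k : ℕ} (h : Van a t (k + 1) f) {x : Fin d → ℝ} (hx : x ∈ cube a)
    (hl : x l = a l ∨ x l = a l + 1) : f (t, x) = 0 :=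
  h.1 (t, x) ⟨rfl, hx, l, hl⟩

theorem VanS.mono : ∀ {k : ℕ} {f : ST(d) → ℝ}, VanS Z (k + 1) f → VanS Z k f
  | 0, _, _ => trivial
  | _ + 1, _, h => ⟨h.1, fun l => (h.2 l).mono⟩

theorem VanS.add : ∀ {k : ℕ} {f g : ST(d) → ℝ}, Sm f → Sm g → VanS Z k f → VanS Z k g →
    VanS Z k fun p => f p + g p
  | 0, _, _, _, _, _, _ => trivial
  | k + 1, f, g, hf, hg, h1, h2 => by
    refine ⟨fun x hx => by simp [h1.1 x hx, h2.1 x hx], fun l => ?_⟩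
    rw [show pd l (fun p => f p + g p) = fun p => pd l f p + pd l g p from dv_add hf hg]
    exact VanS.add (hf.pd l) (hg.pd l) (h1.2 l) (h2.2 l)

theorem VanS.mul : ∀ {k : ℕ} {f g : ST(d) → ℝ}, Sm f → Sm g → VanS Z k g →
    VanS Z k fun p => f p * g p
  | 0, _, _, _, _, _ => trivial
  | k + 1, f, g, hf, hg, h => by
    refine ⟨fun x hx => by simp [h.1 x hx], fun l => ?_⟩
    rw [show pd l (fun p => f p * g p) = fun p => pd l f p * g p + f p * pd l g p from dv_mul hf hg]
    exact VanS.add (ContDiff.mul (hf.pd l) hg) (ContDiff.mul hf (hg.pd l))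
      (VanS.mul (hf.pd l) hg h.mono) (VanS.mul hf (hg.pd l) (h.2 l))

theorem VanS.dw {k : ℕ} : ∀ {W : List (Fin d)} {f : ST(d) → ℝ}, Sm f →
    VanS Z (W.length + k) f → VanS Z k (dw W f)
  | [], f, _, h => by simpa [dw_nil] using h
  | l :: W, f, hf, h => by
    rw [dw_cons, show BDE.pd l (BDE.dw W f) = BDE.dw W (BDE.pd l f) from dw_comm hf [l] W]
    refine VanS.dw (hf.pd l) ?_
    rw [List.length_cons, show W.length + 1 + k = (W.length + k) + 1 by omega] at h
    exact h.2 l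

/-- Integration by parts along a word. -/
theorem integral_mul_dw : ∀ {W : List (Fin d)} {f g : ST(d) → ℝ}, Sm f → Sm g →
    Van a t W.length f →
    ∫ x in cube a, f (t, x) * dw W g (t, x) =
      (-1) ^ W.length * ∫ x in cube a, dw W f (t, x) * g (t, x)
  | [], f, g, _, _, _ => by simp [BDE.dw]
  | l :: W, f, g, hf, hg, h => by
    have h1 := integral_pd_mul (l := l) (a := a) (t := t) hf (hg.dw W)
      (fun x hx hl => by rw [VanS.zero_on h hx hl, zero_mul])
    have h2 := integral_mul_dw (W := W) (hf.pd l) hg (h.2 l)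
    rw [show BDE.dw W (BDE.pd l f) = BDE.dw (l :: W) f from dw_comm hf W [l]] at h2
    rw [dw_cons]
    rw [List.length_cons, pow_succ, mul_neg_one, neg_mul, ← h2, h1, neg_neg]

end cube

/-- Cosine Fourier coefficient over the unit cube. -/
noncomputable def fc {d : ℕ} (a : Fin d → ℝ) (k : Fin d → ℤ) (f : (Fin d → ℝ) → ℝ) : ℝ :=
  ∫ x in cube a, f x * cos (2 * Real.pi * ∑ i, k i * x i)

/-- Sine Fourier coefficient over the unit cube. -/
noncomputable def fs {d : ℕ} (a : Fin d → ℝ) (k : Fin d → ℤ) (f : (Fin d → ℝ) → ℝ) : ℝ :=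
  ∫ x in cube a, f x * sin (2 * Real.pi * ∑ i, k i * x i)

section parseval

attribute [local instance] instMeasureSpaceUnitAddCircle

variable {d : ℕ}

theorem ioc_ae_eq_cube (a : Fin d → ℝ) :
    ({x | ∀ i, x i ∈ Ioc (a i) (a i + 1)} : Set (Fin d → ℝ)) =ᵐ[volume] cube a := by
  have h := Measure.univ_pi_Ioc_ae_eq_Icc (μ := fun _ : Fin d => (volume : Measure ℝ)) (f := a)
    (g := fun i => a i + 1)
  have e : ({x | ∀ i, x i ∈ Ioc (a i) (a i + 1)} : Set (Fin d → ℝ)) =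
      Set.pi univ fun i => Ioc (a i) (a i + 1) := by
    ext x; simp
  rw [e]
  exact h

theorem mFourier_coe (k : Fin d → ℤ) (x : Fin d → ℝ) :
    UnitAddTorus.mFourier (-k) (fun i => (x i : UnitAddCircle)) =
      (cos (2 * Real.pi * ∑ i, k i * x i) : ℂ) -
        (sin (2 * Real.pi * ∑ i, k i * x i) : ℂ) * Complex.I := by
  have h1 : UnitAddTorus.mFourier (-k) (fun i => (x i : UnitAddCircle)) =
      Complex.exp (((-(2 * Real.pi * ∑ i, k i * x i) : ℝ) : ℂ) * Complex.I) := by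
    simp only [UnitAddTorus.mFourier, ContinuousMap.coe_mk, fourier_coe_apply, Pi.neg_apply]
    rw [← Complex.exp_sum]
    congr 1
    push_cast
    rw [mul_sum, ← Finset.sum_neg_distrib, sum_mul]
    refine sum_congr rfl fun i _ => ?_
    ring
  rw [h1, Complex.exp_mul_I]
  push_cast
  rw [Complex.cos_neg, Complex.sin_neg]
  ring

/-- Transplantation of a function on the cube to the torus. -/
noncomputable def tor (a : Fin d → ℝ) (f : (Fin d → ℝ) → ℝ) (z : UnitAddTorus (Fin d)) : ℂ :=
  (f (UnitAddTorus.measurableEquivPiIoc a z).1 : ℂ)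

theorem tor_coe (a : Fin d → ℝ) (f : (Fin d → ℝ) → ℝ) {x : Fin d → ℝ}
    (hx : ∀ i, x i ∈ Ioc (a i) (a i + 1)) : tor a f (fun i => (x i : UnitAddCircle)) = (f x : ℂ) := by
  have h := (UnitAddTorus.measurableEquivPiIoc a).apply_symm_apply ⟨x, hx⟩
  rw [UnitAddTorus.coe_symm_measurableEquivPiIoc_apply] at h
  rw [tor, h]

theorem memLp_tor (a : Fin d → ℝ) {f : (Fin d → ℝ) → ℝ} (hf : Continuous f) :
    MemLp (tor a f) 2 (volume : Measure (UnitAddTorus (Fin d))) := by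
  obtain ⟨C, hC⟩ := (isCompact_cube a).exists_bound_of_continuousOn hf.continuousOn
  have hm : Measurable (tor a f) :=
    Complex.measurable_ofReal.comp (hf.measurable.comp (measurable_subtype_coe.comp
      (UnitAddTorus.measurableEquivPiIoc a).measurable))
  have hp : IsProbabilityMeasure (volume : Measure UnitAddCircle) :=
    inferInstanceAs (IsProbabilityMeasure AddCircle.haarAddCircle)
  refine MemLp.of_bound hm.aestronglyMeasurable C (Filter.Eventually.of_forall fun z => ?_)
  rw [tor, Complex.norm_real]
  have := (UnitAddTorus.measurableEquivPiIoc a z).2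
  exact hC _ ⟨fun i => (this i).1.le, fun i => (this i).2⟩

theorem mFourierCoeff_tor (a : Fin d → ℝ) {f : (Fin d → ℝ) → ℝ} (hf : Continuous f)
    (k : Fin d → ℤ) :
    UnitAddTorus.mFourierCoeff ((memLp_tor a hf).toLp _) k = (fc a k f : ℂ) - (fs a k f : ℂ) * Complex.I := by
  have h1 : UnitAddTorus.mFourierCoeff ((memLp_tor a hf).toLp _) k =
      UnitAddTorus.mFourierCoeff (tor a f) k := by
    refine integral_congr_ae ?_
    filter_upwards [(memLp_tor a hf).coeFn_toLp] with z hz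
    rw [hz]
  have hms : MeasurableSet {x : Fin d → ℝ | ∀ i, x i ∈ Ioc (a i) (a i + 1)} :=
    MeasurableSet.univ_pi' fun i => measurableSet_Ioc
  rw [h1, UnitAddTorus.mFourierCoeff_eq_integral _ k a]
  have h2 : ∫ (x : Fin d → ℝ) in {x : Fin d → ℝ | ∀ i, x i ∈ Ioc (a i) (a i + 1)},
      UnitAddTorus.mFourier (-k) (fun i => (x i : UnitAddCircle)) • tor a f (fun i => (x i : UnitAddCircle)) =
      ∫ x in {x : Fin d → ℝ | ∀ i, x i ∈ Ioc (a i) (a i + 1)},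
        (((f x * cos (2 * Real.pi * ∑ i, k i * x i) : ℝ) : ℂ) -
          ((f x * sin (2 * Real.pi * ∑ i, k i * x i) : ℝ) : ℂ) * Complex.I) := by
    refine setIntegral_congr_fun hms fun x hx => ?_
    simp only [mFourier_coe, tor_coe a f hx, smul_eq_mul]
    push_cast
    ring
  rw [h2, setIntegral_congr_set (ioc_ae_eq_cube a), integral_sub, integral_mul_const,
    integral_complex_ofReal, integral_complex_ofReal, fc, fs]
  · exact Integrable.ofReal (integrableOn_cube
      (f := fun x => f x * cos (2 * Real.pi * ∑ i, k i * x i)) (by fun_prop))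
  · exact (Integrable.ofReal (integrableOn_cube
      (f := fun x => f x * sin (2 * Real.pi * ∑ i, k i * x i)) (by fun_prop))).mul_const _

theorem integral_tor (a : Fin d → ℝ) {f g : (Fin d → ℝ) → ℝ} (hf : Continuous f)
    (hg : Continuous g) :
    ∫ z, (starRingEnd ℂ) ((memLp_tor a hf).toLp _ z) * (memLp_tor a hg).toLp _ z =
      ((∫ x in cube a, f x * g x : ℝ) : ℂ) := by
  have h1 : ∫ z, (starRingEnd ℂ) ((memLp_tor a hf).toLp _ z) * (memLp_tor a hg).toLp _ z =
      ∫ z, (starRingEnd ℂ) (tor a f z) * tor a g z := by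
    refine integral_congr_ae ?_
    filter_upwards [(memLp_tor a hf).coeFn_toLp, (memLp_tor a hg).coeFn_toLp] with z hz hz'
    rw [hz, hz']
  have hms : MeasurableSet {x : Fin d → ℝ | ∀ i, x i ∈ Ioc (a i) (a i + 1)} :=
    MeasurableSet.univ_pi' fun i => measurableSet_Ioc
  rw [h1, UnitAddTorus.integral_preimage _ a, ← setIntegral_congr_set (ioc_ae_eq_cube a),
    ← integral_complex_ofReal]
  refine setIntegral_congr_fun hms fun x hx => ?_
  simp only [tor_coe a f hx, tor_coe a g hx, Complex.conj_ofReal]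
  push_cast
  ring

/-- Parseval identity on the unit cube. -/
theorem hasSum_parseval (a : Fin d → ℝ) {f g : (Fin d → ℝ) → ℝ} (hf : Continuous f)
    (hg : Continuous g) :
    HasSum (fun k : Fin d → ℤ => fc a k f * fc a k g + fs a k f * fs a k g)
      (∫ x in cube a, f x * g x) := by
  have h := UnitAddTorus.hasSum_prod_mFourierCoeff ((memLp_tor a hf).toLp _)
    ((memLp_tor a hg).toLp _)
  rw [integral_tor a hf hg] at h
  have h2 := Complex.hasSum_re h
  rw [Complex.ofReal_re] at h2
  refine h2.congr_fun fun k => ?_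
  rw [mFourierCoeff_tor a hf, mFourierCoeff_tor a hg]
  simp

end parseval

/-- The word of a multi-index. -/
def word {d : ℕ} (α : Fin d → ℕ) : List (Fin d) :=
  (List.finRange d).flatMap fun i => List.replicate (α i) i

section garding

variable {d n m : ℕ} {a : Fin d → ℝ} {t : ℝ}

theorem prod_word {M : Type*} [CommMonoid M] (α : Fin d → ℕ) (η : Fin d → M) :
    ((word α).map η).prod = ∏ i, η i ^ α i := by
  rw [word, List.map_flatMap, List.flatMap, List.prod_flatten, List.map_map]
  have : (List.prod ∘ fun i => List.map η (List.replicate (α i) i)) = fun i => η i ^ α i := by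
    funext i
    simp
  rw [this, ← List.ofFn_eq_map, List.prod_ofFn]

theorem length_word (α : Fin d → ℕ) : (word α).length = ∑ i, α i := by
  have h := prod_word α fun _ => Multiplicative.ofAdd 1
  have : Multiplicative.toAdd (((word α).map fun _ => Multiplicative.ofAdd 1).prod) = (word α).length := by
    simp
  rw [← this, h]
  simp [toAdd_prod]

theorem length_word_of_mem {α : Fin d → ℕ} (h : α ∈ MIdx d m) : (word α).length = m := by
  rw [length_word]
  exact (Finset.mem_filter.1 h).2

theorem sm_phase (k : Fin d → ℤ) :
    Sm fun p : ST(d) => 2 * Real.pi * ∑ i, k i * p.2 i := by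
  refine contDiff_const.mul (ContDiff.sum fun i _ => contDiff_const.mul ?_)
  exact (contDiff_apply ℝ ℝ i).comp contDiff_snd

theorem fderiv_phase (k : Fin d → ℤ) (l : Fin d) (p : ST(d)) :
    fderiv ℝ (fun p : ST(d) => 2 * Real.pi * ∑ i, k i * p.2 i) p (0, Pi.single l 1) =
      2 * Real.pi * k l := by
  let L : ST(d) →L[ℝ] ℝ := (2 * Real.pi) • ∑ i, (k i : ℝ) •
    ((ContinuousLinearMap.proj (R := ℝ) (φ := fun _ : Fin d => ℝ) i).comp
      (ContinuousLinearMap.snd ℝ ℝ (Fin d → ℝ)))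
  have : (fun p : ST(d) => 2 * Real.pi * ∑ i, k i * p.2 i) = L := by
    funext p
    simp [L]
  rw [this, L.fderiv]
  simp [L, Pi.single_apply]

theorem pd_cos (k : Fin d → ℤ) (l : Fin d) :
    pd l (fun p => cos (2 * Real.pi * ∑ i, k i * p.2 i)) =
      fun p => -(2 * Real.pi * k l) * sin (2 * Real.pi * ∑ i, (k i : ℝ) * p.2 i) := by
  funext p
  rw [pd, dv, fderiv_cos ((sm_phase k).diff p)]
  simp only [smul_apply, fderiv_phase, smul_eq_mul]
  ring

theorem pd_sin (k : Fin d → ℤ) (l : Fin d) :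
    pd l (fun p => sin (2 * Real.pi * ∑ i, k i * p.2 i)) =
      fun p => (2 * Real.pi * k l) * cos (2 * Real.pi * ∑ i, (k i : ℝ) * p.2 i) := by
  funext p
  rw [pd, dv, fderiv_sin ((sm_phase k).diff p)]
  simp only [smul_apply, fderiv_phase, smul_eq_mul]
  ring

theorem fc_pd {f : ST(d) → ℝ} (hf : Sm f) (h : Van a t 1 f) (k : Fin d → ℤ) (l : Fin d) :
    fc a k (fun x => pd l f (t, x)) = (2 * Real.pi * k l) * fs a k fun x => f (t, x) := by
  have h1 := integral_pd_mul (a := a) (t := t) (l := l) hf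
    (g := fun p => cos (2 * Real.pi * ∑ i, k i * p.2 i)) (Real.contDiff_cos.comp (sm_phase k))
    fun x hx hl => by rw [VanS.zero_on h hx hl, zero_mul]
  rw [fc, h1, pd_cos, fs, ← integral_const_mul, ← integral_neg]
  congr 1
  funext x
  ring

theorem fs_pd {f : ST(d) → ℝ} (hf : Sm f) (h : Van a t 1 f) (k : Fin d → ℤ) (l : Fin d) :
    fs a k (fun x => pd l f (t, x)) = -(2 * Real.pi * k l) * fc a k fun x => f (t, x) := by
  have h1 := integral_pd_mul (a := a) (t := t) (l := l) hf
    (g := fun p => sin (2 * Real.pi * ∑ i, k i * p.2 i)) (Real.contDiff_sin.comp (sm_phase k))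
    fun x hx hl => by rw [VanS.zero_on h hx hl, zero_mul]
  rw [fs, h1, pd_sin, fc, ← integral_const_mul, ← integral_neg]
  congr 1
  funext x
  ring

/-- Real part of the product of Fourier coefficients. -/
noncomputable def fpair (a : Fin d → ℝ) (k : Fin d → ℤ) (f g : (Fin d → ℝ) → ℝ) : ℝ :=
  fc a k f * fc a k g + fs a k f * fs a k g

theorem fpair_dw (k : Fin d → ℤ) : ∀ {V W : List (Fin d)} {f g : ST(d) → ℝ}, Sm f → Sm g →
    V.length = W.length → Van a t V.length f → Van a t V.length g →
    fpair a k (fun x => dw V f (t, x)) (fun x => dw W g (t, x)) =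
      (V.map fun l => 2 * Real.pi * (k l : ℝ)).prod * (W.map fun l => 2 * Real.pi * (k l : ℝ)).prod *
        fpair a k (fun x => f (t, x)) fun x => g (t, x)
  | [], [], f, g, _, _, _, _, _ => by simp [dw_nil]
  | [], _ :: _, _, _, _, _, h, _, _ => by simp at h
  | _ :: _, [], _, _, _, _, h, _, _ => by simp at h
  | l :: V, l' :: W, f, g, hf, hg, h, h1, h2 => by
    have hVW : V.length = W.length := by simpa using h
    have hv : Van a t 1 (dw V f) := VanS.dw hf (by simpa using h1)
    have hw : Van a t 1 (dw W g) := VanS.dw hg (by rw [← hVW]; simpa using h2)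
    have ih := fpair_dw k (V := V) (W := W) hf hg hVW h1.mono h2.mono
    simp only [fpair] at ih ⊢
    simp only [dw_cons]
    rw [fc_pd (hf.dw V) hv, fs_pd (hf.dw V) hv, fc_pd (hg.dw W) hw, fs_pd (hg.dw W) hw,
      List.map_cons, List.map_cons, List.prod_cons, List.prod_cons]
    linear_combination (2 * Real.pi * (k l : ℝ)) * (2 * Real.pi * (k l' : ℝ)) * ih

theorem prod_map_sq_le (η : Fin d → ℝ) : ∀ W : List (Fin d),
    (W.map η).prod ^ 2 ≤ (∑ i, η i ^ 2) ^ W.length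
  | [] => by simp
  | l :: W => by
    have h0 : 0 ≤ ∑ i, η i ^ 2 := sum_nonneg fun i _ => sq_nonneg _
    have h1 : η l ^ 2 ≤ ∑ i, η i ^ 2 :=
      single_le_sum (f := fun i => η i ^ 2) (fun i _ => sq_nonneg _) (Finset.mem_univ l)
    rw [List.map_cons, List.prod_cons, mul_pow, List.length_cons, pow_succ, mul_comm]
    exact mul_le_mul (prod_map_sq_le η W) h1 (sq_nonneg _) (pow_nonneg h0 _)

/-- Gårding inequality on the cube. -/
theorem garding {lam : ℝ} (hlam : 0 ≤ lam) {A : (Fin d → ℕ) → (Fin d → ℕ) → Fin n → Fin n → ℝ}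
    (hA : LegHad d n m lam A) {v : Fin n → ST(d) → ℝ} (hv : ∀ i, Sm (v i))
    (hV : ∀ i, Van a t m (v i)) {W : List (Fin d)} (hW : W.length = m) :
    lam * ∑ i, ∫ x in cube a, dw W (v i) (t, x) ^ 2 ≤
      ∑ α ∈ MIdx d m, ∑ β ∈ MIdx d m, ∑ i, ∑ j,
        A α β i j * ∫ x in cube a, dw (word α) (v i) (t, x) * dw (word β) (v j) (t, x) := by
  have hc : ∀ W i, Continuous fun x => dw W (v i) (t, x) := fun W i =>
    continuous_slice ((hv i).dw W).continuous' t
  have h1 : HasSum (fun k : Fin d → ℤ => lam * ∑ i, fpair a k (fun x => dw W (v i) (t, x))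
      fun x => dw W (v i) (t, x)) (lam * ∑ i, ∫ x in cube a, dw W (v i) (t, x) ^ 2) := by
    refine HasSum.mul_left _ (hasSum_sum fun i _ => ?_)
    simp_rw [sq]
    exact hasSum_parseval a (hc W i) (hc W i)
  have h2 : HasSum (fun k : Fin d → ℤ => ∑ α ∈ MIdx d m, ∑ β ∈ MIdx d m, ∑ i, ∑ j,
      A α β i j * fpair a k (fun x => dw (word α) (v i) (t, x)) fun x => dw (word β) (v j) (t, x))
      (∑ α ∈ MIdx d m, ∑ β ∈ MIdx d m, ∑ i, ∑ j,
        A α β i j * ∫ x in cube a, dw (word α) (v i) (t, x) * dw (word β) (v j) (t, x)) := by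
    refine hasSum_sum fun α _ => hasSum_sum fun β _ => hasSum_sum fun i _ => hasSum_sum fun j _ => ?_
    exact HasSum.mul_left _ (hasSum_parseval a (hc _ i) (hc _ j))
  refine hasSum_le (fun k => ?_) h1 h2
  set η : Fin d → ℝ := fun l => 2 * Real.pi * (k l : ℝ) with hη
  set X : Fin n → ℝ := fun i => fc a k fun x => v i (t, x)
  set Y : Fin n → ℝ := fun i => fs a k fun x => v i (t, x)
  have e1 : ∀ i, fpair a k (fun x => dw W (v i) (t, x)) (fun x => dw W (v i) (t, x)) =
      (W.map η).prod ^ 2 * (X i ^ 2 + Y i ^ 2) := by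
    intro i
    rw [fpair_dw k (hv i) (hv i) rfl (by rw [hW]; exact hV i) (by rw [hW]; exact hV i), fpair]
    ring
  have e2 : ∀ α ∈ MIdx d m, ∀ β ∈ MIdx d m, ∀ i j, fpair a k (fun x => dw (word α) (v i) (t, x))
      (fun x => dw (word β) (v j) (t, x)) =
      ((∏ l, η l ^ α l) * ∏ l, η l ^ β l) * (X i * X j + Y i * Y j) := by
    intro α hα β hβ i j
    have ha := length_word_of_mem hα
    have hb := length_word_of_mem hβ
    rw [fpair_dw k (hv i) (hv j) (by rw [ha, hb]) (by rw [ha]; exact hV i) (by rw [ha]; exact hV j),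
      fpair, prod_word, prod_word]
  have hX := hA X η
  have hY := hA Y η
  have hle : (W.map η).prod ^ 2 ≤ (∑ l, η l ^ 2) ^ m := hW ▸ prod_map_sq_le η W
  calc lam * ∑ i, fpair a k (fun x => dw W (v i) (t, x)) (fun x => dw W (v i) (t, x))
      = lam * ((W.map η).prod ^ 2 * ∑ i, (X i ^ 2 + Y i ^ 2)) := by
        simp_rw [e1, mul_sum]
    _ ≤ lam * ((∑ l, η l ^ 2) ^ m * ∑ i, (X i ^ 2 + Y i ^ 2)) := by
        have : 0 ≤ ∑ i, (X i ^ 2 + Y i ^ 2) := sum_nonneg fun i _ => by positivity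
        gcongr
    _ = lam * (∑ i, X i ^ 2) * (∑ l, η l ^ 2) ^ m + lam * (∑ i, Y i ^ 2) * (∑ l, η l ^ 2) ^ m := by
        rw [sum_add_distrib]; ring
    _ ≤ _ := add_le_add hX hY
    _ = _ := by
        simp_rw [← sum_add_distrib]
        refine sum_congr rfl fun α hα => sum_congr rfl fun β hβ =>
          sum_congr rfl fun i _ => sum_congr rfl fun j _ => ?_
        rw [e2 α hα β hβ]
        ring

end garding

/-- A smooth cutoff, one on `[-ρ, ρ]` and zero outside `(-ρ', ρ')`. -/
noncomputable def chi (ρ ρ' s : ℝ) : ℝ := Real.smoothTransition ((ρ' ^ 2 - s ^ 2) / (ρ' ^ 2 - ρ ^ 2))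

/-- The product cutoff in the space variables. -/
noncomputable def cut {d : ℕ} (ρ ρ' : ℝ) (p : ST(d)) : ℝ := ∏ i, chi ρ ρ' (p.2 i)

section cutoff

variable {d : ℕ} {ρ ρ' : ℝ}

theorem chi_smooth (ρ ρ' : ℝ) : Sm (chi ρ ρ') := by
  unfold chi
  exact Real.smoothTransition.contDiff.comp
    ((contDiff_const.sub (contDiff_id.pow 2)).div_const _)

theorem chi_nonneg (s : ℝ) : 0 ≤ chi ρ ρ' s := Real.smoothTransition.nonneg _

theorem chi_le_one (s : ℝ) : chi ρ ρ' s ≤ 1 := Real.smoothTransition.le_one _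

theorem chi_eq_one (h0 : 0 < ρ) (h : ρ < ρ') {s : ℝ} (hs : |s| ≤ ρ) : chi ρ ρ' s = 1 := by
  refine Real.smoothTransition.one_of_one_le ?_
  have h1 : s ^ 2 ≤ ρ ^ 2 := sq_le_sq' (by linarith [neg_le_of_abs_le hs]) (le_of_abs_le hs)
  rw [one_le_div (by nlinarith)]
  linarith

theorem chi_eq_zero (h0 : 0 < ρ) (h : ρ < ρ') {s : ℝ} (hs : ρ' ≤ |s|) : chi ρ ρ' s = 0 := by
  refine Real.smoothTransition.zero_of_nonpos ?_
  have h1 : ρ' ^ 2 ≤ s ^ 2 := by rw [← sq_abs s]; gcongr; linarith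
  exact div_nonpos_of_nonpos_of_nonneg (by linarith) (by nlinarith)

theorem cut_smooth (ρ ρ' : ℝ) : Sm (cut (d := d) ρ ρ') := by
  unfold cut
  refine contDiff_prod fun i _ => ?_
  exact (chi_smooth ρ ρ').comp ((contDiff_apply ℝ ℝ i).comp contDiff_snd)

theorem cut_nonneg (p : ST(d)) : 0 ≤ cut ρ ρ' p :=
  Finset.prod_nonneg fun _ _ => chi_nonneg _

theorem cut_le_one (p : ST(d)) : cut ρ ρ' p ≤ 1 :=
  Finset.prod_le_one (fun _ _ => chi_nonneg _) fun _ _ => chi_le_one _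

theorem cut_eq_one (h0 : 0 < ρ) (h : ρ < ρ') {p : ST(d)} (hp : ∀ i, |p.2 i| ≤ ρ) :
    cut ρ ρ' p = 1 :=
  Finset.prod_eq_one fun i _ => chi_eq_one h0 h (hp i)

theorem cut_eq_zero (h0 : 0 < ρ) (h : ρ < ρ') {p : ST(d)} {i : Fin d}
    (hp : ρ' ≤ |p.2 i|) : cut ρ ρ' p = 0 :=
  Finset.prod_eq_zero (Finset.mem_univ i) (chi_eq_zero h0 h hp)

theorem td_cut_pow (ρ ρ' : ℝ) (q : ℕ) : td (fun p : ST(d) => cut ρ ρ' p ^ q) = fun _ => 0 := by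
  funext p
  have h := (hasDerivAt_td (f := fun p : ST(d) => cut ρ ρ' p ^ q)
    ((cut_smooth ρ ρ').pow q) p.2 p.1).deriv
  rw [show p = (p.1, p.2) from rfl, ← h]
  simp [cut]

end cutoff

/-- Lower-order operators arising from commutators with powers of a cutoff. -/
inductive Lot {d : ℕ} (ψ : ST(d) → ℝ) (q k : ℕ) :
    ((ST(d) → ℝ) → ST(d) → ℝ) → Prop
  | zero : Lot ψ q k fun _ _ => 0
  | term (c : ST(d) → ℝ) (V : List (Fin d)) (e : ℕ) (hc : Sm c) (hV : V.length < k)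
      (he : q + V.length ≤ e + k) : Lot ψ q k fun f p => c p * ψ p ^ e * dw V f p
  | add {S T : (ST(d) → ℝ) → ST(d) → ℝ} :
      Lot ψ q k S → Lot ψ q k T → Lot ψ q k fun f p => S f p + T f p

section lot

variable {d : ℕ} {ψ : ST(d) → ℝ} {q k : ℕ}
  {T : (ST(d) → ℝ) → ST(d) → ℝ}

theorem Lot.smooth (hψ : Sm ψ) (h : Lot ψ q k T) {f : ST(d) → ℝ} (hf : Sm f) : Sm (T f) := by
  induction h with
  | zero => exact contDiff_const
  | term c V e hc hV he => exact (ContDiff.mul hc (ContDiff.pow hψ e)).mul (hf.dw V)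
  | add _ _ h1 h2 => exact ContDiff.add h1 h2

theorem dv_pow {d : ℕ} {v : ST(d)} {ψ : ST(d) → ℝ} (hψ : Sm ψ) (e : ℕ) :
    dv v (fun p => ψ p ^ e) = fun p => e * ψ p ^ (e - 1) * dv v ψ p := by
  funext p
  rw [dv, fderiv_fun_pow e (hψ.diff p)]
  simp [dv]

theorem Lot.pd (hψ : Sm ψ) (h : Lot ψ q k T) (l : Fin d) :
    ∃ T', Lot ψ q (k + 1) T' ∧ ∀ f, Sm f → pd l (T f) = T' f := by
  induction h with
  | zero => exact ⟨_, Lot.zero, fun f _ => dv_const 0⟩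
  | term c V e hc hV he =>
    refine ⟨_, ((Lot.term (BDE.pd l c) V e (hc.pd l) (by omega) (by omega)).add
      (Lot.term (fun p => c p * (e * BDE.pd l ψ p)) V (e - 1)
        (ContDiff.mul hc (contDiff_const.mul (hψ.pd l))) (by omega) (by omega))).add
      (Lot.term c (l :: V) e hc (by simpa using hV) (by simp; omega)), fun f hf => ?_⟩
    have h1 : Sm fun p => ψ p ^ e := ContDiff.pow hψ e
    rw [show BDE.pd l (fun p => c p * ψ p ^ e * dw V f p) = _ from
      dv_mul (ContDiff.mul hc h1) (hf.dw V), dv_mul hc h1, dv_pow hψ e]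
    funext p
    simp only [dw_cons, BDE.pd]
    ring
  | add hS hT h1 h2 =>
    obtain ⟨S', hS', eS⟩ := h1
    obtain ⟨T', hT', eT⟩ := h2
    refine ⟨_, hS'.add hT', fun f hf => ?_⟩
    rw [← eS f hf, ← eT f hf]
    exact dv_add (hS.smooth hψ hf) (hT.smooth hψ hf)

/-- Commutator of a word with a power of the cutoff. -/
theorem exists_lot (hψ : Sm ψ) (q : ℕ) : ∀ W : List (Fin d), ∃ T, Lot ψ q W.length T ∧
    ∀ f, Sm f → dw W (fun p => ψ p ^ q * f p) = fun p => ψ p ^ q * dw W f p + T f p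
  | [] => ⟨_, Lot.zero, fun f _ => by simp [dw_nil]⟩
  | l :: W => by
    obtain ⟨T, hT, eT⟩ := exists_lot hψ q W
    obtain ⟨T', hT', eT'⟩ := hT.pd hψ l
    refine ⟨_, hT'.add (Lot.term (fun p => q * pd l ψ p) W (q - 1)
      (contDiff_const.mul (hψ.pd l)) (by simp) (by omega)), fun f hf => ?_⟩
    have h1 : Sm fun p => ψ p ^ q := ContDiff.pow hψ q
    rw [dw_cons, eT f hf, show pd l (fun p => ψ p ^ q * dw W f p + T f p) = _ from
      dv_add (ContDiff.mul h1 (hf.dw W)) (hT.smooth hψ hf), dv_mul h1 (hf.dw W), dv_pow hψ q,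
      ← eT' f hf]
    funext p
    simp only [dw_cons, pd]
    ring

/-- Weighted sum of the absolute values of the derivatives of order less than `k`. -/
noncomputable def lsum {d : ℕ} (ψ : ST(d) → ℝ) (k : ℕ) (f : ST(d) → ℝ)
    (p : ST(d)) : ℝ :=
  ∑ j ∈ Finset.range k, ψ p ^ j * ∑ w : Fin j → Fin d, |dw (List.ofFn w) f p|

theorem lsum_nonneg (h0 : ∀ p, 0 ≤ ψ p) (k : ℕ) (f : ST(d) → ℝ) (p : ST(d)) :
    0 ≤ lsum ψ k f p :=
  sum_nonneg fun j _ => mul_nonneg (pow_nonneg (h0 p) j)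
    (sum_nonneg fun _ _ => abs_nonneg _)

theorem le_lsum (h0 : ∀ p, 0 ≤ ψ p) {V : List (Fin d)} (hV : V.length < k)
    (f : ST(d) → ℝ) (p : ST(d)) :
    ψ p ^ V.length * |dw V f p| ≤ lsum ψ k f p := by
  have h1 : |dw V f p| ≤ ∑ w : Fin V.length → Fin d, |dw (List.ofFn w) f p| := by
    have := single_le_sum (f := fun w : Fin V.length → Fin d => |dw (List.ofFn w) f p|)
      (fun _ _ => abs_nonneg _) (Finset.mem_univ V.get)
    simpa using this
  refine (mul_le_mul_of_nonneg_left h1 (pow_nonneg (h0 p) _)).trans ?_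
  exact single_le_sum (f := fun j => ψ p ^ j * ∑ w : Fin j → Fin d, |dw (List.ofFn w) f p|)
    (fun j _ => mul_nonneg (pow_nonneg (h0 p) j) (sum_nonneg fun _ _ => abs_nonneg _))
    (Finset.mem_range.2 hV)

theorem Lot.bound (h0 : ∀ p, 0 ≤ ψ p) (h1 : ∀ p, ψ p ≤ 1) (h : Lot ψ q k T) (hkq : k ≤ q)
    {S : Set ST(d)} (hS : IsCompact S) :
    ∃ C, 0 ≤ C ∧ ∀ f, ∀ p ∈ S, |T f p| ≤ C * (ψ p ^ (q - k) * lsum ψ k f p) := by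
  induction h with
  | zero => exact ⟨0, le_rfl, fun f p _ => by simp⟩
  | term c V e hc hV he =>
    obtain ⟨C, hC⟩ := hS.exists_bound_of_continuousOn hc.continuous'.continuousOn
    refine ⟨max C 0, le_max_right _ _, fun f p hp => ?_⟩
    rw [abs_mul, abs_mul, abs_of_nonneg (pow_nonneg (h0 p) e), mul_assoc]
    refine mul_le_mul ((hC p hp).trans (le_max_left _ _)) ?_
      (mul_nonneg (pow_nonneg (h0 p) _) (abs_nonneg _)) (le_max_right _ _)
    calc ψ p ^ e * |dw V f p| ≤ ψ p ^ (q - k + V.length) * |dw V f p| := by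
          refine mul_le_mul_of_nonneg_right ?_ (abs_nonneg _)
          exact pow_le_pow_of_le_one (h0 p) (h1 p) (by omega)
      _ = ψ p ^ (q - k) * (ψ p ^ V.length * |dw V f p|) := by rw [pow_add]; ring
      _ ≤ _ := mul_le_mul_of_nonneg_left (le_lsum h0 hV f p) (pow_nonneg (h0 p) _)
  | add _ _ i1 i2 =>
    obtain ⟨C, hC0, hC⟩ := i1
    obtain ⟨D, hD0, hD⟩ := i2
    refine ⟨C + D, by positivity, fun f p hp => ?_⟩
    rw [add_mul]
    exact (abs_add_le _ _).trans (add_le_add (hC f p hp) (hD f p hp))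

/-- Bound of the commutator of a word with a power of the cutoff. -/
theorem exists_commutator_bound (hψ : Sm ψ) (h0 : ∀ p, 0 ≤ ψ p) (h1 : ∀ p, ψ p ≤ 1)
    {S : Set ST(d)} (hS : IsCompact S) (q k : ℕ) (hkq : k ≤ q) :
    ∃ C, 0 ≤ C ∧ ∀ W : List (Fin d), W.length = k → ∀ f, Sm f → ∀ p ∈ S,
      |dw W (fun p => ψ p ^ q * f p) p - ψ p ^ q * dw W f p| ≤
        C * (ψ p ^ (q - k) * lsum ψ k f p) := by
  have key : ∀ w : Fin k → Fin d, ∃ C, 0 ≤ C ∧ ∀ f, Sm f → ∀ p ∈ S,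
      |dw (List.ofFn w) (fun p => ψ p ^ q * f p) p - ψ p ^ q * dw (List.ofFn w) f p| ≤
        C * (ψ p ^ (q - k) * lsum ψ k f p) := by
    intro w
    obtain ⟨T, hT, eT⟩ := exists_lot hψ q (List.ofFn w)
    rw [List.length_ofFn] at hT
    obtain ⟨C, hC0, hC⟩ := hT.bound h0 h1 hkq hS
    refine ⟨C, hC0, fun f hf p hp => ?_⟩
    rw [eT f hf]
    simpa using hC f p hp
  choose C hC0 hC using key
  refine ⟨∑ w, C w, sum_nonneg fun w _ => hC0 w, fun W hW f hf p hp => ?_⟩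
  subst hW
  have h := hC W.get f hf p hp
  rw [List.ofFn_get] at h
  refine h.trans ?_
  refine mul_le_mul_of_nonneg_right (single_le_sum (fun w _ => hC0 w) (Finset.mem_univ _)) ?_
  exact mul_nonneg (pow_nonneg (h0 p) _) (lsum_nonneg h0 _ f p)

end lot

/-- Lower corner of the reference cube, whose normal coordinate lies in `[0, 1]`. -/
noncomputable def lo {d : ℕ} (N : Fin d) : Fin d → ℝ := fun i => if i = N then 0 else -(1 / 2)

/-- Smooth solutions near the reference half box. -/
structure Sol {d n : ℕ} (m : ℕ) (N : Fin d) (K lam : ℝ) (u : Fin n → ST(d) → ℝ) : Prop where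
  smooth : ∀ i, Sm (u i)
  eqn : ∀ t ∈ Icc (-1 : ℝ) 0, ∃ A : (Fin d → ℕ) → (Fin d → ℕ) → Fin n → Fin n → ℝ,
    (∀ α β i j, |A α β i j| ≤ K) ∧ LegHad d n m lam A ∧
    ∀ x : Fin d → ℝ, (∀ i, |x i| < 1) → 0 ≤ x N → ∀ i,
      td (u i) (t, x) + (-1) ^ m * ∑ α ∈ MIdx d m, ∑ β ∈ MIdx d m, ∑ j,
        A α β i j * dw (word α ++ word β) (u j) (t, x) = 0
  bdry : ∀ t ∈ Icc (-1 : ℝ) 0, ∀ x : Fin d → ℝ, (∀ i, |x i| < 1) → x N = 0 → ∀ k < m, ∀ i,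
    dw (List.replicate k N) (u i) (t, x) = 0

/-- The flat part of the boundary. -/
def flatBd {d : ℕ} (N : Fin d) : Set ST(d) :=
  {p | p.1 ∈ Icc (-1 : ℝ) 0 ∧ (∀ i, |p.2 i| < 1) ∧ p.2 N = 0}

section sol

variable {d n m : ℕ} {N : Fin d} {K lam : ℝ} {u : Fin n → ST(d) → ℝ}

theorem pd_eq_zero_of_line {f : ST(d) → ℝ} (hf : Sm f) {t : ℝ} {x : Fin d → ℝ} {l : Fin d}
    (h : ∀ᶠ s in 𝓝 (x l), f (t, update x l s) = 0) : pd l f (t, x) = 0 := by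
  have h1 := BDE.hasDerivAt_update hf t x l (x l)
  rw [Function.update_eq_self] at h1
  have h2 : (fun s => f (t, update x l s)) =ᶠ[𝓝 (x l)] fun _ => 0 := h
  have h3 := h2.hasDerivAt_iff.1 h1
  exact h3.unique (hasDerivAt_const _ _)

theorem eventually_abs_update_lt {x : Fin d → ℝ} (hx : ∀ i, |x i| < 1) (l : Fin d) :
    ∀ᶠ s in 𝓝 (x l), ∀ i, |update x l s i| < 1 := by
  have h1 : ∀ᶠ s in 𝓝 (x l), |s| < 1 := (continuous_abs.tendsto (x l)).eventually_lt_const (hx l)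
  filter_upwards [h1] with s hs i
  by_cases hi : i = l
  · subst hi; simpa using hs
  · simpa [hi] using hx i

theorem pd_eq_zero_flat {f : ST(d) → ℝ} (hf : Sm f) {l : Fin d} (hl : l ≠ N)
    (h : ∀ p ∈ flatBd N, f p = 0) : ∀ p ∈ flatBd N, pd l f p = 0 := by
  intro p hp
  refine pd_eq_zero_of_line (t := p.1) (x := p.2) hf ?_
  filter_upwards [eventually_abs_update_lt hp.2.1 l] with s hs
  exact h _ ⟨hp.1, hs, by simpa [hl.symm] using hp.2.2⟩

theorem Sol.pd (hu : Sol m N K lam u) {l : Fin d} (hl : l ≠ N) :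
    Sol m N K lam fun i => pd l (u i) := by
  refine ⟨fun i => (hu.smooth i).pd l, fun t ht => ?_, fun t ht x hx hxN k hk i => ?_⟩
  · obtain ⟨A, hA, hLH, hE⟩ := hu.eqn t ht
    refine ⟨A, hA, hLH, fun x hx hxN i => ?_⟩
    have hs : ∀ α β j, Sm fun p => A α β i j * dw (word α ++ word β) (u j) p := fun α β j =>
      contDiff_const.mul ((hu.smooth j).dw _)
    have hs3 : Sm fun p => ∑ α ∈ MIdx d m, ∑ β ∈ MIdx d m, ∑ j,
        A α β i j * dw (word α ++ word β) (u j) p :=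
      ContDiff.sum fun α _ => ContDiff.sum fun β _ => ContDiff.sum fun j _ => hs α β j
    have hs4 : Sm fun p => (-1 : ℝ) ^ m * ∑ α ∈ MIdx d m, ∑ β ∈ MIdx d m, ∑ j,
        A α β i j * dw (word α ++ word β) (u j) p := contDiff_const.mul hs3
    have h0 := pd_eq_zero_of_line (t := t) (x := x) (l := l) (ContDiff.add ((hu.smooth i).td) hs4) ?_
    · rw [← h0, td_pd (hu.smooth i)]
      rw [show BDE.pd l (fun p => td (u i) p + (-1 : ℝ) ^ m * ∑ α ∈ MIdx d m, ∑ β ∈ MIdx d m, ∑ j,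
        A α β i j * dw (word α ++ word β) (u j) p) = _ from dv_add (hu.smooth i).td hs4,
        dv_const_mul _ hs3, dv_sum _ _ fun α _ => ContDiff.sum fun β _ => ContDiff.sum fun j _ => hs α β j]
      congr 2
      refine sum_congr rfl fun α _ => ?_
      rw [dv_sum _ _ fun β _ => ContDiff.sum fun j _ => hs α β j]
      refine sum_congr rfl fun β _ => ?_
      rw [dv_sum _ _ fun j _ => hs α β j]
      refine sum_congr rfl fun j _ => ?_
      rw [dv_const_mul _ ((hu.smooth j).dw _)]
      congr 1
      exact congrFun (dw_comm (hu.smooth j) (word α ++ word β) [l]) (t, x)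
    · filter_upwards [eventually_abs_update_lt hx l] with s hs
      exact hE _ hs (by simpa [hl.symm] using hxN) i
  · rw [show dw (List.replicate k N) (BDE.pd l (u i)) = BDE.pd l (dw (List.replicate k N) (u i)) from
      dw_comm (hu.smooth i) (List.replicate k N) [l]]
    exact pd_eq_zero_flat ((hu.smooth i).dw _) hl (fun p hp => hu.bdry p.1 hp.1 p.2 hp.2.1 hp.2.2 k hk i)
      (t, x) ⟨ht, hx, hxN⟩

theorem Sol.dw (hu : Sol m N K lam u) {V : List (Fin d)} (hV : ∀ l ∈ V, l ≠ N) :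
    Sol m N K lam fun i => dw V (u i) := by
  induction V with
  | nil => exact hu
  | cons l V ih =>
    exact (ih fun k hk => hV k (List.mem_cons_of_mem _ hk)).pd (hV l List.mem_cons_self)

theorem vanS_flat : ∀ {k : ℕ} {f : ST(d) → ℝ}, Sm f →
    (∀ j < k, ∀ p ∈ flatBd N, dw (List.replicate j N) f p = 0) → VanS (flatBd N) k f
  | 0, _, _, _ => trivial
  | k + 1, f, hf, h => by
    refine ⟨fun p hp => h 0 (Nat.succ_pos k) p hp, fun l => vanS_flat (hf.pd l) fun j hj p hp => ?_⟩
    by_cases hl : l = N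
    · subst hl
      have := h (j + 1) (by omega) p hp
      rwa [List.replicate_succ', dw_append] at this
    · rw [show BDE.dw (List.replicate j N) (BDE.pd l f) = BDE.pd l (BDE.dw (List.replicate j N) f) from
        dw_comm hf (List.replicate j N) [l]]
      exact pd_eq_zero_flat (hf.dw _) hl (h j (by omega)) p hp

theorem Sol.vanS (hu : Sol m N K lam u) (i : Fin n) : VanS (flatBd N) m (u i) :=
  vanS_flat (hu.smooth i) fun j hj p hp => hu.bdry p.1 hp.1 p.2 hp.2.1 hp.2.2 j hj i

theorem vanS_of_isOpen {Z : Set ST(d)} (hZ : IsOpen Z) :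
    ∀ {k : ℕ} {f : ST(d) → ℝ}, (∀ p ∈ Z, f p = 0) → VanS Z k f
  | 0, _, _ => trivial
  | k + 1, f, h => by
    refine ⟨h, fun l => vanS_of_isOpen hZ fun p hp => ?_⟩
    have : f =ᶠ[𝓝 p] fun _ => 0 := by
      filter_upwards [hZ.mem_nhds hp] with q hq using h q hq
    rw [BDE.pd, dv, this.fderiv_eq]
    simp

theorem VanS.union_subset {Z Z' Z'' : Set ST(d)} (hZ : Z'' ⊆ Z ∪ Z') :
    ∀ {k : ℕ} {f : ST(d) → ℝ}, VanS Z k f → VanS Z' k f → VanS Z'' k f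
  | 0, _, _, _ => trivial
  | _ + 1, _, h, h' => ⟨fun p hp => (hZ hp).elim (h.1 p) (h'.1 p),
      fun l => VanS.union_subset hZ (h.2 l) (h'.2 l)⟩

theorem isOpen_far (ρ' : ℝ) : IsOpen {p : ST(d) | ∃ i, ρ' < |p.2 i|} := by
  have : {p : ST(d) | ∃ i, ρ' < |p.2 i|} = ⋃ i, {p | ρ' < |p.2 i|} := by
    ext p; simp
  rw [this]
  exact isOpen_iUnion fun i => isOpen_lt continuous_const (by fun_prop)

theorem mem_cube_lo {x : Fin d → ℝ} (hx : x ∈ cube (lo N)) : 0 ≤ x N ∧ ∀ i, i ≠ N → |x i| ≤ 1 / 2 := by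
  refine ⟨by simpa [lo] using hx.1 N, fun i hi => ?_⟩
  have h1 := hx.1 i
  have h2 := hx.2 i
  simp only [lo, if_neg hi] at h1 h2
  rw [abs_le]
  constructor <;> linarith

/-- A solution multiplied by a power of a cutoff vanishes to order `m` on the boundary of the cube. -/
theorem Sol.van_cut (hu : Sol m N K lam u) {ρ ρ' : ℝ} (h0 : 0 < ρ) (h1 : ρ < ρ') (h2 : ρ' < 1 / 2)
    {q : ℕ} (hq : 1 ≤ q) {t : ℝ} (ht : t ∈ Icc (-1 : ℝ) 0) (i : Fin n) :
    Van (lo N) t m fun p => cut ρ ρ' p ^ q * u i p := by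
  have hc : Sm fun p : ST(d) => cut ρ ρ' p ^ q := ContDiff.pow (cut_smooth ρ ρ') q
  refine VanS.union_subset (Z := flatBd N) (Z' := {p | ∃ i, ρ' < |p.2 i|}) ?_
    (VanS.mul hc (hu.smooth i) (hu.vanS i)) (vanS_of_isOpen (isOpen_far ρ') ?_)
  · rintro p ⟨rfl, hp, l, hl⟩
    by_cases hfar : ∃ i, ρ' < |p.2 i|
    · exact Or.inr hfar
    · push Not at hfar
      refine Or.inl ⟨ht, fun i => by linarith [hfar i], ?_⟩
      have hl' := abs_le.1 (hfar l)
      by_cases hN : l = N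
      · subst hN
        rcases hl with hl | hl
        · simpa [lo] using hl
        · simp only [lo, if_true] at hl; linarith
      · simp only [lo, if_neg hN] at hl
        rcases hl with hl | hl <;> linarith
  · rintro p ⟨i, hi⟩
    rw [cut_eq_zero h0 h1 hi.le, zero_pow (by omega), zero_mul]

end sol

/-- Weighted square density of the derivatives of order `k`. -/
noncomputable def sden {d n : ℕ} (ψ : ST(d) → ℝ) (k : ℕ)
    (u : Fin n → ST(d) → ℝ) (p : ST(d)) : ℝ :=
  ∑ i, ∑ w : Fin k → Fin d, (ψ p ^ (k + 1) * dw (List.ofFn w) (u i) p) ^ 2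

/-- Integral of the weighted square density. -/
noncomputable def wen {d n : ℕ} (N : Fin d) (ψ : ST(d) → ℝ) (k : ℕ)
    (u : Fin n → ST(d) → ℝ) (t : ℝ) : ℝ :=
  ∫ x in cube (lo N), sden ψ k u (t, x)

theorem cube_integral_mono {d : ℕ} {a : Fin d → ℝ} {f g : (Fin d → ℝ) → ℝ} (hf : Continuous f)
    (hg : Continuous g) (h : ∀ x ∈ cube a, f x ≤ g x) : ∫ x in cube a, f x ≤ ∫ x in cube a, g x :=
  setIntegral_mono_on (integrableOn_cube hf) (integrableOn_cube hg) (measurableSet_cube a) h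

section energy

variable {d n m : ℕ} {N : Fin d} {K lam : ℝ} {ψ : ST(d) → ℝ}
  {u : Fin n → ST(d) → ℝ}

theorem sden_nonneg (k : ℕ) (p : ST(d)) : 0 ≤ sden ψ k u p :=
  sum_nonneg fun _ _ => sum_nonneg fun _ _ => sq_nonneg _

theorem sden_smooth (hψ : Sm ψ) (hu : ∀ i, Sm (u i)) (k : ℕ) : Sm (sden ψ k u) := by
  unfold sden
  exact ContDiff.sum fun i _ => ContDiff.sum fun w _ =>
    ((ContDiff.pow hψ _).mul ((hu i).dw _)).pow 2

theorem wen_nonneg (k : ℕ) (t : ℝ) : 0 ≤ wen N ψ k u t :=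
  setIntegral_nonneg (measurableSet_cube _) fun _ _ => sden_nonneg _ _

theorem sq_le_sden {W : List (Fin d)} {k : ℕ} (hW : W.length = k) (i : Fin n) (p : ST(d)) :
    (ψ p ^ (k + 1) * dw W (u i) p) ^ 2 ≤ sden ψ k u p := by
  subst hW
  have h1 := single_le_sum (f := fun w : Fin W.length → Fin d =>
    (ψ p ^ (W.length + 1) * dw (List.ofFn w) (u i) p) ^ 2) (fun _ _ => sq_nonneg _)
    (Finset.mem_univ W.get)
  have h2 := single_le_sum (f := fun i => ∑ w : Fin W.length → Fin d,
    (ψ p ^ (W.length + 1) * dw (List.ofFn w) (u i) p) ^ 2)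
    (fun _ _ => sum_nonneg fun _ _ => sq_nonneg _) (Finset.mem_univ i)
  simp only [List.ofFn_get] at h1
  exact h1.trans h2

/-- Pointwise control of the lower-order sum by the square densities. -/
theorem mul_lsum_le (d n m : ℕ) : ∃ C, 0 ≤ C ∧ ∀ (ψ : ST(d) → ℝ)
    (u : Fin n → ST(d) → ℝ) (p : ST(d)) (i : Fin n), 0 ≤ ψ p →
    ψ p * lsum ψ m (u i) p ≤ C * √(∑ k ∈ Finset.range m, sden ψ k u p) := by
  refine ⟨∑ j ∈ Finset.range m, ∑ _w : Fin j → Fin d, (1 : ℝ), by positivity, fun ψ u p i h0 => ?_⟩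
  rw [lsum, mul_sum, sum_mul]
  refine sum_le_sum fun j hj => ?_
  rw [← mul_assoc, mul_sum, sum_mul]
  refine sum_le_sum fun w _ => ?_
  rw [one_mul]
  refine Real.le_sqrt_of_sq_le ?_
  have h1 := sq_le_sden (ψ := ψ) (u := u) (W := List.ofFn w) (k := j) (by simp) i p
  have h2 := single_le_sum (f := fun k => sden ψ k u p) (fun k _ => sden_nonneg k p) hj
  refine le_trans (le_of_eq ?_) (h1.trans h2)
  rw [mul_pow, sq_abs, pow_succ]
  ring

theorem energy_pointwise (n m : ℕ) (hψ : Sm ψ) (h0 : ∀ p, 0 ≤ ψ p)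
    (h1 : ∀ p, ψ p ≤ 1) {S : Set ST(d)} (hS : IsCompact S) :
    ∃ C, 0 ≤ C ∧ ∀ u : Fin n → ST(d) → ℝ, (∀ i, Sm (u i)) → ∀ p ∈ S,
      (∀ W : List (Fin d), W.length = m → ∀ i,
        |dw W (fun p => ψ p ^ (m + 1) * u i p) p - ψ p ^ (m + 1) * dw W (u i) p| ≤
          C * √(∑ k ∈ Finset.range m, sden ψ k u p)) ∧
      ∀ V W : List (Fin d), V.length = m → W.length = m → ∀ i j,
        |dw V (fun p => ψ p ^ (2 * m + 2) * u i p) p * dw W (u j) p -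
          dw V (fun p => ψ p ^ (m + 1) * u i p) p * dw W (fun p => ψ p ^ (m + 1) * u j p) p| ≤
          C * (√(sden ψ m u p) * √(∑ k ∈ Finset.range m, sden ψ k u p) +
            ∑ k ∈ Finset.range m, sden ψ k u p) := by
  obtain ⟨C0, hC0, hL⟩ := mul_lsum_le d n m
  obtain ⟨C1, hC1, hc1⟩ := exists_commutator_bound hψ h0 h1 hS (m + 1) m (by omega)
  obtain ⟨C2, hC2, hc2⟩ := exists_commutator_bound hψ h0 h1 hS (2 * m + 2) m (by omega)
  have hc1' : ∀ u : Fin n → ST(d) → ℝ, (∀ i, Sm (u i)) → ∀ p ∈ S,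
      ∀ W : List (Fin d), W.length = m → ∀ i,
        |dw W (fun p => ψ p ^ (m + 1) * u i p) p - ψ p ^ (m + 1) * dw W (u i) p| ≤
          C1 * C0 * √(∑ k ∈ Finset.range m, sden ψ k u p) := by
    intro u hu p hp W hW i
    refine (hc1 W hW (u i) (hu i) p hp).trans ?_
    rw [show m + 1 - m = 1 by omega, pow_one, mul_assoc]
    exact mul_le_mul_of_nonneg_left (hL ψ u p i (h0 p)) hC1
  refine ⟨C1 * C0 + (C2 * C0 + 2 * (C1 * C0) + (C1 * C0) ^ 2), by positivity, fun u hu p hp => ⟨?_, ?_⟩⟩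
  · intro W hW i
    refine (hc1' u hu p hp W hW i).trans ?_
    refine mul_le_mul_of_nonneg_right ?_ (sqrt_nonneg _)
    have : 0 ≤ C2 * C0 + 2 * (C1 * C0) + (C1 * C0) ^ 2 := by positivity
    linarith
  · intro V W hV hW i j
    have a1 := hc1' u hu p hp V hV i
    have a2 := hc1' u hu p hp W hW j
    have a3 := hc2 V hV (u i) (hu i) p hp
    have a4 := hL ψ u p i (h0 p)
    have b1 := Real.abs_le_sqrt (sq_le_sden (ψ := ψ) (u := u) hV i p)
    have b2 := Real.abs_le_sqrt (sq_le_sden (ψ := ψ) (u := u) hW j p)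
    have hsq := Real.mul_self_sqrt (sum_nonneg fun k (_ : k ∈ Finset.range m) =>
      sden_nonneg (ψ := ψ) (u := u) k p)
    set L := √(∑ k ∈ Finset.range m, sden ψ k u p)
    set B := √(sden ψ m u p)
    have hL0 : 0 ≤ L := sqrt_nonneg _
    have hB0 : 0 ≤ B := sqrt_nonneg _
    rw [← hsq]
    rw [show ψ p ^ (2 * m + 2 - m) * lsum ψ m (u i) p = ψ p ^ (m + 1) * (ψ p * lsum ψ m (u i) p) by
      rw [show 2 * m + 2 - m = (m + 1) + 1 by omega, pow_succ (ψ p) (m + 1)]; ring] at a3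
    set X := ψ p ^ (m + 1) * dw V (u i) p
    set Y := ψ p ^ (m + 1) * dw W (u j) p with hY
    set P := dw V (fun p => ψ p ^ (m + 1) * u i p) p
    set Q := dw W (fun p => ψ p ^ (m + 1) * u j p) p
    set R := dw V (fun p => ψ p ^ (2 * m + 2) * u i p) p
    have e : R * dw W (u j) p - P * Q =
        (R - ψ p ^ (2 * m + 2) * dw V (u i) p) * dw W (u j) p - (P - X) * Y - X * (Q - Y)
          - (P - X) * (Q - Y) := by
      simp only [X, Y]
      ring
    have t1 : |(R - ψ p ^ (2 * m + 2) * dw V (u i) p) * dw W (u j) p| ≤ C2 * C0 * (B * L) := by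
      rw [abs_mul]
      calc _ ≤ C2 * (ψ p ^ (m + 1) * (ψ p * lsum ψ m (u i) p)) * |dw W (u j) p| :=
            mul_le_mul_of_nonneg_right a3 (abs_nonneg _)
        _ = C2 * (ψ p * lsum ψ m (u i) p) * |Y| := by
            rw [hY, abs_mul, abs_of_nonneg (pow_nonneg (h0 p) _)]; ring
        _ ≤ C2 * (C0 * L) * B := by
            refine mul_le_mul (mul_le_mul_of_nonneg_left a4 hC2) b2 (abs_nonneg _) (by positivity)
        _ = _ := by ring
    have t2 : |(P - X) * Y| ≤ C1 * C0 * L * B := by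
      rw [abs_mul]; exact mul_le_mul a1 b2 (abs_nonneg _) (by positivity)
    have t3 : |X * (Q - Y)| ≤ B * (C1 * C0 * L) := by
      rw [abs_mul]; exact mul_le_mul b1 a2 (abs_nonneg _) (by positivity)
    have t4 : |(P - X) * (Q - Y)| ≤ C1 * C0 * L * (C1 * C0 * L) := by
      rw [abs_mul]; exact mul_le_mul a1 a2 (abs_nonneg _) (by positivity)
    rw [e]
    have hBL : 0 ≤ B * L := by positivity
    have hLL : 0 ≤ L * L := by positivity
    have hCC : 0 ≤ C1 * C0 := by positivity
    have hCC2 : 0 ≤ C2 * C0 := by positivity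
    have n1 := abs_le.1 t1
    have n2 := abs_le.1 t2
    have n3 := abs_le.1 t3
    have n4 := abs_le.1 t4
    have g1 : 0 ≤ (C1 * C0) ^ 2 * (B * L) := by positivity
    have g2 : 0 ≤ (C1 * C0) * (B * L) := by positivity
    have g3 : 0 ≤ (C1 * C0) * (L * L) := by positivity
    have g4 : 0 ≤ (C2 * C0) * (L * L) := by positivity
    have g5 : (C1 * C0 + (C2 * C0 + 2 * (C1 * C0) + (C1 * C0) ^ 2)) * (B * L + L * L) =
        3 * ((C1 * C0) * (B * L)) + C2 * C0 * (B * L) + (C1 * C0) ^ 2 * (B * L) +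
        3 * ((C1 * C0) * (L * L)) + C2 * C0 * (L * L) + (C1 * C0) ^ 2 * (L * L) := by ring
    have g6 : C1 * C0 * L * B = (C1 * C0) * (B * L) := by ring
    have g7 : B * (C1 * C0 * L) = (C1 * C0) * (B * L) := by ring
    have g8 : C1 * C0 * L * (C1 * C0 * L) = (C1 * C0) ^ 2 * (L * L) := by ring
    rw [abs_le]
    constructor <;> linarith [n1.1, n1.2, n2.1, n2.2, n3.1, n3.2, n4.1, n4.2]

theorem wen_sum (hψ : Sm ψ) (hu : ∀ i, Sm (u i)) (t : ℝ) :
    ∫ x in cube (lo N), ∑ k ∈ Finset.range m, sden ψ k u (t, x) =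
      ∑ k ∈ Finset.range m, wen N ψ k u t := by
  rw [integral_finsetSum _ fun k _ => integrableOn_cube
    (continuous_slice (sden_smooth hψ hu k).continuous' t)]
  rfl

theorem wen_eq (hψ : Sm ψ) (hu : ∀ i, Sm (u i)) (k : ℕ) (t : ℝ) : wen N ψ k u t =
    ∑ w : Fin k → Fin d, ∑ i, ∫ x in cube (lo N), (ψ (t, x) ^ (k + 1) * dw (List.ofFn w) (u i) (t, x)) ^ 2 := by
  have hc : ∀ (w : Fin k → Fin d) i, Continuous fun x =>
      (ψ (t, x) ^ (k + 1) * dw (List.ofFn w) (u i) (t, x)) ^ 2 := fun w i =>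
    continuous_slice (f := fun p => (ψ p ^ (k + 1) * dw (List.ofFn w) (u i) p) ^ 2)
      (ContDiff.continuous ((ContDiff.mul (ContDiff.pow hψ _) ((hu i).dw _)).pow 2)) t
  rw [wen, sum_comm]
  unfold sden
  rw [integral_finsetSum _ fun i _ => integrableOn_cube (continuous_finsetSum _ fun w _ => hc w i)]
  refine sum_congr rfl fun i _ => ?_
  rw [integral_finsetSum _ fun w _ => integrableOn_cube (hc w i)]

/-- Testing the equation with a cut-off solution. -/
theorem exists_test_identity (hu : Sol m N K lam u) {ρ ρ' : ℝ} (h0 : 0 < ρ) (h1 : ρ < ρ') (h2 : ρ' < 1 / 2)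
    {t : ℝ} (ht : t ∈ Icc (-1 : ℝ) 0) : ∃ A : (Fin d → ℕ) → (Fin d → ℕ) → Fin n → Fin n → ℝ,
    (∀ α β i j, |A α β i j| ≤ K) ∧ LegHad d n m lam A ∧
    ∑ i, ∫ x in cube (lo N), cut ρ ρ' (t, x) ^ (2 * m + 2) * u i (t, x) * td (u i) (t, x) =
      -∑ α ∈ MIdx d m, ∑ β ∈ MIdx d m, ∑ i, ∑ j, A α β i j * ∫ x in cube (lo N),
        dw (word α) (fun p => cut ρ ρ' p ^ (2 * m + 2) * u i p) (t, x) * dw (word β) (u j) (t, x) := by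
  obtain ⟨A, hA, hLH, hE⟩ := hu.eqn t ht
  refine ⟨A, hA, hLH, ?_⟩
  have hsv : ∀ i, Sm fun p => cut ρ ρ' p ^ (2 * m + 2) * u i p := fun i =>
    ContDiff.mul (ContDiff.pow (cut_smooth ρ ρ') _) (hu.smooth i)
  have key : ∀ i, ∫ x in cube (lo N), cut ρ ρ' (t, x) ^ (2 * m + 2) * u i (t, x) * td (u i) (t, x) =
      -∑ α ∈ MIdx d m, ∑ β ∈ MIdx d m, ∑ j, A α β i j * ∫ x in cube (lo N),
        dw (word α) (fun p => cut ρ ρ' p ^ (2 * m + 2) * u i p) (t, x) * dw (word β) (u j) (t, x) := by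
    intro i
    have hpt : ∀ x ∈ cube (lo N), cut ρ ρ' (t, x) ^ (2 * m + 2) * u i (t, x) * td (u i) (t, x) =
        -∑ α ∈ MIdx d m, ∑ β ∈ MIdx d m, ∑ j, A α β i j * ((-1) ^ m *
          (cut ρ ρ' (t, x) ^ (2 * m + 2) * u i (t, x) * dw (word α) (dw (word β) (u j)) (t, x))) := by
      intro x hx
      by_cases hfar : ∃ k, ρ' ≤ |x k|
      · obtain ⟨k, hk⟩ := hfar
        rw [cut_eq_zero h0 h1 (p := (t, x)) hk]
        simp
      · push Not at hfar
        have e := hE x (fun k => by linarith [hfar k]) (mem_cube_lo hx).1 i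
        rw [eq_neg_of_add_eq_zero_left e, mul_neg]
        congr 1
        simp only [mul_sum]
        refine sum_congr rfl fun α _ => sum_congr rfl fun β _ =>
          sum_congr rfl fun j _ => ?_
        rw [dw_append]
        ring
    have hc : ∀ α β j, Continuous fun x => A α β i j * ((-1) ^ m *
          (cut ρ ρ' (t, x) ^ (2 * m + 2) * u i (t, x) * dw (word α) (dw (word β) (u j)) (t, x))) := by
      intro α β j
      have h1 := continuous_slice (hsv i).continuous' t
      have h2 := continuous_slice (((hu.smooth j).dw (word β)).dw (word α)).continuous' t
      exact continuous_const.mul (continuous_const.mul (h1.mul h2))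
    rw [setIntegral_congr_fun (measurableSet_cube _) hpt, integral_neg,
      integral_finsetSum _ fun α _ => integrableOn_cube (continuous_finsetSum _ fun β _ =>
        continuous_finsetSum _ fun j _ => hc α β j)]
    congr 1
    refine sum_congr rfl fun α hα => ?_
    rw [integral_finsetSum _ fun β _ => integrableOn_cube (continuous_finsetSum _ fun j _ => hc α β j)]
    refine sum_congr rfl fun β hβ => ?_
    rw [integral_finsetSum _ fun j _ => integrableOn_cube (hc α β j)]
    refine sum_congr rfl fun j _ => ?_
    have hv := hu.van_cut h0 h1 h2 (q := 2 * m + 2) (by omega) ht i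
    rw [integral_const_mul, integral_const_mul, integral_mul_dw (W := word α) (hsv i)
      ((hu.smooth j).dw (word β)) (by rw [length_word_of_mem hα]; exact hv), length_word_of_mem hα,
      ← mul_assoc, ← mul_assoc, mul_assoc (A α β i j), ← mul_pow]
    norm_num
  rw [sum_congr rfl fun i _ => key i, Finset.sum_neg_distrib, sum_comm]
  congr 1
  refine sum_congr rfl fun α _ => ?_
  rw [sum_comm]

theorem energy_inequality (hlam : 0 < lam) (hK : 0 ≤ K) {ρ ρ' : ℝ} (h0 : 0 < ρ) (h1 : ρ < ρ')
    (h2 : ρ' < 1 / 2) : ∃ c C : ℝ, 0 < c ∧ 0 ≤ C ∧ ∀ u : Fin n → ST(d) → ℝ,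
      Sol m N K lam u → ∀ t ∈ Icc (-1 : ℝ) 0,
      ∑ i, ∫ x in cube (lo N), cut ρ ρ' (t, x) ^ (2 * m + 2) * u i (t, x) * td (u i) (t, x) ≤
        -c * wen N (cut ρ ρ') m u t + C * ∑ k ∈ Finset.range m, wen N (cut ρ ρ') k u t := by
  have hψ : Sm (cut (d := d) ρ ρ') := cut_smooth ρ ρ'
  have hS : IsCompact (Icc (-1 : ℝ) 0 ×ˢ cube (lo N)) := isCompact_Icc.prod (isCompact_cube _)
  obtain ⟨C1, hC1, hE⟩ := energy_pointwise n m hψ cut_nonneg cut_le_one hS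
  have : Nonempty (Fin d) := ⟨N⟩
  set D : ℝ := (Fintype.card (Fin m → Fin d) : ℝ) with hD
  have hD1 : 0 < D := by rw [hD]; exact_mod_cast Fintype.card_pos
  set P : ℝ := ∑ α ∈ MIdx d m, ∑ β ∈ MIdx d m, ∑ i : Fin n, ∑ j : Fin n, K with hP
  have hP0 : 0 ≤ P := sum_nonneg fun _ _ => sum_nonneg fun _ _ =>
    sum_nonneg fun _ _ => sum_nonneg fun _ _ => hK
  obtain ⟨ε, hε, hPε⟩ : ∃ ε > 0, P * C1 * ε ≤ lam / (4 * D) := by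
    refine ⟨lam / (4 * D) / (P * C1 + 1), by positivity, ?_⟩
    rw [mul_div_assoc', div_le_iff₀ (by positivity)]
    have : 0 ≤ lam / (4 * D) := by positivity
    nlinarith
  refine ⟨lam / (4 * D), lam * n * C1 ^ 2 + P * (C1 * (1 + 1 / (4 * ε))), by positivity,
    by positivity, fun u hu t ht => ?_⟩
  obtain ⟨A, hA, hLH, hT⟩ := exists_test_identity hu h0 h1 h2 ht
  rw [hT]
  set ψ := cut (d := d) ρ ρ'
  set I := wen N ψ m u t
  set J := ∑ k ∈ Finset.range m, wen N ψ k u t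
  have hJ0 : 0 ≤ J := sum_nonneg fun k _ => wen_nonneg k t
  have hI0 : 0 ≤ I := wen_nonneg m t
  have hsd : ∀ k, Continuous fun x => sden ψ k u (t, x) := fun k =>
    continuous_slice (sden_smooth hψ hu.smooth k).continuous' t
  have hsdm : Continuous fun x => ∑ k ∈ Finset.range m, sden ψ k u (t, x) :=
    continuous_finsetSum _ fun k _ => hsd k
  have hsv : ∀ q i, Sm fun p => ψ p ^ q * u i p := fun q i =>
    ContDiff.mul (ContDiff.pow hψ _) (hu.smooth i)
  have hcv : ∀ q i W, Continuous fun x => dw W (fun p => ψ p ^ q * u i p) (t, x) := fun q i W =>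
    continuous_slice ((hsv q i).dw W).continuous' t
  have hcu : ∀ i W, Continuous fun x => dw W (u i) (t, x) := fun i W =>
    continuous_slice ((hu.smooth i).dw W).continuous' t
  have herr : ∀ V W : List (Fin d), V.length = m → W.length = m → ∀ i j,
      |(∫ x in cube (lo N), dw V (fun p => ψ p ^ (2 * m + 2) * u i p) (t, x) * dw W (u j) (t, x)) -
        ∫ x in cube (lo N), dw V (fun p => ψ p ^ (m + 1) * u i p) (t, x) *
          dw W (fun p => ψ p ^ (m + 1) * u j p) (t, x)| ≤ C1 * (ε * I + (1 + 1 / (4 * ε)) * J) := by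
    intro V W hV hW i j
    have hca : Continuous fun x => dw V (fun p => ψ p ^ (2 * m + 2) * u i p) (t, x) *
        dw W (u j) (t, x) := (hcv _ _ _).mul (hcu _ _)
    have hcb : Continuous fun x => dw V (fun p => ψ p ^ (m + 1) * u i p) (t, x) *
        dw W (fun p => ψ p ^ (m + 1) * u j p) (t, x) := (hcv _ _ _).mul (hcv _ _ _)
    rw [← integral_sub (integrableOn_cube hca) (integrableOn_cube hcb)]
    refine abs_integral_le_integral_abs.trans ?_
    have hr : ∫ x in cube (lo N), C1 * (ε * sden ψ m u (t, x) +
        (1 + 1 / (4 * ε)) * ∑ k ∈ Finset.range m, sden ψ k u (t, x)) =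
        C1 * (ε * I + (1 + 1 / (4 * ε)) * J) := by
      have q1 : Continuous fun x => ε * sden ψ m u (t, x) := continuous_const.mul (hsd m)
      have q2 : Continuous fun x => (1 + 1 / (4 * ε)) * ∑ k ∈ Finset.range m, sden ψ k u (t, x) :=
        continuous_const.mul hsdm
      rw [integral_const_mul, integral_add (integrableOn_cube q1) (integrableOn_cube q2), integral_const_mul, integral_const_mul,
        wen_sum hψ hu.smooth]
      rfl
    rw [← hr]
    refine cube_integral_mono (hca.sub hcb).abs
      (continuous_const.mul ((continuous_const.mul (hsd m)).add (continuous_const.mul hsdm)))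
      fun x hx => ?_
    refine ((hE u hu.smooth (t, x) ⟨ht, hx⟩).2 V W hV hW i j).trans ?_
    refine mul_le_mul_of_nonneg_left ?_ hC1
    have hs0 : 0 ≤ ∑ k ∈ Finset.range m, sden ψ k u (t, x) := sum_nonneg fun k _ => sden_nonneg _ _
    have q1 := sq_sqrt (sden_nonneg (ψ := ψ) (u := u) m (t, x))
    have q2 := sq_sqrt hs0
    set a := √(sden ψ m u (t, x))
    set b := √(∑ k ∈ Finset.range m, sden ψ k u (t, x))
    rw [← q1, ← q2]
    have h3 : 0 ≤ ε * (a - b / (2 * ε)) ^ 2 := by positivity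
    have h4 : ε * (a - b / (2 * ε)) ^ 2 = ε * a ^ 2 - a * b + 1 / (4 * ε) * b ^ 2 := by
      field_simp; ring
    linarith
  have hlow : ∀ W : List (Fin d), W.length = m → ∀ i,
      1 / 2 * (∫ x in cube (lo N), (ψ (t, x) ^ (m + 1) * dw W (u i) (t, x)) ^ 2) - C1 ^ 2 * J ≤
        ∫ x in cube (lo N), dw W (fun p => ψ p ^ (m + 1) * u i p) (t, x) ^ 2 := by
    intro W hW i
    have hcc : Continuous fun x => (ψ (t, x) ^ (m + 1) * dw W (u i) (t, x)) ^ 2 :=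
      ((continuous_slice (ContDiff.pow hψ (m + 1)).continuous t).mul (hcu i W)).pow 2
    have q1 : Continuous fun x => 1 / 2 * (ψ (t, x) ^ (m + 1) * dw W (u i) (t, x)) ^ 2 :=
      continuous_const.mul hcc
    have q2 : Continuous fun x => C1 ^ 2 * ∑ k ∈ Finset.range m, sden ψ k u (t, x) :=
      continuous_const.mul hsdm
    rw [show J = _ from (wen_sum hψ hu.smooth t).symm, ← integral_const_mul, ← integral_const_mul,
      ← integral_sub (integrableOn_cube q1) (integrableOn_cube q2)]
    refine cube_integral_mono ((continuous_const.mul hcc).sub (continuous_const.mul hsdm))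
      ((hcv _ _ _).pow 2) fun x hx => ?_
    have h3 := (hE u hu.smooth (t, x) ⟨ht, hx⟩).1 W hW i
    have hs0 : 0 ≤ ∑ k ∈ Finset.range m, sden ψ k u (t, x) := sum_nonneg fun k _ => sden_nonneg _ _
    have h4 := sq_le_sq' (abs_le.1 h3).1 (abs_le.1 h3).2
    rw [mul_pow, sq_sqrt hs0] at h4
    set X := dw W (fun p => ψ p ^ (m + 1) * u i p) (t, x)
    nlinarith [sq_nonneg (ψ (t, x) ^ (m + 1) * dw W (u i) (t, x) - 2 * X)]
  have hsumerr : (∑ α ∈ MIdx d m, ∑ β ∈ MIdx d m, ∑ i, ∑ j, A α β i j * ∫ x in cube (lo N),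
        dw (word α) (fun p => ψ p ^ (m + 1) * u i p) (t, x) *
          dw (word β) (fun p => ψ p ^ (m + 1) * u j p) (t, x)) -
      (∑ α ∈ MIdx d m, ∑ β ∈ MIdx d m, ∑ i, ∑ j, A α β i j * ∫ x in cube (lo N),
        dw (word α) (fun p => ψ p ^ (2 * m + 2) * u i p) (t, x) * dw (word β) (u j) (t, x)) ≤
      P * (C1 * (ε * I + (1 + 1 / (4 * ε)) * J)) := by
    simp only [hP, sum_mul, ← Finset.sum_sub_distrib]
    refine sum_le_sum fun α hα => sum_le_sum fun β hβ => sum_le_sum fun i _ =>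
      sum_le_sum fun j _ => ?_
    rw [← mul_sub]
    refine (le_abs_self _).trans ?_
    rw [abs_mul, abs_sub_comm]
    exact mul_le_mul (hA α β i j) (herr _ _ (length_word_of_mem hα) (length_word_of_mem hβ) i j)
      (abs_nonneg _) hK
  have hvan : ∀ i, Van (lo N) t m (fun p => ψ p ^ (m + 1) * u i p) := fun i =>
    hu.van_cut h0 h1 h2 (by omega) ht i
  have hW : ∀ w : Fin m → Fin d, lam * ((1 / 2 * ∑ i, ∫ x in cube (lo N),
      (ψ (t, x) ^ (m + 1) * dw (List.ofFn w) (u i) (t, x)) ^ 2) - n * (C1 ^ 2 * J)) ≤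
      (∑ α ∈ MIdx d m, ∑ β ∈ MIdx d m, ∑ i, ∑ j, A α β i j * ∫ x in cube (lo N),
        dw (word α) (fun p => ψ p ^ (2 * m + 2) * u i p) (t, x) * dw (word β) (u j) (t, x)) +
      P * (C1 * (ε * I + (1 + 1 / (4 * ε)) * J)) := by
    intro w
    have hg := garding hlam.le hLH (hsv (m + 1)) hvan (W := List.ofFn w) (by simp)
    have h3 : lam * ((1 / 2 * ∑ i, ∫ x in cube (lo N),
      (ψ (t, x) ^ (m + 1) * dw (List.ofFn w) (u i) (t, x)) ^ 2) - n * (C1 ^ 2 * J)) ≤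
      lam * ∑ i, ∫ x in cube (lo N), dw (List.ofFn w) (fun p => ψ p ^ (m + 1) * u i p) (t, x) ^ 2 := by
      refine mul_le_mul_of_nonneg_left ?_ hlam.le
      have h5 := sum_le_sum fun i (_ : i ∈ Finset.univ) => hlow (List.ofFn w) (by simp) i
      rw [Finset.sum_sub_distrib, ← mul_sum] at h5
      simpa using h5
    linarith
  have hfin := sum_le_sum fun w (_ : w ∈ (Finset.univ : Finset (Fin m → Fin d))) => hW w
  rw [← mul_sum, Finset.sum_sub_distrib, ← mul_sum, ← wen_eq hψ hu.smooth] at hfin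
  simp only [sum_const, Finset.card_univ, nsmul_eq_mul] at hfin
  rw [← hD] at hfin
  set T := ∑ α ∈ MIdx d m, ∑ β ∈ MIdx d m, ∑ i, ∑ j, A α β i j * ∫ x in cube (lo N),
        dw (word α) (fun p => ψ p ^ (2 * m + 2) * u i p) (t, x) * dw (word β) (u j) (t, x)
  have hd1 : lam / (2 * D) * I - lam * n * C1 ^ 2 * J ≤
      T + P * (C1 * (ε * I + (1 + 1 / (4 * ε)) * J)) := by
    have : lam / (2 * D) * I - lam * n * C1 ^ 2 * J =
      lam * (1 / 2 * I - D * (n * (C1 ^ 2 * J))) / D := by field_simp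
    rw [this, div_le_iff₀ hD1]
    linarith
  have hd2 : P * (C1 * (ε * I)) ≤ lam / (4 * D) * I := by
    have := mul_le_mul_of_nonneg_right hPε hI0
    linarith
  have hd3 : lam / (2 * D) = 2 * (lam / (4 * D)) := by field_simp; ring
  rw [hd3] at hd1
  linarith

end energy

section interp

variable {d n m : ℕ} {N : Fin d} {K lam : ℝ} {u : Fin n → ST(d) → ℝ}

theorem cut_eq_zero_or_mem_flatBd {ρ ρ' : ℝ} (h0 : 0 < ρ) (h1 : ρ < ρ') (h2 : ρ' < 1 / 2) {t : ℝ}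
    (ht : t ∈ Icc (-1 : ℝ) 0) {x : Fin d → ℝ} {l : Fin d}
    (hl : x l = lo N l ∨ x l = lo N l + 1) : cut ρ ρ' (t, x) = 0 ∨ (t, x) ∈ flatBd N := by
  by_cases hfar : ∃ k, ρ' ≤ |x k|
  · obtain ⟨k, hk⟩ := hfar
    exact Or.inl (cut_eq_zero h0 h1 (p := (t, x)) hk)
  · push Not at hfar
    refine Or.inr ⟨ht, fun i => by linarith [hfar i], ?_⟩
    have hl' := abs_lt.1 (hfar l)
    by_cases hN : l = N
    · subst hN
      simp only [lo, if_pos] at hl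
      rcases hl with hl | hl
      · exact hl
      · linarith
    · simp only [lo, if_neg hN] at hl
      rcases hl with hl | hl <;> linarith

theorem wen_interpolation {ρ ρ' : ℝ} (h0 : 0 < ρ) (h1 : ρ < ρ') (h2 : ρ' < 1 / 2) :
    ∃ c : ℝ → ℝ, (∀ δ, 0 < δ → 0 ≤ c δ) ∧ ∀ u : Fin n → ST(d) → ℝ,
      Sol m N K lam u → ∀ t ∈ Icc (-1 : ℝ) 0, ∀ j, 1 ≤ j → j < m → ∀ δ > 0,
      wen N (cut ρ ρ') j u t ≤ δ * wen N (cut ρ ρ') (j + 1) u t + c δ * wen N (cut ρ ρ') (j - 1) u t := by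
  have hψ : Sm (cut (d := d) ρ ρ') := cut_smooth ρ ρ'
  have hS : IsCompact (Icc (-1 : ℝ) 0 ×ˢ cube (lo N)) := isCompact_Icc.prod (isCompact_cube _)
  have hB : ∀ l : Fin d, ∃ B, ∀ p ∈ Icc (-1 : ℝ) 0 ×ˢ cube (lo N), |pd l (cut ρ ρ') p| ≤ B := fun l =>
    hS.exists_bound_of_continuousOn (hψ.pd l).continuous'.continuousOn
  choose B hB using hB
  set P : ℝ := (2 * m + 2) * ∑ l, |B l| with hP
  have hP0 : 0 ≤ P := by positivity
  set M : ℝ := n * (d : ℝ) ^ m + 1 with hM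
  have hM0 : 0 < M := by positivity
  refine ⟨fun δ => 2 * M * (P ^ 2 / (4 * (1 / (2 * M))) + 1 / (4 * (δ / (2 * M)))),
    fun δ hδ => by positivity, fun u hu t ht j hj hjm δ hδ => ?_⟩
  obtain ⟨k, rfl⟩ := Nat.exists_eq_add_of_le' hj
  set ψ := cut (d := d) ρ ρ'
  rw [Nat.add_sub_cancel]
  obtain ⟨a, ha⟩ : ∃ a, a = δ / (2 * M) := ⟨_, rfl⟩
  obtain ⟨b, hb⟩ : ∃ b, b = 1 / (2 * M) := ⟨_, rfl⟩
  have ha0 : 0 < a := by rw [ha]; positivity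
  have hb0 : 0 < b := by rw [hb]; positivity
  simp only [← ha, ← hb]
  have hsd : ∀ k, Continuous fun x => sden ψ k u (t, x) := fun k =>
    continuous_slice (sden_smooth hψ hu.smooth k).continuous' t
  have hterm : ∀ (w : Fin (k + 1) → Fin d) (i : Fin n),
      ∫ x in cube (lo N), (ψ (t, x) ^ (k + 1 + 1) * dw (List.ofFn w) (u i) (t, x)) ^ 2 ≤
        a * wen N ψ (k + 1 + 1) u t + b * wen N ψ (k + 1) u t +
          (P ^ 2 / (4 * b) + 1 / (4 * a)) * wen N ψ k u t := by
    intro w i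
    rw [List.ofFn_succ, dw_cons]
    set W := List.ofFn fun i : Fin k => w i.succ with hW
    have hWl : W.length = k := by simp [hW]
    set l := w 0
    set g := dw W (u i) with hg
    have hgs : Sm g := (hu.smooth i).dw W
    have hψq : Sm fun p => ψ p ^ (2 * k + 4) := ContDiff.pow hψ _
    have hGs : Sm fun p => ψ p ^ (2 * k + 4) * pd l g p := ContDiff.mul hψq (hgs.pd l)
    have hvg : VanS (flatBd N) (m - k) g := by
      refine VanS.dw (hu.smooth i) ?_
      rw [hWl, show k + (m - k) = m by omega]
      exact hu.vanS i
    have hibp := integral_pd_mul (a := lo N) (t := t) (l := l) hgs hGs (fun x hx hl => by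
      rcases cut_eq_zero_or_mem_flatBd (N := N) h0 h1 h2 ht hl with h | h
      · simp only [ψ, h]; simp
      · obtain ⟨q, hq⟩ : ∃ q, m - k = q + 1 := ⟨m - k - 1, by omega⟩
        rw [hq] at hvg
        rw [hvg.1 _ h, zero_mul])
    have hpdG : pd l (fun p => ψ p ^ (2 * k + 4) * pd l g p) = fun p =>
        ((2 * k + 4 : ℕ) * ψ p ^ (2 * k + 4 - 1) * pd l ψ p) * pd l g p +
          ψ p ^ (2 * k + 4) * pd l (pd l g) p := by
      rw [show pd l (fun p => ψ p ^ (2 * k + 4) * pd l g p) = _ from dv_mul hψq (hgs.pd l),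
        dv_pow hψ]
      rfl
    have e1 : ∫ x in cube (lo N), (ψ (t, x) ^ (k + 1 + 1) * pd l g (t, x)) ^ 2 =
        ∫ x in cube (lo N), -(g (t, x) * pd l (fun p => ψ p ^ (2 * k + 4) * pd l g p) (t, x)) := by
      rw [integral_neg, ← hibp]
      refine setIntegral_congr_fun (measurableSet_cube _) fun x _ => ?_
      ring
    have q0 : Continuous fun x => a * sden ψ (k + 1 + 1) u (t, x) := continuous_const.mul (hsd _)
    have q1 : Continuous fun x => b * sden ψ (k + 1) u (t, x) := continuous_const.mul (hsd _)
    have q2 : Continuous fun x => (P ^ 2 / (4 * b) + 1 / (4 * a)) * sden ψ k u (t, x) :=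
      continuous_const.mul (hsd _)
    have q01 : Continuous fun x => a * sden ψ (k + 1 + 1) u (t, x) + b * sden ψ (k + 1) u (t, x) :=
      q0.add q1
    have e2 : a * wen N ψ (k + 1 + 1) u t + b * wen N ψ (k + 1) u t +
          (P ^ 2 / (4 * b) + 1 / (4 * a)) * wen N ψ k u t =
        ∫ x in cube (lo N), (a * sden ψ (k + 1 + 1) u (t, x) + b * sden ψ (k + 1) u (t, x) +
          (P ^ 2 / (4 * b) + 1 / (4 * a)) * sden ψ k u (t, x)) := by
      rw [integral_add (integrableOn_cube q01) (integrableOn_cube q2),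
        integral_add (integrableOn_cube q0) (integrableOn_cube q1), integral_const_mul,
        integral_const_mul, integral_const_mul]
      rfl
    rw [e1, e2]
    refine cube_integral_mono ?_ (q01.add q2) fun x hx => ?_
    · have := continuous_slice hgs.continuous' t
      have := continuous_slice (hGs.pd l).continuous' t
      fun_prop
    rw [hpdG]
    have hψ0 : 0 ≤ ψ (t, x) := cut_nonneg _
    have b0 := Real.abs_le_sqrt (sq_le_sden (ψ := ψ) (u := u) hWl i (t, x))
    have b1 := Real.abs_le_sqrt (sq_le_sden (ψ := ψ) (u := u) (W := l :: W) (k := k + 1)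
      (by simp [hWl]) i (t, x))
    have b2 := Real.abs_le_sqrt (sq_le_sden (ψ := ψ) (u := u) (W := l :: l :: W) (k := k + 1 + 1)
      (by simp [hWl]) i (t, x))
    rw [dw_cons] at b1
    rw [dw_cons, dw_cons] at b2
    rw [← hg] at b0 b1 b2
    have r0 := sq_sqrt (sden_nonneg (ψ := ψ) (u := u) k (t, x))
    have r1 := sq_sqrt (sden_nonneg (ψ := ψ) (u := u) (k + 1) (t, x))
    have r2 := sq_sqrt (sden_nonneg (ψ := ψ) (u := u) (k + 1 + 1) (t, x))
    set s0 := √(sden ψ k u (t, x))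
    set s1 := √(sden ψ (k + 1) u (t, x))
    set s2 := √(sden ψ (k + 1 + 1) u (t, x))
    have hs0 : 0 ≤ s0 := sqrt_nonneg _
    have hs1 : 0 ≤ s1 := sqrt_nonneg _
    have hs2 : 0 ≤ s2 := sqrt_nonneg _
    rw [← r0, ← r1, ← r2]
    have hpl : |((2 * k + 4 : ℕ) : ℝ) * pd l ψ (t, x)| ≤ P := by
      rw [abs_mul, hP, abs_of_nonneg (Nat.cast_nonneg _)]
      refine mul_le_mul ?_ ?_ (abs_nonneg _) (by positivity)
      · have : 2 * k + 4 ≤ 2 * m + 2 := by omega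
        exact_mod_cast this
      · exact ((hB l (t, x) ⟨ht, hx⟩).trans (le_abs_self _)).trans
          (single_le_sum (f := fun l => |B l|) (fun _ _ => abs_nonneg _) (Finset.mem_univ l))
    have t1 : |(((2 * k + 4 : ℕ) : ℝ) * pd l ψ (t, x)) * ((ψ (t, x) ^ (k + 1 + 1) * pd l g (t, x)) *
        (ψ (t, x) ^ (k + 1) * g (t, x)))| ≤ P * (s1 * s0) := by
      rw [abs_mul]
      refine mul_le_mul hpl ?_ (abs_nonneg _) hP0
      rw [abs_mul]
      exact mul_le_mul b1 b0 (abs_nonneg _) hs1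
    have t2 : |(ψ (t, x) ^ (k + 1 + 1 + 1) * pd l (pd l g) (t, x)) * (ψ (t, x) ^ (k + 1) * g (t, x))| ≤
        s2 * s0 := by
      rw [abs_mul]
      exact mul_le_mul b2 b0 (abs_nonneg _) hs2
    have e3 : -(g (t, x) * (((2 * k + 4 : ℕ) * ψ (t, x) ^ (2 * k + 4 - 1) * pd l ψ (t, x)) * pd l g (t, x) +
          ψ (t, x) ^ (2 * k + 4) * pd l (pd l g) (t, x))) =
        -((((2 * k + 4 : ℕ) : ℝ) * pd l ψ (t, x)) * ((ψ (t, x) ^ (k + 1 + 1) * pd l g (t, x)) *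
        (ψ (t, x) ^ (k + 1) * g (t, x)))) -
        (ψ (t, x) ^ (k + 1 + 1 + 1) * pd l (pd l g) (t, x)) * (ψ (t, x) ^ (k + 1) * g (t, x)) := by
      rw [show 2 * k + 4 - 1 = (k + 1 + 1) + (k + 1) by omega]
      ring
    rw [e3]
    have g1 : a * (s2 - s0 / (2 * a)) ^ 2 = a * s2 ^ 2 - s2 * s0 + 1 / (4 * a) * s0 ^ 2 := by
      field_simp; ring
    have g2 : b * (s1 - P * s0 / (2 * b)) ^ 2 = b * s1 ^ 2 - P * (s1 * s0) + P ^ 2 / (4 * b) * s0 ^ 2 := by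
      field_simp; ring
    have g3 : 0 ≤ a * (s2 - s0 / (2 * a)) ^ 2 := by positivity
    have g4 : 0 ≤ b * (s1 - P * s0 / (2 * b)) ^ 2 := by positivity
    linarith [(abs_le.1 t1).1, (abs_le.1 t2).1]
  have hsum := sum_le_sum fun w (_ : w ∈ (Finset.univ : Finset (Fin (k + 1) → Fin d))) =>
    sum_le_sum fun i (_ : i ∈ Finset.univ) => hterm w i
  rw [← wen_eq hψ hu.smooth] at hsum
  simp only [sum_const, Finset.card_univ, nsmul_eq_mul, Fintype.card_fin, Fintype.card_fun] at hsum
  set w0 := wen N ψ k u t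
  set w1 := wen N ψ (k + 1) u t
  set w2 := wen N ψ (k + 1 + 1) u t
  have p0 : 0 ≤ w0 := wen_nonneg k t
  have p1 : 0 ≤ w1 := wen_nonneg (k + 1) t
  have p2 : 0 ≤ w2 := wen_nonneg (k + 1 + 1) t
  have hX0 : 0 ≤ a * w2 + b * w1 + (P ^ 2 / (4 * b) + 1 / (4 * a)) * w0 := by positivity
  have hMle : ((d ^ (k + 1) : ℕ) : ℝ) * n ≤ M := by
    have hd1 : (1 : ℝ) ≤ d := by exact_mod_cast N.pos
    have : (d : ℝ) ^ (k + 1) ≤ (d : ℝ) ^ m := pow_le_pow_right₀ hd1 hjm.le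
    have h3 : (d : ℝ) ^ (k + 1) * n ≤ (d : ℝ) ^ m * n := mul_le_mul_of_nonneg_right this (Nat.cast_nonneg n)
    push_cast
    rw [hM]
    linarith
  have hfin := mul_le_mul_of_nonneg_right hMle hX0
  have hMa : M * a = δ / 2 := by rw [ha]; field_simp
  have hMb : M * b = 1 / 2 := by rw [hb]; field_simp
  have hle : w1 ≤ M * a * w2 + M * b * w1 + M * (P ^ 2 / (4 * b) + 1 / (4 * a)) * w0 := by
    linarith
  rw [hMa, hMb] at hle
  linarith

/-- Energy inequality with all intermediate derivatives absorbed. -/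
theorem energy_inequality' (hm : 1 ≤ m) (hlam : 0 < lam) (hK : 0 ≤ K) {ρ ρ' : ℝ} (h0 : 0 < ρ) (h1 : ρ < ρ')
    (h2 : ρ' < 1 / 2) : ∃ c C : ℝ, 0 < c ∧ 0 ≤ C ∧ ∀ u : Fin n → ST(d) → ℝ,
      Sol m N K lam u → ∀ t ∈ Icc (-1 : ℝ) 0,
      ∑ i, ∫ x in cube (lo N), cut ρ ρ' (t, x) ^ (2 * m + 2) * u i (t, x) * td (u i) (t, x) ≤
        -c * wen N (cut ρ ρ') 1 u t + C * wen N (cut ρ ρ') 0 u t := by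
  obtain ⟨c, C, hc, hC, hE⟩ := energy_inequality (n := n) (m := m) (N := N) hlam hK h0 h1 h2
  obtain ⟨f, hf, hI⟩ := wen_interpolation (n := n) (m := m) (N := N) (K := K) (lam := lam) h0 h1 h2
  obtain ⟨C1, hC1, hD1⟩ := discrete_interpolation f hf m (c / (2 * (C * m + 1))) (by positivity)
  obtain ⟨C2, hC2, hD2⟩ := discrete_interpolation f hf m 1 one_pos
  refine ⟨c / 2, C * (m * C1) + c / 2 * C2, by positivity, by positivity, fun u hu t ht => ?_⟩
  have a1 := hE u hu t ht
  have a2 := hD1 (fun j => wen N (cut ρ ρ') j u t) (fun j => wen_nonneg j t)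
    (fun j hj hjm δ hδ => hI u hu t ht j hj hjm δ hδ)
  have a3 := hD2 (fun j => wen N (cut ρ ρ') j u t) (fun j => wen_nonneg j t)
    (fun j hj hjm δ hδ => hI u hu t ht j hj hjm δ hδ)
  have p0 : 0 ≤ wen N (cut ρ ρ') 0 u t := wen_nonneg 0 t
  have pm : 0 ≤ wen N (cut ρ ρ') m u t := wen_nonneg m t
  have a4 : wen N (cut ρ ρ') 1 u t ≤ wen N (cut ρ ρ') m u t + C2 * wen N (cut ρ ρ') 0 u t := by
    rcases Nat.lt_or_ge 1 m with h | h
    · have := a3 1 h; linarith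
    · obtain rfl : m = 1 := by omega
      have : 0 ≤ C2 * wen N (cut ρ ρ') 0 u t := by positivity
      linarith
  have a5 := sum_le_sum fun k (hk : k ∈ Finset.range m) => a2 k (Finset.mem_range.1 hk)
  rw [sum_const, Finset.card_range, nsmul_eq_mul] at a5
  have a6 := mul_le_mul_of_nonneg_left a5 hC
  set w0 := wen N (cut ρ ρ') 0 u t
  set w1 := wen N (cut ρ ρ') 1 u t
  set wm := wen N (cut ρ ρ') m u t
  have a7 : C * (m * (c / (2 * (C * m + 1)) * wm)) ≤ c / 2 * wm := by
    have e : C * (m * (c / (2 * (C * m + 1)) * wm)) = (C * m) / (C * m + 1) * (c / 2 * wm) := by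
      field_simp
    rw [e]
    refine mul_le_of_le_one_left (by positivity) ?_
    rw [div_le_one (by positivity)]
    linarith
  have a8 := mul_le_mul_of_nonneg_left a4 (by positivity : 0 ≤ c / 2)
  linarith

end interp

section cacc

variable {d n m : ℕ} {N : Fin d} {K lam : ℝ} {u : Fin n → ST(d) → ℝ}

theorem continuous_integral_cube {f : ST(d) → ℝ} (hf : Sm f) (a : Fin d → ℝ) :
    Continuous fun t => ∫ x in cube a, f (t, x) :=
  continuous_iff_continuousAt.2 fun t => (hasDerivAt_integral_cube hf a t).continuousAt

theorem wen_continuous {ψ : ST(d) → ℝ} (hψ : Sm ψ) (hu : ∀ i, Sm (u i)) (k : ℕ) :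
    Continuous (wen N ψ k u) :=
  continuous_integral_cube (sden_smooth hψ hu k) _

/-- Caccioppoli inequality in integrated form. -/
theorem caccioppoli (hm : 1 ≤ m) (hlam : 0 < lam) (hK : 0 ≤ K) {ρ ρ' : ℝ} (h0 : 0 < ρ) (h1 : ρ < ρ')
    (h2 : ρ' < 1 / 2) : ∃ c C : ℝ, 0 < c ∧ 0 ≤ C ∧ ∀ u : Fin n → ST(d) → ℝ,
      Sol m N K lam u → ∀ t₁ b : ℝ, -1 ≤ t₁ → t₁ ≤ b → b ≤ 0 →
      (b - t₁) * (∑ i, ∫ x in cube (lo N), (cut ρ ρ' (b, x) ^ (m + 1) * u i (b, x)) ^ 2) +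
        c * (∫ t in t₁..b, (t - t₁) * wen N (cut ρ ρ') 1 u t) ≤
        C * ∫ t in t₁..b, wen N (cut ρ ρ') 0 u t := by
  obtain ⟨c, C, hc, hC, hE⟩ := energy_inequality' (n := n) (m := m) (N := N) hm hlam hK h0 h1 h2
  refine ⟨2 * c, 1 + 2 * C, by positivity, by positivity, fun u hu t₁ b ht₁ hb hb0 => ?_⟩
  have hψ : Sm (cut (d := d) ρ ρ') := cut_smooth ρ ρ'
  set ψ := cut (d := d) ρ ρ'
  have hψq : ∀ q, Sm fun p => ψ p ^ q := fun q => ContDiff.pow hψ q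
  set f : Fin n → ST(d) → ℝ := fun i p => ψ p ^ (2 * m + 2) * (u i p * u i p) with hf
  have hfs : ∀ i, Sm (f i) := fun i => ContDiff.mul (hψq _) (ContDiff.mul (hu.smooth i) (hu.smooth i))
  set g : Fin n → ST(d) → ℝ := fun i p => ψ p ^ (2 * m + 2) * u i p * td (u i) p with hg
  have hgs : ∀ i, Sm (g i) := fun i => ContDiff.mul (ContDiff.mul (hψq _) (hu.smooth i)) (hu.smooth i).td
  have htd : ∀ i, td (f i) = fun p => 2 * g i p := by
    intro i
    rw [hf, show td (fun p => ψ p ^ (2 * m + 2) * (u i p * u i p)) = _ from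
      dv_mul (hψq _) (ContDiff.mul (hu.smooth i) (hu.smooth i)), dv_mul (hu.smooth i) (hu.smooth i),
      show dv ((1 : ℝ), (0 : Fin d → ℝ)) (fun p => ψ p ^ (2 * m + 2)) = fun _ => 0 from
        td_cut_pow ρ ρ' _]
    funext p
    simp only [hg, td]
    ring
  set y : ℝ → ℝ := fun t => ∑ i, ∫ x in cube (lo N), f i (t, x) with hy
  set y' : ℝ → ℝ := fun t => ∑ i, ∫ x in cube (lo N), td (f i) (t, x) with hy'
  have hyd : ∀ t, HasDerivAt y (y' t) t := fun t =>
    HasDerivAt.fun_sum fun i _ => hasDerivAt_integral_cube (hfs i) (lo N) t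
  have hyc : Continuous y := continuous_iff_continuousAt.2 fun t => (hyd t).continuousAt
  have hy'c : Continuous y' := continuous_finsetSum _ fun i _ => continuous_integral_cube (hfs i).td _
  have hw0 : Continuous (wen N ψ 0 u) := wen_continuous hψ hu.smooth 0
  have hw1 : Continuous (wen N ψ 1 u) := wen_continuous hψ hu.smooth 1
  have hyle : ∀ t, y t ≤ wen N ψ 0 u t := by
    intro t
    rw [wen_eq hψ hu.smooth]
    simp only [Finset.univ_unique, Finset.sum_singleton]
    refine sum_le_sum fun i _ => ?_
    have hc1 := continuous_slice (hψq (0 + 1)).continuous' t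
    have hc2 := continuous_slice (hu.smooth i).continuous' t
    refine cube_integral_mono (continuous_slice (hfs i).continuous' t) ((hc1.mul hc2).pow 2) fun x _ => ?_
    have hle : ψ (t, x) ^ (2 * m + 2) ≤ ψ (t, x) ^ 2 :=
      pow_le_pow_of_le_one (cut_nonneg _) (cut_le_one _) (by omega)
    simp only [hf, List.ofFn_zero, dw_nil, Nat.zero_add, pow_one]
    rw [mul_pow, ← sq]
    exact mul_le_mul_of_nonneg_right hle (sq_nonneg _)
  have hy'le : ∀ t ∈ Icc (-1 : ℝ) 0, y' t ≤ 2 * (-c * wen N ψ 1 u t + C * wen N ψ 0 u t) := by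
    intro t ht
    refine le_trans (le_of_eq ?_) (mul_le_mul_of_nonneg_left (hE u hu t ht) two_pos.le)
    rw [hy', mul_sum]
    refine sum_congr rfl fun i _ => ?_
    rw [htd, integral_const_mul]
  have hyb : ∑ i, ∫ x in cube (lo N), (ψ (b, x) ^ (m + 1) * u i (b, x)) ^ 2 = y b := by
    refine sum_congr rfl fun i _ => ?_
    congr 1
    funext x
    simp only [hf]
    ring
  rw [hyb]
  have hprod : ∀ t, HasDerivAt (fun t => (t - t₁) * y t) (1 * y t + (t - t₁) * y' t) t := fun t =>
    ((hasDerivAt_id t).sub_const t₁).mul (hyd t)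
  have hftc : ∫ t in t₁..b, (1 * y t + (t - t₁) * y' t) = (b - t₁) * y b := by
    rw [intervalIntegral.integral_eq_sub_of_hasDerivAt (fun t _ => hprod t)
      (Continuous.intervalIntegrable (by fun_prop) _ _)]
    ring
  rw [← hftc, ← intervalIntegral.integral_const_mul, ← intervalIntegral.integral_const_mul,
    ← intervalIntegral.integral_add]
  · refine intervalIntegral.integral_mono_on hb ?_ ?_ fun t ht => ?_
    · exact Continuous.intervalIntegrable (by fun_prop) _ _
    · exact Continuous.intervalIntegrable (by fun_prop) _ _
    have a1 := hyle t
    have a2 := mul_le_mul_of_nonneg_left (hy'le t ⟨by linarith [ht.1], by linarith [ht.2]⟩)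
      (by linarith [ht.1] : 0 ≤ t - t₁)
    have p0 : 0 ≤ wen N ψ 0 u t := wen_nonneg 0 t
    have a3 : (t - t₁) * (2 * C * wen N ψ 0 u t) ≤ 1 * (2 * C * wen N ψ 0 u t) :=
      mul_le_mul_of_nonneg_right (by linarith [ht.2]) (by positivity)
    linarith
  all_goals exact Continuous.intervalIntegrable (by fun_prop) _ _

/-- Squared `L²` norm on the reference half cylinder. -/
noncomputable def msq (N : Fin d) (u : Fin n → ST(d) → ℝ) : ℝ :=
  ∫ t in (-(1 / 2) : ℝ)..0, ∑ i, ∫ x in cube (lo N), u i (t, x) ^ 2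

theorem wen_zero_le (hu : ∀ i, Sm (u i)) (ρ ρ' t : ℝ) :
    wen N (cut ρ ρ') 0 u t ≤ ∑ i, ∫ x in cube (lo N), u i (t, x) ^ 2 := by
  have hψ : Sm (cut (d := d) ρ ρ') := cut_smooth ρ ρ'
  rw [wen_eq hψ hu]
  simp only [Finset.univ_unique, Finset.sum_singleton]
  refine sum_le_sum fun i _ => ?_
  have hc1 := continuous_slice hψ.continuous' t
  have hc2 := continuous_slice (hu i).continuous' t
  simp only [List.ofFn_zero, dw_nil, Nat.zero_add, pow_one]
  refine cube_integral_mono ((hc1.mul hc2).pow 2) (hc2.pow 2) fun x _ => ?_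
  rw [mul_pow]
  exact mul_le_of_le_one_left (sq_nonneg _) (pow_le_one₀ (cut_nonneg _) (cut_le_one _))

/-- Nested cutoffs: the larger one equals one where the smaller one does not vanish. -/
theorem cut_eq_one_of_ne {ρ ρ' σ σ' : ℝ} (h0 : 0 < ρ) (h1 : ρ < ρ') (h2 : ρ' ≤ σ) (h3 : σ < σ')
    {p : ST(d)} (h : cut ρ ρ' p ≠ 0) : cut σ σ' p = 1 := by
  refine cut_eq_one (by linarith) h3 fun i => ?_
  by_contra hi
  push Not at hi
  exact h (cut_eq_zero h0 h1 (i := i) (by linarith))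

theorem wen_zero_pd_le (hu : ∀ i, Sm (u i)) {ρ ρ' σ σ' : ℝ} (h0 : 0 < ρ) (h1 : ρ < ρ') (h2 : ρ' ≤ σ)
    (h3 : σ < σ') (l : Fin d) (t : ℝ) :
    wen N (cut ρ ρ') 0 (fun i => pd l (u i)) t ≤ wen N (cut σ σ') 1 u t := by
  refine cube_integral_mono
    (continuous_slice (sden_smooth (cut_smooth _ _) (fun i => (hu i).pd l) 0).continuous' t)
    (continuous_slice (sden_smooth (cut_smooth _ _) hu 1).continuous' t) fun x _ => ?_
  refine sum_le_sum fun i _ => ?_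
  simp only [Finset.univ_unique, Finset.sum_singleton, List.ofFn_zero, dw_nil, Nat.zero_add, pow_one]
  by_cases h : cut ρ ρ' (t, x) = 0
  · rw [h]
    simp only [zero_mul]
    exact le_trans (by norm_num) (sum_nonneg fun _ _ => sq_nonneg _)
  · have e := cut_eq_one_of_ne h0 h1 h2 h3 h
    refine le_trans ?_ (single_le_sum (f := fun w : Fin 1 → Fin d =>
      (cut σ σ' (t, x) ^ (1 + 1) * dw (List.ofFn w) (u i) (t, x)) ^ 2)
      (fun _ _ => sq_nonneg _) (Finset.mem_univ fun _ => l))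
    rw [e, mul_pow]
    simp only [List.ofFn_succ, List.ofFn_zero, dw_cons, dw_nil, one_pow, one_mul]
    exact mul_le_of_le_one_left (sq_nonneg _) (pow_le_one₀ (cut_nonneg _) (cut_le_one _))

theorem integral_wen_dw (hm : 1 ≤ m) (hlam : 0 < lam) (hK : 0 ≤ K) {V : List (Fin d)} :
    (∀ l ∈ V, l ≠ N) → ∀ {ρ ρ' τ : ℝ}, 0 < ρ → ρ < ρ' → ρ' < 1 / 2 → 0 < τ → τ < 1 / 2 →
    ∃ C : ℝ, 0 ≤ C ∧ ∀ u : Fin n → ST(d) → ℝ, Sol m N K lam u →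
      ∫ t in (-τ)..0, wen N (cut ρ ρ') 0 (fun i => dw V (u i)) t ≤ C * msq N u := by
  induction V with
  | nil =>
    intro _ ρ ρ' τ h0 h1 h2 h3 h4
    refine ⟨1, zero_le_one, fun u hu => ?_⟩
    simp only [dw_nil, one_mul]
    have hs : ∀ i, Sm fun p => u i p ^ 2 := fun i => ContDiff.pow (hu.smooth i) 2
    have hcs : Continuous fun t => ∑ i, ∫ x in cube (lo N), u i (t, x) ^ 2 :=
      continuous_finsetSum _ fun i _ => continuous_integral_cube (hs i) _
    have hw := wen_continuous (N := N) (cut_smooth (d := d) ρ ρ') hu.smooth 0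
    refine (intervalIntegral.integral_mono_on (by linarith) (hw.intervalIntegrable _ _)
      (hcs.intervalIntegrable _ _) fun t _ => wen_zero_le hu.smooth ρ ρ' t).trans ?_
    refine intervalIntegral.integral_mono_interval (by linarith) (by linarith) le_rfl
      (Filter.Eventually.of_forall fun t => sum_nonneg fun i _ =>
        setIntegral_nonneg (measurableSet_cube _) fun _ _ => sq_nonneg _) (hcs.intervalIntegrable _ _)
  | cons l V ih =>
    intro hV ρ ρ' τ h0 h1 h2 h3 h4
    have hV' : ∀ k ∈ V, k ≠ N := fun k hk => hV k (List.mem_cons_of_mem _ hk)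
    set σ := (ρ' + 1 / 2) / 2 with hσ
    set τ' := (τ + 1 / 2) / 2 with hτ'
    obtain ⟨C, hC, hI⟩ := ih hV' (ρ := ρ') (ρ' := σ) (τ := τ') (by linarith) (by linarith)
      (by linarith) (by linarith) (by linarith)
    obtain ⟨c, D, hc, hD, hcac⟩ := caccioppoli (n := n) (m := m) (N := N) hm hlam hK (ρ := ρ') (ρ' := σ)
      (by linarith) (by linarith) (by linarith)
    refine ⟨D * C / (c * (τ' - τ)), div_nonneg (by positivity) (mul_nonneg hc.le (by linarith)),
      fun u hu => ?_⟩
    have hv := hu.dw hV'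
    have a1 := hI u hu
    have a2 := hcac _ hv (-τ') 0 (by linarith) (by linarith) le_rfl
    have hw1 := wen_continuous (N := N) (cut_smooth (d := d) ρ' σ) hv.smooth 1
    have hwl := wen_continuous (N := N) (cut_smooth (d := d) ρ ρ')
      (fun i => (hv.smooth i).pd l) 0
    have a3 : 0 ≤ (0 - -τ') * ∑ i, ∫ x in cube (lo N),
        (cut ρ' σ (0, x) ^ (m + 1) * dw V (u i) (0, x)) ^ 2 :=
      mul_nonneg (by linarith) (sum_nonneg fun i _ =>
        setIntegral_nonneg (measurableSet_cube _) fun _ _ => sq_nonneg _)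
    have a4 : (τ' - τ) * ∫ t in (-τ)..0, wen N (cut ρ ρ') 0 (fun i => dw (l :: V) (u i)) t ≤
        ∫ t in (-τ')..0, (t - -τ') * wen N (cut ρ' σ) 1 (fun i => dw V (u i)) t := by
      rw [← intervalIntegral.integral_const_mul]
      refine le_trans (intervalIntegral.integral_mono_on
        (g := fun t => (t - -τ') * wen N (cut ρ' σ) 1 (fun i => dw V (u i)) t) (by linarith)
        ((continuous_const.mul hwl).intervalIntegrable _ _)
        (Continuous.intervalIntegrable (by fun_prop) _ _) fun t ht => ?_) ?_
      · exact mul_le_mul (by linarith [ht.1]) (wen_zero_pd_le hv.smooth h0 h1 le_rfl (by linarith) l t)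
          (wen_nonneg _ _) (by linarith [ht.1])
      · refine intervalIntegral.integral_mono_interval (by linarith) (by linarith) le_rfl ?_
          (Continuous.intervalIntegrable (by fun_prop) _ _)
        refine (ae_restrict_iff' measurableSet_Ioc).2 (Filter.Eventually.of_forall fun t ht => ?_)
        exact mul_nonneg (by linarith [ht.1]) (wen_nonneg _ _)
    have hpos : 0 < c * (τ' - τ) := mul_pos hc (by linarith)
    rw [div_mul_eq_mul_div, le_div_iff₀ hpos]
    have a5 := mul_le_mul_of_nonneg_left a1 hD
    have a6 := mul_le_mul_of_nonneg_left a4 hc.le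
    linarith

/-- Tangential derivatives are bounded in `L²` uniformly in time. -/
theorem integral_sq_cut_dw_le (hm : 1 ≤ m) (hlam : 0 < lam) (hK : 0 ≤ K) {V : List (Fin d)}
    (hV : ∀ l ∈ V, l ≠ N) {ρ ρ' τ : ℝ} (h0 : 0 < ρ) (h1 : ρ < ρ') (h2 : ρ' < 1 / 2) (h3 : 0 < τ)
    (h4 : τ < 1 / 2) : ∃ C : ℝ, 0 ≤ C ∧ ∀ u : Fin n → ST(d) → ℝ, Sol m N K lam u →
      ∀ t ∈ Icc (-τ) 0, ∀ i,
      ∫ x in cube (lo N), (cut ρ ρ' (t, x) * dw V (u i) (t, x)) ^ 2 ≤ C * msq N u := by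
  set σ := (ρ' + 1 / 2) / 2 with hσ
  set τ' := (τ + 1 / 2) / 2 with hτ'
  obtain ⟨C, hC, hI⟩ := integral_wen_dw (n := n) (m := m) hm hlam hK hV (ρ := ρ') (ρ' := σ) (τ := τ')
    (by linarith) (by linarith) (by linarith) (by linarith) (by linarith)
  obtain ⟨c, D, hc, hD, hcac⟩ := caccioppoli (n := n) (m := m) (N := N) hm hlam hK (ρ := ρ') (ρ' := σ)
    (by linarith) (by linarith) (by linarith)
  refine ⟨D * C / (τ' - τ), div_nonneg (by positivity) (by linarith), fun u hu t ht i => ?_⟩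
  have hv := hu.dw hV
  have hw0 := wen_continuous (N := N) (cut_smooth (d := d) ρ' σ) hv.smooth 0
  have a1 := hI u hu
  have a2 := hcac _ hv (-τ') t (by linarith) (by linarith [ht.1]) ht.2
  have a3 : 0 ≤ ∫ t in (-τ')..t, (t - -τ') * wen N (cut ρ' σ) 1 (fun i => dw V (u i)) t :=
    intervalIntegral.integral_nonneg (by linarith [ht.1]) fun s hs =>
      mul_nonneg (by linarith [hs.1]) (wen_nonneg _ _)
  have a4 : ∫ t in (-τ')..t, wen N (cut ρ' σ) 0 (fun i => dw V (u i)) t ≤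
      ∫ t in (-τ')..0, wen N (cut ρ' σ) 0 (fun i => dw V (u i)) t :=
    intervalIntegral.integral_mono_interval le_rfl (by linarith [ht.1]) ht.2
      (Filter.Eventually.of_forall fun t => wen_nonneg _ _) (hw0.intervalIntegrable _ _)
  have hcc : ∀ (r r' : ℝ) q, Continuous fun x => (cut r r' (t, x) ^ q * dw V (u i) (t, x)) ^ 2 :=
    fun r r' q => ((continuous_slice (ContDiff.pow (cut_smooth r r') q).continuous t).mul
      (continuous_slice (hv.smooth i).continuous' t)).pow 2
  have a5 : ∫ x in cube (lo N), (cut ρ ρ' (t, x) * dw V (u i) (t, x)) ^ 2 ≤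
      ∑ i, ∫ x in cube (lo N), (cut ρ' σ (t, x) ^ (m + 1) * dw V (u i) (t, x)) ^ 2 := by
    refine le_trans ?_ (single_le_sum (f := fun i => ∫ x in cube (lo N),
      (cut ρ' σ (t, x) ^ (m + 1) * dw V (u i) (t, x)) ^ 2) (fun i _ =>
        setIntegral_nonneg (measurableSet_cube _) fun _ _ => sq_nonneg _) (Finset.mem_univ i))
    refine cube_integral_mono (by simpa using hcc ρ ρ' 1) (hcc _ _ _) fun x _ => ?_
    by_cases h : cut ρ ρ' (t, x) = 0
    · rw [h, zero_mul]
      exact le_trans (by norm_num) (sq_nonneg _)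
    · rw [cut_eq_one_of_ne h0 h1 le_rfl (by linarith) h, mul_pow]
      simp only [one_pow, one_mul]
      exact mul_le_of_le_one_left (sq_nonneg _) (pow_le_one₀ (cut_nonneg _) (cut_le_one _))
  rw [div_mul_eq_mul_div, le_div_iff₀ (by linarith)]
  set S := ∑ i, ∫ x in cube (lo N), (cut ρ' σ (t, x) ^ (m + 1) * dw V (u i) (t, x)) ^ 2
  have hS : 0 ≤ S := sum_nonneg fun i _ =>
        setIntegral_nonneg (measurableSet_cube _) fun _ _ => sq_nonneg _
  have a6 := mul_le_mul_of_nonneg_left (a4.trans a1) hD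
  have a7 : (∫ x in cube (lo N), (cut ρ ρ' (t, x) * dw V (u i) (t, x)) ^ 2) * (τ' - τ) ≤
      (t - -τ') * S := by
    rw [mul_comm]
    exact mul_le_mul (by linarith [ht.1]) a5 (setIntegral_nonneg (measurableSet_cube _)
      fun _ _ => sq_nonneg _) (by linarith [ht.1])
  have a8 := mul_nonneg hc.le a3
  linarith

end cacc

/-- Vanishing outside the box of radius `ρ`. -/
def VanFar {d : ℕ} (ρ : ℝ) (f : ST(d) → ℝ) : Prop := ∀ p, (∃ i, ρ < |p.2 i|) → f p = 0

section sobolev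

variable {d n m : ℕ} {N : Fin d} {K lam ρ : ℝ} {f : ST(d) → ℝ}

theorem VanFar.pd (h : VanFar ρ f) (l : Fin d) : VanFar ρ (pd l f) := by
  intro p hp
  have h1 : f =ᶠ[𝓝 p] fun _ => 0 := by
    filter_upwards [(isOpen_far ρ).mem_nhds hp] with q hq using h q hq
  rw [BDE.pd, dv, h1.fderiv_eq]
  simp

theorem VanFar.dw (h : VanFar ρ f) : ∀ W : List (Fin d), VanFar ρ (dw W f)
  | [] => h
  | l :: W => (VanFar.dw h W).pd l

theorem sq_le_integral_pd (hf : Sm f) (h : VanFar ρ f) (hρ : ρ < 1 / 2) (t : ℝ) (x : Fin d → ℝ)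
    (l : Fin d) :
    f (t, x) ^ 2 ≤ ∫ s in (-(1 / 2) : ℝ)..(1 / 2), pd l f (t, update x l s) ^ 2 := by
  have hc : Continuous fun s => pd l f (t, update x l s) := ContDiff.continuous (sm_line (hf.pd l) t x l)
  by_cases hx : |x l| ≤ 1 / 2
  · rw [abs_le] at hx
    have h1 : ∫ s in (-(1 / 2) : ℝ)..(x l), pd l f (t, update x l s) = f (t, x) := by
      rw [intervalIntegral.integral_eq_sub_of_hasDerivAt
        (fun s _ => BDE.hasDerivAt_update hf t x l s) (hc.intervalIntegrable _ _),
        Function.update_eq_self, h (t, update x l (-(1 / 2))) ⟨l, ?_⟩, sub_zero]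
      simp only [Function.update_self]
      rw [abs_neg, abs_of_pos (by norm_num)]
      exact hρ
    rw [← h1]
    refine (intervalIntegral_sq_le hx.1 hc).trans ?_
    have h2 : ∫ s in (-(1 / 2) : ℝ)..(x l), pd l f (t, update x l s) ^ 2 ≤
        ∫ s in (-(1 / 2) : ℝ)..(1 / 2), pd l f (t, update x l s) ^ 2 :=
      intervalIntegral.integral_mono_interval le_rfl hx.1 hx.2
        (Filter.Eventually.of_forall fun s => sq_nonneg _) ((hc.pow 2).intervalIntegrable _ _)
    have h3 : 0 ≤ ∫ s in (-(1 / 2) : ℝ)..(x l), pd l f (t, update x l s) ^ 2 :=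
      intervalIntegral.integral_nonneg hx.1 fun s _ => sq_nonneg _
    exact le_trans (mul_le_of_le_one_left h3 (by linarith)) h2
  · rw [h (t, x) ⟨l, by push Not at hx; simpa using hρ.trans hx⟩]
    exact le_trans (by norm_num) (intervalIntegral.integral_nonneg (by norm_num) fun s _ => sq_nonneg _)

/-- The one-dimensional factors of Lebesgue measure on the cube. -/
noncomputable def cubeMeas (N : Fin d) (i : Fin d) : Measure ℝ :=
  volume.restrict (Icc (lo N i) (lo N i + 1))

instance (i : Fin d) : IsFiniteMeasure (cubeMeas N i) := by
  unfold cubeMeas; infer_instance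

theorem pi_cubeMeas : Measure.pi (cubeMeas N) = volume.restrict (cube (lo N)) := by
  unfold cubeMeas cube
  rw [← Measure.restrict_pi_pi, ← pi_univ_Icc]
  rfl

theorem measurable_ofReal_sq (hf : Sm f) (t : ℝ) : Measurable fun x => ENNReal.ofReal (f (t, x) ^ 2) :=
  ENNReal.measurable_ofReal.comp ((continuous_slice hf.continuous' t).pow 2).measurable

theorem lmarginal_sq_le (hf : Sm f) (h : VanFar ρ f) (hρ : ρ < 1 / 2) (t : ℝ) {S : Finset (Fin d)}
    (hN : N ∈ S) : ∀ {W : List (Fin d)}, W.Nodup → (∀ l ∈ W, l ∉ S) →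
    lmarginal (cubeMeas N) S (fun x => ENNReal.ofReal (f (t, x) ^ 2)) ≤
      lmarginal (cubeMeas N) (S ∪ W.toFinset) (fun x => ENNReal.ofReal (dw W f (t, x) ^ 2))
  | [], _, _ => by simp [BDE.dw]
  | l :: W, hnd, hd => by
    rw [List.nodup_cons] at hnd
    refine (lmarginal_sq_le hf h hρ t hN hnd.2 fun k hk => hd k (List.mem_cons_of_mem _ hk)).trans ?_
    have hl : l ∉ S ∪ W.toFinset := by
      simp [hnd.1, hd l List.mem_cons_self]
    have hlN : l ≠ N := fun h => hd l List.mem_cons_self (h ▸ hN)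
    rw [List.toFinset_cons, Finset.union_insert,
      lmarginal_insert' _ (measurable_ofReal_sq (hf.dw (l :: W)) t) hl]
    refine lmarginal_mono fun x => ?_
    have hc : Continuous fun s => pd l (BDE.dw W f) (t, update x l s) ^ 2 :=
      (ContDiff.continuous (sm_line ((hf.dw W).pd l) t x l)).pow 2
    have h1 := sq_le_integral_pd (hf.dw W) (h.dw W) hρ t x l
    rw [intervalIntegral.integral_of_le (by norm_num), ← integral_Icc_eq_integral_Ioc] at h1
    refine (ENNReal.ofReal_le_ofReal h1).trans ?_
    rw [ofReal_integral_eq_lintegral_ofReal hc.integrableOn_Icc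
      (Filter.Eventually.of_forall fun s => sq_nonneg _)]
    simp only [cubeMeas, lo, if_neg hlN]
    norm_num
    rfl

theorem integral_line_sq_le (hf : Sm f) (h : VanFar ρ f) (hρ : ρ < 1 / 2) (t : ℝ) (x : Fin d → ℝ) :
    ∫ s in 0..1, f (t, update x N s) ^ 2 ≤
      ∫ y in cube (lo N), dw ((Finset.univ.erase N).toList) f (t, y) ^ 2 := by
  have h1 := lmarginal_sq_le hf h hρ t (N := N) (S := {N}) (by simp)
    (W := (Finset.univ.erase N).toList) (Finset.nodup_toList _) (by simp) x
  have h2 : ({N} : Finset (Fin d)) ∪ (Finset.univ.erase N).toList.toFinset = Finset.univ := by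
    ext i; simp
  rw [h2, ← lintegral_eq_lmarginal_univ, pi_cubeMeas, lmarginal_singleton] at h1
  have hc : Continuous fun s => f (t, update x N s) ^ 2 := (ContDiff.continuous (sm_line hf t x N)).pow 2
  have hc2 : Continuous fun y => BDE.dw ((Finset.univ.erase N).toList) f (t, y) ^ 2 :=
    (continuous_slice (hf.dw _).continuous' t).pow 2
  rw [← ofReal_integral_eq_lintegral_ofReal (integrableOn_cube hc2)
    (Filter.Eventually.of_forall fun s => sq_nonneg _)] at h1
  simp only [cubeMeas, lo, if_true, zero_add] at h1
  rw [← ofReal_integral_eq_lintegral_ofReal hc.integrableOn_Icc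
    (Filter.Eventually.of_forall fun s => sq_nonneg _),
    ENNReal.ofReal_le_ofReal_iff (setIntegral_nonneg (measurableSet_cube _) fun _ _ => sq_nonneg _)] at h1
  rwa [intervalIntegral.integral_of_le (by norm_num), ← integral_Icc_eq_integral_Ioc]

/-- Derivatives of a cut-off solution are bounded in `L²` uniformly in time. -/
theorem integral_sq_dw_mul_le (hm : 1 ≤ m) (hlam : 0 < lam) (hK : 0 ≤ K) (h0 : 0 < ρ)
    (h2 : ρ < 1 / 2) {τ : ℝ} (h3 : 0 < τ) (h4 : τ < 1 / 2) : ∀ {W : List (Fin d)},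
    (∀ l ∈ W, l ≠ N) → ∀ {V : List (Fin d)}, (∀ l ∈ V, l ≠ N) → ∀ {φ : ST(d) → ℝ}, Sm φ →
    VanFar ρ φ → ∃ C : ℝ, 0 ≤ C ∧ ∀ u : Fin n → ST(d) → ℝ, Sol m N K lam u →
      ∀ t ∈ Icc (-τ) 0, ∀ i,
      ∫ x in cube (lo N), dw W (fun p => φ p * dw V (u i) p) (t, x) ^ 2 ≤ C * msq N u
  | [], _, V, hV, φ, hφ, hφ0 => by
    obtain ⟨C, hC, h⟩ := integral_sq_cut_dw_le (n := n) (m := m) hm hlam hK hV (ρ := ρ)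
      (ρ' := (ρ + 1 / 2) / 2) h0 (by linarith) (by linarith) h3 h4
    obtain ⟨B, hB⟩ := ((isCompact_Icc (a := -τ) (b := (0 : ℝ))).prod
      (isCompact_cube (lo N))).exists_bound_of_continuousOn hφ.continuous'.continuousOn
    refine ⟨B ^ 2 * C, by positivity, fun u hu t ht i => ?_⟩
    have hs := (hu.smooth i).dw V
    have hcu : Continuous fun x => (cut ρ ((ρ + 1 / 2) / 2) (t, x) * BDE.dw V (u i) (t, x)) ^ 2 :=
      ((continuous_slice (cut_smooth _ _).continuous' t).mul (continuous_slice hs.continuous' t)).pow 2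
    have h5 : ∫ x in cube (lo N), (φ (t, x) * BDE.dw V (u i) (t, x)) ^ 2 ≤ ∫ x in cube (lo N),
        B ^ 2 * (cut ρ ((ρ + 1 / 2) / 2) (t, x) * BDE.dw V (u i) (t, x)) ^ 2 := by
      refine cube_integral_mono (((continuous_slice hφ.continuous' t).mul
        (continuous_slice hs.continuous' t)).pow 2) (continuous_const.mul hcu) fun x hx => ?_
      by_cases hfar : ∃ i, ρ < |x i|
      · rw [hφ0 (t, x) hfar, zero_mul]
        exact le_trans (by norm_num) (mul_nonneg (sq_nonneg B) (sq_nonneg _))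
      · push Not at hfar
        rw [cut_eq_one h0 (by linarith) hfar, one_mul, mul_pow]
        refine mul_le_mul_of_nonneg_right ?_ (sq_nonneg _)
        rw [← sq_abs]
        exact pow_le_pow_left₀ (abs_nonneg _) (hB (t, x) ⟨ht, hx⟩) 2
    rw [integral_const_mul] at h5
    have h6 := mul_le_mul_of_nonneg_left (h u hu t ht i) (sq_nonneg B)
    simp only [BDE.dw_nil]
    linarith
  | l :: W, hW, V, hV, φ, hφ, hφ0 => by
    have hW' : ∀ l ∈ W, l ≠ N := fun k hk => hW k (List.mem_cons_of_mem _ hk)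
    obtain ⟨C₁, hC₁, a1⟩ := integral_sq_dw_mul_le hm hlam hK h0 h2 h3 h4 hW' hV (hφ.pd l) (hφ0.pd l)
    obtain ⟨C₂, hC₂, a2⟩ := integral_sq_dw_mul_le hm hlam hK h0 h2 h3 h4 hW' (V := l :: V)
      (fun k hk => by
        rcases List.mem_cons.1 hk with rfl | hk
        exacts [hW _ List.mem_cons_self, hV k hk]) hφ hφ0
    refine ⟨2 * C₁ + 2 * C₂, by positivity, fun u hu t ht i => ?_⟩
    have hs := (hu.smooth i).dw V
    have s1 : Sm fun p => BDE.pd l φ p * BDE.dw V (u i) p := ContDiff.mul (hφ.pd l) hs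
    have s2 : Sm fun p => φ p * BDE.dw (l :: V) (u i) p := ContDiff.mul hφ (hs.pd l)
    have h5 : BDE.dw (l :: W) (fun p => φ p * BDE.dw V (u i) p) = fun p =>
        BDE.dw W (fun p => BDE.pd l φ p * BDE.dw V (u i) p) p +
          BDE.dw W (fun p => φ p * BDE.dw (l :: V) (u i) p) p := by
      rw [← dw_add W s1 s2, dw_cons, show BDE.pd l (BDE.dw W fun p => φ p * BDE.dw V (u i) p) =
        BDE.dw W (BDE.pd l fun p => φ p * BDE.dw V (u i) p) from
          dw_comm (ContDiff.mul hφ hs) [l] W]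
      congr 1
      exact dv_mul hφ hs
    have c1 : Continuous fun x => BDE.dw W (fun p => BDE.pd l φ p * BDE.dw V (u i) p) (t, x) ^ 2 :=
      (continuous_slice (s1.dw W).continuous' t).pow 2
    have c2 : Continuous fun x => BDE.dw W (fun p => φ p * BDE.dw (l :: V) (u i) p) (t, x) ^ 2 :=
      (continuous_slice (s2.dw W).continuous' t).pow 2
    have c1' : Continuous fun x => 2 * BDE.dw W (fun p => BDE.pd l φ p * BDE.dw V (u i) p) (t, x) ^ 2 :=
      continuous_const.mul c1
    have c2' : Continuous fun x => 2 * BDE.dw W (fun p => φ p * BDE.dw (l :: V) (u i) p) (t, x) ^ 2 :=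
      continuous_const.mul c2
    have h6 : ∫ x in cube (lo N), BDE.dw (l :: W) (fun p => φ p * BDE.dw V (u i) p) (t, x) ^ 2 ≤
        ∫ x in cube (lo N), (2 * BDE.dw W (fun p => BDE.pd l φ p * BDE.dw V (u i) p) (t, x) ^ 2 +
          2 * BDE.dw W (fun p => φ p * BDE.dw (l :: V) (u i) p) (t, x) ^ 2) := by
      refine cube_integral_mono ?_ (c1'.add c2') fun x _ => ?_
      · exact (continuous_slice (Sm.dw (ContDiff.mul hφ hs) _).continuous' t).pow 2
      · rw [h5]
        exact add_sq_le.trans_eq (by ring)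
    rw [integral_add (integrableOn_cube c1') (integrableOn_cube c2'), integral_const_mul,
      integral_const_mul] at h6
    have h7 := a1 u hu t ht i
    have h8 := a2 u hu t ht i
    linarith

/-- `L²` bounds on normal lines for tangential derivatives. -/
theorem integral_line_le (hm : 1 ≤ m) (hlam : 0 < lam) (hK : 0 ≤ K) {V : List (Fin d)}
    (hV : ∀ l ∈ V, l ≠ N) {ρ ρ' τ : ℝ} (h0 : 0 < ρ) (h1 : ρ < ρ') (h2 : ρ' < 1 / 2) (h3 : 0 < τ)
    (h4 : τ < 1 / 2) : ∃ C : ℝ, 0 ≤ C ∧ ∀ u : Fin n → ST(d) → ℝ, Sol m N K lam u →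
      ∀ t ∈ Icc (-τ) 0, ∀ x : Fin d → ℝ, (∀ l, l ≠ N → |x l| ≤ ρ) → ∀ i,
      ∫ s in 0..1, (chi ρ ρ' s * dw V (u i) (t, update x N s)) ^ 2 ≤ C * msq N u := by
  have hfar : VanFar ρ' (cut (d := d) ρ ρ') := fun p ⟨i, hi⟩ => cut_eq_zero h0 h1 hi.le
  obtain ⟨C, hC, h⟩ := integral_sq_dw_mul_le (n := n) (m := m) hm hlam hK (h0.trans h1) h2 h3 h4
    (W := (Finset.univ.erase N).toList) (by simp) hV (cut_smooth ρ ρ') hfar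
  refine ⟨C, hC, fun u hu t ht x hx i => le_trans (le_of_eq ?_) ((integral_line_sq_le
    (ContDiff.mul (cut_smooth ρ ρ') ((hu.smooth i).dw V))
    (fun p hp => by rw [hfar p hp, zero_mul]) h2 t x).trans (h u hu t ht i))⟩
  congr 1
  funext s
  congr 2
  rw [cut, ← Finset.mul_prod_erase _ _ (Finset.mem_univ N), Finset.prod_eq_one, mul_one]
  · simp
  · intro l hl
    have hl := Finset.ne_of_mem_erase hl
    simp only [Function.update_of_ne hl]
    exact chi_eq_one h0 h1 (hx l hl)

end sobolev

section lines
variable {d n m : ℕ} {N : Fin d} {K lam : ℝ} {ρ ρ' σ σ' : ℝ} {f : ST(d) → ℝ}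

/-- The localized restriction of a function to a line in the normal direction. -/
noncomputable def tl (N : Fin d) (ρ ρ' : ℝ) (f : ST(d) → ℝ) (t : ℝ) (x : Fin d → ℝ)
    (s : ℝ) : ℝ := chi ρ ρ' s * f (t, update x N s)

theorem tl_smooth (hf : Sm f) (t : ℝ) (x : Fin d → ℝ) : Sm (tl N ρ ρ' f t x) :=
  ContDiff.mul (chi_smooth ρ ρ') (sm_line hf t x N)

theorem eventually_chi_eq_zero (h0 : 0 < ρ) (h1 : ρ < ρ') {s : ℝ} (hs : ρ' < |s|) :
    chi ρ ρ' =ᶠ[𝓝 s] fun _ => 0 := by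
  have h : ∀ᶠ r in 𝓝 s, ρ' < |r| := continuous_abs.continuousAt.eventually (eventually_gt_nhds hs)
  filter_upwards [h] with r hr
  exact chi_eq_zero h0 h1 hr.le

theorem iteratedDeriv_chi_eq_zero (h0 : 0 < ρ) (h1 : ρ < ρ') {s : ℝ} (hs : ρ' < |s|) (q : ℕ) :
    iteratedDeriv q (chi ρ ρ') s = 0 := by
  rw [(eventually_chi_eq_zero h0 h1 hs).iteratedDeriv_eq]
  simp

theorem tl_flat (h0 : 0 < ρ) (h1 : ρ < ρ') (h2 : ρ' < 1) (hf : Sm f) {t : ℝ} {x : Fin d → ℝ}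
    (hz : ∀ k < m, dw (List.replicate k N) f (t, update x N 0) = 0) :
    Flat m (tl N ρ ρ' f t x) := by
  intro j hj
  refine ⟨?_, ?_⟩
  · unfold tl
    rw [iteratedDeriv_mul_sm (chi_smooth ρ ρ') (sm_line hf t x N)]
    refine sum_eq_zero fun i _ => ?_
    rw [iteratedDeriv_line hf]
    exact mul_eq_zero_of_right _ (hz (j - i) (by omega))
  · have h : tl N ρ ρ' f t x =ᶠ[𝓝 1] fun _ => 0 := by
      filter_upwards [eventually_chi_eq_zero h0 h1 (s := 1) (by simpa using h2)] with r hr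
      rw [tl, hr, zero_mul]
    rw [h.iteratedDeriv_eq]
    simp

theorem mul_iteratedDeriv_tl (h0 : 0 < ρ) (h1 : ρ < ρ') (hf : Sm f) (t : ℝ) (x : Fin d → ℝ)
    {φ : ℝ → ℝ} (hφ : ∀ s, ρ ≤ |s| → φ s = 0) (q : ℕ) (s : ℝ) :
    φ s * iteratedDeriv q (tl N ρ ρ' f t x) s =
      φ s * dw (List.replicate q N) f (t, update x N s) := by
  rcases le_or_gt ρ |s| with hs | hs
  · rw [hφ s hs, zero_mul, zero_mul]
  · have h : tl N ρ ρ' f t x =ᶠ[𝓝 s] fun s => f (t, update x N s) := by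
      have h : ∀ᶠ r in 𝓝 s, |r| < ρ := continuous_abs.continuousAt.eventually (eventually_lt_nhds hs)
      filter_upwards [h] with r hr
      rw [tl, chi_eq_one h0 h1 hr.le, one_mul]
    rw [h.iteratedDeriv_eq, iteratedDeriv_line hf]

theorem hasDerivAt_tl (hf : Sm f) (t : ℝ) (x : Fin d → ℝ) (s : ℝ) :
    HasDerivAt (fun t => tl N ρ ρ' f t x s) (tl N ρ ρ' (td f) t x s) t :=
  (hasDerivAt_td hf _ t).const_mul _

theorem continuous_tl (hf : Continuous f) (x : Fin d → ℝ) :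
    Continuous fun p : ℝ × ℝ => tl N ρ ρ' f p.1 x p.2 := by
  unfold tl
  exact ((chi_smooth ρ ρ').continuous.comp continuous_snd).mul
    (hf.comp (continuous_fst.prodMk (continuous_const.update N continuous_snd)))

theorem hasDerivAt_integral_tl (hf : Sm f) (t : ℝ) (x : Fin d → ℝ) {z : ℝ → ℝ}
    (hz : Continuous z) :
    HasDerivAt (fun t => ∫ s in 0..1, tl N ρ ρ' f t x s * z s)
      (∫ s in 0..1, tl N ρ ρ' (td f) t x s * z s) t := by
  have h := hasDerivAt_integral_of_continuous (K := Icc (0 : ℝ) 1) (μ := volume) isCompact_Icc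
    measurableSet_Icc (by simp) (F := fun t s => tl N ρ ρ' f t x s * z s)
    (F' := fun t s => tl N ρ ρ' (td f) t x s * z s)
    ((continuous_tl hf.continuous' x).mul (hz.comp continuous_snd))
    ((continuous_tl hf.td.continuous' x).mul (hz.comp continuous_snd))
    (fun t s => (hasDerivAt_tl hf t x s).mul_const _) t
  simpa only [intervalIntegral.integral_of_le zero_le_one, ← integral_Icc_eq_integral_Ioc] using h

end lines

section word
variable {d n m : ℕ} {N : Fin d} {K lam : ℝ} {ι : Type} {e : ι → ℝ → ℝ} {μ : ι → ℝ}

/-- Regularity of order `p` in the normal direction, for solutions of the system. -/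
def Lev (n m : ℕ) {d : ℕ} (N : Fin d) (K lam : ℝ) {ι : Type} (e : ι → ℝ → ℝ) (μ : ι → ℝ) (p : ℝ) : Prop :=
  ∀ V : List (Fin d), (∀ l ∈ V, l ≠ N) → ∀ ρ ρ' τ : ℝ, 0 < ρ → ρ < ρ' → ρ' < 1 / 2 → 0 < τ → τ < 1 / 2 →
    ∃ C : ℝ, 0 ≤ C ∧ ∀ u : Fin n → ST(d) → ℝ, Sol m N K lam u →
      ∀ t ∈ Icc (-τ) 0, ∀ x : Fin d → ℝ, (∀ l, l ≠ N → |x l| ≤ ρ) → ∀ i,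
        Tail m e μ (tl N ρ ρ' (dw V (u i)) t x) p (C * √(msq N u))

theorem lev_base (hm : 1 ≤ m) (hlam : 0 < lam) (hK : 0 ≤ K) (h : IsEigenSystem m e μ) :
    Lev n m N K lam e μ (-(1 / 4)) := by
  intro V hV ρ ρ' τ h0 h1 h2 h3 h4
  obtain ⟨C, hC, hb⟩ := integral_line_le (n := n) hm hlam hK hV h0 h1 h2 h3 h4
  refine ⟨√C, sqrt_nonneg _, fun u hu t ht x hx i => ?_⟩
  refine h.tail_of_nrm_le (tl_smooth ((hu.smooth i).dw V) t x).continuous (by norm_num) ?_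
  rw [← Real.sqrt_mul hC]
  exact Real.sqrt_le_sqrt (hb u hu t ht x hx i)

theorem Sol.flat_tl (hu : Sol m N K lam u) {V : List (Fin d)} (hV : ∀ l ∈ V, l ≠ N) {ρ ρ' t : ℝ}
    (h0 : 0 < ρ) (h1 : ρ < ρ') (h2 : ρ' < 1) (ht : t ∈ Icc (-1 : ℝ) 0) {x : Fin d → ℝ}
    (hx : ∀ l, l ≠ N → |x l| < 1) (i : Fin n) : Flat m (tl N ρ ρ' (BDE.dw V (u i)) t x) := by
  refine tl_flat h0 h1 h2 ((hu.smooth i).dw V) fun k hk => ?_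
  refine (hu.dw hV).bdry t ht _ (fun l => ?_) (by simp) k hk i
  by_cases hl : l = N
  · subst hl; simp
  · rw [Function.update_of_ne hl]; exact hx l hl

/-- Pairing of a localized normal derivative of order less than `2m`. -/
theorem Lev.pairing (hm : 1 ≤ m) (h : IsEigenSystem m e μ) {p : ℝ}
    (hs : ∀ j : ℤ, (j : ℝ) / 2 ≠ p) (hL : Lev n m N K lam e μ p) {V : List (Fin d)}
    (hV : ∀ l ∈ V, l ≠ N) {q : ℕ} (hq : q < 2 * m) {ρ ρ' τ : ℝ} (h0 : 0 < ρ) (h1 : ρ < ρ')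
    (h2 : ρ' < 1 / 2) (h3 : 0 < τ) (h4 : τ < 1 / 2) {φ : ℝ → ℝ} (hφ : Sm φ)
    (hφ0 : ∀ s, ρ' < |s| → φ s = 0) :
    ∃ C : ℝ, 0 ≤ C ∧ ∀ u : Fin n → ST(d) → ℝ, Sol m N K lam u →
      ∀ t ∈ Icc (-τ) 0, ∀ x : Fin d → ℝ, (∀ l, l ≠ N → |x l| ≤ ρ) → ∀ (j : Fin n) (i : ℕ) (a : ι → ℝ),
        |∫ s in 0..1, φ s * dw (List.replicate q N) (dw V (u j)) (t, update x N s) *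
          comb e (blk m μ i) a s| ≤
        C * √(msq N u) * pw i (-min (1 / 2) (p - 2 * m + 1)) * nrm (comb e (blk m μ i) a) := by
  obtain ⟨σ, hσ, hσ'⟩ := exists_between h2
  obtain ⟨σ', hs1, hs2⟩ := exists_between hσ'
  obtain ⟨C1, hC1, H1⟩ := hL V hV σ σ' τ (by linarith) hs1 hs2 h3 h4
  obtain ⟨C2, hC2, H2⟩ := h.pairing hm hφ hs hq
  refine ⟨C2 * C1, by positivity, fun u hu t ht x hx j i a => ?_⟩
  have hx' : ∀ l, l ≠ N → |x l| ≤ σ := fun l hl => (hx l hl).trans (by linarith)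
  have h5 := H2 _ _ (tl_smooth ((hu.smooth j).dw V) t x)
    (hu.flat_tl hV (by linarith) hs1 (by linarith) ⟨by linarith [ht.1], ht.2⟩
      (fun l hl => lt_of_le_of_lt (hx' l hl) (by linarith)) j) (H1 u hu t ht x hx' j) i a
  simp only [mul_iteratedDeriv_tl (ρ := σ) (ρ' := σ') (by linarith) hs1 ((hu.smooth j).dw V) t x
    (fun s hs => hφ0 s (lt_of_lt_of_le hσ hs)) q] at h5
  rw [← mul_assoc] at h5
  exact h5

theorem continuous_line {f : ST(d) → ℝ} (hf : Sm f) (t : ℝ) (x : Fin d → ℝ) (l : Fin d) :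
    Continuous fun s => f (t, update x l s) := (sm_line hf t x l).continuous

/-- Pairing of the top order normal derivative. -/
theorem Lev.pairing_top (hm : 1 ≤ m) (h : IsEigenSystem m e μ) {p : ℝ}
    (hs : ∀ j : ℤ, (j : ℝ) / 2 ≠ p) (hL : Lev n m N K lam e μ p) {V : List (Fin d)}
    (hV : ∀ l ∈ V, l ≠ N) {ρ ρ' τ : ℝ} (h0 : 0 < ρ) (h1 : ρ < ρ')
    (h2 : ρ' < 1 / 2) (h3 : 0 < τ) (h4 : τ < 1 / 2) :
    ∃ C : ℝ, 0 ≤ C ∧ ∀ u : Fin n → ST(d) → ℝ, Sol m N K lam u →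
      ∀ t ∈ Icc (-τ) 0, ∀ x : Fin d → ℝ, (∀ l, l ≠ N → |x l| ≤ ρ) → ∀ (j : Fin n) (i : ℕ) (a : ι → ℝ),
        |(∫ s in 0..1, chi ρ ρ' s * dw (List.replicate (2 * m) N) (dw V (u j))
            (t, update x N s) * comb e (blk m μ i) a s) -
          (-1) ^ m * ∫ s in 0..1, tl N ρ ρ' (dw V (u j)) t x s *
            comb e (blk m μ i) (fun k => μ k * a k) s| ≤
        C * √(msq N u) * pw i (-min (1 / 2) (p - 2 * m + 1)) * nrm (comb e (blk m μ i) a) := by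
  choose C hC H using fun k : ℕ => hL.pairing hm h hs hV (q := 2 * m - (k + 1)) (by omega) h0 h1 h2
    h3 h4 (Sm.iterDeriv (chi_smooth ρ ρ') (k + 1))
    (fun s hs => iteratedDeriv_chi_eq_zero h0 h1 hs (k + 1))
  refine ⟨∑ k ∈ Finset.range (2 * m), ((2 * m).choose (k + 1) : ℝ) * C k,
    sum_nonneg fun k _ => mul_nonneg (Nat.cast_nonneg _) (hC k), fun u hu t ht x hx j i a => ?_⟩
  have hf := (hu.smooth j).dw V
  set f := dw V (u j) with hfdef
  set z := comb e (blk m μ i) a with hz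
  have hzs : Sm z := h.comb_smooth _ _
  have ibp := integral_iteratedDeriv_mul (tl_smooth (ρ := ρ) (ρ' := ρ') hf t x) hzs
    (hu.flat_tl hV h0 h1 (by linarith) ⟨by linarith [ht.1], ht.2⟩
      (fun l hl => lt_of_le_of_lt (hx l hl) (by linarith)) j) (h.flat_comb _ a) le_rfl
  have e1 : ∀ s, iteratedDeriv (2 * m) z s = (-1) ^ m * comb e (blk m μ i) (fun k => μ k * a k) s := by
    intro s
    rw [hz, h.comb_eq]
    simp only [comb, mul_sum]
    exact sum_congr rfl fun k _ => by ring
  have e2 : ∫ s in 0..1, tl N ρ ρ' f t x s * iteratedDeriv (2 * m) z s =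
      (-1) ^ m * ∫ s in 0..1, tl N ρ ρ' f t x s * comb e (blk m μ i) (fun k => μ k * a k) s := by
    rw [← intervalIntegral.integral_const_mul]
    exact intervalIntegral.integral_congr fun s _ => by simp only [e1]; ring
  have e3 : ∀ s, iteratedDeriv (2 * m) (tl N ρ ρ' f t x) s * z s =
      chi ρ ρ' s * dw (List.replicate (2 * m) N) f (t, update x N s) * z s +
      ∑ k ∈ Finset.range (2 * m), ((2 * m).choose (k + 1) : ℝ) *
        (iteratedDeriv (k + 1) (chi ρ ρ') s *
          dw (List.replicate (2 * m - (k + 1)) N) f (t, update x N s) * z s) := by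
    intro s
    have := iteratedDeriv_mul_sm (chi_smooth ρ ρ') (sm_line hf t x N) (2 * m) s
    unfold tl
    rw [this, Finset.sum_range_succ']
    simp only [iteratedDeriv_line hf, iteratedDeriv_zero, Nat.choose_zero_right, Nat.cast_one, one_mul,
      Nat.sub_zero]
    rw [add_mul, add_comm, sum_mul]
    congr 1
    exact sum_congr rfl fun k _ => by ring
  have c1 : ∀ k, Continuous fun s => iteratedDeriv k (chi ρ ρ') s := fun k =>
    (Sm.iterDeriv (chi_smooth ρ ρ') k).continuous
  have c2 : ∀ q, Continuous fun s => dw (List.replicate q N) f (t, update x N s) := fun q =>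
    continuous_line (hf.dw _) t x N
  have c3 : Continuous z := hzs.continuous
  have c4 : ∀ k, Continuous fun s => iteratedDeriv (k + 1) (chi ρ ρ') s *
          dw (List.replicate (2 * m - (k + 1)) N) f (t, update x N s) * z s := fun k =>
    ((c1 _).mul (c2 _)).mul c3
  have c6 : ∀ k, Continuous fun s => ((2 * m).choose (k + 1) : ℝ) *
      (iteratedDeriv (k + 1) (chi ρ ρ') s *
          dw (List.replicate (2 * m - (k + 1)) N) f (t, update x N s) * z s) := fun k =>
    continuous_const.mul (c4 k)
  have c5 : Continuous fun s => chi ρ ρ' s * dw (List.replicate (2 * m) N) f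
      (t, update x N s) * z s := ((chi_smooth ρ ρ').continuous.mul (c2 _)).mul c3
  have e4 : ∫ s in 0..1, iteratedDeriv (2 * m) (tl N ρ ρ' f t x) s * z s =
      (∫ s in 0..1, chi ρ ρ' s * dw (List.replicate (2 * m) N) f (t, update x N s) * z s) +
      ∑ k ∈ Finset.range (2 * m), ((2 * m).choose (k + 1) : ℝ) *
        ∫ s in 0..1, (iteratedDeriv (k + 1) (chi ρ ρ') s *
          dw (List.replicate (2 * m - (k + 1)) N) f (t, update x N s) * z s) := by
    simp only [e3]
    rw [intervalIntegral.integral_add (c5.intervalIntegrable _ _)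
      ((continuous_finsetSum _ fun k _ => c6 k).intervalIntegrable _ _),
      intervalIntegral.integral_finsetSum
        fun k _ => (c6 k).intervalIntegrable _ _]
    simp only [intervalIntegral.integral_const_mul]
  rw [e2, pow_mul, neg_one_sq, one_pow, one_mul, e4] at ibp
  rw [← ibp, sub_add_cancel_left, abs_neg]
  refine (abs_sum_le_sum_abs _ _).trans ?_
  rw [sum_mul, sum_mul, sum_mul]
  refine sum_le_sum fun k _ => ?_
  rw [abs_mul, Nat.abs_cast]
  calc _ ≤ ((2 * m).choose (k + 1) : ℝ) * (C k * √(msq N u) *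
        pw i (-min (1 / 2) (p - 2 * m + 1)) * nrm z) :=
        mul_le_mul_of_nonneg_left (H k u hu t ht x hx j i a) (Nat.cast_nonneg _)
    _ = _ := by ring

theorem prod_map_single (N : Fin d) (W : List (Fin d)) :
    (W.map (Pi.single N (1 : ℝ))).prod = if ∀ l ∈ W, l = N then 1 else 0 := by
  induction W with
  | nil => simp
  | cons l W ih =>
    rw [List.map_cons, List.prod_cons, ih]
    by_cases hl : l = N
    · subst hl; simp
    · simp [hl]

/-- Pairing of an arbitrary derivative of order `2m`. -/
theorem Lev.pairing_word (hm : 1 ≤ m) (h : IsEigenSystem m e μ) {p : ℝ}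
    (hs : ∀ j : ℤ, (j : ℝ) / 2 ≠ p) (hL : Lev n m N K lam e μ p) {V : List (Fin d)}
    (hV : ∀ l ∈ V, l ≠ N) {ρ ρ' τ : ℝ} (h0 : 0 < ρ) (h1 : ρ < ρ')
    (h2 : ρ' < 1 / 2) (h3 : 0 < τ) (h4 : τ < 1 / 2) {W : List (Fin d)} (hW : W.length = 2 * m) :
    ∃ C : ℝ, 0 ≤ C ∧ ∀ u : Fin n → ST(d) → ℝ, Sol m N K lam u →
      ∀ t ∈ Icc (-τ) 0, ∀ x : Fin d → ℝ, (∀ l, l ≠ N → |x l| ≤ ρ) → ∀ (j : Fin n) (i : ℕ) (a : ι → ℝ),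
        |(∫ s in 0..1, chi ρ ρ' s * dw W (dw V (u j))
            (t, update x N s) * comb e (blk m μ i) a s) -
          (W.map (Pi.single N (1 : ℝ))).prod * ((-1) ^ m * ∫ s in 0..1,
            tl N ρ ρ' (dw V (u j)) t x s * comb e (blk m μ i) (fun k => μ k * a k) s)| ≤
        C * √(msq N u) * pw i (-min (1 / 2) (p - 2 * m + 1)) * nrm (comb e (blk m μ i) a) := by
  rw [prod_map_single]
  by_cases hall : ∀ l ∈ W, l = N
  · obtain rfl : W = List.replicate (2 * m) N := List.eq_replicate_iff.2 ⟨hW, hall⟩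
    simp only [if_pos hall, one_mul]
    exact hL.pairing_top hm h hs hV h0 h1 h2 h3 h4
  · rw [if_neg hall]
    simp only [zero_mul, sub_zero]
    have hperm := List.filter_append_perm (fun l => decide (l = N)) W
    set A := W.filter fun l => decide (l = N) with hA
    set B := W.filter fun l => !decide (l = N) with hB
    have hAr : A = List.replicate A.length N :=
      List.eq_replicate_iff.2 ⟨rfl, fun l hl => by simpa using (List.mem_filter.1 hl).2⟩
    have hBt : ∀ l ∈ B, l ≠ N := fun l hl => by simpa using (List.mem_filter.1 hl).2
    have hBlen : 1 ≤ B.length := by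
      push Not at hall
      obtain ⟨l, hl, hlN⟩ := hall
      exact List.length_pos_of_mem (List.mem_filter.2 ⟨hl, by simpa using hlN⟩)
    have hlen : A.length + B.length = 2 * m := by
      rw [← hW, ← hperm.length_eq, List.length_append]
    have hVB : ∀ l ∈ B ++ V, l ≠ N := fun l hl => (List.mem_append.1 hl).elim (hBt l) (hV l)
    obtain ⟨C, hC, H⟩ := hL.pairing hm h hs hVB (q := A.length) (by omega) h0 h1 h2 h3 h4
      (chi_smooth ρ ρ') (fun s hs => chi_eq_zero h0 h1 hs.le)
    refine ⟨C, hC, fun u hu t ht x hx j i a => ?_⟩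
    have e1 : dw W (dw V (u j)) = dw (List.replicate A.length N) (dw (B ++ V) (u j)) := by
      rw [dw_perm ((hu.smooth j).dw V) hperm.symm, dw_append, dw_append, ← hAr]
    rw [e1]
    exact H u hu t ht x hx j i a

theorem legHad_single {A : (Fin d → ℕ) → (Fin d → ℕ) → Fin n → Fin n → ℝ} (hA : LegHad d n m lam A)
    (ξ : Fin n → ℝ) :
    lam * ∑ i, ξ i ^ 2 ≤ ∑ i, ∑ j, (∑ α ∈ MIdx d m, ∑ β ∈ MIdx d m,
      ((word α ++ word β).map (Pi.single N (1 : ℝ))).prod * A α β i j) * ξ i * ξ j := by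
  have h := hA ξ (Pi.single N (1 : ℝ))
  have h1 : ∑ l, (Pi.single N (1 : ℝ) : Fin d → ℝ) l ^ 2 = 1 := by
    rw [Finset.sum_eq_single N]
    · simp
    · intro b _ hb; simp [hb]
    · simp
  rw [h1, one_pow, mul_one] at h
  refine h.trans (le_of_eq ?_)
  simp only [List.map_append, List.prod_append, prod_word, sum_mul]
  rw [sum_congr rfl fun α _ => sum_comm, sum_comm]
  refine sum_congr rfl fun i _ => ?_
  rw [sum_congr rfl fun α _ => sum_comm, sum_comm]
  refine sum_congr rfl fun j _ => sum_congr rfl fun α _ =>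
    sum_congr rfl fun β _ => by ring

theorem exists_uniform {ι' : Type*} (S : Finset ι') {P : ι' → ℝ → Prop}
    (h : ∀ k ∈ S, ∃ C : ℝ, 0 ≤ C ∧ P k C) (hmono : ∀ k C C', P k C → C ≤ C' → P k C') :
    ∃ C : ℝ, 0 ≤ C ∧ ∀ k ∈ S, P k C := by
  classical
  choose! C hC hP using h
  refine ⟨∑ k ∈ S, C k, sum_nonneg hC, fun k hk => hmono k _ _ (hP k hk) ?_⟩
  exact single_le_sum (f := C) hC hk

/-- The equation for the spectral blocks of the localized solution. -/
theorem Lev.evolution (hm : 1 ≤ m) (h : IsEigenSystem m e μ) (hK : 0 ≤ K) {p : ℝ}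
    (hs : ∀ j : ℤ, (j : ℝ) / 2 ≠ p) (hL : Lev n m N K lam e μ p) {V : List (Fin d)}
    (hV : ∀ l ∈ V, l ≠ N) {ρ ρ' τ : ℝ} (h0 : 0 < ρ) (h1 : ρ < ρ')
    (h2 : ρ' < 1 / 2) (h3 : 0 < τ) (h4 : τ < 1 / 2) :
    ∃ C : ℝ, 0 ≤ C ∧ ∀ u : Fin n → ST(d) → ℝ, Sol m N K lam u →
      ∀ t ∈ Icc (-τ) 0, ∃ B : Fin n → Fin n → ℝ,
        (∀ i j, |B i j| ≤ ∑ _α ∈ MIdx d m, ∑ _β ∈ MIdx d m, K) ∧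
        (∀ ξ : Fin n → ℝ, lam * ∑ i, ξ i ^ 2 ≤ ∑ i, ∑ j, B i j * ξ i * ξ j) ∧
      ∀ x : Fin d → ℝ, (∀ l, l ≠ N → |x l| ≤ ρ) → ∀ (i₀ : Fin n) (i : ℕ) (a : ι → ℝ),
        |(∫ s in 0..1, tl N ρ ρ' (td (dw V (u i₀))) t x s * comb e (blk m μ i) a s) +
          ∑ j, B i₀ j * ∫ s in 0..1,
            tl N ρ ρ' (dw V (u j)) t x s * comb e (blk m μ i) (fun k => μ k * a k) s| ≤
        C * √(msq N u) * pw i (-min (1 / 2) (p - 2 * m + 1)) * nrm (comb e (blk m μ i) a) := by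
  obtain ⟨C, hC, H⟩ := exists_uniform (MIdx d m ×ˢ MIdx d m)
    (P := fun k C => ∀ u : Fin n → ST(d) → ℝ, Sol m N K lam u →
      ∀ t ∈ Icc (-τ) 0, ∀ x : Fin d → ℝ, (∀ l, l ≠ N → |x l| ≤ ρ) → ∀ (j : Fin n) (i : ℕ) (a : ι → ℝ),
        |(∫ s in 0..1, chi ρ ρ' s * dw (word k.1 ++ word k.2) (dw V (u j))
            (t, update x N s) * comb e (blk m μ i) a s) -
          ((word k.1 ++ word k.2).map (Pi.single N (1 : ℝ))).prod * ((-1) ^ m * ∫ s in 0..1,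
            tl N ρ ρ' (dw V (u j)) t x s * comb e (blk m μ i) (fun k => μ k * a k) s)| ≤
        C * √(msq N u) * pw i (-min (1 / 2) (p - 2 * m + 1)) * nrm (comb e (blk m μ i) a))
    (fun k hk => hL.pairing_word hm h hs hV h0 h1 h2 h3 h4 (by
      rw [Finset.mem_product] at hk
      rw [List.length_append, length_word_of_mem hk.1, length_word_of_mem hk.2]; omega))
    (fun k C C' hP hCC u hu t ht x hx j i a => (hP u hu t ht x hx j i a).trans (by
      have := pw_pos i (-min (1 / 2) (p - 2 * m + 1))
      have := nrm_nonneg (comb e (blk m μ i) a)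
      gcongr))
  refine ⟨∑ _α ∈ MIdx d m, ∑ _β ∈ MIdx d m, ∑ _j : Fin n, K * C,
    sum_nonneg fun _ _ => sum_nonneg fun _ _ => sum_nonneg fun _ _ => by positivity,
    fun u hu t ht => ?_⟩
  have ht' : t ∈ Icc (-1 : ℝ) 0 := ⟨by linarith [ht.1], ht.2⟩
  obtain ⟨A, hAK, hAL, hA⟩ := (hu.dw hV).eqn t ht'
  refine ⟨fun i j => ∑ α ∈ MIdx d m, ∑ β ∈ MIdx d m,
      ((word α ++ word β).map (Pi.single N (1 : ℝ))).prod * A α β i j, fun i j => ?_,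
      legHad_single hAL, fun x hx i₀ i a => ?_⟩
  · refine (abs_sum_le_sum_abs _ _).trans (sum_le_sum fun α _ => ?_)
    refine (abs_sum_le_sum_abs _ _).trans (sum_le_sum fun β _ => ?_)
    rw [prod_map_single, abs_mul]
    refine (mul_le_of_le_one_left (abs_nonneg _) ?_).trans (hAK α β i j)
    split_ifs <;> simp
  set z := comb e (blk m μ i) a with hz
  have hzs : Continuous z := (h.comb_smooth _ _).continuous
  have e1 : ∀ s ∈ uIcc (0 : ℝ) 1, tl N ρ ρ' (td (dw V (u i₀))) t x s * z s =
      ∑ α ∈ MIdx d m, ∑ β ∈ MIdx d m, ∑ j, (-(-1) ^ m * A α β i₀ j) *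
        (chi ρ ρ' s * dw (word α ++ word β) (dw V (u j)) (t, update x N s) * z s) := by
    intro s hs
    rw [uIcc_of_le zero_le_one] at hs
    unfold tl
    rcases le_or_gt ρ' |s| with hs' | hs'
    · simp [chi_eq_zero h0 h1 hs']
    · have h5 := hA (update x N s) (fun l => by
        by_cases hl : l = N
        · subst hl; rw [Function.update_self]; linarith
        · rw [Function.update_of_ne hl]; linarith [hx l hl]) (by simpa using hs.1) i₀
      rw [eq_neg_of_add_eq_zero_left h5]
      simp only [mul_sum, sum_mul, ← Finset.sum_neg_distrib]
      refine sum_congr rfl fun α _ => sum_congr rfl fun β _ =>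
        sum_congr rfl fun j _ => by ring
  have c1 : ∀ α β j, Continuous fun s => (-(-1) ^ m * A α β i₀ j) *
        (chi ρ ρ' s * dw (word α ++ word β) (dw V (u j)) (t, update x N s) * z s) :=
    fun α β j => continuous_const.mul (((chi_smooth ρ ρ').continuous.mul
      (continuous_line (((hu.smooth j).dw V).dw _) t x N)).mul hzs)
  have e2 : ∫ s in 0..1, tl N ρ ρ' (td (dw V (u i₀))) t x s * z s =
      ∑ α ∈ MIdx d m, ∑ β ∈ MIdx d m, ∑ j, (-(-1) ^ m * A α β i₀ j) * ∫ s in 0..1,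
        (chi ρ ρ' s * dw (word α ++ word β) (dw V (u j)) (t, update x N s) * z s) := by
    rw [intervalIntegral.integral_congr e1, intervalIntegral.integral_finsetSum
      fun α _ => (continuous_finsetSum _ fun β _ => continuous_finsetSum _ fun j _ =>
        c1 α β j).intervalIntegrable _ _]
    refine sum_congr rfl fun α _ => ?_
    rw [intervalIntegral.integral_finsetSum
      fun β _ => (continuous_finsetSum _ fun j _ => c1 α β j).intervalIntegrable _ _]
    refine sum_congr rfl fun β _ => ?_
    rw [intervalIntegral.integral_finsetSum fun j _ => (c1 α β j).intervalIntegrable _ _]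
    exact sum_congr rfl fun j _ => intervalIntegral.integral_const_mul _ _
  have hsq : ((-1 : ℝ) ^ m) * (-1) ^ m = 1 := by rw [← mul_pow]; simp
  have e3 : ∑ j, (∑ α ∈ MIdx d m, ∑ β ∈ MIdx d m,
      ((word α ++ word β).map (Pi.single N (1 : ℝ))).prod * A α β i₀ j) * (∫ s in 0..1,
            tl N ρ ρ' (dw V (u j)) t x s * comb e (blk m μ i) (fun k => μ k * a k) s) =
      ∑ α ∈ MIdx d m, ∑ β ∈ MIdx d m, ∑ j, ((-1) ^ m * A α β i₀ j) *
        (((word α ++ word β).map (Pi.single N (1 : ℝ))).prod * ((-1) ^ m * ∫ s in 0..1,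
            tl N ρ ρ' (dw V (u j)) t x s * comb e (blk m μ i) (fun k => μ k * a k) s)) := by
    simp only [sum_mul]
    rw [sum_comm]
    refine sum_congr rfl fun α _ => ?_
    rw [sum_comm]
    refine sum_congr rfl fun β _ => sum_congr rfl fun j _ => ?_
    linear_combination (-((word α ++ word β).map (Pi.single N (1 : ℝ))).prod * A α β i₀ j *
      (∫ s in 0..1, tl N ρ ρ' (dw V (u j)) t x s * comb e (blk m μ i) (fun k => μ k * a k) s)) * hsq
  rw [e2, e3]
  simp only [← sum_add_distrib, sum_mul]
  refine (abs_sum_le_sum_abs _ _).trans (sum_le_sum fun α hα => ?_)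
  refine (abs_sum_le_sum_abs _ _).trans (sum_le_sum fun β hβ => ?_)
  refine (abs_sum_le_sum_abs _ _).trans (sum_le_sum fun j _ => ?_)
  have h6 := H (α, β) (Finset.mem_product.2 ⟨hα, hβ⟩) u hu t ht x hx j i a
  rw [show ∀ X Y : ℝ, (-(-1) ^ m * A α β i₀ j) * X + ((-1) ^ m * A α β i₀ j) * Y =
    -((-1) ^ m * A α β i₀ j * (X - Y)) from fun X Y => by ring, abs_neg, abs_mul, abs_mul, abs_pow,
    abs_neg, abs_one, one_pow, one_mul]
  calc _ ≤ K * (C * √(msq N u) * pw i (-min (1 / 2) (p - 2 * m + 1)) * nrm z) :=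
        mul_le_mul (hAK α β i₀ j) h6 (abs_nonneg _) hK
    _ = _ := by ring

end word

section ode
variable {n : ℕ} {ι : Type}

theorem sum_sq_le_of_system {S : Finset ι} {μ : ι → ℝ} {L lam F t0 t1 : ℝ} (hL : 0 < L) (hlam : 0 < lam)
    (hμ : ∀ k ∈ S, L ≤ μ k) {c c' : Fin n → ι → ℝ → ℝ}
    (hc : ∀ j k t, HasDerivAt (c j k) (c' j k t) t)
    (h : ∀ t ∈ Icc t0 t1, ∃ B : Fin n → Fin n → ℝ,
      (∀ ξ : Fin n → ℝ, lam * ∑ i, ξ i ^ 2 ≤ ∑ i, ∑ j, B i j * ξ i * ξ j) ∧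
      ∀ j, |∑ k ∈ S, c j k t * c' j k t + ∑ l, B j l * ∑ k ∈ S, μ k * c j k t * c l k t| ≤
        F * √(∑ k ∈ S, c j k t ^ 2)) :
    ∀ t ∈ Icc t0 t1, ∑ j, ∑ k ∈ S, c j k t ^ 2 ≤
      exp (-(lam * L) * (t - t0)) * ∑ j, ∑ k ∈ S, c j k t0 ^ 2 + n * F ^ 2 / (lam * L) / (lam * L) := by
  have hΛ : 0 < lam * L := mul_pos hlam hL
  refine le_of_deriv_le_damped (y := fun t => ∑ j, ∑ k ∈ S, c j k t ^ 2)
    (y' := fun t => ∑ j, ∑ k ∈ S, 2 * (c j k t * c' j k t)) hΛ (by positivity) (fun t _ => ?_) fun t ht => ?_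
  · refine HasDerivAt.fun_sum fun j _ => HasDerivAt.fun_sum fun k _ => ?_
    refine ((hc j k t).fun_pow 2).congr_deriv ?_
    push_cast; ring
  · obtain ⟨B, hB, hE⟩ := h t ht
    have e1 : ∀ j, ∑ k ∈ S, c j k t * c' j k t ≤ -(∑ l, B j l * ∑ k ∈ S, μ k * c j k t * c l k t) +
        ((lam * L) / 2 * ∑ k ∈ S, c j k t ^ 2 + F ^ 2 / (2 * (lam * L))) := by
      intro j
      have h1 := le_of_abs_le (hE j)
      have h2 : 0 ≤ ∑ k ∈ S, c j k t ^ 2 := sum_nonneg fun _ _ => sq_nonneg _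
      have h3 : F * √(∑ k ∈ S, c j k t ^ 2) ≤
          (lam * L) / 2 * ∑ k ∈ S, c j k t ^ 2 + F ^ 2 / (2 * (lam * L)) := by
        have h4 := sq_sqrt h2
        have h5 : 0 ≤ (lam * L * √(∑ k ∈ S, c j k t ^ 2) - F) ^ 2 / (2 * (lam * L)) := by positivity
        have h6 : ∀ r Λ : ℝ, 0 < Λ → (Λ * r - F) ^ 2 / (2 * Λ) = Λ / 2 * r ^ 2 + F ^ 2 / (2 * Λ) - F * r := by
          intro r Λ hΛ; field_simp; ring
        rw [h6 _ _ hΛ, h4] at h5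
        linarith
      linarith
    have e2 : lam * L * ∑ j, ∑ k ∈ S, c j k t ^ 2 ≤ ∑ j, ∑ l, B j l * ∑ k ∈ S, μ k * c j k t * c l k t := by
      calc _ = ∑ k ∈ S, L * (lam * ∑ j, c j k t ^ 2) := by
            rw [sum_comm, mul_sum]; exact sum_congr rfl fun k _ => by ring
        _ ≤ ∑ k ∈ S, μ k * ∑ j, ∑ l, B j l * c j k t * c l k t := by
            refine sum_le_sum fun k hk => ?_
            have h5 : 0 ≤ lam * ∑ j, c j k t ^ 2 :=
              mul_nonneg hlam.le (sum_nonneg fun _ _ => sq_nonneg _)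
            calc _ ≤ μ k * (lam * ∑ j, c j k t ^ 2) := mul_le_mul_of_nonneg_right (hμ k hk) h5
              _ ≤ _ := mul_le_mul_of_nonneg_left (hB fun j => c j k t) (hL.le.trans (hμ k hk))
        _ = _ := by
            simp only [mul_sum]
            rw [sum_comm]
            refine sum_congr rfl fun j _ => ?_
            rw [sum_comm]
            refine sum_congr rfl fun l _ => sum_congr rfl fun k _ => by ring
    have e3 := sum_le_sum fun j (_ : j ∈ Finset.univ) => e1 j
    rw [sum_add_distrib, sum_add_distrib, Finset.sum_neg_distrib, ← mul_sum,
      sum_const, Finset.card_univ, Fintype.card_fin, nsmul_eq_mul] at e3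
    simp only [← mul_sum]
    have e4 : (n : ℝ) * (F ^ 2 / (2 * (lam * L))) = n * F ^ 2 / (lam * L) / 2 := by field_simp
    rw [e4] at e3
    linarith

end ode

section step
variable {d n m : ℕ} {N : Fin d} {K lam : ℝ} {ι : Type} {e : ι → ℝ → ℝ} {μ : ι → ℝ}

theorem exp_neg_le {x : ℝ} (hx : 0 < x) : exp (-x) ≤ 6 / x ^ 3 := by
  rw [Real.exp_neg, le_div_iff₀ (by positivity), inv_mul_le_iff₀ (Real.exp_pos x)]
  have := Real.pow_div_factorial_le_exp x hx.le 3
  norm_num [Nat.factorial] at this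
  linarith

theorem Lev.step (hm : 1 ≤ m) (h : IsEigenSystem m e μ) (hlam : 0 < lam) (hK : 0 ≤ K) {p σ : ℝ}
    (hs : ∀ j : ℤ, (j : ℝ) / 2 ≠ p) (hL : Lev n m N K lam e μ p)
    (hσ : σ = min (1 / 2) (p - 2 * m + 1)) (hpos : 0 < 2 * m + σ) :
    Lev n m N K lam e μ (2 * m + σ) := by
  intro V hV ρ ρ' τ h0 h1 h2 h3 h4
  obtain ⟨τ', hτ, hτ'⟩ := exists_between h4
  obtain ⟨C1, hC1, H1⟩ := hL.evolution hm h hK hs hV h0 h1 h2 (h3.trans hτ) hτ'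
  obtain ⟨C0, hC0, H0⟩ := hL V hV ρ ρ' τ' h0 h1 h2 (h3.trans hτ) hτ'
  obtain ⟨C2, hC2, H2⟩ := h.tail_of_blocks hm hpos
  set δ := τ' - τ with hδ
  have hδ0 : 0 < δ := by linarith
  obtain ⟨D, hD⟩ : ∃ D, D = 6 / (lam * δ) ^ 3 * (n * C0 ^ 2) + n * C1 ^ 2 / lam ^ 2 := ⟨_, rfl⟩
  have hD0 : 0 ≤ D := by rw [hD]; positivity
  refine ⟨C2 * √D, by positivity, fun u hu t ht x hx j => ?_⟩
  obtain ⟨M, hM⟩ : ∃ M, M = √(msq N u) := ⟨_, rfl⟩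
  have hM0 : 0 ≤ M := hM ▸ sqrt_nonneg _
  rw [← hM, mul_assoc]
  have hsm : ∀ t j, Sm (tl N ρ ρ' (dw V (u j)) t x) := fun t j => tl_smooth ((hu.smooth j).dw V) t x
  refine H2 _ _ (hsm t j).continuous (by positivity) fun i => ?_
  obtain ⟨L, hLd⟩ : ∃ L, L = ((2 : ℝ) ^ i) ^ (2 * m) := ⟨_, rfl⟩
  have hLpw : L = pw i (2 * m) := by rw [hLd, ← pw_natCast]; push_cast; rfl
  have hL0 : 0 < L := hLpw ▸ pw_pos _ _
  set S := blk m μ i with hS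
  have hcomb : ∀ t j (a : ι → ℝ), ∫ s in 0..1, tl N ρ ρ' (dw V (u j)) t x s * comb e S a s =
      ∑ k ∈ S, a k * cf e (tl N ρ ρ' (dw V (u j)) t x) k := by
    intro t j a
    exact (intervalIntegral.integral_congr fun s _ => mul_comm _ _).trans
      (h.integral_comb_mul S a (hsm t j).continuous)
  have hcomb' : ∀ t j (a : ι → ℝ), ∫ s in 0..1, tl N ρ ρ' (td (dw V (u j))) t x s * comb e S a s =
      ∑ k ∈ S, a k * cf e (tl N ρ ρ' (td (dw V (u j))) t x) k := by
    intro t j a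
    exact (intervalIntegral.integral_congr fun s _ => mul_comm _ _).trans
      (h.integral_comb_mul S a (tl_smooth ((hu.smooth j).dw V).td t x).continuous)
  have hode := sum_sq_le_of_system (S := S) (μ := μ) (L := L) (lam := lam) (F := C1 * M * pw i (-σ))
    (t0 := -τ') (t1 := 0) hL0 hlam (fun k hk => hLd ▸ ((h.mem_blk hm).1 hk).1)
    (c := fun j k t => cf e (tl N ρ ρ' (dw V (u j)) t x) k)
    (c' := fun j k t => cf e (tl N ρ ρ' (td (dw V (u j))) t x) k)
    (fun j k t => hasDerivAt_integral_tl ((hu.smooth j).dw V) t x (h.smooth k).continuous)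
    (fun t ht => by
      obtain ⟨B, -, hB, hE⟩ := H1 u hu t ht
      refine ⟨B, hB, fun j => ?_⟩
      have h5 := hE x hx j i (fun k => cf e (tl N ρ ρ' (dw V (u j)) t x) k)
      rw [← hσ, ← hM, ← hS, hcomb'] at h5
      simp only [hcomb] at h5
      rw [nrm, h.nsq_comb] at h5
      exact h5) t ⟨by linarith [ht.1], ht.2⟩
  have hinit : ∑ j, ∑ k ∈ S, cf e (tl N ρ ρ' (dw V (u j)) (-τ') x) k ^ 2 ≤ n * C0 ^ 2 * M ^ 2 := by
    have h5 : ∀ j, ∑ k ∈ S, cf e (tl N ρ ρ' (dw V (u j)) (-τ') x) k ^ 2 ≤ C0 ^ 2 * M ^ 2 := by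
      intro j
      have h6 := nsq_nonneg (fun s => tl N ρ ρ' (dw V (u j)) (-τ') x s -
        comb e S (cf e (tl N ρ ρ' (dw V (u j)) (-τ') x)) s)
      rw [h.nsq_sub_comb _ (hsm _ _).continuous] at h6
      have h7 := H0 u hu (-τ') ⟨le_rfl, by linarith⟩ x hx j 0
      simp only [pw_zero_left, mul_one, SS, h.lowS_zero hm, comb, Finset.sum_empty, sub_zero, ← hM] at h7
      have h8 := pow_le_pow_left₀ (nrm_nonneg _) h7 2
      rw [nrm_sq] at h8
      rw [← mul_pow]
      linarith
    refine (sum_le_sum fun j _ => h5 j).trans (le_of_eq ?_)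
    rw [sum_const, Finset.card_univ, Fintype.card_fin, nsmul_eq_mul, mul_assoc]
  have hP : nrm (PP m e μ i (tl N ρ ρ' (dw V (u j)) t x)) ^ 2 ≤
      ∑ j, ∑ k ∈ S, cf e (tl N ρ ρ' (dw V (u j)) t x) k ^ 2 := by
    rw [nrm_sq, PP, h.nsq_comb]
    exact single_le_sum (f := fun j => ∑ k ∈ S, cf e (tl N ρ ρ' (dw V (u j)) t x) k ^ 2)
      (fun j _ => sum_nonneg fun _ _ => sq_nonneg _) (Finset.mem_univ j)
  have hexp : exp (-(lam * L) * (t - -τ')) ≤ 6 / (lam * δ) ^ 3 * pw i (-(2 * (2 * m + σ))) := by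
    have h5 : lam * L * δ ≤ lam * L * (t - -τ') :=
      mul_le_mul_of_nonneg_left (by linarith [ht.1]) (by positivity)
    calc _ ≤ exp (-(lam * L * δ)) := Real.exp_le_exp.2 (by linarith)
      _ ≤ 6 / (lam * L * δ) ^ 3 := exp_neg_le (by positivity)
      _ = 6 / (lam * δ) ^ 3 * pw i (-(6 * m)) := by
          have : L ^ 3 = pw i (6 * m) := by
            rw [hLpw, pow_succ, pow_two, ← pw_add, ← pw_add]; ring_nf
          rw [pw_neg, ← this]; field_simp
      _ ≤ _ := by
          refine mul_le_mul_of_nonneg_left (pw_mono _ ?_) (by positivity)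
          have : σ ≤ 1 / 2 := hσ ▸ min_le_left _ _
          have : (1 : ℝ) ≤ m := by exact_mod_cast hm
          linarith
  have hF : n * (C1 * M * pw i (-σ)) ^ 2 / (lam * L) / (lam * L) =
      n * C1 ^ 2 / lam ^ 2 * M ^ 2 * pw i (-(2 * (2 * m + σ))) := by
    have h5 : pw i (-(2 * (2 * m + σ))) = pw i (-σ) ^ 2 * (L⁻¹) ^ 2 := by
      rw [hLpw, ← pw_neg, pw_sq, pw_sq, ← pw_add]; ring_nf
    rw [h5]; field_simp
  have hfin : nrm (PP m e μ i (tl N ρ ρ' (dw V (u j)) t x)) ^ 2 ≤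
      (√D * M * pw i (-(2 * m + σ))) ^ 2 := by
    rw [mul_pow, mul_pow, sq_sqrt hD0, pw_sq, mul_neg]
    refine hP.trans (hode.trans ?_)
    rw [hF]
    have h5 := mul_le_mul hexp hinit (sum_nonneg fun _ _ => sum_nonneg fun _ _ => sq_nonneg _)
      (by have := pw_pos i (-(2 * (2 * m + σ))); positivity)
    rw [hD]
    linarith
  have := pw_pos i (-(2 * m + σ))
  exact le_of_sq_le_sq hfin (by positivity)

/-- The bootstrap: solutions have order `2m + 1/2` in the normal direction. -/
theorem lev_top (hm : 1 ≤ m) (h : IsEigenSystem m e μ) (hlam : 0 < lam) (hK : 0 ≤ K) :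
    Lev n m N K lam e μ (2 * m + 1 / 2) := by
  have hm' : (1 : ℝ) ≤ m := by exact_mod_cast hm
  have hne : ∀ q : ℤ, ∀ j : ℤ, (j : ℝ) / 2 ≠ (q : ℝ) - 1 / 4 := by
    intro q j hj
    have h1 : (4 * q : ℤ) - 1 = 2 * j := by
      have : ((4 * q - 1 : ℤ) : ℝ) = ((2 * j : ℤ) : ℝ) := by push_cast; linarith
      exact_mod_cast this
    omega
  have key : ∀ q : ℕ, q ≤ 2 * m → Lev n m N K lam e μ ((q : ℝ) - 1 / 4) := by
    intro q
    induction q with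
    | zero => intro _; simpa using lev_base hm hlam hK h
    | succ q ih =>
      intro hq
      have hq' : (q : ℝ) + 1 ≤ 2 * m := by exact_mod_cast hq
      have := (ih (by omega)).step hm h hlam hK (by exact_mod_cast hne q) (σ := q - 1 / 4 - 2 * m + 1)
        (by rw [min_eq_right (by linarith)]) (by linarith [(Nat.cast_nonneg q : (0 : ℝ) ≤ q)])
      push_cast
      convert this using 1
      ring
  have h5 := (key (2 * m) le_rfl).step hm h hlam hK (by exact_mod_cast hne (2 * m)) (σ := 1 / 2)
    (by push_cast; rw [min_eq_left (by linarith)]) (by linarith)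
  exact h5

theorem IsEigenSystem.iteratedDeriv_le_of_tail_of_lt (hm : 1 ≤ m) (h : IsEigenSystem m e μ) {s : ℝ}
    (hs : (m : ℝ) + 1 / 2 < s) :
    ∃ C, 0 < C ∧ ∀ (g : ℝ → ℝ) (N : ℝ), Sm g → Flat m g → Tail m e μ g s N →
      ∀ x ∈ Icc (0 : ℝ) 1, |iteratedDeriv m g x| ≤ C * N := by
  obtain ⟨C, hC, H⟩ := h.SS_sup hm (s := s) (j := m) (by omega) (by linarith)
  refine ⟨C, hC, fun g N hg hgf hT => ?_⟩
  refine abs_iteratedDeriv_le_of_tendsto hm hg hgf (fun k => h.SS_smooth k g)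
    (fun k => h.flat_comb _ _) (h.tendsto_nsq_sub_SS hm hg.continuous) fun k x hx => ?_
  have := H g N hg.continuous hT k x hx
  rwa [max_eq_left (by linarith), pw_zero, mul_one] at this

theorem Tail.mono {g : ℝ → ℝ} {s s' N : ℝ} (h : Tail m e μ g s N) (hs : s' ≤ s) :
    Tail m e μ g s' N := fun i =>
  (h i).trans (mul_le_mul_of_nonneg_left (pw_mono i (by linarith)) h.nonneg)

theorem Lev.mono {p p' : ℝ} (h : Lev n m N K lam e μ p) (hp : p' ≤ p) : Lev n m N K lam e μ p' := by
  intro V hV ρ ρ' τ h0 h1 h2 h3 h4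
  obtain ⟨C, hC, H⟩ := h V hV ρ ρ' τ h0 h1 h2 h3 h4
  exact ⟨C, hC, fun u hu t ht x hx i => (H u hu t ht x hx i).mono hp⟩

theorem le_mul_rpow_mul_rpow {X a D b θ : ℝ} (hX : 0 ≤ X) (ha : 0 ≤ a) (hD : 0 ≤ D) (hb : 0 ≤ b)
    (h0 : 0 ≤ θ) (h1 : θ ≤ 1) (hXD : X ≤ a * D) (hXb : X ≤ a * b) : X ≤ a * D ^ θ * b ^ (1 - θ) := by
  have e : ∀ y : ℝ, 0 ≤ y → y ^ θ * y ^ (1 - θ) = y := fun y hy => by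
    rw [← Real.rpow_add' hy (by norm_num), add_sub_cancel, Real.rpow_one]
  calc X = X ^ θ * X ^ (1 - θ) := (e X hX).symm
    _ ≤ (a * D) ^ θ * (a * b) ^ (1 - θ) := by
        have h2 : 0 ≤ 1 - θ := by linarith
        exact mul_le_mul (Real.rpow_le_rpow hX hXD h0) (Real.rpow_le_rpow hX hXb h2)
          (Real.rpow_nonneg hX _) (Real.rpow_nonneg (mul_nonneg ha hD) _)
    _ = (a ^ θ * a ^ (1 - θ)) * D ^ θ * b ^ (1 - θ) := by
        rw [Real.mul_rpow ha hD, Real.mul_rpow ha hb]; ring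
    _ = _ := by rw [e a ha]

theorem IsEigenSystem.abs_sum_mul_le (h : IsEigenSystem m e μ) (hm : 1 ≤ m) (i : ℕ) (a c : ι → ℝ) :
    |∑ k ∈ blk m μ i, μ k * a k * c k| ≤ 2 ^ (2 * m) * pw i (2 * m) *
      nrm (comb e (blk m μ i) a) * nrm (comb e (blk m μ i) c) := by
  have h1 : ∀ k ∈ blk m μ i, |μ k * a k * c k| ≤ 2 ^ (2 * m) * pw i (2 * m) * (|a k| * |c k|) := by
    intro k hk
    have h2 := ((h.mem_blk hm).1 hk).2
    have h3 : (0 : ℝ) ≤ μ k := zero_le_one.trans (h.one_le k)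
    have h4 : ((2 : ℝ) ^ (i + 1)) ^ (2 * m) = 2 ^ (2 * m) * pw i (2 * m) := by
      rw [pow_succ', mul_pow, ← pw_natCast]; push_cast; rfl
    rw [abs_mul, abs_mul, abs_of_nonneg h3, mul_assoc]
    exact mul_le_mul_of_nonneg_right (h4 ▸ h2.le) (by positivity)
  refine (abs_sum_le_sum_abs _ _).trans ((sum_le_sum h1).trans ?_)
  rw [← mul_sum, mul_assoc _ (nrm _)]
  have := pw_pos i (2 * m)
  refine mul_le_mul_of_nonneg_left ?_ (by positivity)
  have h5 := Real.sum_mul_le_sqrt_mul_sqrt (blk m μ i) (fun k => |a k|) (fun k => |c k|)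
  simpa only [sq_abs, nrm, h.nsq_comb] using h5

theorem comb_sub (S : Finset ι) (a b : ι → ℝ) (s : ℝ) :
    comb e S (fun k => a k - b k) s = comb e S a s - comb e S b s := by
  simp only [comb, sub_mul, Finset.sum_sub_distrib]

theorem IsEigenSystem.cf_sub (h : IsEigenSystem m e μ) {f g : ℝ → ℝ} (hf : Continuous f) (hg : Continuous g)
    (k : ι) : cf e (fun s => f s - g s) k = cf e f k - cf e g k := by
  unfold cf
  have q1 : Continuous fun s => f s * e k s := hf.mul (h.smooth k).continuous
  have q2 : Continuous fun s => g s * e k s := hg.mul (h.smooth k).continuous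
  rw [← intervalIntegral.integral_sub (q1.intervalIntegrable _ _) (q2.intervalIntegrable _ _)]
  simp only [sub_mul]

/-- Hölder continuity in time of the localized solution, in spectral form. -/
theorem tail_time (hm : 1 ≤ m) (h : IsEigenSystem m e μ) (hlam : 0 < lam) (hK : 0 ≤ K)
    {V : List (Fin d)} (hV : ∀ l ∈ V, l ≠ N) {γ : ℝ} (hγ0 : 0 < γ) (hγ1 : γ < 1) {ρ ρ' τ : ℝ}
    (h0 : 0 < ρ) (h1 : ρ < ρ') (h2 : ρ' < 1 / 2) (h3 : 0 < τ) (h4 : τ < 1 / 2) :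
    ∃ C : ℝ, 0 ≤ C ∧ ∀ u : Fin n → ST(d) → ℝ, Sol m N K lam u →
      ∀ t ∈ Icc (-τ) 0, ∀ t' ∈ Icc (-τ) 0, ∀ x : Fin d → ℝ, (∀ l, l ≠ N → |x l| ≤ ρ) → ∀ i,
        Tail m e μ (fun s => tl N ρ ρ' (dw V (u i)) t x s - tl N ρ ρ' (dw V (u i)) t' x s)
          (2 * m + 1 / 2 - γ) (C * (√(msq N u) * |t - t'| ^ (γ / (2 * m)))) := by
  have hm' : (1 : ℝ) ≤ m := by exact_mod_cast hm
  have hL := lev_top (n := n) (N := N) hm h hlam hK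
  have hL' : Lev n m N K lam e μ (2 * m - 1 / 4) := hL.mono (by linarith)
  obtain ⟨C1, hC1, H1⟩ := hL'.evolution hm h hK (by
    intro j hj
    have h1 : (8 * m : ℤ) - 1 = 2 * j := by
      have : ((8 * m - 1 : ℤ) : ℝ) = ((2 * j : ℤ) : ℝ) := by push_cast; linarith
      exact_mod_cast this
    omega) hV h0 h1 h2 h3 h4
  obtain ⟨C0, hC0, H0⟩ := hL V hV ρ ρ' τ h0 h1 h2 h3 h4
  obtain ⟨C2, hC2, H2⟩ := h.tail_of_blocks hm (s := 2 * m + 1 / 2 - γ) (by linarith)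
  obtain ⟨KB, hKB⟩ : ∃ KB, KB = ∑ _α ∈ MIdx d m, ∑ _β ∈ MIdx d m, K := ⟨_, rfl⟩
  have hKB0 : 0 ≤ KB := hKB ▸ sum_nonneg fun _ _ => sum_nonneg fun _ _ => hK
  rw [← hKB] at H1
  obtain ⟨D1, hD1⟩ : ∃ D1, D1 = C1 + n * (KB * (2 ^ (2 * m) * C0)) := ⟨_, rfl⟩
  have hD10 : 0 ≤ D1 := by rw [hD1]; positivity
  refine ⟨C2 * (D1 + 2 * C0), by positivity, fun u hu t ht t' ht' x hx j => ?_⟩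
  obtain ⟨M, hM⟩ : ∃ M, M = √(msq N u) := ⟨_, rfl⟩
  have hM0 : 0 ≤ M := hM ▸ sqrt_nonneg _
  have hD := abs_nonneg (t - t')
  have hDr : 0 ≤ |t - t'| ^ (γ / (2 * m)) := Real.rpow_nonneg hD _
  rw [← hM, mul_assoc]
  have hsm : ∀ t j, Sm (tl N ρ ρ' (dw V (u j)) t x) := fun t j => tl_smooth ((hu.smooth j).dw V) t x
  have hcs : Continuous (fun s => tl N ρ ρ' (dw V (u j)) t x s - tl N ρ ρ' (dw V (u j)) t' x s) :=
    (hsm t j).continuous.sub (hsm t' j).continuous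
  refine H2 _ _ hcs (by positivity) fun i => ?_
  set S := blk m μ i with hS
  have hcomb : ∀ t j (a : ι → ℝ), ∫ s in 0..1, tl N ρ ρ' (dw V (u j)) t x s * comb e S a s =
      ∑ k ∈ S, a k * cf e (tl N ρ ρ' (dw V (u j)) t x) k := by
    intro t j a
    exact (intervalIntegral.integral_congr fun s _ => mul_comm _ _).trans
      (h.integral_comb_mul S a (hsm t j).continuous)
  have hp := pw_pos i
  have hPP : ∀ t ∈ Icc (-τ) 0, ∀ j, nrm (PP m e μ i (tl N ρ ρ' (dw V (u j)) t x)) ≤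
      C0 * M * pw i (-(2 * m + 1 / 2)) := fun t ht j =>
    (h.nrm_PP_le hm i (hsm t j).continuous).trans (hM ▸ H0 u hu t ht x hx j i)
  set ω := fun s => tl N ρ ρ' (dw V (u j)) t x s - tl N ρ ρ' (dw V (u j)) t' x s with hω
  have hcf : ∀ k, cf e ω k = cf e (tl N ρ ρ' (dw V (u j)) t x) k - cf e (tl N ρ ρ' (dw V (u j)) t' x) k :=
    h.cf_sub (hsm t j).continuous (hsm t' j).continuous
  set z := comb e S (cf e ω) with hz
  have hzs : Continuous z := (h.comb_smooth _ _).continuous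
  have hz0 : 0 ≤ nrm z := nrm_nonneg _
  have b1 : nrm z ≤ 2 * C0 * M * pw i (-(2 * m + 1 / 2)) := by
    have e1 : z = fun s => PP m e μ i (tl N ρ ρ' (dw V (u j)) t x) s -
        PP m e μ i (tl N ρ ρ' (dw V (u j)) t' x) s := by
      funext s
      rw [hz, funext hcf, comb_sub]; rfl
    rw [e1]
    have := nrm_sub_le (h.PP_smooth i (tl N ρ ρ' (dw V (u j)) t x)).continuous
      (h.PP_smooth i (tl N ρ ρ' (dw V (u j)) t' x)).continuous
    linarith [hPP t ht j, hPP t' ht' j]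
  have hmm : 2 ^ (2 * m) * pw i (2 * m) * (C0 * M * pw i (-(2 * m + 1 / 2))) =
      2 ^ (2 * m) * C0 * M * pw i (-(1 / 2)) := by
    have : pw i (-(1 / 2)) = pw i (2 * m) * pw i (-(2 * m + 1 / 2)) := by rw [← pw_add]; ring_nf
    rw [this]; ring
  have b2 : nrm z ^ 2 ≤ D1 * M * pw i (-(1 / 2)) * nrm z * |t - t'| := by
    have e1 : nrm z ^ 2 = (∫ s in 0..1, tl N ρ ρ' (dw V (u j)) t x s * z s) -
        ∫ s in 0..1, tl N ρ ρ' (dw V (u j)) t' x s * z s := by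
      rw [nrm_sq, hz, h.nsq_comb, hcomb, hcomb, ← Finset.sum_sub_distrib]
      refine sum_congr rfl fun k _ => ?_
      rw [hcf]; ring
    have e2 := Convex.norm_image_sub_le_of_norm_hasDerivWithin_le (s := Icc (-τ) 0)
      (C := D1 * M * pw i (-(1 / 2)) * nrm z)
      (fun r _ => (hasDerivAt_integral_tl (ρ := ρ) (ρ' := ρ') ((hu.smooth j).dw V) r x hzs).hasDerivWithinAt)
      (fun r hr => by
        obtain ⟨B, hBK, -, hE⟩ := H1 u hu r hr
        have h5 := hE x hx j i (cf e ω)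
        rw [min_eq_left (by linarith), ← hM, ← hS, ← hz] at h5
        have h6 : |∑ l, B j l * ∫ s in 0..1,
            tl N ρ ρ' (dw V (u l)) r x s * comb e S (fun k => μ k * cf e ω k) s| ≤
            n * (KB * (2 ^ (2 * m) * C0 * M * pw i (-(1 / 2)) * nrm z)) := by
          refine (abs_sum_le_sum_abs _ _).trans ((sum_le_sum fun l _ => ?_).trans (by
            rw [sum_const, Finset.card_univ, Fintype.card_fin, nsmul_eq_mul]))
          rw [abs_mul, hcomb]
          refine mul_le_mul (hBK j l) ?_ (abs_nonneg _) hKB0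
          refine (h.abs_sum_mul_le hm i (cf e ω) _).trans ?_
          rw [← hmm]
          have h7 := mul_le_mul_of_nonneg_left (hPP r hr l)
            (mul_nonneg (mul_nonneg (by positivity : (0 : ℝ) ≤ 2 ^ (2 * m)) (hp (2 * m)).le) hz0)
          refine h7.trans (le_of_eq (by ring))
        rw [Real.norm_eq_abs]
        have h8 := abs_sub_abs_le_abs_sub
          (∫ s in 0..1, tl N ρ ρ' (td (dw V (u j))) r x s * z s)
          (-(∑ l, B j l * ∫ s in 0..1,
            tl N ρ ρ' (dw V (u l)) r x s * comb e S (fun k => μ k * cf e ω k) s))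
        rw [abs_neg, sub_neg_eq_add] at h8
        rw [hD1]
        linarith) (convex_Icc _ _) ht' ht
    rw [Real.norm_eq_abs, Real.norm_eq_abs] at e2
    rw [e1]
    exact (le_abs_self _).trans e2
  have b3 : nrm z ≤ D1 * M * pw i (-(1 / 2)) * |t - t'| := by
    rcases hz0.eq_or_lt with h5 | h5
    · rw [← h5]
      have := hp (-(1 / 2)); positivity
    · refine le_of_mul_le_mul_right ?_ h5
      linarith [b2, pow_two (nrm z)]
  have hq := hp (-(1 / 2))
  have hq2 := hp (-(2 * m))
  have b4 := le_mul_rpow_mul_rpow (X := nrm z) (a := (D1 + 2 * C0) * M * pw i (-(1 / 2))) (D := |t - t'|)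
    (b := pw i (-(2 * m))) (θ := γ / (2 * m)) hz0 (by positivity) hD hq2.le (by positivity)
    (by rw [div_le_one (by positivity)]; linarith)
    (by have : 0 ≤ 2 * C0 * M * pw i (-(1 / 2)) * |t - t'| := by positivity
        linarith)
    (by have : 0 ≤ D1 * M * pw i (-(1 / 2)) * pw i (-(2 * m)) := by positivity
        have h6 : pw i (-(2 * m + 1 / 2)) = pw i (-(1 / 2)) * pw i (-(2 * m)) := by
          rw [← pw_add]; ring_nf
        rw [h6] at b1
        linarith)
  refine b4.trans (le_of_eq ?_)
  have e5 : pw i (-(2 * m + 1 / 2 - γ)) = pw i (-(1 / 2)) * pw i (-(2 * m)) ^ (1 - γ / (2 * m)) := by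
    rw [pw, pw, pw, ← Real.rpow_mul (by norm_num), ← Real.rpow_add two_pos]
    congr 1
    field_simp
    ring
  rw [e5]; ring

end step

section regularity
variable {d n m : ℕ} {N : Fin d} {K lam : ℝ}

theorem iteratedDeriv_tl {f : ST(d) → ℝ} {ρ ρ' : ℝ} (h0 : 0 < ρ) (h1 : ρ < ρ') (hf : Sm f)
    (t : ℝ) (x : Fin d → ℝ) {s : ℝ} (hs : |s| < ρ) (q : ℕ) :
    iteratedDeriv q (tl N ρ ρ' f t x) s = dw (List.replicate q N) f (t, update x N s) := by
  have := mul_iteratedDeriv_tl (N := N) h0 h1 hf t x (φ := fun s => if |s| < ρ then 1 else 0)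
    (fun s hs => if_neg (not_lt.2 hs)) q s
  simpa only [hs, if_true, one_mul] using this

/-- Interior-to-boundary sup bound for the top normal derivative. -/
theorem abs_dw_le (hm : 1 ≤ m) (hlam : 0 < lam) (hK : 0 ≤ K) {V : List (Fin d)} (hV : ∀ l ∈ V, l ≠ N) :
    ∃ C : ℝ, 0 ≤ C ∧ ∀ u : Fin n → ST(d) → ℝ, Sol m N K lam u →
      ∀ t ∈ Icc (-(1 / 4) : ℝ) 0, ∀ x : Fin d → ℝ, (∀ l, |x l| < 1 / 4) → 0 ≤ x N → ∀ i,
        |dw (List.replicate m N) (dw V (u i)) (t, x)| ≤ C * √(msq N u) := by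
  obtain ⟨ι, e, μ, h⟩ := exists_isEigenSystem hm
  obtain ⟨C, hC, H⟩ := lev_top (n := n) (N := N) hm h hlam hK V hV (1 / 4) (3 / 8) (1 / 4)
    (by norm_num) (by norm_num) (by norm_num) (by norm_num) (by norm_num)
  obtain ⟨C', hC', H'⟩ := h.iteratedDeriv_le_of_tail_of_lt hm (s := 2 * m + 1 / 2)
    (by have : (1 : ℝ) ≤ m := by exact_mod_cast hm
        linarith)
  refine ⟨C' * C, by positivity, fun u hu t ht x hx hxN i => ?_⟩
  have hsm := (hu.smooth i).dw V
  have h1 := H' _ _ (tl_smooth hsm t x) (hu.flat_tl hV (by norm_num) (by norm_num) (by norm_num)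
    ⟨by linarith [ht.1], ht.2⟩ (fun l _ => (hx l).trans (by norm_num)) i)
    (H u hu t ht x (fun l _ => (hx l).le) i) (x N) ⟨hxN, by linarith [(abs_lt.1 (hx N)).2]⟩
  rw [iteratedDeriv_tl (by norm_num) (by norm_num) hsm t x (hx N), Function.update_eq_self] at h1
  rwa [mul_assoc]

/-- Hölder bound for the top normal derivative in the normal direction. -/
theorem abs_dw_sub_le_normal (hm : 1 ≤ m) (hlam : 0 < lam) (hK : 0 ≤ K) {γ : ℝ} (hγ : γ < 1) :
    ∃ C : ℝ, 0 ≤ C ∧ ∀ u : Fin n → ST(d) → ℝ, Sol m N K lam u →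
      ∀ t ∈ Icc (-(1 / 4) : ℝ) 0, ∀ x : Fin d → ℝ, (∀ l, |x l| < 1 / 4) → 0 ≤ x N → ∀ i,
        |dw (List.replicate m N) (u i) (t, x) - dw (List.replicate m N) (u i) (t, update x N 0)|
          ≤ C * √(msq N u) * x N ^ γ := by
  obtain ⟨ι, e, μ, h⟩ := exists_isEigenSystem hm
  obtain ⟨C, hC, H⟩ := lev_top (n := n) (N := N) hm h hlam hK [] (by simp) (1 / 4) (3 / 8) (1 / 4)
    (by norm_num) (by norm_num) (by norm_num) (by norm_num) (by norm_num)
  obtain ⟨C', hC', H'⟩ := h.holder_of_tail hm hγ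
  refine ⟨C' * C, by positivity, fun u hu t ht x hx hxN i => ?_⟩
  have hsm := hu.smooth i
  have h1 := H' _ _ (tl_smooth hsm t x) (hu.flat_tl (V := []) (by simp) (by norm_num) (by norm_num)
    (by norm_num) ⟨by linarith [ht.1], ht.2⟩ (fun l _ => (hx l).trans (by norm_num)) i)
    (H u hu t ht x (fun l _ => (hx l).le) i) (x N) ⟨hxN, by linarith [(abs_lt.1 (hx N)).2]⟩
    0 ⟨le_rfl, zero_le_one⟩
  rw [iteratedDeriv_tl (by norm_num) (by norm_num) hsm t x (hx N), Function.update_eq_self,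
    iteratedDeriv_tl (by norm_num) (by norm_num) hsm t x (by norm_num), sub_zero,
    abs_of_nonneg hxN] at h1
  rwa [mul_assoc C']

/-- Hölder bound for the top normal derivative in time. -/
theorem abs_dw_sub_le_time (hm : 1 ≤ m) (hlam : 0 < lam) (hK : 0 ≤ K) {γ : ℝ} (hγ0 : 0 < γ)
    (hγ : γ < 1) :
    ∃ C : ℝ, 0 ≤ C ∧ ∀ u : Fin n → ST(d) → ℝ, Sol m N K lam u →
      ∀ t ∈ Icc (-(1 / 4) : ℝ) 0, ∀ x : Fin d → ℝ, (∀ l, |x l| < 1 / 4) → 0 ≤ x N → ∀ i,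
        |dw (List.replicate m N) (u i) (t, x) - dw (List.replicate m N) (u i) (0, x)|
          ≤ C * √(msq N u) * |t| ^ (γ / (2 * m)) := by
  obtain ⟨ι, e, μ, h⟩ := exists_isEigenSystem hm
  have hm' : (1 : ℝ) ≤ m := by exact_mod_cast hm
  obtain ⟨C, hC, H⟩ := tail_time (n := n) (N := N) (V := []) (ρ := 1 / 4) (ρ' := 3 / 8) (τ := 1 / 4)
    hm h hlam hK (by simp) hγ0 hγ
    (by norm_num) (by norm_num) (by norm_num) (by norm_num) (by norm_num)
  obtain ⟨C', hC', H'⟩ := h.iteratedDeriv_le_of_tail_of_lt hm (s := 2 * m + 1 / 2 - γ) (by linarith)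
  refine ⟨C' * C, by positivity, fun u hu t ht x hx hxN i => ?_⟩
  have hsm := hu.smooth i
  have hz : (0 : ℝ) ∈ Icc (-(1 / 4) : ℝ) 0 := by norm_num
  have hf : ∀ t ∈ Icc (-(1 / 4) : ℝ) 0, Flat m (tl N (1 / 4) (3 / 8) (u i) t x) := fun t ht =>
    hu.flat_tl (V := []) (by simp) (by norm_num) (by norm_num)
      (by norm_num) ⟨by linarith [ht.1], ht.2⟩ (fun l _ => (hx l).trans (by norm_num)) i
  have s1 := tl_smooth (N := N) (ρ := 1 / 4) (ρ' := 3 / 8) hsm t x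
  have s2 := tl_smooth (N := N) (ρ := 1 / 4) (ρ' := 3 / 8) hsm 0 x
  have h1 := H' _ _ (ContDiff.sub s1 s2) (Flat.sub s1 s2 (hf t ht) (hf 0 hz))
    (H u hu t ht 0 hz x (fun l _ => (hx l).le) i) (x N) ⟨hxN, by linarith [(abs_lt.1 (hx N)).2]⟩
  rw [iteratedDeriv_fun_sub (s1.contDiffAt _ _) (s2.contDiffAt _ _),
    iteratedDeriv_tl (by norm_num) (by norm_num) hsm t x (hx N),
    iteratedDeriv_tl (by norm_num) (by norm_num) hsm 0 x (hx N), Function.update_eq_self, sub_zero] at h1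
  linarith

theorem abs_sub_le_of_pd_le {f : ST(d) → ℝ} (hf : Sm f) (t : ℝ) (y : Fin d → ℝ) {B r : ℝ}
    (hB : ∀ s ∈ Icc (0 : ℝ) 1, ∀ l, |y l * pd l f (t, s • y)| ≤ r * B) :
    |f (t, y) - f (t, 0)| ≤ d * (r * B) := by
  have hd : ∀ s : ℝ, HasDerivAt (fun s : ℝ => f (t, s • y)) (∑ l, y l * pd l f (t, s • y)) s := by
    intro s
    have h1 : HasDerivAt (fun s : ℝ => (t, s • y)) ((0 : ℝ), (1 : ℝ) • y) s :=
      (hasDerivAt_const s t).prodMk ((hasDerivAt_id s).smul_const y)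
    have h2 := (hf.diff (t, s • y)).hasFDerivAt.comp_hasDerivAt s h1
    have h3 : ((0 : ℝ), (1 : ℝ) • y) = ∑ l, y l • ((0 : ℝ), (Pi.single l (1 : ℝ) : Fin d → ℝ)) := by
      refine Prod.ext ?_ ?_
      · simp [Prod.fst_sum]
      · rw [Prod.snd_sum]
        funext k
        simp [Finset.sum_apply, Pi.single_apply]
    rw [h3, map_sum] at h2
    simp only [map_smul, smul_eq_mul] at h2
    exact h2
  have h4 := Convex.norm_image_sub_le_of_norm_hasDerivWithin_le (s := Icc (0 : ℝ) 1) (C := d * (r * B))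
    (fun s _ => (hd s).hasDerivWithinAt) (fun s hs => by
      rw [Real.norm_eq_abs]
      refine (abs_sum_le_sum_abs _ _).trans ((sum_le_sum fun l _ => hB s hs l).trans ?_)
      simp) (convex_Icc _ _) (x := 0) (y := 1) (by simp) (by simp)
  simpa using h4

/-- Oscillation of the top normal derivative around the origin. -/
theorem abs_dw_sub_le (hm : 1 ≤ m) (hlam : 0 < lam) (hK : 0 ≤ K) {γ : ℝ} (hγ0 : 0 < γ)
    (hγ : γ < 1) :
    ∃ C : ℝ, 0 ≤ C ∧ ∀ u : Fin n → ST(d) → ℝ, Sol m N K lam u →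
      ∀ r : ℝ, 0 < r → r < 1 / 4 → ∀ t ∈ Icc (-r ^ (2 * m)) 0, ∀ x : Fin d → ℝ, (∀ l, |x l| ≤ r) →
        0 ≤ x N → ∀ i,
        |dw (List.replicate m N) (u i) (t, x) - dw (List.replicate m N) (u i) (0, 0)|
          ≤ C * √(msq N u) * r ^ γ := by
  obtain ⟨C1, hC1, H1⟩ := abs_dw_sub_le_time (n := n) (N := N) hm hlam hK hγ0 hγ
  obtain ⟨C2, hC2, H2⟩ := abs_dw_sub_le_normal (n := n) (N := N) hm hlam hK hγ
  have hE : ∀ l : Fin d, ∃ C : ℝ, 0 ≤ C ∧ (l ≠ N → ∀ u : Fin n → ST(d) → ℝ, Sol m N K lam u →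
      ∀ t ∈ Icc (-(1 / 4) : ℝ) 0, ∀ x : Fin d → ℝ, (∀ l, |x l| < 1 / 4) → 0 ≤ x N → ∀ i,
        |dw (List.replicate m N) (dw [l] (u i)) (t, x)| ≤ C * √(msq N u)) := by
    intro l
    by_cases hl : l = N
    · exact ⟨0, le_rfl, fun h => absurd hl h⟩
    · obtain ⟨C, hC, H⟩ := abs_dw_le (n := n) (N := N) (V := [l]) hm hlam hK (by simpa using hl)
      exact ⟨C, hC, fun _ => H⟩
  choose E hE0 hE using hE
  refine ⟨C1 + C2 + d * ∑ l, E l, add_nonneg (add_nonneg hC1 hC2)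
    (mul_nonneg (Nat.cast_nonneg _) (sum_nonneg fun l _ => hE0 l)), fun u hu r h0 h1 t ht x hx hxN i => ?_⟩
  obtain ⟨M, hM⟩ : ∃ M, M = √(msq N u) := ⟨_, rfl⟩
  have hM0 : 0 ≤ M := hM ▸ sqrt_nonneg _
  have hx' : ∀ l, |x l| < 1 / 4 := fun l => (hx l).trans_lt h1
  have hr4 : r ^ (2 * m) ≤ 1 / 4 := by
    calc r ^ (2 * m) ≤ r ^ 1 := pow_le_pow_of_le_one h0.le (by linarith) (by omega)
      _ ≤ 1 / 4 := by rw [pow_one]; exact h1.le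
  have hm0 : (0 : ℝ) < m := by exact_mod_cast hm
  have k1 := H1 u hu t ⟨by linarith [ht.1], ht.2⟩ x hx' hxN i
  have k2 := H2 u hu 0 ⟨by norm_num, le_rfl⟩ x hx' hxN i
  obtain ⟨y, hy⟩ : ∃ y, y = update x N 0 := ⟨_, rfl⟩
  have hyN : y N = 0 := by simp [hy]
  have hyr : ∀ l, |y l| ≤ r := by
    intro l
    by_cases hl : l = N
    · rw [hl, hyN, abs_zero]; exact h0.le
    · rw [hy, Function.update_of_ne hl]; exact hx l
  have k3 := abs_sub_le_of_pd_le (r := r) (B := (∑ l, E l) * M) ((hu.smooth i).dw (List.replicate m N)) 0 y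
    (by
      intro s hs l
      have hEs : 0 ≤ ∑ l, E l := sum_nonneg fun l _ => hE0 l
      by_cases hl : l = N
      · rw [hl, hyN, zero_mul, abs_zero]; positivity
      · rw [abs_mul]
        refine mul_le_mul (hyr l) ?_ (abs_nonneg _) h0.le
        have h5 : ∀ k, |(s • y) k| < 1 / 4 := fun k => by
          rw [Pi.smul_apply, smul_eq_mul, abs_mul, abs_of_nonneg hs.1]
          calc s * |y k| ≤ 1 * |y k| := mul_le_mul_of_nonneg_right hs.2 (abs_nonneg _)
            _ < 1 / 4 := by rw [one_mul]; exact (hyr k).trans_lt h1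
        have h6 := hE l hl u hu 0 ⟨by norm_num, le_rfl⟩ (s • y) h5 (by simp [hyN]) i
        rw [dw_comm (hu.smooth i), ← hM] at h6
        exact h6.trans (mul_le_mul_of_nonneg_right
          (single_le_sum (fun l _ => hE0 l) (Finset.mem_univ l)) hM0))
  rw [← hy] at k2
  rw [← hM] at k1 k2 ⊢
  have e1 : |t| ^ (γ / (2 * m)) ≤ r ^ γ := by
    have h2 : |t| ≤ r ^ (2 * m) := by rw [abs_of_nonpos ht.2]; linarith [ht.1]
    calc |t| ^ (γ / (2 * m)) ≤ (r ^ (2 * m)) ^ (γ / (2 * m)) :=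
          Real.rpow_le_rpow (abs_nonneg _) h2 (by positivity)
      _ = r ^ γ := by
          rw [← Real.rpow_natCast, ← Real.rpow_mul h0.le]
          congr 1
          push_cast
          field_simp
  have e2 : x N ^ γ ≤ r ^ γ := Real.rpow_le_rpow hxN ((le_abs_self _).trans (hx N)) hγ0.le
  have e3 : r ≤ r ^ γ := by
    calc r = r ^ (1 : ℝ) := (Real.rpow_one r).symm
      _ ≤ r ^ γ := Real.rpow_le_rpow_of_exponent_ge h0 (by linarith) hγ.le
  have f1 := mul_le_mul_of_nonneg_left e1 (mul_nonneg hC1 hM0)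
  have f2 := mul_le_mul_of_nonneg_left e2 (mul_nonneg hC2 hM0)
  have hEs : 0 ≤ ∑ l, E l := sum_nonneg fun l _ => hE0 l
  have f3 := mul_le_mul_of_nonneg_left e3 (mul_nonneg (mul_nonneg (Nat.cast_nonneg d) hEs) hM0)
  have g1 := abs_sub_le (dw (List.replicate m N) (u i) (t, x)) (dw (List.replicate m N) (u i) (0, x))
    (dw (List.replicate m N) (u i) (0, 0))
  have g2 := abs_sub_le (dw (List.replicate m N) (u i) (0, x)) (dw (List.replicate m N) (u i) (0, y))
    (dw (List.replicate m N) (u i) (0, 0))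
  linarith

/-- Vanishing rate of the normal derivatives at the flat boundary. -/
theorem abs_dw_le_pow (hm : 1 ≤ m) (hlam : 0 < lam) (hK : 0 ≤ K) :
    ∃ C : ℝ, 0 ≤ C ∧ ∀ u : Fin n → ST(d) → ℝ, Sol m N K lam u →
      ∀ t ∈ Icc (-(1 / 4) : ℝ) 0, ∀ k l, k + l = m → ∀ x : Fin d → ℝ, (∀ l, |x l| < 1 / 4) → 0 ≤ x N → ∀ i,
        |dw (List.replicate l N) (u i) (t, x)| ≤ C * √(msq N u) * x N ^ k := by
  obtain ⟨C, hC, H⟩ := abs_dw_le (n := n) (N := N) (V := []) hm hlam hK (by simp)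
  refine ⟨C, hC, fun u hu t ht k => ?_⟩
  induction k with
  | zero =>
    intro l hl x hx hxN i
    rw [show l = m by omega, pow_zero, mul_one]
    exact H u hu t ht x hx hxN i
  | succ k ih =>
    intro l hl x hx hxN i
    have hM : 0 ≤ C * √(msq N u) := mul_nonneg hC (sqrt_nonneg _)
    have hb : ∀ s ∈ Icc 0 (x N), ∀ j, |update x N s j| < 1 / 4 := by
      intro s hs j
      by_cases hj : j = N
      · rw [hj, Function.update_self, abs_of_nonneg hs.1]
        exact hs.2.trans_lt ((le_abs_self _).trans_lt (hx N))
      · rw [Function.update_of_ne hj]; exact hx j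
    have h1 := Convex.norm_image_sub_le_of_norm_hasDerivWithin_le (s := Icc 0 (x N))
      (C := C * √(msq N u) * x N ^ k)
      (fun s _ => (hasDerivAt_update ((hu.smooth i).dw (List.replicate l N)) t x N s).hasDerivWithinAt)
      (fun s hs => by
        have h2 := ih (l + 1) (by omega) _ (hb s hs) (by simpa using hs.1) i
        rw [List.replicate_succ, dw_cons, Function.update_self] at h2
        exact h2.trans (mul_le_mul_of_nonneg_left (pow_le_pow_left₀ hs.1 hs.2 k) hM))
      (convex_Icc _ _) (x := 0) (y := x N) ⟨le_rfl, hxN⟩ ⟨hxN, le_rfl⟩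
    rw [hu.bdry t ⟨by linarith [ht.1], ht.2⟩ (update x N 0)
      (fun j => (hb 0 ⟨le_rfl, hxN⟩ j).trans (by norm_num)) (by simp) l (by omega) i, sub_zero, sub_zero,
      Function.update_eq_self, Real.norm_eq_abs, Real.norm_eq_abs, abs_of_nonneg hxN] at h1
    rwa [pow_succ, ← mul_assoc]

end regularity

section transfer
variable {d n m : ℕ}

section pder
variable {F : Type*} [NormedAddCommGroup F] [NormedSpace ℝ F] {u : ET(d) → F}

theorem pder_eq (hu : Sm u) (l : Fin d) (p : ET(d)) :
    pder l u p = fderiv ℝ u p (0, single l 1) := by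
  have h1 : HasFDerivAt (fun y => (p.1, y)) (ContinuousLinearMap.inr ℝ ℝ (EuclideanSpace ℝ (Fin d))) p.2 :=
    hasFDerivAt_prodMk_right p.1 p.2
  have h2 := ((hu.diff (p.1, p.2)).hasFDerivAt.comp p.2 h1).fderiv
  change fderiv ℝ (u ∘ fun y => (p.1, y)) p.2 _ = _
  rw [h2]
  rfl

theorem Sm.pder (hu : Sm u) (l : Fin d) : Sm (pder l u) := by
  have : _root_.pder l u = fun p => fderiv ℝ u p (0, single l 1) := funext (pder_eq hu l)
  rw [this]
  exact (ContDiff.fderiv_right (m := ((⊤ : ℕ∞) : WithTop ℕ∞)) hu (by simp)).clm_apply contDiff_const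

theorem Sm.foldr_pder (hu : Sm u) (W : List (Fin d)) : Sm (W.foldr _root_.pder u) := by
  induction W with
  | nil => exact hu
  | cons l W ih => exact Sm.pder ih l

theorem iterate_pder (k : ℕ) (l : Fin d) (u : ET(d) → F) :
    (_root_.pder l)^[k] u = (List.replicate k l).foldr _root_.pder u := by
  induction k with
  | zero => rfl
  | succ k ih => rw [Function.iterate_succ_apply', ih, List.replicate_succ, List.foldr_cons]

theorem Dmul_eq (γ : Fin d → ℕ) (u : ET(d) → F) :
    Dmul γ u = (word γ).foldr _root_.pder u := by
  unfold Dmul word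
  induction List.finRange d with
  | nil => rfl
  | cons l W ih => rw [List.foldr_cons, ih, List.flatMap_cons, List.foldr_append, iterate_pder]

theorem tder_eq (hu : Sm u) (p : ET(d)) :
    tder u p = fderiv ℝ u p (1, 0) := by
  have h1 : HasDerivAt (fun s => (s, p.2)) ((1 : ℝ), (0 : EuclideanSpace ℝ (Fin d))) p.1 :=
    (hasDerivAt_id p.1).prodMk (hasDerivAt_const p.1 p.2)
  exact ((hu.diff (p.1, p.2)).hasFDerivAt.comp_hasDerivAt p.1 h1).deriv

end pder

/-- The parabolic rescaling from coordinates to space-time. -/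
noncomputable def resc (m : ℕ) (L : ℝ) (X : ET(d)) (p : ST(d)) :
    ET(d) :=
  (X.1 + L ^ (2 * m) * p.1, X.2 + L • (EuclideanSpace.equiv (Fin d) ℝ).symm p.2)

variable {L : ℝ} {X : ET(d)} {u : ET(d) → EuclideanSpace ℝ (Fin n)}

theorem sm_resc : Sm (resc m L X) := by
  unfold resc
  refine ContDiff.prodMk ?_ ?_
  · exact contDiff_const.add (contDiff_const.mul contDiff_fst)
  · have h : ContDiff ℝ ((⊤ : ℕ∞) : WithTop ℕ∞) fun p : ST(d) =>
        (EuclideanSpace.equiv (Fin d) ℝ).symm p.2 :=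
      (EuclideanSpace.equiv (Fin d) ℝ).symm.contDiff.comp contDiff_snd
    exact contDiff_const.add (h.const_smul L)

theorem sm_comp_resc (hu : Sm u) (i : Fin n) : Sm fun p => u (resc m L X p) i := by
  have h1 : ContDiff ℝ ((⊤ : ℕ∞) : WithTop ℕ∞) fun y : EuclideanSpace ℝ (Fin n) => y i :=
    (EuclideanSpace.proj i : EuclideanSpace ℝ (Fin n) →L[ℝ] ℝ).contDiff
  exact h1.comp (ContDiff.comp hu sm_resc)

theorem dv_comp_resc (hu : Sm u) (i : Fin n) (v : ST(d)) (p : ST(d)) :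
    dv v (fun p => u (resc m L X p) i) p =
      fderiv ℝ u (resc m L X p) (L ^ (2 * m) * v.1, L • (EuclideanSpace.equiv (Fin d) ℝ).symm v.2) i := by
  have h1 : HasFDerivAt (resc m L X) (((L ^ (2 * m)) • ContinuousLinearMap.fst ℝ ℝ (Fin d → ℝ)).prod
      (L • ((EuclideanSpace.equiv (Fin d) ℝ).symm.toContinuousLinearMap ∘L
        ContinuousLinearMap.snd ℝ ℝ (Fin d → ℝ)))) p := by
    refine HasFDerivAt.prodMk ?_ ?_
    · exact ((hasFDerivAt_fst).const_mul (L ^ (2 * m))).const_add _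
    · exact (((EuclideanSpace.equiv (Fin d) ℝ).symm.hasFDerivAt.comp p hasFDerivAt_snd).const_smul L).const_add _
  have h2 := (EuclideanSpace.proj i : EuclideanSpace ℝ (Fin n) →L[ℝ] ℝ).hasFDerivAt.comp p
    ((hu.diff (resc m L X p)).hasFDerivAt.comp p h1)
  exact congrArg (fun A => A v) h2.fderiv

theorem pd_comp_resc (hu : Sm u) (i : Fin n) (l : Fin d) (p : ST(d)) :
    pd l (fun p => u (resc m L X p) i) p = L * pder l u (resc m L X p) i := by
  rw [pd, dv_comp_resc hu, pder_eq hu]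
  have : ((L ^ (2 * m) * 0, L • (EuclideanSpace.equiv (Fin d) ℝ).symm (Pi.single l 1)) :
      ET(d)) = L • (0, single l 1) := by
    rw [Prod.smul_mk, mul_zero, smul_zero]
    rfl
  dsimp only
  rw [this, map_smul]
  rfl

theorem td_comp_resc (hu : Sm u) (i : Fin n) (p : ST(d)) :
    td (fun p => u (resc m L X p) i) p = L ^ (2 * m) * tder u (resc m L X p) i := by
  rw [td, dv_comp_resc hu, tder_eq hu]
  have : ((L ^ (2 * m) * 1, L • (EuclideanSpace.equiv (Fin d) ℝ).symm 0) :
      ET(d)) = (L ^ (2 * m)) • (1, 0) := by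
    rw [Prod.smul_mk, map_zero, smul_zero, smul_zero, smul_eq_mul]
  dsimp only
  rw [this, map_smul]
  rfl

theorem dw_comp_resc (hu : Sm u) (i : Fin n) (W : List (Fin d)) :
    dw W (fun p => u (resc m L X p) i) = fun p => L ^ W.length * W.foldr pder u (resc m L X p) i := by
  induction W with
  | nil => simp [dw_nil]
  | cons l W ih =>
    have h1 := hu.foldr_pder W
    rw [dw_cons, ih]
    funext p
    have h2 := dv_const_mul (v := ((0 : ℝ), (Pi.single l 1 : Fin d → ℝ))) (L ^ W.length)
      (sm_comp_resc (m := m) (L := L) (X := X) h1 i)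
    have h3 := congrFun h2 p
    have h4 := pd_comp_resc (m := m) (L := L) (X := X) h1 i l p
    rw [pd] at h4 ⊢
    rw [h3, h4, List.length_cons, List.foldr_cons, pow_succ]
    ring

theorem word_add_perm (α β : Fin d → ℕ) : (word (α + β)).Perm (word α ++ word β) := by
  rw [List.perm_iff_count]
  intro l
  have h : ∀ γ : Fin d → ℕ, (word γ).count l = γ l := by
    intro γ
    rw [word, List.count_flatMap]
    have : (fun i => List.count l (List.replicate (γ i) i)) = fun i => if i = l then γ i else 0 := by
      funext i
      simp [List.count_replicate]
    have h2 : (List.count l ∘ fun i => List.replicate (γ i) i) = fun i => if i = l then γ i else 0 := this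
    rw [h2, ← List.ofFn_eq_map, List.sum_ofFn]
    simp
  rw [List.count_append, h, h, h, Pi.add_apply]

theorem dw_word_comp_resc (hu : Sm u) (i : Fin n) {α β : Fin d → ℕ} (hα : α ∈ MIdx d m) (hβ : β ∈ MIdx d m)
    (p : ST(d)) :
    dw (word α ++ word β) (fun p => u (resc m L X p) i) p =
      L ^ (2 * m) * Dmul (α + β) u (resc m L X p) i := by
  have hl : (word (α + β)).length = 2 * m := by
    rw [(word_add_perm α β).length_eq, List.length_append, length_word_of_mem hα, length_word_of_mem hβ,
      two_mul]
  rw [← dw_perm (sm_comp_resc hu i) (word_add_perm α β), dw_comp_resc hu, hl, Dmul_eq]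

end transfer

section coefficients
open Filter
variable {d n m : ℕ} {N : Fin d} {K lam R : ℝ} {X : ET(d)}
  {u : ET(d) → EuclideanSpace ℝ (Fin n)}

theorem continuous_tder (hu : Sm u) : Continuous (tder u) := by
  have : tder u = fun p => fderiv ℝ u p (1, 0) := funext (tder_eq hu)
  rw [this]
  exact ((ContDiff.continuous_fderiv hu (by simp)).clm_apply continuous_const)

theorem continuous_Dmul (hu : Sm u) (γ : Fin d → ℕ) : Continuous (Dmul γ u) := by
  rw [Dmul_eq]
  exact ContDiff.continuous (hu.foldr_pder _)

theorem mem_closure_halfBall {x : EuclideanSpace ℝ (Fin d)} {ρ : ℝ} (hx : x ∈ ball X.2 ρ)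
    (hxN : 0 ≤ x N) : x ∈ closure (ball X.2 ρ ∩ {x | 0 < x N}) := by
  have h1 : Continuous fun s : ℝ => x + s • single N (1 : ℝ) := by fun_prop
  have h2 : Tendsto (fun s : ℝ => x + s • single N (1 : ℝ)) (𝓝[>] 0) (𝓝 x) := by
    have := h1.tendsto 0
    rw [zero_smul, add_zero] at this
    exact this.mono_left nhdsWithin_le_nhds
  refine mem_closure_of_tendsto h2 ?_
  filter_upwards [h2.eventually (isOpen_ball.mem_nhds hx), self_mem_nhdsWithin] with s h3 h4
  refine ⟨h3, ?_⟩
  have h5 : (0 : ℝ) < s := h4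
  simp only [mem_ofPred_eq, PiLp.add_apply, PiLp.smul_apply, PiLp.single_apply, if_true, smul_eq_mul, mul_one]
  linarith

/-- The equation holds at almost every time, at every point of the half ball. -/
theorem ae_forall_eq (hu : Sm u) {A : (Fin d → ℕ) → (Fin d → ℕ) → ℝ → Fin n → Fin n → ℝ} {ρ : ℝ}
    (h : ∀ᵐ p ∂(volume.restrict (QCylP d m N ρ X)), ∀ i,
        tder u p i + (-1 : ℝ) ^ m * ∑ α ∈ MIdx d m, ∑ β ∈ MIdx d m, ∑ j,
          A α β p.1 i j * Dmul (α + β) u p j = 0) :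
    ∀ᵐ t ∂(volume.restrict (Ioo (X.1 - ρ ^ (2 * m)) X.1)), ∀ x ∈ ball X.2 ρ, 0 ≤ x N → ∀ i,
        tder u (t, x) i + (-1 : ℝ) ^ m * ∑ α ∈ MIdx d m, ∑ β ∈ MIdx d m, ∑ j,
          A α β t i j * Dmul (α + β) u (t, x) j = 0 := by
  have hQ : QCylP d m N ρ X = Ioo (X.1 - ρ ^ (2 * m)) X.1 ×ˢ (ball X.2 ρ ∩ {x | 0 < x N}) := by
    ext p
    simp only [QCylP, QCyl, mem_prod, mem_inter_iff, mem_ofPred_eq, and_assoc]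
  rw [hQ, Measure.volume_eq_prod, ← Measure.prod_restrict] at h
  filter_upwards [Measure.ae_ae_of_ae_prod h] with t ht x hx hxN i
  obtain ⟨g, hg⟩ : ∃ g : EuclideanSpace ℝ (Fin d) → ℝ, g = fun x =>
      tder u (t, x) i + (-1 : ℝ) ^ m * ∑ α ∈ MIdx d m, ∑ β ∈ MIdx d m, ∑ j,
          A α β t i j * Dmul (α + β) u (t, x) j := ⟨_, rfl⟩
  have c1 := continuous_tder hu
  have c2 := fun γ => continuous_Dmul hu γ
  have hgc : Continuous g := by
    rw [hg]
    refine Continuous.add ?_ (continuous_const.mul (continuous_finsetSum _ fun α _ =>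
      continuous_finsetSum _ fun β _ => continuous_finsetSum _ fun j _ => continuous_const.mul ?_))
    · fun_prop
    · have := c2 (α + β); fun_prop
  have hU : IsOpen (ball X.2 ρ ∩ {x : EuclideanSpace ℝ (Fin d) | 0 < x N}) :=
    isOpen_ball.inter (isOpen_lt continuous_const (by fun_prop))
  have h1 : g =ᵐ[volume.restrict (ball X.2 ρ ∩ {x : EuclideanSpace ℝ (Fin d) | 0 < x N})] fun _ => 0 := by
    filter_upwards [ht] with y hy
    rw [hg]; exact hy i
  have h2 := Measure.eqOn_open_of_ae_eq h1 hU hgc.continuousOn continuous_const.continuousOn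
  have h3 : closure (ball X.2 ρ ∩ {x : EuclideanSpace ℝ (Fin d) | 0 < x N}) ⊆ {x | g x = 0} :=
    closure_minimal h2 (isClosed_eq hgc continuous_const)
  have h4 := h3 (mem_closure_halfBall hx hxN)
  rw [hg] at h4
  exact h4

theorem mem_closure_of_ae {a b : ℝ} {P : ℝ → Prop} (h : ∀ᵐ t ∂(volume.restrict (Ioo a b)), P t) {t : ℝ}
    (ht : t ∈ Icc a b) (hab : a < b) : t ∈ closure {t | P t} := by
  rw [← closure_Ioo hab.ne] at ht
  rw [_root_.mem_closure_iff] at ht ⊢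
  intro U hU htU
  obtain ⟨s, hs⟩ := ht U hU htU
  have h1 : 0 < volume (U ∩ Ioo a b) := (hU.inter isOpen_Ioo).measure_pos _ ⟨s, hs⟩
  have h2 : ∀ᵐ t ∂(volume.restrict (U ∩ Ioo a b)), P t := ae_restrict_of_ae_restrict_of_subset inter_subset_right h
  have h3 : (ae (volume.restrict (U ∩ Ioo a b))).NeBot := by
    rw [ae_neBot, Ne, Measure.restrict_eq_zero]
    exact h1.ne'
  obtain ⟨r, hr1, hr2⟩ := (h2.and (ae_restrict_mem (hU.inter isOpen_Ioo).measurableSet)).exists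
  exact ⟨r, hr2.1, hr1⟩

/-- At every time there are admissible coefficients for which the equation holds in the half ball. -/
theorem exists_coeff (hu : Sm u) (hR : 0 < R) {ρ : ℝ} (hρ : R ≤ ρ)
    {A : (Fin d → ℕ) → (Fin d → ℕ) → ℝ → Fin n → Fin n → ℝ}
    (hA : ∀ α β t i j, |A α β t i j| ≤ K) (hL : ∀ t : ℝ, LegHad d n m lam (fun α β => A α β t))
    (h : ∀ᵐ p ∂(volume.restrict (QCylP d m N ρ X)), ∀ i,
        tder u p i + (-1 : ℝ) ^ m * ∑ α ∈ MIdx d m, ∑ β ∈ MIdx d m, ∑ j,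
          A α β p.1 i j * Dmul (α + β) u p j = 0) {t : ℝ} (ht : t ∈ Icc (X.1 - R ^ (2 * m)) X.1) :
    ∃ B : (Fin d → ℕ) → (Fin d → ℕ) → Fin n → Fin n → ℝ, (∀ α β i j, |B α β i j| ≤ K) ∧
      LegHad d n m lam B ∧ ∀ x ∈ ball X.2 ρ, 0 ≤ x N → ∀ i,
        tder u (t, x) i + (-1 : ℝ) ^ m * ∑ α ∈ MIdx d m, ∑ β ∈ MIdx d m, ∑ j,
          B α β i j * Dmul (α + β) u (t, x) j = 0 := by
  have hpow : R ^ (2 * m) ≤ ρ ^ (2 * m) := pow_le_pow_left₀ hR.le hρ _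
  have hpos : 0 < ρ ^ (2 * m) := pow_pos (hR.trans_le hρ) _
  have hcl := mem_closure_of_ae (ae_forall_eq hu h) (t := t) ⟨by linarith [ht.1], ht.2⟩ (by linarith)
  obtain ⟨G, hG⟩ : ∃ G : Set ℝ, G = {t | ∀ x ∈ ball X.2 ρ, 0 ≤ x N → ∀ i,
        tder u (t, x) i + (-1 : ℝ) ^ m * ∑ α ∈ MIdx d m, ∑ β ∈ MIdx d m, ∑ j,
          A α β t i j * Dmul (α + β) u (t, x) j = 0} := ⟨_, rfl⟩
  rw [← hG, mem_closure_iff_nhdsWithin_neBot] at hcl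
  obtain ⟨U, hU⟩ := Ultrafilter.exists_le (𝓝[G] t)
  have hlim : ∀ α β i j, ∃ b ∈ Icc (-K) K, Tendsto (fun s => A α β s i j) U (𝓝 b) := by
    intro α β i j
    have h1 : Ultrafilter.map (fun s => A α β s i j) U ≤ 𝓟 (Icc (-K) K) := by
      have h2 : (fun s => A α β s i j) ⁻¹' Icc (-K) K = univ :=
        eq_univ_of_forall fun s => abs_le.1 (hA α β s i j)
      refine le_principal_iff.2 ?_
      change (fun s => A α β s i j) ⁻¹' Icc (-K) K ∈ (U : Filter ℝ)
      rw [h2]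
      exact univ_mem
    obtain ⟨b, hb, hb'⟩ := isCompact_Icc.ultrafilter_le_nhds _ h1
    exact ⟨b, hb, hb'⟩
  choose B hB hBt using hlim
  refine ⟨B, fun α β i j => abs_le.2 (hB α β i j), fun ξ η => ?_, fun x hx hxN i => ?_⟩
  · have h1 : Tendsto (fun s => ∑ α ∈ MIdx d m, ∑ β ∈ MIdx d m, ∑ i, ∑ j,
        A α β s i j * ξ i * ξ j * ((∏ k, η k ^ α k) * ∏ k, η k ^ β k)) U
        (𝓝 (∑ α ∈ MIdx d m, ∑ β ∈ MIdx d m, ∑ i, ∑ j,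
        B α β i j * ξ i * ξ j * ((∏ k, η k ^ α k) * ∏ k, η k ^ β k))) :=
      tendsto_finsetSum _ fun α _ => tendsto_finsetSum _ fun β _ => tendsto_finsetSum _ fun i _ =>
        tendsto_finsetSum _ fun j _ => (((hBt α β i j).mul_const _).mul_const _).mul_const _
    exact ge_of_tendsto' h1 fun s => hL s ξ η
  · have c1 := continuous_tder hu
    have c2 := fun γ => continuous_Dmul hu γ
    have hUt : (U : Filter ℝ) ≤ 𝓝 t := hU.trans nhdsWithin_le_nhds
    have e1 : Tendsto (fun s => tder u (s, x) i) U (𝓝 (tder u (t, x) i)) := by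
      have : Continuous fun s => tder u (s, x) i := by fun_prop
      exact (this.tendsto t).mono_left hUt
    have e2 : ∀ γ j, Tendsto (fun s => Dmul γ u (s, x) j) U (𝓝 (Dmul γ u (t, x) j)) := by
      intro γ j
      have h1 := c2 γ
      have : Continuous fun s => Dmul γ u (s, x) j := by fun_prop
      exact (this.tendsto t).mono_left hUt
    have e3 : Tendsto (fun s => tder u (s, x) i + (-1 : ℝ) ^ m * ∑ α ∈ MIdx d m, ∑ β ∈ MIdx d m, ∑ j,
          A α β s i j * Dmul (α + β) u (s, x) j) U (𝓝 (tder u (t, x) i +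
          (-1 : ℝ) ^ m * ∑ α ∈ MIdx d m, ∑ β ∈ MIdx d m, ∑ j,
          B α β i j * Dmul (α + β) u (t, x) j)) :=
      e1.add ((tendsto_finsetSum _ fun α _ => tendsto_finsetSum _ fun β _ =>
        tendsto_finsetSum _ fun j _ => (hBt α β i j).mul (e2 _ _)).const_mul _)
    have e4 : ∀ᶠ s in (U : Filter ℝ), tder u (s, x) i + (-1 : ℝ) ^ m * ∑ α ∈ MIdx d m, ∑ β ∈ MIdx d m, ∑ j,
          A α β s i j * Dmul (α + β) u (s, x) j = 0 := by
      have h1 : G ∈ (U : Filter ℝ) := hU self_mem_nhdsWithin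
      filter_upwards [h1] with s hs
      rw [hG] at hs
      exact hs x hx hxN i
    exact tendsto_nhds_unique e3 (tendsto_const_nhds.congr' (e4.mono fun s hs => hs.symm))

/-- The boundary conditions extend to the closed time interval. -/
theorem bdry_closed (hu : Sm u) (hR : 0 < R) {ρ : ℝ} (hρ : R ≤ ρ)
    (h : ∀ q ∈ QCyl d m ρ X, q.2 N = 0 → ∀ k < m, (pder N)^[k] u q = 0) {t : ℝ}
    (ht : t ∈ Icc (X.1 - R ^ (2 * m)) X.1) {x : EuclideanSpace ℝ (Fin d)} (hx : x ∈ ball X.2 ρ)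
    (hxN : x N = 0) {k : ℕ} (hk : k < m) : (pder N)^[k] u (t, x) = 0 := by
  have hpow : R ^ (2 * m) ≤ ρ ^ (2 * m) := pow_le_pow_left₀ hR.le hρ _
  have hpos : 0 < ρ ^ (2 * m) := pow_pos (hR.trans_le hρ) _
  have c : Continuous fun s => (pder N)^[k] u (s, x) := by
    have : Continuous ((pder N)^[k] u) := by
      rw [iterate_pder]; exact ContDiff.continuous (hu.foldr_pder _)
    fun_prop
  have h1 : closure (Ioo (X.1 - ρ ^ (2 * m)) X.1) ⊆ {s | (pder N)^[k] u (s, x) = 0} :=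
    closure_minimal (fun s hs => h (s, x) ⟨hs, hx⟩ hxN k hk) (isClosed_eq c continuous_const)
  rw [closure_Ioo (by linarith)] at h1
  exact h1 ⟨by linarith [ht.1], ht.2⟩

theorem resc_mem {L : ℝ} (hd : 1 ≤ d) (hL : L = R / (2 * d)) (hR : 0 < R) {p : ST(d)}
    (h1 : p.1 ∈ Icc (-1 : ℝ) 0) (h2 : ∀ i, |p.2 i| ≤ 1) :
    (resc m L X p).1 ∈ Icc (X.1 - L ^ (2 * m)) X.1 ∧ (resc m L X p).2 ∈ ball X.2 R := by
  have hd' : (1 : ℝ) ≤ d := by exact_mod_cast hd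
  have hL0 : 0 < L := by rw [hL]; positivity
  have hp : 0 < L ^ (2 * m) := pow_pos hL0 _
  refine ⟨⟨?_, ?_⟩, ?_⟩
  · simp only [resc]; nlinarith [h1.1]
  · simp only [resc]; nlinarith [h1.2]
  · rw [mem_ball, dist_eq_norm]
    simp only [resc, add_sub_cancel_left]
    rw [norm_smul, Real.norm_eq_abs, abs_of_pos hL0]
    have h3 : ‖(EuclideanSpace.equiv (Fin d) ℝ).symm p.2‖ ≤ d := by
      rw [EuclideanSpace.norm_eq]
      refine Real.sqrt_le_iff.2 ⟨by positivity, ?_⟩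
      calc ∑ i, ‖(EuclideanSpace.equiv (Fin d) ℝ).symm p.2 i‖ ^ 2 ≤ ∑ _i : Fin d, (1 : ℝ) :=
            sum_le_sum fun i _ => by
              rw [Real.norm_eq_abs, sq_le_one_iff_abs_le_one, abs_abs]
              exact h2 i
        _ = d := by simp
        _ ≤ (d : ℝ) ^ 2 := by nlinarith
    calc L * _ ≤ L * d := mul_le_mul_of_nonneg_left h3 hL0.le
      _ = R / 2 := by rw [hL]; field_simp
      _ < R := by linarith

/-- The rescaled solution is a solution near the reference half box. -/
theorem sol_resc {L : ℝ} (hd : 1 ≤ d) (hu : Sm u) (hN : X.2 N = 0) (hR : 0 < R) (hL : L = R / (2 * d))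
    {A : (Fin d → ℕ) → (Fin d → ℕ) → ℝ → Fin n → Fin n → ℝ}
    (hA : ∀ α β t i j, |A α β t i j| ≤ K) (hLH : ∀ t : ℝ, LegHad d n m lam (fun α β => A α β t))
    (h : ∀ᵐ p ∂(volume.restrict (QCylP d m N (2 * R) X)), ∀ i,
        tder u p i + (-1 : ℝ) ^ m * ∑ α ∈ MIdx d m, ∑ β ∈ MIdx d m, ∑ j,
          A α β p.1 i j * Dmul (α + β) u p j = 0)
    (hb : ∀ q ∈ QCyl d m (2 * R) X, q.2 N = 0 → ∀ k < m, (pder N)^[k] u q = 0) :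
    Sol m N K lam fun i p => u (resc m L X p) i := by
  have hd' : (1 : ℝ) ≤ d := by exact_mod_cast hd
  have hL0 : 0 < L := by rw [hL]; positivity
  have hLR : L ≤ R := by
    rw [hL, div_le_iff₀ (by positivity)]; nlinarith
  have hpow : L ^ (2 * m) ≤ R ^ (2 * m) := pow_le_pow_left₀ hL0.le hLR _
  have hcoord : ∀ (t : ℝ) (x : Fin d → ℝ), (resc m L X (t, x)).2 N = L * x N := by
    intro t x
    simp [resc, hN]
  refine ⟨fun i => sm_comp_resc hu i, fun t ht => ?_, fun t ht x hx hxN k hk i => ?_⟩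
  · have h1 := (resc_mem (m := m) (X := X) (p := (t, 0)) hd hL hR ht (by simp)).1
    obtain ⟨B, hB, hBL, hBe⟩ := exists_coeff hu hR (ρ := 2 * R) (by linarith) hA hLH h
      ⟨by linarith [h1.1], h1.2⟩
    refine ⟨B, hB, hBL, fun x hx hxN i => ?_⟩
    have h2 := (resc_mem (m := m) (X := X) (p := (t, x)) hd hL hR ht (fun i => (hx i).le)).2
    have h3 := hBe (resc m L X (t, x)).2 (ball_subset_ball (by linarith) h2)
      (by rw [hcoord]; exact mul_nonneg hL0.le hxN) i
    have h4 : ((resc m L X (t, 0)).1, (resc m L X (t, x)).2) = resc m L X (t, x) := rfl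
    rw [h4] at h3
    rw [td_comp_resc hu, sum_congr rfl fun α hα => sum_congr rfl fun β hβ =>
      sum_congr rfl fun j _ => by
        rw [dw_word_comp_resc (X := X) (L := L) hu j hα hβ (t, x)]]
    calc _ = L ^ (2 * m) * (tder u (resc m L X (t, x)) i + (-1 : ℝ) ^ m * ∑ α ∈ MIdx d m, ∑ β ∈ MIdx d m, ∑ j,
          B α β i j * Dmul (α + β) u (resc m L X (t, x)) j) := by
          simp only [mul_add, mul_sum]
          congr 1
          refine sum_congr rfl fun α _ => sum_congr rfl fun β _ =>
            sum_congr rfl fun j _ => ?_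
          ring
      _ = 0 := by rw [h3, mul_zero]
  · have h2 := resc_mem (m := m) (X := X) (p := (t, x)) hd hL hR ht (fun i => (hx i).le)
    have h3 := bdry_closed hu hR (ρ := 2 * R) (by linarith) hb (t := (resc m L X (t, x)).1)
      ⟨by linarith [h2.1.1], h2.1.2⟩ (ball_subset_ball (by linarith) h2.2) (by rw [hcoord, hxN, mul_zero]) hk
    rw [dw_comp_resc hu]
    rw [iterate_pder] at h3
    have h4 : ((resc m L X (t, x)).1, (resc m L X (t, x)).2) = resc m L X (t, x) := rfl
    rw [h4] at h3
    simp [h3]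

end coefficients

section mass
variable {d n m : ℕ} {N : Fin d} {R L : ℝ} {X : ET(d)}
  {u : ET(d) → EuclideanSpace ℝ (Fin n)}

theorem QCylP_eq : QCylP d m N R X = Ioo (X.1 - R ^ (2 * m)) X.1 ×ˢ (ball X.2 R ∩ {x | 0 < x N}) := by
  ext p
  simp only [QCylP, QCyl, mem_prod, mem_inter_iff, mem_ofPred_eq, and_assoc]

theorem isOpen_QCylP : IsOpen (QCylP d m N R X) := by
  rw [QCylP_eq]
  exact isOpen_Ioo.prod (isOpen_ball.inter (isOpen_lt continuous_const (by fun_prop)))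

theorem integrableOn_QCylP {F : Type*} [NormedAddCommGroup F] {g : ET(d) → F}
    (hg : Continuous g) : IntegrableOn g (QCylP d m N R X) := by
  have h1 : IsCompact (Icc (X.1 - R ^ (2 * m)) X.1 ×ˢ closedBall X.2 R) :=
    isCompact_Icc.prod (isCompact_closedBall _ _)
  refine (hg.continuousOn.integrableOn_compact h1).mono_set ?_
  rw [QCylP_eq]
  exact prod_mono Ioo_subset_Icc_self (inter_subset_left.trans ball_subset_closedBall)

theorem integral_comp_resc (hL : 0 < L) {F : ET(d) → ℝ} (hF : Integrable F) :
    ∫ s, ∫ x, F (resc m L X (s, x)) = (L ^ (2 * m))⁻¹ * ((L ^ d)⁻¹ * ∫ p, F p) := by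
  have h1 : ∀ τ : ℝ, ∫ x : Fin d → ℝ, F (τ, X.2 + L • (EuclideanSpace.equiv (Fin d) ℝ).symm x) =
      (L ^ d)⁻¹ * ∫ y, F (τ, y) := by
    intro τ
    have e1 := (EuclideanSpace.volume_preserving_symm_measurableEquiv_toLp (Fin d)).symm.integral_comp'
      (fun y => F (τ, X.2 + L • y))
    have e2 := Measure.integral_comp_smul (volume : Measure (EuclideanSpace ℝ (Fin d)))
      (fun y => F (τ, X.2 + y)) L
    have e3 := integral_add_left_eq_self (μ := (volume : Measure (EuclideanSpace ℝ (Fin d))))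
      (fun y => F (τ, y)) X.2
    rw [e3, finrank_euclideanSpace, Fintype.card_fin, abs_of_pos (inv_pos.2 (pow_pos hL d)), smul_eq_mul] at e2
    exact e1.trans e2
  have h2 : ∀ s : ℝ, ∫ x, F (resc m L X (s, x)) = (L ^ d)⁻¹ * ∫ y, F (X.1 + L ^ (2 * m) * s, y) :=
    fun s => h1 (X.1 + L ^ (2 * m) * s)
  simp only [h2]
  have e2 := Measure.integral_comp_mul_left (fun s => ∫ y, F (X.1 + s, y)) (L ^ (2 * m))
  have e3 := integral_add_left_eq_self (μ := (volume : Measure ℝ)) (fun s => ∫ y, F (s, y)) X.1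
  rw [integral_const_mul, e2, e3, Measure.volume_eq_prod, integral_prod _ hF,
    abs_of_pos (inv_pos.2 (pow_pos hL _)), smul_eq_mul]
  ring

/-- The mass of the rescaled solution. -/
theorem msq_resc_le (hd : 1 ≤ d) (hu : Continuous u) (hN : X.2 N = 0) (hR : 0 < R) (hL : L = R / (2 * d)) :
    msq N (fun i p => u (resc m L X p) i) ≤
      (L ^ (2 * m))⁻¹ * ((L ^ d)⁻¹ * ∫ p in QCylP d m N R X, ‖u p‖ ^ 2) := by
  have hd' : (1 : ℝ) ≤ d := by exact_mod_cast hd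
  have hL0 : 0 < L := by rw [hL]; positivity
  have hLR : L ≤ R := by
    rw [hL, div_le_iff₀ (by positivity)]; nlinarith
  have hpow : L ^ (2 * m) ≤ R ^ (2 * m) := pow_le_pow_left₀ hL0.le hLR _
  have ha : 0 < L ^ (2 * m) := pow_pos hL0 _
  obtain ⟨S, hS⟩ : ∃ S : Set ET(d), S =
    {p | (p.1 - X.1) / L ^ (2 * m) ∈ Ioo (-(1 / 2) : ℝ) 0 ∧
      ∀ i, (p.2 i - X.2 i) / L ∈ Ioo (lo N i) (lo N i + 1)} := ⟨_, rfl⟩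
  have hSo : MeasurableSet S := by
    have e : S = (fun p : ET(d) => (p.1 - X.1) / L ^ (2 * m)) ⁻¹' Ioo (-(1 / 2) : ℝ) 0 ∩
        ⋂ i, (fun p : ET(d) => (p.2 i - X.2 i) / L) ⁻¹' Ioo (lo N i) (lo N i + 1) := by
      rw [hS]
      ext p
      simp
    rw [e]
    refine MeasurableSet.inter (measurableSet_Ioo.preimage (by fun_prop))
      (MeasurableSet.iInter fun i => measurableSet_Ioo.preimage ?_)
    have : Continuous fun p : ET(d) => (p.2 i - X.2 i) / L := by fun_prop
    exact this.measurable
  have hmem : ∀ s x, resc m L X (s, x) ∈ S ↔ s ∈ Ioo (-(1 / 2) : ℝ) 0 ∧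
      x ∈ (univ : Set (Fin d)).pi fun i => Ioo (lo N i) (lo N i + 1) := by
    intro s x
    have e1 : ((resc m L X (s, x)).1 - X.1) / L ^ (2 * m) = s := by
      simp only [resc]; field_simp; ring
    have e2 : ∀ i, ((resc m L X (s, x)).2 i - X.2 i) / L = x i := by
      intro i
      have : (resc m L X (s, x)).2 i = X.2 i + L * x i := rfl
      rw [this]; field_simp; ring
    rw [hS, mem_ofPred_eq, e1]
    simp only [e2, mem_univ_pi]
  have hSQ : S ⊆ QCylP d m N R X := by
    rintro p hp
    obtain ⟨q, rfl⟩ : ∃ q, p = resc m L X q := by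
      refine ⟨((p.1 - X.1) / L ^ (2 * m), fun i => (p.2 i - X.2 i) / L), Prod.ext ?_ ?_⟩
      · simp only [resc]; field_simp; ring
      · ext i
        change p.2 i = X.2 i + L * ((p.2 i - X.2 i) / L)
        field_simp; ring
    obtain ⟨s, x⟩ := q
    obtain ⟨hs, hx⟩ := (hmem s x).1 hp
    rw [mem_univ_pi] at hx
    have h1 : ∀ i, |x i| ≤ 1 := by
      intro i
      have := hx i
      unfold lo at this
      split_ifs at this
      · exact abs_le.2 ⟨by linarith [this.1], by linarith [this.2]⟩
      · exact abs_le.2 ⟨by linarith [this.1], by linarith [this.2]⟩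
    have h2 := resc_mem (m := m) (X := X) (p := (s, x)) hd hL hR ⟨by linarith [hs.1], hs.2.le⟩ h1
    refine ⟨⟨⟨?_, ?_⟩, h2.2⟩, ?_⟩
    · simp only [resc]
      nlinarith [hs.1]
    · simp only [resc]
      nlinarith [hs.2]
    · have h3 : (resc m L X (s, x)).2 N = X.2 N + L * x N := rfl
      rw [h3, hN, zero_add]
      have := (hx N).1
      rw [lo, if_pos rfl] at this
      exact mul_pos hL0 this
  have hintg : IntegrableOn (fun p => ‖u p‖ ^ 2) (QCylP d m N R X) := integrableOn_QCylP (by fun_prop)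
  have key := integral_comp_resc (m := m) (X := X) hL0
    ((integrable_indicator_iff hSo).2 (hintg.mono_set hSQ))
  have hle : ∫ p, S.indicator (fun p => ‖u p‖ ^ 2) p ≤ ∫ p in QCylP d m N R X, ‖u p‖ ^ 2 := by
    rw [integral_indicator hSo]
    exact setIntegral_mono_set hintg (ae_of_all _ fun p => by positivity) hSQ.eventuallyLE
  have hmsq : msq N (fun i p => u (resc m L X p) i) =
      ∫ s, ∫ x, S.indicator (fun p => ‖u p‖ ^ 2) (resc m L X (s, x)) := by
    have hcr : Continuous (resc m L X) := ContDiff.continuous sm_resc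
    rw [msq, intervalIntegral.integral_of_le (by norm_num), integral_Ioc_eq_integral_Ioo,
      ← integral_indicator measurableSet_Ioo]
    congr 1
    funext s
    by_cases hs : s ∈ Ioo (-(1 / 2) : ℝ) 0
    · rw [indicator_of_mem hs]
      have e1 : (fun x => S.indicator (fun p => ‖u p‖ ^ 2) (resc m L X (s, x))) =
          ((univ : Set (Fin d)).pi fun i => Ioo (lo N i) (lo N i + 1)).indicator
            fun x => ‖u (resc m L X (s, x))‖ ^ 2 := by
        funext x
        by_cases hx : x ∈ (univ : Set (Fin d)).pi fun i => Ioo (lo N i) (lo N i + 1)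
        · rw [indicator_of_mem ((hmem s x).2 ⟨hs, hx⟩), indicator_of_mem hx]
        · rw [indicator_of_notMem (fun h => hx ((hmem s x).1 h).2), indicator_of_notMem hx]
      rw [e1, integral_indicator (MeasurableSet.univ_pi fun i => measurableSet_Ioo)]
      have e2 : ((univ : Set (Fin d)).pi fun i => Ioo (lo N i) (lo N i + 1)) =ᵐ[volume] cube (lo N) :=
        Measure.univ_pi_Ioo_ae_eq_Icc
      rw [setIntegral_congr_set e2, ← integral_finsetSum _ fun i _ => integrableOn_cube (by fun_prop)]
      congr 1
      funext x
      rw [EuclideanSpace.norm_sq_eq]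
      simp only [Real.norm_eq_abs, sq_abs]
    · rw [indicator_of_notMem hs]
      have e1 : (fun x => S.indicator (fun p => ‖u p‖ ^ 2) (resc m L X (s, x))) = fun _ => 0 := by
        funext x
        rw [indicator_of_notMem fun h => hs ((hmem s x).1 h).1]
      rw [e1, integral_zero]
  rw [hmsq, key]
  have : 0 < L ^ d := pow_pos hL0 d
  gcongr

end mass

theorem norm_intervalIntegral_sq_le {F : Type*} [NormedAddCommGroup F] [NormedSpace ℝ F] {g : ℝ → F} (hg : Continuous g) {b : ℝ} (hb : 0 ≤ b) :
    ‖∫ s in (0 : ℝ)..b, g s‖ ^ 2 ≤ b * ∫ s in (0 : ℝ)..b, ‖g s‖ ^ 2 := by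
  have h1 := intervalIntegral.norm_integral_le_integral_norm (f := g) (μ := volume) hb
  have h2 := intervalIntegral_sq_le hb hg.norm
  rw [sub_zero] at h2
  exact (pow_le_pow_left₀ (norm_nonneg _) h1 2).trans h2

section poincare
variable {d m : ℕ} {N : Fin d} {R : ℝ} {X : ET(d)}
  {F : Type*} [NormedAddCommGroup F] [InnerProductSpace ℝ F] [CompleteSpace F]
  {f : ET(d) → F}

/-- Moving a point of the half cylinder towards the flat boundary. -/
theorem sub_mem_QCylP (hN : X.2 N = 0) {p : ET(d)} (hp : p ∈ QCylP d m N R X)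
    {s : ℝ} (hs : s ∈ Icc 0 (p.2 N)) :
    p - s • (0, single N (1 : ℝ)) ∈ QCyl d m R X ∧
      (p - s • ((0 : ℝ), single N (1 : ℝ))).2 N = p.2 N - s := by
  have e : (p - s • ((0 : ℝ), single N (1 : ℝ))).2 N = p.2 N - s := by simp
  refine ⟨⟨?_, ?_⟩, e⟩
  · simpa using hp.1.1
  · have h1 : dist p.2 X.2 < R := hp.1.2
    refine mem_ball.2 (lt_of_le_of_lt ?_ h1)
    rw [EuclideanSpace.dist_eq, EuclideanSpace.dist_eq]
    refine Real.sqrt_le_sqrt (sum_le_sum fun i _ => ?_)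
    by_cases hi : i = N
    · subst hi
      rw [e, hN, Real.dist_eq, Real.dist_eq, sub_zero, sub_zero, sq_abs, sq_abs]
      exact pow_le_pow_left₀ (by linarith [hs.2]) (by linarith [hs.1]) 2
    · simp [hi]

theorem norm_sq_le_integral_pder (hf : Sm f) (hN : X.2 N = 0)
    (hb : ∀ q ∈ QCyl d m R X, q.2 N = 0 → f q = 0) {p : ET(d)}
    (hp : p ∈ QCylP d m N R X) :
    ‖f p‖ ^ 2 ≤ p.2 N * ∫ s in (0 : ℝ)..p.2 N, ‖pder N f (p - s • (0, single N (1 : ℝ)))‖ ^ 2 := by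
  have hc : Continuous fun s : ℝ => p - s • ((0 : ℝ), single N (1 : ℝ)) := by fun_prop
  have hg : Continuous fun s : ℝ => pder N f (p - s • (0, single N (1 : ℝ))) :=
    (ContDiff.continuous (Sm.pder hf N)).comp hc
  have hd : ∀ s : ℝ, HasDerivAt (fun s : ℝ => f (p - s • (0, single N (1 : ℝ))))
      (-pder N f (p - s • (0, single N (1 : ℝ)))) s := by
    intro s
    have h1 : HasDerivAt (fun s : ℝ => p - s • ((0 : ℝ), single N (1 : ℝ)))
        (-((1 : ℝ) • ((0 : ℝ), single N (1 : ℝ)))) s :=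
      ((hasDerivAt_id s).smul_const _).const_sub p
    have h2 := (hf.diff (p - s • (0, single N (1 : ℝ)))).hasFDerivAt.comp_hasDerivAt s h1
    rw [one_smul, map_neg, ← pder_eq hf] at h2
    exact h2
  have h3 := intervalIntegral.integral_eq_sub_of_hasDerivAt (fun s _ => hd s)
    (hg.neg.intervalIntegrable 0 (p.2 N))
  obtain ⟨h4, h5⟩ := sub_mem_QCylP hN hp (s := p.2 N) ⟨hp.2.le, le_rfl⟩
  rw [hb _ h4 (by rw [h5, sub_self]), zero_smul, sub_zero, zero_sub, intervalIntegral.integral_neg, neg_inj] at h3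
  rw [← h3]
  exact norm_intervalIntegral_sq_le hg hp.2.le

/-- Poincaré inequality in the half cylinder. -/
theorem poincare_QCylP (hf : Sm f) (hN : X.2 N = 0) (hR : 0 < R)
    (hb : ∀ q ∈ QCyl d m R X, q.2 N = 0 → f q = 0) :
    ∫ p in QCylP d m N R X, ‖f p‖ ^ 2 ≤ R ^ 2 * ∫ p in QCylP d m N R X, ‖pder N f p‖ ^ 2 := by
  obtain ⟨v, hv⟩ : ∃ v : ET(d), v = (0, single N (1 : ℝ)) := ⟨_, rfl⟩
  obtain ⟨Q, hQ⟩ : ∃ Q, Q = QCylP d m N R X := ⟨_, rfl⟩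
  have hQm : MeasurableSet Q := hQ ▸ isOpen_QCylP.measurableSet
  have hDc : Continuous (pder N f) := ContDiff.continuous (Sm.pder hf N)
  have hfc : Continuous f := ContDiff.continuous hf
  obtain ⟨G, hG⟩ : ∃ G : ET(d) → ENNReal, G =
      Q.indicator fun p => ENNReal.ofReal (‖pder N f p‖ ^ 2) := ⟨_, rfl⟩
  have hGm : Measurable G := by
    rw [hG]
    refine Measurable.indicator ?_ hQm
    have : Continuous fun p => ‖pder N f p‖ ^ 2 := by fun_prop
    exact this.measurable.ennreal_ofReal
  have hpt : ∀ p ∈ Q, ENNReal.ofReal (‖f p‖ ^ 2) ≤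
      ENNReal.ofReal R * ∫⁻ s in Ioo 0 R, G (p - s • v) := by
    intro p hp
    rw [hQ] at hp
    have h1 := norm_sq_le_integral_pder hf hN hb hp
    have hpN : p.2 N < R := by
      have h2 : dist p.2 X.2 < R := hp.1.2
      have h3 := (EuclideanSpace.norm_eq (p.2 - X.2)).symm ▸ (dist_eq_norm p.2 X.2)
      have h4 : ‖(p.2 - X.2) N‖ ≤ ‖p.2 - X.2‖ := PiLp.norm_apply_le _ N
      rw [PiLp.sub_apply, hN, sub_zero, ← dist_eq_norm p.2 X.2] at h4
      exact (le_abs_self _).trans_lt (h4.trans_lt h2)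
    have hc : Continuous fun s : ℝ => ‖pder N f (p - s • v)‖ ^ 2 := by fun_prop
    rw [← hv] at h1
    have h5 : ENNReal.ofReal (∫ s in (0 : ℝ)..p.2 N, ‖pder N f (p - s • v)‖ ^ 2) ≤
        ∫⁻ s in Ioo 0 R, G (p - s • v) := by
      rw [intervalIntegral.integral_of_le hp.2.le, integral_Ioc_eq_integral_Ioo,
        ofReal_integral_eq_lintegral_ofReal
          ((hc.integrableOn_Icc (a := 0) (b := p.2 N)).mono_set Ioo_subset_Icc_self)
          (ae_of_all _ fun s => by positivity)]
      refine (setLIntegral_mono' measurableSet_Ioo fun s hs => ?_).trans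
        (lintegral_mono_set (Ioo_subset_Ioo_right hpN.le))
      obtain ⟨h6, h7⟩ := sub_mem_QCylP hN hp (s := s) ⟨hs.1.le, hs.2.le⟩
      have h8 : p - s • v ∈ Q := by
        rw [hQ, hv]
        exact ⟨h6, by rw [h7]; linarith [hs.2]⟩
      rw [hG, indicator_of_mem h8]
    calc ENNReal.ofReal (‖f p‖ ^ 2) ≤
        ENNReal.ofReal (p.2 N * ∫ s in (0 : ℝ)..p.2 N, ‖pder N f (p - s • v)‖ ^ 2) :=
          ENNReal.ofReal_le_ofReal h1
      _ = ENNReal.ofReal (p.2 N) * ENNReal.ofReal (∫ s in (0 : ℝ)..p.2 N, ‖pder N f (p - s • v)‖ ^ 2) :=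
          ENNReal.ofReal_mul hp.2.le
      _ ≤ _ := mul_le_mul' (ENNReal.ofReal_le_ofReal hpN.le) h5
  have hjm : Measurable (Function.uncurry fun (p : ET(d)) (s : ℝ) => G (p - s • v)) := by
    have : Continuous fun q : ET(d) × ℝ => q.1 - q.2 • v := by fun_prop
    exact hGm.comp this.measurable
  have hmain : ∫⁻ p in Q, ENNReal.ofReal (‖f p‖ ^ 2) ≤
      ENNReal.ofReal (R ^ 2) * ∫⁻ p in Q, ENNReal.ofReal (‖pder N f p‖ ^ 2) := by
    calc ∫⁻ p in Q, ENNReal.ofReal (‖f p‖ ^ 2) ≤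
        ∫⁻ p in Q, ENNReal.ofReal R * ∫⁻ s in Ioo 0 R, G (p - s • v) := setLIntegral_mono' hQm hpt
      _ ≤ ∫⁻ p, ENNReal.ofReal R * ∫⁻ s in Ioo 0 R, G (p - s • v) := setLIntegral_le_lintegral _ _
      _ = ENNReal.ofReal R * ∫⁻ p, ∫⁻ s in Ioo 0 R, G (p - s • v) :=
          lintegral_const_mul' _ _ ENNReal.ofReal_ne_top
      _ = ENNReal.ofReal R * ∫⁻ s in Ioo 0 R, ∫⁻ p, G (p - s • v) := by
          rw [lintegral_lintegral_swap hjm.aemeasurable]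
      _ = ENNReal.ofReal R * ∫⁻ _s in Ioo 0 R, ∫⁻ p, G p := by
          congr 2
          funext s
          have : (volume : Measure ET(d)).IsAddRightInvariant :=
            inferInstanceAs ((volume : Measure ℝ).prod volume).IsAddRightInvariant
          exact lintegral_sub_right_eq_self G (s • v)
      _ = _ := by
          rw [setLIntegral_const, Real.volume_Ioo, sub_zero, hG, lintegral_indicator hQm,
            mul_comm (lintegral _ _), ← mul_assoc, ← ENNReal.ofReal_mul hR.le, pow_two]
  have i1 : IntegrableOn (fun p => ‖f p‖ ^ 2) Q := hQ ▸ integrableOn_QCylP (by fun_prop)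
  have i2 : IntegrableOn (fun p => ‖pder N f p‖ ^ 2) Q := hQ ▸ integrableOn_QCylP (by fun_prop)
  rw [← hQ]
  rw [← ofReal_integral_eq_lintegral_ofReal i1 (ae_of_all _ fun s => by positivity),
    ← ofReal_integral_eq_lintegral_ofReal i2 (ae_of_all _ fun s => by positivity),
    ← ENNReal.ofReal_mul (by positivity)] at hmain
  exact (ENNReal.ofReal_le_ofReal_iff (mul_nonneg (by positivity)
    (integral_nonneg fun p => by positivity))).1 hmain

theorem poincare_iterate (hf : Sm f) (hN : X.2 N = 0) (hR : 0 < R) (k : ℕ)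
    (hb : ∀ q ∈ QCyl d m R X, q.2 N = 0 → ∀ j < k, (pder N)^[j] f q = 0) :
    ∫ p in QCylP d m N R X, ‖f p‖ ^ 2 ≤
      R ^ (2 * k) * ∫ p in QCylP d m N R X, ‖(pder N)^[k] f p‖ ^ 2 := by
  induction k with
  | zero => simp
  | succ k ih =>
    refine (ih fun q hq hqN j hj => hb q hq hqN j (by omega)).trans ?_
    have hs : Sm ((pder N)^[k] f) := by rw [iterate_pder]; exact hf.foldr_pder _
    have h1 := poincare_QCylP hs hN hR fun q hq hqN => hb q hq hqN k (by omega)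
    rw [Function.iterate_succ_apply']
    calc _ ≤ R ^ (2 * k) * (R ^ 2 * _) := mul_le_mul_of_nonneg_left h1 (by positivity)
      _ = _ := by rw [← mul_assoc, ← pow_add]; rfl

theorem setIntegral_QCylP_le {g : ET(d) → ℝ} {r B : ℝ} (hr : 0 < r)
    (hg : ∀ p ∈ QCylP d m N r X, |g p| ≤ B) (hB : 0 ≤ B) :
    ∫ p in QCylP d m N r X, g p ≤
      B * (r ^ (2 * m) * (r ^ d * volume.real (ball (0 : EuclideanSpace ℝ (Fin d)) 1))) := by
  have hv : volume (QCyl d m r X) =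
      ENNReal.ofReal (r ^ (2 * m)) * (ENNReal.ofReal (r ^ d) * volume (ball (0 : EuclideanSpace ℝ (Fin d)) 1)) := by
    rw [QCyl, Measure.volume_eq_prod, Measure.prod_prod, Real.volume_Ioo, sub_sub_cancel,
      Measure.addHaar_ball_of_pos _ _ hr, finrank_euclideanSpace, Fintype.card_fin]
  have hb : volume (ball (0 : EuclideanSpace ℝ (Fin d)) 1) < ⊤ := measure_ball_lt_top
  have hfin : volume (QCyl d m r X) < ⊤ := by
    rw [hv]
    exact ENNReal.mul_lt_top ENNReal.ofReal_lt_top (ENNReal.mul_lt_top ENNReal.ofReal_lt_top hb)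
  have hsub : QCylP d m N r X ⊆ QCyl d m r X := fun p hp => hp.1
  have h1 := norm_setIntegral_le_of_norm_le_const (f := g) ((measure_mono hsub).trans_lt hfin) hg
  have h2 : volume.real (QCylP d m N r X) ≤ volume.real (QCyl d m r X) := measureReal_mono hsub hfin.ne
  have h3 : volume.real (QCyl d m r X) =
      r ^ (2 * m) * (r ^ d * volume.real (ball (0 : EuclideanSpace ℝ (Fin d)) 1)) := by
    rw [measureReal_def, hv, ENNReal.toReal_mul, ENNReal.toReal_mul, ENNReal.toReal_ofReal (by positivity),
      ENNReal.toReal_ofReal (by positivity), measureReal_def]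
  rw [← h3]
  exact (le_abs_self _).trans (h1.trans (mul_le_mul_of_nonneg_left h2 hB))

theorem integral_sub_average_sq_le {α : Type*} [MeasurableSpace α] {μ : Measure α} [IsFiniteMeasure μ]
    {g : α → F} (hg : MemLp g 2 μ) (c : F) :
    ∫ p, ‖g p - ⨍ q, g q ∂μ‖ ^ 2 ∂μ ≤ ∫ p, ‖g p - c‖ ^ 2 ∂μ := by
  obtain ⟨a, ha⟩ : ∃ a, a = ⨍ q, g q ∂μ := ⟨_, rfl⟩
  have h1 : Integrable g μ := hg.integrable (by norm_num)
  have i1 : Integrable (fun p => ‖g p - a‖ ^ 2) μ := (hg.sub (memLp_const a)).integrable_norm_pow (by norm_num)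
  have i2 : Integrable (fun p => inner ℝ (a - c) (g p - a)) μ := (h1.sub (integrable_const a)).const_inner _
  have e1 : ∫ p, inner ℝ (a - c) (g p - a) ∂μ = 0 := by
    have h2 : ∫ p, g p - a ∂μ = 0 := ha ▸ integral_sub_average μ g
    have h3 : Integrable (fun p => g p - a) μ := h1.sub (integrable_const a)
    rw [integral_inner h3, h2, inner_zero_right]
  have e2 : ∀ p, ‖g p - c‖ ^ 2 = ‖g p - a‖ ^ 2 + 2 * inner ℝ (a - c) (g p - a) + ‖a - c‖ ^ 2 := by
    intro p
    rw [← sub_add_sub_cancel (g p) a c, norm_add_sq_real, real_inner_comm]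
  rw [← ha]
  simp only [e2]
  have i3 : Integrable (fun p => ‖g p - a‖ ^ 2 + 2 * inner ℝ (a - c) (g p - a)) μ := i1.add (i2.const_mul 2)
  rw [integral_add i3 (integrable_const _), integral_add i1 (i2.const_mul 2),
    integral_const_mul, e1, mul_zero, add_zero]
  exact le_add_of_nonneg_right (integral_nonneg fun _ => by positivity)

end poincare

section decay
variable {d n m : ℕ} {N : Fin d} {K lam R L r : ℝ} {X : ET(d)}
  {u : ET(d) → EuclideanSpace ℝ (Fin n)}

theorem norm_sq_le_of_abs_le {w : EuclideanSpace ℝ (Fin n)} {B : ℝ} (h : ∀ i, |w i| ≤ B) :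
    ‖w‖ ^ 2 ≤ n * B ^ 2 := by
  rw [EuclideanSpace.norm_sq_eq]
  refine (Finset.sum_le_card_nsmul _ _ (B ^ 2) fun i _ => ?_).trans (by simp)
  exact pow_le_pow_left₀ (norm_nonneg _) (h i) 2

theorem exists_resc_eq (hL : 0 < L) (hN : X.2 N = 0) {p : ET(d)}
    (hp : p ∈ QCylP d m N r X) :
    ∃ t x, resc m L X (t, x) = p ∧ t ∈ Icc (-(r / L) ^ (2 * m)) 0 ∧ (∀ i, |x i| ≤ r / L) ∧ 0 ≤ x N := by
  have hLm : 0 < L ^ (2 * m) := pow_pos hL _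
  refine ⟨(p.1 - X.1) / L ^ (2 * m), fun i => (p.2 i - X.2 i) / L, ?_, ⟨?_, ?_⟩, fun i => ?_, ?_⟩
  · refine Prod.ext ?_ ?_
    · simp only [resc]
      field_simp
      ring
    · ext i
      simp only [resc, PiLp.add_apply, PiLp.smul_apply, smul_eq_mul]
      change X.2 i + L * ((p.2 i - X.2 i) / L) = p.2 i
      field_simp
      ring
  · rw [div_pow, ← neg_div]
    exact div_le_div_of_nonneg_right (by linarith [hp.1.1.1]) hLm.le
  · exact div_nonpos_of_nonpos_of_nonneg (by linarith [hp.1.1.2]) hLm.le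
  · rw [abs_div, abs_of_pos hL]
    refine div_le_div_of_nonneg_right ?_ hL.le
    have h1 : dist p.2 X.2 < r := hp.1.2
    have h2 : ‖(p.2 - X.2) i‖ ≤ ‖p.2 - X.2‖ := PiLp.norm_apply_le _ i
    rw [← dist_eq_norm p.2 X.2] at h2
    exact h2.trans h1.le
  · have h1 : 0 < p.2 N := hp.2
    simp only [hN, sub_zero]
    positivity

theorem abs_iterate_pder_resc (hu : Sm u) (hL : 0 < L) (l : ℕ) (i : Fin n) (q : ST(d)) :
    (pder N)^[l] u (resc m L X q) i =
      dw (List.replicate l N) (fun p => u (resc m L X p) i) q / L ^ l := by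
  rw [dw_comp_resc hu, iterate_pder, List.length_replicate]
  field_simp

theorem setIntegral_sq_le_of_abs_le (hd : 1 ≤ d) (hu : Sm u) (hN : X.2 N = 0) (hR : 0 < R)
    (hL : L = R / (2 * d)) (hr : 0 < r) {l : ℕ}
    (hb : ∀ q ∈ QCyl d m R X, q.2 N = 0 → ∀ j < l, (pder N)^[j] u q = 0)
    {g : ET(d) → EuclideanSpace ℝ (Fin n)} {C σ : ℝ}
    (hg : ∀ p ∈ QCylP d m N r X, ∀ i, |g p i| ≤ C * √(msq N fun i p => u (resc m L X p) i) * σ / L ^ l) :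
    ∫ p in QCylP d m N r X, ‖g p‖ ^ 2 ≤
      n * C ^ 2 * volume.real (ball (0 : EuclideanSpace ℝ (Fin d)) 1) * (2 * d) ^ (2 * l + d + 2 * m) *
        σ ^ 2 * (r / R) ^ (d + 2 * m) * ∫ p in QCylP d m N R X, ‖(pder N)^[l] u p‖ ^ 2 := by
  obtain ⟨V, hV⟩ : ∃ V, V = volume.real (ball (0 : EuclideanSpace ℝ (Fin d)) 1) := ⟨_, rfl⟩
  have hV0 : 0 ≤ V := hV ▸ measureReal_nonneg
  have hd' : (0 : ℝ) < 2 * d := by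
    have : (1 : ℝ) ≤ d := by exact_mod_cast hd
    linarith
  have hL0 : 0 < L := by rw [hL]; positivity
  have h1 := msq_resc_le (m := m) hd (ContDiff.continuous hu) hN hR hL
  have h2 := poincare_iterate hu hN hR l hb
  obtain ⟨M, hM⟩ : ∃ M, M = msq N fun i p => u (resc m L X p) i := ⟨_, rfl⟩
  obtain ⟨J, hJ⟩ : ∃ J, J = ∫ p in QCylP d m N R X, ‖(pder N)^[l] u p‖ ^ 2 := ⟨_, rfl⟩
  rw [← hM] at hg h1
  rw [← hJ] at h2 ⊢
  have hMle : √M ^ 2 ≤ (L ^ (2 * m))⁻¹ * ((L ^ d)⁻¹ * (R ^ (2 * l) * J)) := by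
    have hJ0 : 0 ≤ J := hJ ▸ integral_nonneg fun _ => by positivity
    have h3 : M ≤ (L ^ (2 * m))⁻¹ * ((L ^ d)⁻¹ * (R ^ (2 * l) * J)) :=
      h1.trans (mul_le_mul_of_nonneg_left (mul_le_mul_of_nonneg_left h2 (by positivity)) (by positivity))
    rcases le_total 0 M with h4 | h4
    · rwa [sq_sqrt h4]
    · rw [Real.sqrt_eq_zero_of_nonpos h4]
      simp only [ne_eq, OfNat.ofNat_ne_zero, not_false_eq_true, zero_pow]
      positivity
  have h5 := setIntegral_QCylP_le (m := m) (N := N) (X := X) (g := fun p => ‖g p‖ ^ 2) hr (fun p hp => by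
    rw [abs_of_nonneg (by positivity)]
    exact norm_sq_le_of_abs_le (hg p hp)) (by positivity)
  rw [← hV] at h5 ⊢
  refine h5.trans ?_
  have h6 := mul_le_mul_of_nonneg_left hMle
    (show 0 ≤ n * C ^ 2 * σ ^ 2 / L ^ (2 * l) * (r ^ (2 * m) * (r ^ d * V)) by positivity)
  refine (le_of_eq ?_).trans (h6.trans (le_of_eq ?_))
  · rw [div_pow, mul_pow, mul_pow, ← pow_mul L, mul_comm l 2]
    ring
  · have e : R = 2 * d * L := by rw [hL]; field_simp
    rw [e]
    simp only [div_pow, mul_pow, pow_add]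
    field_simp

theorem one_le_mul_pow {E : ℕ} {e : ℕ} {a θ : ℝ} (ha : 1 ≤ a) (hθ : 1 ≤ a * θ) (he : e ≤ E) (h0 : 0 ≤ θ) :
    1 ≤ a ^ E * θ ^ e := by
  have h1 : 1 ≤ (a * θ) ^ e := one_le_pow₀ hθ
  rw [mul_pow] at h1
  exact h1.trans (mul_le_mul_of_nonneg_right (pow_le_pow_right₀ ha he) (pow_nonneg h0 _))

theorem setIntegral_QCylP_mono {F : Type*} [NormedAddCommGroup F] {g : ET(d) → F} (hg : Continuous g) (hr : 0 ≤ r)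
    (hrR : r ≤ R) : ∫ p in QCylP d m N r X, ‖g p‖ ^ 2 ≤ ∫ p in QCylP d m N R X, ‖g p‖ ^ 2 := by
  refine setIntegral_mono_set (integrableOn_QCylP (by fun_prop)) (ae_of_all _ fun p => by positivity) ?_
  refine LE.le.eventuallyLE fun p hp => ⟨⟨⟨?_, hp.1.1.2⟩, ball_subset_ball hrR hp.1.2⟩, hp.2⟩
  have := pow_le_pow_left₀ hr hrR (2 * m)
  linarith [hp.1.1.1]

theorem decay_lower (hd : 1 ≤ d) (hm : 1 ≤ m) (hlam : 0 < lam) (hK : 0 ≤ K) :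
    ∃ C : ℝ, 0 ≤ C ∧ ∀ (u : ET(d) → EuclideanSpace ℝ (Fin n)) (R : ℝ)
      (X : ET(d)), Sm u → 0 < R → X.2 N = 0 →
      (Sol m N K lam fun i p => u (resc m (R / (2 * d)) X p) i) →
      (∀ q ∈ QCyl d m R X, q.2 N = 0 → ∀ j < m, (pder N)^[j] u q = 0) →
      ∀ r, 0 < r → r ≤ R → ∀ l < m,
        ∫ p in QCylP d m N r X, ‖(pder N)^[l] u p‖ ^ 2 ≤
          C * (r / R) ^ (2 * (m - l) + d + 2 * m) * ∫ p in QCylP d m N R X, ‖(pder N)^[l] u p‖ ^ 2 := by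
  obtain ⟨C, hC, H⟩ := abs_dw_le_pow (n := n) (N := N) hm hlam hK
  obtain ⟨V, hV⟩ : ∃ V, V = volume.real (ball (0 : EuclideanSpace ℝ (Fin d)) 1) := ⟨_, rfl⟩
  have hV0 : 0 ≤ V := hV ▸ measureReal_nonneg
  have hd' : (1 : ℝ) ≤ d := by exact_mod_cast hd
  refine ⟨n * C ^ 2 * V * (2 * d) ^ (4 * m + d) + (8 * d) ^ (4 * m + d), by positivity,
    fun u R X hu hR hN hS hb r hr hrR l hl => ?_⟩
  obtain ⟨L, hL⟩ : ∃ L, L = R / (2 * d) := ⟨_, rfl⟩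
  rw [← hL] at hS
  have hL0 : 0 < L := by rw [hL]; positivity
  have hI : 0 ≤ ∫ p in QCylP d m N R X, ‖(pder N)^[l] u p‖ ^ 2 := integral_nonneg fun _ => by positivity
  have hρ : r / L = 2 * d * (r / R) := by rw [hL]; field_simp
  rcases lt_or_ge (r / L) (1 / 4) with h | h
  · have h1 := setIntegral_sq_le_of_abs_le (g := (pder N)^[l] u) (C := C) (σ := (r / L) ^ (m - l)) hd hu hN hR hL hr
      (l := l) (fun q hq hq0 j hj => hb q hq hq0 j (hj.trans hl)) (fun p hp i => ?_)
    · refine h1.trans (mul_le_mul_of_nonneg_right ?_ hI)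
      rw [← hV, hρ, show 4 * m + d = 2 * l + d + 2 * m + 2 * (m - l) by omega, add_mul]
      refine (le_of_eq ?_).trans (le_add_of_nonneg_right (by positivity))
      generalize 2 * (d : ℝ) = D
      ring
    · obtain ⟨t, x, rfl, ht, hx, hxN⟩ := exists_resc_eq hL0 hN hp
      rw [abs_iterate_pder_resc hu hL0, abs_div, abs_of_pos (pow_pos hL0 l)]
      refine div_le_div_of_nonneg_right ?_ (pow_pos hL0 l).le
      have h2 : (r / L) ^ (2 * m) ≤ 1 / 4 :=
        (pow_le_of_le_one (by positivity) (by linarith) (by omega)).trans h.le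
      refine (H _ hS t ⟨by linarith [ht.1], ht.2⟩ (m - l) l (by omega) x
        (fun j => (hx j).trans_lt h) hxN i).trans ?_
      exact mul_le_mul_of_nonneg_left (pow_le_pow_left₀ hxN ((le_abs_self _).trans (hx N)) _) (by positivity)
  · have hs : Sm ((pder N)^[l] u) := by rw [iterate_pder]; exact hu.foldr_pder _
    have h1 := setIntegral_QCylP_mono (m := m) (N := N) (X := X) (ContDiff.continuous hs) hr.le hrR
    refine h1.trans (le_mul_of_one_le_left hI ?_)
    rw [add_mul]
    refine (one_le_mul_pow (a := 8 * d) (E := 4 * m + d) ?_ ?_ ?_ ?_).trans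
      (le_add_of_nonneg_left (by positivity))
    · linarith
    · rw [hρ] at h; linarith
    · omega
    · positivity

end decay

section oscillation
variable {d n m : ℕ} {N : Fin d} {K lam R L r : ℝ} {X : ET(d)}
  {F : Type*} [NormedAddCommGroup F] [NormedSpace ℝ F]

theorem pder_smul_pow_const (l : Fin d) (a : ℝ) (j : ℕ) (c : F) :
    pder l (fun p : ET(d) => (a * p.2 N ^ j) • c) =
      fun p => ((if l = N then a * j else 0) * p.2 N ^ (j - 1)) • c := by
  funext p
  have h1 : HasFDerivAt (fun y : EuclideanSpace ℝ (Fin d) => y N) (EuclideanSpace.proj N : _ →L[ℝ] ℝ) p.2 :=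
    (EuclideanSpace.proj N : EuclideanSpace ℝ (Fin d) →L[ℝ] ℝ).hasFDerivAt
  have h2 := ((h1.pow j).const_mul a).smul_const c
  rw [pder, h2.fderiv]
  by_cases hl : l = N
  · subst hl
    simp [mul_assoc]
  · simp [hl, Ne.symm hl]

/-- Derivatives of the monomial `x_N ^ k`. -/
theorem foldr_pder_monomial (W : List (Fin d)) (k : ℕ) (c : F) :
    W.foldr pder (fun p : ET(d) => p.2 N ^ k • c) =
      fun p => ((if ∀ l ∈ W, l = N then (k.descFactorial W.length : ℝ) else 0) *
        p.2 N ^ (k - W.length)) • c := by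
  induction W with
  | nil => simp
  | cons l W ih =>
    rw [List.foldr_cons, ih, pder_smul_pow_const]
    funext p
    rw [List.length_cons, Nat.descFactorial_succ, Nat.sub_sub]
    by_cases h1 : l = N <;> by_cases h2 : ∀ x ∈ W, x = N <;> simp [h1, h2, mul_comm]

theorem sm_monomial (k : ℕ) (c : F) : Sm fun p : ET(d) => p.2 N ^ k • c := by
  have h : Sm fun p : ET(d) => p.2 N :=
    (EuclideanSpace.proj N : EuclideanSpace ℝ (Fin d) →L[ℝ] ℝ).contDiff.comp contDiff_snd
  exact (h.pow k).smul contDiff_const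

theorem foldr_pder_sub {f g : ET(d) → F} (hf : Sm f) (hg : Sm g) (W : List (Fin d)) :
    W.foldr pder (fun p => f p - g p) = fun p => W.foldr pder f p - W.foldr pder g p := by
  induction W with
  | nil => rfl
  | cons l W ih =>
    have h1 := hf.foldr_pder W
    have h2 := hg.foldr_pder W
    rw [List.foldr_cons, ih]
    funext p
    rw [pder_eq (h1.sub h2), fderiv_fun_sub (h1.diff p) (h2.diff p), List.foldr_cons, List.foldr_cons,
      pder_eq h1, pder_eq h2]
    rfl

theorem integral_sub_average_QCylP_le {g : ET(d) → EuclideanSpace ℝ (Fin n)}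
    (hg : Continuous g) (c : EuclideanSpace ℝ (Fin n)) :
    ∫ p in QCylP d m N r X, ‖g p - ⨍ q in QCylP d m N r X, g q‖ ^ 2 ≤
      ∫ p in QCylP d m N r X, ‖g p - c‖ ^ 2 := by
  have hfin : IsFiniteMeasure (volume.restrict (QCylP d m N r X)) := by
    have h1 := integrableOn_QCylP (m := m) (N := N) (X := X) (R := r) (continuous_const (y := (1 : ℝ)))
    exact (integrable_const_iff.1 h1).resolve_left one_ne_zero
  exact integral_sub_average_sq_le ((memLp_two_iff_integrable_sq_norm hg.aestronglyMeasurable).2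
    (integrableOn_QCylP (by fun_prop))) c

theorem decay_top (hd : 1 ≤ d) (hm : 1 ≤ m) (hlam : 0 < lam) (hK : 0 ≤ K) {γ : ℝ} (hγ0 : 0 < γ) (hγ : γ < 1) :
    ∃ C : ℝ, 0 ≤ C ∧ ∀ (u : ET(d) → EuclideanSpace ℝ (Fin n)) (R : ℝ)
      (X : ET(d)), Sm u → 0 < R → X.2 N = 0 →
      (Sol m N K lam fun i p => u (resc m (R / (2 * d)) X p) i) →
      (∀ q ∈ QCyl d m R X, q.2 N = 0 → ∀ j < m, (pder N)^[j] u q = 0) →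
      ∀ r, 0 < r → r ≤ R → ∃ a : EuclideanSpace ℝ (Fin n),
        ∫ p in QCylP d m N r X, ‖(pder N)^[m] u p - a‖ ^ 2 ≤
          C * (r / R) ^ (2 * γ + (d : ℝ) + 2 * m) * ∫ p in QCylP d m N R X, ‖(pder N)^[m] u p‖ ^ 2 := by
  obtain ⟨C, hC, H⟩ := abs_dw_sub_le (n := n) (N := N) hm hlam hK hγ0 hγ
  obtain ⟨V, hV⟩ : ∃ V, V = volume.real (ball (0 : EuclideanSpace ℝ (Fin d)) 1) := ⟨_, rfl⟩
  have hV0 : 0 ≤ V := hV ▸ measureReal_nonneg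
  have hd' : (1 : ℝ) ≤ d := by exact_mod_cast hd
  have hD : (0 : ℝ) < 2 * d := by linarith
  refine ⟨n * C ^ 2 * V * (2 * d) ^ (2 * m + d + 2 * m) * ((2 * d) ^ γ) ^ 2 +
    (8 * d) ^ (2 * γ + (d : ℝ) + 2 * m), by positivity, fun u R X hu hR hN hS hb r hr hrR => ?_⟩
  obtain ⟨L, hL⟩ : ∃ L, L = R / (2 * d) := ⟨_, rfl⟩
  rw [← hL] at hS
  have hL0 : 0 < L := by rw [hL]; positivity
  have hI : 0 ≤ ∫ p in QCylP d m N R X, ‖(pder N)^[m] u p‖ ^ 2 := integral_nonneg fun _ => by positivity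
  have hρ : r / L = 2 * d * (r / R) := by rw [hL]; field_simp
  have hθ : 0 < r / R := by positivity
  have hs : Sm ((pder N)^[m] u) := by rw [iterate_pder]; exact hu.foldr_pder _
  have hsc : Continuous ((pder N)^[m] u) := ContDiff.continuous hs
  rcases lt_or_ge (r / L) (1 / 4) with h | h
  · refine ⟨(pder N)^[m] u (resc m L X (0, 0)), ?_⟩
    have h1 := setIntegral_sq_le_of_abs_le (g := fun p => (pder N)^[m] u p - (pder N)^[m] u (resc m L X (0, 0)))
      (C := C) (σ := (r / L) ^ γ) hd hu hN hR hL hr (l := m) hb (fun p hp i => ?_)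
    · refine h1.trans (mul_le_mul_of_nonneg_right ?_ hI)
      have e : (r / R) ^ (2 * γ + (d : ℝ) + 2 * m) = ((r / R) ^ γ) ^ 2 * (r / R) ^ (d + 2 * m) := by
        rw [← Real.rpow_natCast _ (d + 2 * m), ← Real.rpow_mul_natCast hθ.le, ← Real.rpow_add hθ]
        congr 1
        push_cast
        ring
      rw [← hV, hρ, e, add_mul, Real.mul_rpow hD.le hθ.le]
      refine (le_of_eq ?_).trans (le_add_of_nonneg_right (by positivity))
      generalize 2 * (d : ℝ) = D
      ring
    · obtain ⟨t, x, rfl, ht, hx, hxN⟩ := exists_resc_eq hL0 hN hp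
      rw [PiLp.sub_apply, abs_iterate_pder_resc hu hL0, abs_iterate_pder_resc hu hL0, ← sub_div, abs_div,
        abs_of_pos (pow_pos hL0 m)]
      exact div_le_div_of_nonneg_right (H _ hS (r / L) (by positivity) h t ht x hx hxN i) (pow_pos hL0 m).le
  · refine ⟨0, ?_⟩
    simp only [sub_zero]
    refine (setIntegral_QCylP_mono (m := m) (N := N) (X := X) hsc hr.le hrR).trans (le_mul_of_one_le_left hI ?_)
    rw [add_mul, ← Real.mul_rpow (x := 8 * (d : ℝ)) (by linarith) hθ.le]
    have h2 : (1 : ℝ) ≤ (8 * d * (r / R)) ^ (2 * γ + (d : ℝ) + 2 * m) :=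
      Real.one_le_rpow (by rw [hρ] at h; linarith) (by positivity)
    exact h2.trans (le_add_of_nonneg_left (by positivity))

end oscillation
end BDE

/-- Boundary decay estimates (Lemma 4.4) for solutions of the homogeneous
Dirichlet problem with simple coefficients in half cylinders. -/
theorem statement_9 (d n m : ℕ) (hd : 1 ≤ d) (hn : 1 ≤ n) (hm : 1 ≤ m)
    (iN : Fin d) (hiN : (iN : ℕ) = d - 1)
    (K lam g0 : ℝ) (hK : 0 ≤ K) (hlam : 0 < lam) (hg0 : g0 ∈ Set.Ioo (0 : ℝ) 1) :
    ∃ C : ℝ, 0 < C ∧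
      ∀ A : (Fin d → ℕ) → (Fin d → ℕ) → ℝ → Fin n → Fin n → ℝ,
      (∀ α β i j, Measurable fun t => A α β t i j) →
      (∀ α β t i j, |A α β t i j| ≤ K) →
      (∀ t : ℝ, LegHad d n m lam (fun α β => A α β t)) →
      ∀ R : ℝ, 0 < R →
      ∀ X₀ : ℝ × EuclideanSpace ℝ (Fin d), X₀.2 iN = 0 →
      ∀ u : ℝ × EuclideanSpace ℝ (Fin d) → EuclideanSpace ℝ (Fin n),
      ContDiff ℝ (⊤ : ℕ∞) u →
      (∀ᵐ p ∂(volume.restrict (QCylP d m iN (2 * R) X₀)), ∀ i,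
        tder u p i + (-1 : ℝ) ^ m * ∑ α ∈ MIdx d m, ∑ β ∈ MIdx d m, ∑ j,
          A α β p.1 i j * Dmul (α + β) u p j = 0) →
      (∀ q ∈ QCyl d m (2 * R) X₀, q.2 iN = 0 → ∀ k < m, (pder iN)^[k] u q = 0) →
      ∀ r : ℝ, 0 < r → r ≤ R →
        ((∫ p in QCylP d m iN r X₀, ‖u p‖ ^ 2) ≤
          C * (r / R) ^ (d + 4 * m) * ∫ p in QCylP d m iN R X₀, ‖u p‖ ^ 2) ∧
        (∀ l : ℕ, 0 < l → l < m →
          (∫ p in QCylP d m iN r X₀, ‖(pder iN)^[l] u p‖ ^ 2) ≤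
            C * (r / R) ^ (2 * (m - l) + d + 2 * m) *
              ∫ p in QCylP d m iN R X₀, ‖(pder iN)^[l] u p‖ ^ 2) ∧
        ((∫ p in QCylP d m iN r X₀,
            ‖(pder iN)^[m] u p - ⨍ q in QCylP d m iN r X₀, (pder iN)^[m] u q‖ ^ 2) ≤
          C * (r / R) ^ (2 * g0 + (d : ℝ) + 2 * m) *
            ∫ p in QCylP d m iN R X₀,
              ‖(pder iN)^[m] u p - ⨍ q in QCylP d m iN R X₀, (pder iN)^[m] u q‖ ^ 2) := by
  obtain ⟨C1, hC1, H1⟩ := BDE.decay_lower (n := n) (N := iN) hd hm hlam hK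
  obtain ⟨C2, hC2, H2⟩ := BDE.decay_top (n := n) (N := iN) hd hm hlam hK hg0.1 hg0.2
  refine ⟨C1 + C2 + 1, by positivity, fun A _ hAK hLH R hR X₀ hN u hu h hb r hr hrR => ?_⟩
  have hθ : 0 < r / R := by positivity
  have hsub : QCyl d m R X₀ ⊆ QCyl d m (2 * R) X₀ := by
    intro q hq
    have h1 := pow_le_pow_left₀ hR.le (show R ≤ 2 * R by linarith) (2 * m)
    exact ⟨⟨by linarith [hq.1.1], hq.1.2⟩, Metric.ball_subset_ball (by linarith) hq.2⟩
  have hlow : ∀ l < m, (∫ p in QCylP d m iN r X₀, ‖(pder iN)^[l] u p‖ ^ 2) ≤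
      (C1 + C2 + 1) * (r / R) ^ (2 * (m - l) + d + 2 * m) *
        ∫ p in QCylP d m iN R X₀, ‖(pder iN)^[l] u p‖ ^ 2 := fun l hl =>
    (H1 u R X₀ hu hR hN (BDE.sol_resc hd hu hN hR rfl hAK hLH h hb) (fun q hq => hb q (hsub hq)) r hr hrR l hl).trans
      (mul_le_mul_of_nonneg_right (mul_le_mul_of_nonneg_right (by linarith) (by positivity))
        (integral_nonneg fun _ => by positivity))
  refine ⟨?_, fun l _ hl => hlow l hl, ?_⟩
  · have h1 := hlow 0 (by omega)
    rwa [show 2 * (m - 0) + d + 2 * m = d + 4 * m by omega] at h1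
  obtain ⟨c, hc⟩ : ∃ c, c = ⨍ q in QCylP d m iN R X₀, (pder iN)^[m] u q := ⟨_, rfl⟩
  obtain ⟨w, hw⟩ : ∃ w : ℝ × EuclideanSpace ℝ (Fin d) → EuclideanSpace ℝ (Fin n),
    w = fun p => p.2 iN ^ m • ((m.factorial : ℝ)⁻¹ • c) := ⟨_, rfl⟩
  obtain ⟨v, hv⟩ : ∃ v : ℝ × EuclideanSpace ℝ (Fin d) → EuclideanSpace ℝ (Fin n), v = fun p => u p - w p :=
    ⟨_, rfl⟩
  have hws : BDE.Sm w := hw ▸ BDE.sm_monomial m _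
  have hvs : BDE.Sm v := hv ▸ hu.sub hws
  have hvW : ∀ W : List (Fin d), W.foldr pder v = fun p => W.foldr pder u p - W.foldr pder w p :=
    fun W => hv ▸ BDE.foldr_pder_sub hu hws W
  have hvm : (pder iN)^[m] v = fun p => (pder iN)^[m] u p - c := by
    rw [BDE.iterate_pder, hvW, hw, BDE.foldr_pder_monomial, BDE.iterate_pder]
    funext p
    have h1 : (m.factorial : ℝ) ≠ 0 := by positivity
    simp [Nat.descFactorial_self, smul_smul, h1]
  have hvb : ∀ q ∈ QCyl d m (2 * R) X₀, q.2 iN = 0 → ∀ k < m, (pder iN)^[k] v q = 0 := by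
    intro q hq hq0 k hk
    have h1 := hb q hq hq0 k hk
    rw [BDE.iterate_pder] at h1
    rw [BDE.iterate_pder, hvW, hw, BDE.foldr_pder_monomial]
    simp [h1, hq0, show m - k ≠ 0 by omega]
  have hveq : ∀ᵐ p ∂(volume.restrict (QCylP d m iN (2 * R) X₀)), ∀ i,
      tder v p i + (-1 : ℝ) ^ m * ∑ α ∈ MIdx d m, ∑ β ∈ MIdx d m, ∑ j,
        A α β p.1 i j * Dmul (α + β) v p j = 0 := by
    filter_upwards [h] with p hp i
    have e1 : tder v p = tder u p := by
      rw [hv, hw]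
      exact deriv_sub_const (f := fun s => u (s, p.2)) (p.2 iN ^ m • ((m.factorial : ℝ)⁻¹ • c))
    have e2 : ∀ α ∈ MIdx d m, ∀ β ∈ MIdx d m, Dmul (α + β) v p = Dmul (α + β) u p := by
      intro α hα β hβ
      have h1 : ∑ i, (α + β) i = 2 * m := by
        simp only [Pi.add_apply, Finset.sum_add_distrib, (Finset.mem_filter.1 hα).2, (Finset.mem_filter.1 hβ).2]
        ring
      rw [BDE.Dmul_eq, BDE.Dmul_eq, hvW, hw, BDE.foldr_pder_monomial, BDE.length_word, h1]
      simp [Nat.descFactorial_eq_zero_iff_lt.2 (show m < 2 * m by omega)]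
    rw [e1, ← hp i]
    congr 2
    refine Finset.sum_congr rfl fun α hα => Finset.sum_congr rfl fun β hβ => ?_
    rw [e2 α hα β hβ]
  obtain ⟨a, h3⟩ := H2 v R X₀ hvs hR hN (BDE.sol_resc hd hvs hN hR rfl hAK hLH hveq hvb)
    (fun q hq => hvb q (hsub hq)) r hr hrR
  rw [hvm] at h3
  simp only [sub_sub] at h3
  have hus : Continuous ((pder iN)^[m] u) := by
    rw [BDE.iterate_pder]
    exact ContDiff.continuous (BDE.Sm.foldr_pder hu _)
  rw [← hc]
  exact (BDE.integral_sub_average_QCylP_le hus (c + a)).trans (h3.trans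
    (mul_le_mul_of_nonneg_right (mul_le_mul_of_nonneg_right (by linarith) (by positivity))
      (integral_nonneg fun _ => by positivity)))
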